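/- (Stable tensor product rule for Sp_{2n}, i.e. Sp_{2n} ⊂ Sp_{2n} × Sp_{2n}.) Let λ, μ, ν be non-negative integer partitions such that ℓ(λ) ≤ n and ℓ(μ) + ℓ(ν) ≤ n. Then [V^μ_(2n) ⊗ V^ν_(2n), V^λ_(2n)] = Σ c^λ_{αβ} c^μ_{αγ} c^ν_{βγ}, the sum over all triples of non-negative integer partitions (α, β, γ). -/

import Mathlib

open scoped BigOperators TensorProduct
open Matrix

noncomputable section

def IsPartition (f : ℕ → ℕ) : Prop :=
  (∀ ⦃i j : ℕ⦄, i ≤ j → f j ≤ f i) ∧ ∃ N, f N = 0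

def Ptn : Type := {f : ℕ → ℕ // IsPartition f}

def plen (f : ℕ → ℕ) : ℕ := sInf {k | f k = 0}

def conj (f : ℕ → ℕ) : ℕ → ℕ := fun i => Set.ncard {j | i < f j}

def double (f : ℕ → ℕ) : ℕ → ℕ := fun i => 2 * f i

def InSkew (l m : ℕ → ℕ) (i j : ℕ) : Prop := m i ≤ j ∧ j < l i

def IsLRTableau (l m nu : ℕ → ℕ) (T : ℕ → ℕ → ℕ) : Prop :=
  (∀ i, m i ≤ l i) ∧
  (∀ i j, T i j ≠ 0 ↔ InSkew l m i j) ∧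
  (∀ i j k, InSkew l m i j → InSkew l m i k → j ≤ k → T i j ≤ T i k) ∧
  (∀ i k j, InSkew l m i j → InSkew l m k j → i < k → T i j < T k j) ∧
  (∀ r, Set.ncard {p : ℕ × ℕ | T p.1 p.2 = r + 1} = nu r) ∧
  (∀ i j r, Set.ncard {p : ℕ × ℕ | (p.1 < i ∨ (p.1 = i ∧ j ≤ p.2)) ∧ T p.1 p.2 = r + 2}
          ≤ Set.ncard {p : ℕ × ℕ | (p.1 < i ∨ (p.1 = i ∧ j ≤ p.2)) ∧ T p.1 p.2 = r + 1})

def lrCoeff (l m nu : ℕ → ℕ) : ℕ := Set.ncard {T : ℕ → ℕ → ℕ | IsLRTableau l m nu T}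

section Reps

variable {G : Type*} [Group G] {V W : Type*}
  [AddCommGroup V] [Module ℂ V] [AddCommGroup W] [Module ℂ W]

def IsSubrep (ρ : Representation ℂ G V) (U : Submodule ℂ V) : Prop :=
  ∀ g : G, ∀ x ∈ U, ρ g x ∈ U

def IsIrreducibleRep (ρ : Representation ℂ G V) : Prop :=
  Nontrivial V ∧ ∀ U : Submodule ℂ V, IsSubrep ρ U → U = ⊥ ∨ U = ⊤

def equivariantMaps (π : Representation ℂ G W) (ρ : Representation ℂ G V) :
    Submodule ℂ (W →ₗ[ℂ] V) where
  carrier := {f | ∀ g : G, f ∘ₗ (π g) = (ρ g) ∘ₗ f}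
  add_mem' := by
    intro f h hf hh g
    simp only [Set.mem_setOf_eq] at *
    rw [LinearMap.add_comp, LinearMap.comp_add, hf g, hh g]
  zero_mem' := by
    intro g
    simp only [Set.mem_setOf_eq, LinearMap.zero_comp, LinearMap.comp_zero]
  smul_mem' := by
    intro c f hf g
    simp only [Set.mem_setOf_eq] at *
    rw [LinearMap.smul_comp, LinearMap.comp_smul, hf g]

def repMult (ρ : Representation ℂ G V) (π : Representation ℂ G W) : ℕ :=
  Module.finrank ℂ (equivariantMaps π ρ)

end Reps

def IsUpperUni {N : ℕ} (A : Matrix (Fin N) (Fin N) ℂ) : Prop :=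
  (∀ i, A i i = 1) ∧ ∀ i j : Fin N, (j : ℕ) < (i : ℕ) → A i j = 0

def IsGLHW (n : ℕ) (a : Fin n → ℤ) {V : Type*} [AddCommGroup V] [Module ℂ V]
    (ρ : Representation ℂ (GL (Fin n) ℂ) V) : Prop :=
  IsIrreducibleRep ρ ∧ FiniteDimensional ℂ V ∧
  ∃ v : V, v ≠ 0 ∧
    (∀ g : GL (Fin n) ℂ, IsUpperUni (g : Matrix (Fin n) (Fin n) ℂ) → ρ g v = v) ∧
    (∀ (g : GL (Fin n) ℂ) (d : Fin n → ℂ),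
      (g : Matrix (Fin n) (Fin n) ℂ) = Matrix.diagonal d →
      ρ g v = (∏ i, d i ^ (a i)) • v)

def polyWeight (n : ℕ) (lam : ℕ → ℕ) : Fin n → ℤ := fun i => (lam (i : ℕ) : ℤ)

def ratWeight (n : ℕ) (lp lm : ℕ → ℕ) : Fin n → ℤ :=
  fun i => (lp (i : ℕ) : ℤ) - (lm (n - 1 - (i : ℕ)) : ℤ)

def formGroup {ι : Type*} [Fintype ι] [DecidableEq ι] (S : Matrix ι ι ℂ) :
    Subgroup (GL ι ℂ) where
  carrier := {g | (g : Matrix ι ι ℂ)ᵀ * S * (g : Matrix ι ι ℂ) = S}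
  one_mem' := by
    simp [Matrix.transpose_one]
  mul_mem' := by
    intro a b ha hb
    set A : Matrix ι ι ℂ := (a : Matrix ι ι ℂ) with hA
    set B : Matrix ι ι ℂ := (b : Matrix ι ι ℂ) with hB
    have ha' : Aᵀ * S * A = S := ha
    have hb' : Bᵀ * S * B = S := hb
    show ((↑(a * b) : Matrix ι ι ℂ))ᵀ * S * (↑(a * b) : Matrix ι ι ℂ) = S
    have hab : (↑(a * b) : Matrix ι ι ℂ) = A * B := Units.val_mul a b
    rw [hab, Matrix.transpose_mul]
    calc Bᵀ * Aᵀ * S * (A * B) = Bᵀ * (Aᵀ * S * A) * B := by noncomm_ring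
    _ = S := by rw [ha', hb']
  inv_mem' := by
    intro a ha
    set A : Matrix ι ι ℂ := (a : Matrix ι ι ℂ) with hA
    have ha' : Aᵀ * S * A = S := ha
    set C : Matrix ι ι ℂ := ((a⁻¹ : GL ι ℂ) : Matrix ι ι ℂ) with hC
    show Cᵀ * S * C = S
    have hac : A * C = 1 := by
      rw [hA, hC, ← Units.val_mul, mul_inv_cancel, Units.val_one]
    calc Cᵀ * S * C = Cᵀ * (Aᵀ * S * A) * C := by rw [ha']
    _ = (A * C)ᵀ * S * (A * C) := by rw [Matrix.transpose_mul]; noncomm_ring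
    _ = S := by rw [hac]; simp [Matrix.transpose_one]

def symForm (n : ℕ) : Matrix (Fin n) (Fin n) ℂ :=
  Matrix.of fun i j => if (i : ℕ) + (j : ℕ) = n - 1 then 1 else 0

def sympForm (n : ℕ) : Matrix (Fin (2 * n)) (Fin (2 * n)) ℂ :=
  Matrix.of fun i j =>
    if (i : ℕ) + (j : ℕ) = 2 * n - 1 then (if (i : ℕ) < n then 1 else -1) else 0

def OGL (n : ℕ) : Subgroup (GL (Fin n) ℂ) := formGroup (symForm n)

def SpGL (n : ℕ) : Subgroup (GL (Fin (2 * n)) ℂ) := formGroup (sympForm n)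

/-- The matrix of a distinguished reflection (an element of `O_n(ℂ)` of determinant `-1`
fixing the highest weight vectors of the representations `E^mu_(n)` for
`ℓ(mu) < n/2`): for odd `n`, the reflection negating the middle basis vector; for even
`n`, the permutation swapping the two middle basis vectors. -/
def reflMatrix (n : ℕ) : Matrix (Fin n) (Fin n) ℂ :=
  Matrix.of fun i j =>
    if 2 * (i : ℕ) + 1 = n ∧ i = j then -1
    else if (2 * (i : ℕ) = n ∧ 2 * (j : ℕ) + 2 = n) ∨ (2 * (i : ℕ) + 2 = n ∧ 2 * (j : ℕ) = n)
      then 1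
    else if i = j ∧ ¬(2 * (i : ℕ) = n ∨ 2 * (i : ℕ) + 2 = n) then 1
    else 0

/-- The partition associated to `mu` (with `(mu')_1 + (mu')_2 ≤ n`): the first column
length `(mu')_1` is replaced by `n - (mu')_1`.  One has `E^{assoc n mu} = E^mu ⊗ det`. -/
def assocPtn (n : ℕ) (mu : ℕ → ℕ) : ℕ → ℕ :=
  conj (fun j => if j = 0 then n - conj mu 0 else conj mu j)

/-- `v` is a highest weight vector of weight `mu` for (the identity component of)
`O_n(ℂ)`: it is fixed by all upper triangular unipotent elements, and the diagonal
torus elements of determinant one act via the character attached to `mu`. -/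
def IsOHWvec (n : ℕ) (mu : ℕ → ℕ) {V : Type*} [AddCommGroup V] [Module ℂ V]
    (ρ : Representation ℂ (OGL n) V) (v : V) : Prop :=
  (∀ g : OGL n, IsUpperUni ((g : GL (Fin n) ℂ) : Matrix (Fin n) (Fin n) ℂ) → ρ g v = v) ∧
  (∀ (g : OGL n) (d : Fin n → ℂ),
    ((g : GL (Fin n) ℂ) : Matrix (Fin n) (Fin n) ℂ) = Matrix.diagonal d →
    (∏ i, d i) = 1 →
    ρ g v = (∏ i, d i ^ (mu (i : ℕ))) • v)

/-- `ρ` is the irreducible rational representation `E^mu_(n)` of the complex orthogonal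
group `O_n(ℂ)`, indexed by a partition `mu` with `(mu')_1 + (mu')_2 ≤ n`. -/
def IsOIrrep (n : ℕ) (mu : ℕ → ℕ) {V : Type*} [AddCommGroup V] [Module ℂ V]
    (ρ : Representation ℂ (OGL n) V) : Prop :=
  IsIrreducibleRep ρ ∧ FiniteDimensional ℂ V ∧
  (if 2 * conj mu 0 ≤ n then
    ∃ v : V, v ≠ 0 ∧ IsOHWvec n mu ρ v ∧
      (2 * conj mu 0 = n ∨
        ∀ g : OGL n, ((g : GL (Fin n) ℂ) : Matrix (Fin n) (Fin n) ℂ) = reflMatrix n →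
          ρ g v = v)
  else
    ∃ v : V, v ≠ 0 ∧ IsOHWvec n (assocPtn n mu) ρ v ∧
      (∀ g : OGL n, ((g : GL (Fin n) ℂ) : Matrix (Fin n) (Fin n) ℂ) = reflMatrix n →
        ρ g v = - v))

/-- `ρ` is the irreducible rational representation `V^mu_(2n)` of `Sp_{2n}(ℂ)` with
highest weight `mu` (a partition with at most `n` parts). -/
def IsSpHW (n : ℕ) (mu : ℕ → ℕ) {V : Type*} [AddCommGroup V] [Module ℂ V]
    (ρ : Representation ℂ (SpGL n) V) : Prop :=
  IsIrreducibleRep ρ ∧ FiniteDimensional ℂ V ∧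
  ∃ v : V, v ≠ 0 ∧
    (∀ g : SpGL n,
      IsUpperUni ((g : GL (Fin (2 * n)) ℂ) : Matrix (Fin (2 * n)) (Fin (2 * n)) ℂ) →
      ρ g v = v) ∧
    (∀ (g : SpGL n) (d : Fin (2 * n) → ℂ),
      ((g : GL (Fin (2 * n)) ℂ) : Matrix (Fin (2 * n)) (Fin (2 * n)) ℂ) = Matrix.diagonal d →
      ρ g v = (∏ i, d i ^ (mu (i : ℕ))) • v)

namespace SpTensor

section Alternants

variable {n : ℕ}

/-- The exponent vector of a monomial in `n` variables. -/
abbrev expo (x : Fin n → ℕ) : Fin n →₀ ℕ := Finsupp.equivFunOnFinite.symm x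

/-- The alternant `det (X_i ^ e_j)`. -/
def alternant (e : Fin n → ℕ) : MvPolynomial (Fin n) ℤ :=
  Matrix.det (Matrix.of fun i j => (MvPolynomial.X i : MvPolynomial (Fin n) ℤ) ^ e j)

/-- The staircase vector. -/
def rho (n : ℕ) : ℕ → ℕ := fun i => n - 1 - i

/-- The alternant attached to the partition `α`. -/
def altP (n : ℕ) (α : ℕ → ℕ) : MvPolynomial (Fin n) ℤ :=
  alternant fun i => α i + rho n i

/-- Complete homogeneous symmetric polynomials. -/
def hpoly (n k : ℕ) : MvPolynomial (Fin n) ℤ :=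
  ∑ x ∈ Finset.piAntidiag Finset.univ k, MvPolynomial.monomial (expo x) 1

lemma alternant_eq_sum (e : Fin n → ℕ) :
    alternant e = ∑ w : Equiv.Perm (Fin n), (Equiv.Perm.sign w : ℤ) •
      (MvPolynomial.monomial (expo fun i => e (w.symm i)) 1 : MvPolynomial (Fin n) ℤ) := by
  rw [alternant, Matrix.det_apply]
  refine Finset.sum_congr rfl fun w _ => ?_
  rw [Units.smul_def]
  congr 1
  rw [MvPolynomial.monomial_eq, Finsupp.prod_fintype _ _ (by simp)]
  simp only [Matrix.of_apply, map_one, one_mul]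
  rw [← Equiv.prod_comp w fun i => MvPolynomial.X i ^ (expo fun i => e (w.symm i)) i]
  simp

lemma alternant_comp_perm (e : Fin n → ℕ) (w : Equiv.Perm (Fin n)) :
    alternant (fun i => e (w i)) = (Equiv.Perm.sign w : ℤ) • alternant e := by
  rw [alternant, alternant]
  have := Matrix.det_permute' w (Matrix.of fun i j => (MvPolynomial.X i : MvPolynomial (Fin n) ℤ) ^ e j)
  rw [zsmul_eq_mul]
  rw [← this]
  rfl

lemma alternant_mul_hpoly (e : Fin n → ℕ) (k : ℕ) :
    alternant e * hpoly n k = ∑ x ∈ Finset.piAntidiag Finset.univ k, alternant (e + x) := by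
  simp_rw [alternant_eq_sum]
  rw [Finset.sum_comm, Finset.sum_mul]
  refine Finset.sum_congr rfl fun w _ => ?_
  rw [hpoly, smul_mul_assoc, Finset.mul_sum, ← Finset.smul_sum]
  congr 1
  refine Finset.sum_nbij' (fun x => fun i => x (w i)) (fun x => fun i => x (w.symm i)) ?_ ?_ ?_ ?_ ?_
  · intro x hx
    simp only [Finset.mem_piAntidiag, Finset.mem_univ, implies_true, and_true] at hx ⊢
    rw [← hx, Equiv.sum_comp w]
  · intro x hx
    simp only [Finset.mem_piAntidiag, Finset.mem_univ, implies_true, and_true] at hx ⊢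
    rw [← hx, Equiv.sum_comp w.symm]
  · intro x _; simp
  · intro x _; simp
  · intro x _
    rw [MvPolynomial.monomial_mul, one_mul]
    have : ((expo fun i => e (w.symm i)) + expo x) = expo fun i => (e + fun i => x (w i)) (w.symm i) := by
      ext i; simp
    rw [this]

lemma sum_piAntidiag_univ {M : Type*} [AddCommMonoid M] (k : ℕ) (F : (Fin n → ℕ) → M) :
    ∑ x ∈ Finset.piAntidiag Finset.univ k, F x
      = ∑ x ∈ Finset.piAntidiag (Finset.range n) k, F fun i => x i := by
  refine Finset.sum_nbij' (fun x i => if h : i < n then x ⟨i, h⟩ else 0) (fun x i => x i)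
    ?_ ?_ ?_ ?_ ?_
  · intro x hx
    simp only [Finset.mem_piAntidiag, Finset.mem_univ, implies_true, and_true] at hx ⊢
    refine ⟨?_, ?_⟩
    · rw [Finset.sum_range, ← hx]; simp
    · intro i hi; by_contra h; simp at h; simp [h] at hi
  · intro x hx
    simp only [Finset.mem_piAntidiag, Finset.mem_univ, implies_true, and_true] at hx ⊢
    rw [← hx.1, Finset.sum_range]
  · intro x _; ext i; simp
  · intro x hx
    simp only [Finset.mem_piAntidiag] at hx
    ext i
    by_cases h : i < n
    · simp [h]
    · simp only [h, dite_false]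
      by_contra h'
      exact h (Finset.mem_range.1 (hx.2 i (Ne.symm h')))
  · intro x _; simp

/-- `κ / η` is a horizontal strip. -/
def Strip (η κ : ℕ → ℕ) : Prop := (∀ i, η i ≤ κ i) ∧ ∀ i, κ (i + 1) ≤ η i

/-- Partitions with at most `n` parts. -/
def IsPar (n : ℕ) (f : ℕ → ℕ) : Prop := Antitone f ∧ ∀ i, n ≤ i → f i = 0

/-- Exchange step of the sign reversing involution in Pieri's rule. -/
def pieriSwap (α x : ℕ → ℕ) (i : ℕ) : ℕ → ℕ := fun l =>
  if l = i then α (i + 1) + x (i + 1) - α i - 1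
  else if l = i + 1 then α i + x i + 1 - α (i + 1) else x l

open Classical in
lemma alternant_swap (α x : ℕ → ℕ) (i : ℕ) (hα : Antitone α) (hi : i + 1 < n)
    (hx : α i < α (i + 1) + x (i + 1)) :
    altP n (α + pieriSwap α x i) = - altP n (α + x) := by
  have key : (fun l : Fin n => (α + pieriSwap α x i) l + rho n l)
      = fun l : Fin n => (fun l : Fin n => (α + x) l + rho n l)
        (Equiv.swap (⟨i, by omega⟩ : Fin n) ⟨i + 1, hi⟩ l) := by
    have hh := hα (Nat.le_succ i)
    simp only [Nat.succ_eq_add_one] at hh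
    ext l
    by_cases h1 : (l : ℕ) = i
    · have : l = ⟨i, by omega⟩ := Fin.ext h1
      rw [this, Equiv.swap_apply_left]
      simp [pieriSwap, rho]
      omega
    · by_cases h2 : (l : ℕ) = i + 1
      · have : l = ⟨i + 1, by omega⟩ := Fin.ext h2
        rw [this, Equiv.swap_apply_right]
        simp [pieriSwap, rho]
        omega
      · rw [Equiv.swap_apply_of_ne_of_ne]
        · simp [pieriSwap, h1, h2]
        · intro h; exact h1 (congrArg Fin.val h)
        · intro h; exact h2 (congrArg Fin.val h)
  rw [altP, key, alternant_comp_perm (fun l : Fin n => (α + x) l + rho n l), Equiv.Perm.sign_swap]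
  · simp [altP]
  · intro h; simpa using congrArg Fin.val h

open Classical in
/-- Pieri's rule for alternants. -/
lemma altP_mul_hpoly (α : ℕ → ℕ) (hα : IsPar n α) (k : ℕ) :
    altP n α * hpoly n k
      = ∑ x ∈ (Finset.piAntidiag (Finset.range n) k).filter (fun x => Strip α (α + x)),
          altP n (α + x) := by
  rw [altP, alternant_mul_hpoly, sum_piAntidiag_univ, Finset.sum_filter]
  have h0 : ∀ x : ℕ → ℕ, alternant (n := n) ((fun i : Fin n => α i + rho n i) + fun i : Fin n => x i)
      = altP n (α + x) := by
    intro x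
    rw [altP]; congr 1; ext i; simp; ring
  simp only [h0]
  rw [← sub_eq_zero, ← Finset.sum_sub_distrib]
  have bad_iff : ∀ x ∈ Finset.piAntidiag (Finset.range n) k, ¬ Strip α (α + x) →
      ∃ i, i + 1 < n ∧ α i < α (i + 1) + x (i + 1) := by
    intro x hx h
    simp only [Strip, Pi.add_apply, le_add_iff_nonneg_right, zero_le, implies_true, true_and,
      not_forall, not_le] at h
    obtain ⟨i, hi⟩ := h
    refine ⟨i, ?_, hi⟩
    by_contra hn
    have h1 := hα.2 (i + 1) (by omega)
    have h2 : x (i + 1) = 0 := by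
      by_contra h'
      have := Finset.mem_range.1 ((Finset.mem_piAntidiag.1 hx).2 _ h')
      omega
    omega
  let P : (ℕ → ℕ) → ℕ → Prop := fun x i => i + 1 < n ∧ α i < α (i + 1) + x (i + 1)
  let J : (ℕ → ℕ) → ℕ := fun x => Nat.findGreatest (P x) n
  have hJ : ∀ x, (∃ i, P x i) → P x (J x) := fun x ⟨i, hi⟩ =>
    Nat.findGreatest_spec (P := P x) (m := i) (by have := hi.1; omega) hi
  have hsw : ∀ x i, P x i → ∀ l, i < l + 1 → (P (pieriSwap α x i) l ↔ P x l) := by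
    intro x i hi l hl
    have hh := hα.1 (Nat.le_succ i)
    simp only [Nat.succ_eq_add_one] at hh
    by_cases h : l = i
    · subst h
      have := hi.1; have := hi.2
      simp [P, pieriSwap, hi.1, hi.2]; omega
    · have h1 : l + 1 ≠ i := by omega
      simp [P, pieriSwap, h, h1]
  have hJs : ∀ x, (∃ i, P x i) → J (pieriSwap α x (J x)) = J x := by
    intro x hx
    have h1 := hJ x hx
    apply le_antisymm
    · by_contra hlt
      push Not at hlt
      have h2 : P (pieriSwap α x (J x)) (J (pieriSwap α x (J x))) :=
        hJ _ ⟨J x, (hsw x _ h1 _ (by omega)).2 h1⟩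
      rw [hsw x _ h1 _ (by omega)] at h2
      have h3 : J (pieriSwap α x (J x)) ≤ J x :=
        Nat.le_findGreatest (by have := h2.1; omega) h2
      omega
    · exact Nat.le_findGreatest (by have := h1.1; omega) ((hsw x _ h1 _ (by omega)).2 h1)
  have hns : ∀ x i, P x i → ¬ Strip α (α + x) := by
    intro x i hi hs
    have := hs.2 i
    have := hi.2
    simp only [Pi.add_apply] at *
    omega
  have hterm : ∀ x, (∃ i, P x i) → (altP n (α + x) - if Strip α (α + x) then altP n (α + x) else 0)
      = altP n (α + x) := fun x ⟨i, hi⟩ => by simp [hns x i hi]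
  have hterm0 : ∀ x, Strip α (α + x) →
      (altP n (α + x) - if Strip α (α + x) then altP n (α + x) else 0) = 0 :=
    fun x h => by simp [h]
  have hmem : ∀ x i, P x i → x ∈ Finset.piAntidiag (Finset.range n) k →
      pieriSwap α x i ∈ Finset.piAntidiag (Finset.range n) k := by
    intro x i hi hx
    rw [Finset.mem_piAntidiag] at hx ⊢
    have hh := hα.1 (Nat.le_succ i)
    simp only [Nat.succ_eq_add_one] at hh
    obtain ⟨hi1, hi2⟩ := hi
    refine ⟨?_, ?_⟩
    · rw [← hx.1]
      have hm1 : i ∈ Finset.range n := by simp; omega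
      have hm2 : i + 1 ∈ (Finset.range n).erase i := by simp; omega
      rw [← Finset.add_sum_erase _ _ hm1, ← Finset.add_sum_erase _ _ hm2,
        ← Finset.add_sum_erase _ _ hm1, ← Finset.add_sum_erase _ _ hm2, ← add_assoc, ← add_assoc]
      congr 1
      · simp [pieriSwap]; omega
      · refine Finset.sum_congr rfl fun l hl => ?_
        simp only [Finset.mem_erase] at hl
        simp [pieriSwap, hl.1, hl.2.1]
    · intro l hl
      by_cases h1 : l = i
      · subst h1; simp; omega
      by_cases h2 : l = i + 1
      · subst h2; simp; omega
      · simp only [pieriSwap, h1, h2, if_false] at hl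
        exact hx.2 l hl
  refine Finset.sum_involution
    (fun x _ => if Strip α (α + x) then x else pieriSwap α x (J x)) ?_ ?_ ?_ ?_
  · intro x hx
    by_cases hs : Strip α (α + x)
    · simp [hs]
    · have hb := bad_iff x hx hs
      have h1 := hJ x hb
      have hb' : ∃ i, P (pieriSwap α x (J x)) i := ⟨J x, (hsw x _ h1 _ (by omega)).2 h1⟩
      simp only [hs, if_false]
      rw [if_neg (hns _ _ hb'.choose_spec), sub_zero, sub_zero, alternant_swap α x _ hα.1 h1.1 h1.2]
      ring
  · intro x hx hne
    by_cases hs : Strip α (α + x)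
    · simp [hs] at hne
    · have hb := bad_iff x hx hs
      have h1 := hJ x hb
      simp only [hs, if_false, sub_zero] at hne ⊢
      intro heq
      have h2 := alternant_swap (n := n) α x _ hα.1 h1.1 h1.2
      rw [heq] at h2
      exact hne (self_eq_neg.1 h2)
  · intro x hx
    by_cases hs : Strip α (α + x)
    · simpa [hs] using hx
    · simp only [hs, if_false]
      exact hmem x _ (hJ x (bad_iff x hx hs)) hx
  · intro x hx
    by_cases hs : Strip α (α + x)
    · simp [hs]
    · have hb := bad_iff x hx hs
      have h1 := hJ x hb
      have hb' : P (pieriSwap α x (J x)) (J x) := (hsw x _ h1 _ (by omega)).2 h1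
      simp only [hs, if_false]
      rw [if_neg (hns _ _ hb'), hJs x hb]
      have hh := hα.1 (Nat.le_succ (J x))
      simp only [Nat.succ_eq_add_one] at hh
      have h12 := h1.2
      ext l
      by_cases e1 : l = J x
      · subst e1; simp [pieriSwap]; omega
      by_cases e2 : l = J x + 1
      · simp [pieriSwap, e2]; omega
      · simp [pieriSwap, e1, e2]

end Alternants

section Chains

variable {n : ℕ}

lemma IsPar.strip {η κ : ℕ → ℕ} (h : Strip η κ) (hκ : ∀ i, n ≤ i → κ i = 0) : IsPar n κ :=
  ⟨antitone_nat_of_succ_le fun i => (h.2 i).trans (h.1 i), hκ⟩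

lemma perm_eq_one_of_strictAnti {e f : Fin n → ℕ} (he : StrictAnti e) (hf : StrictAnti f)
    (w : Equiv.Perm (Fin n)) (h : ∀ i, f i = e (w i)) : w = 1 := by
  have hw : StrictMono w := by
    intro i j hij
    have := hf hij
    rw [h, h] at this
    exact he.lt_iff_gt.1 this
  have := (StrictMono.range_inj hw (strictMono_id (α := Fin n))).1 (by simp [w.surjective.range_eq])
  ext i
  simp [this]

lemma strictAnti_add_rho {α : ℕ → ℕ} (hα : Antitone α) :
    StrictAnti fun i : Fin n => α i + rho n i := by
  intro i j hij
  have := hα hij.le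
  have h1 : (i : ℕ) < j := hij
  have h2 := j.2
  simp only [rho] at *
  have h3 : α j ≤ α i := hα h1.le
  omega

lemma alternant_coeff (e f : Fin n → ℕ) :
    (alternant e).coeff (expo f) = ∑ w : Equiv.Perm (Fin n),
      if ∀ i, f i = e (w.symm i) then (Equiv.Perm.sign w : ℤ) else 0 := by
  rw [alternant_eq_sum, MvPolynomial.coeff_sum]
  refine Finset.sum_congr rfl fun w _ => ?_
  rw [MvPolynomial.coeff_smul, MvPolynomial.coeff_monomial]
  have : (expo fun i => e (w.symm i)) = expo f ↔ ∀ i, f i = e (w.symm i) := by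
    rw [Equiv.apply_eq_iff_eq, funext_iff]
    exact forall_congr' fun i => eq_comm
  simp [this]

open Classical in
lemma altP_coeff {κ μ : ℕ → ℕ} (hκ : IsPar n κ) (hμ : IsPar n μ) :
    (altP n κ).coeff (expo fun i : Fin n => μ i + rho n i) = if κ = μ then 1 else 0 := by
  rw [altP, alternant_coeff]
  have h1 : ∀ w : Equiv.Perm (Fin n),
      (∀ i : Fin n, μ i + rho n i = κ (w.symm i) + rho n (w.symm i)) ↔ (w = 1 ∧ κ = μ) := by
    intro w
    constructor
    · intro h
      have hw : w.symm = 1 := perm_eq_one_of_strictAnti (strictAnti_add_rho hκ.1)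
        (strictAnti_add_rho hμ.1) w.symm h
      have hw' : w = 1 := by
        rw [← Equiv.symm_symm w, hw]; rfl
      refine ⟨hw', ?_⟩
      ext i
      by_cases hi : i < n
      · have := h ⟨i, hi⟩
        rw [hw] at this
        simpa using this.symm
      · rw [hκ.2 i (by omega), hμ.2 i (by omega)]
    · rintro ⟨rfl, rfl⟩ i
      rfl
  simp only [h1]
  by_cases h : κ = μ
  · simp [h]
  · simp [h]

/-- `κ` is a chain of `m` horizontal strips starting at `α`, with sizes `y`. -/
structure IsChain (n m : ℕ) (α y : ℕ → ℕ) (κ : ℕ → ℕ → ℕ) : Prop where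
  zero : κ 0 = α
  strip : ∀ r < m, Strip (κ r) (κ (r + 1))
  const : ∀ r, m ≤ r → κ r = κ m
  supp : ∀ r i, n ≤ i → κ r i = 0
  size : ∀ r < m, ∑ i ∈ Finset.range n, κ (r + 1) i = ∑ i ∈ Finset.range n, κ r i + y r

lemma IsChain.isPar {m : ℕ} {α y : ℕ → ℕ} {κ : ℕ → ℕ → ℕ} (h : IsChain n m α y κ)
    (hα : IsPar n α) (r : ℕ) : IsPar n (κ r) := by
  have : ∀ r ≤ m, IsPar n (κ r) := by
    intro r hr
    cases r with
    | zero => rw [h.zero]; exact hα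
    | succ r => exact IsPar.strip (h.strip r (by omega)) (h.supp _)
  by_cases hr : r ≤ m
  · exact this r hr
  · rw [h.const r (by omega)]; exact this m le_rfl

open Classical in
/-- Iterated Pieri rule. -/
lemma exists_chains (α y : ℕ → ℕ) (hα : IsPar n α) (m : ℕ) :
    ∃ F : Finset (ℕ → ℕ → ℕ), (∀ κ, κ ∈ F ↔ IsChain n m α y κ) ∧
      altP n α * ∏ r ∈ Finset.range m, hpoly n (y r) = ∑ κ ∈ F, altP n (κ m) := by
  induction m with
  | zero =>
    refine ⟨{fun _ => α}, ?_, by simp⟩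
    intro κ
    rw [Finset.mem_singleton]
    constructor
    · rintro rfl
      exact ⟨rfl, by simp, by simp, fun _ => hα.2, by simp⟩
    · intro h
      ext r i
      rw [h.const r (by omega), h.zero]
  | succ m ih =>
    obtain ⟨F, hF, hsum⟩ := ih
    let X : (ℕ → ℕ → ℕ) → Finset (ℕ → ℕ) := fun κ =>
      (Finset.piAntidiag (Finset.range n) (y m)).filter fun x => Strip (κ m) (κ m + x)
    let φ : (Σ _ : ℕ → ℕ → ℕ, ℕ → ℕ) → ℕ → ℕ → ℕ := fun p r =>
      if r ≤ m then p.1 r else p.1 m + p.2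
    refine ⟨(F.sigma X).image φ, ?_, ?_⟩
    · intro κ'
      simp only [Finset.mem_image, Finset.mem_sigma, hF, X, Finset.mem_filter,
        Finset.mem_piAntidiag, Finset.mem_range]
      constructor
      · rintro ⟨⟨κ, x⟩, ⟨hc, ⟨hx1, hx2⟩, hs⟩, rfl⟩
        dsimp only at *
        refine ⟨by simp [φ, hc.zero], ?_, ?_, ?_, ?_⟩
        · intro r hr
          by_cases h : r = m
          · subst h; simpa [φ] using hs
          · have := hc.strip r (by omega)
            have h1 : r ≤ m := by omega
            have h2 : r + 1 ≤ m := by omega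
            simpa [φ, h1, h2] using this
        · intro r hr
          have : ¬ r ≤ m := by omega
          simp [φ, this]
        · intro r i hi
          by_cases h : r ≤ m
          · simp [φ, h, hc.supp _ i hi]
          · simp only [φ, h, if_false, Pi.add_apply, hc.supp _ i hi, zero_add]
            by_contra h'
            have := hx2 i h'
            omega
        · intro r hr
          by_cases h : r = m
          · subst h; simp [φ, Finset.sum_add_distrib, hx1]
          · have := hc.size r (by omega)
            have h1 : r ≤ m := by omega
            have h2 : r + 1 ≤ m := by omega
            simpa [φ, h1, h2] using this
      · intro hc
        have hle : ∀ i, κ' m i ≤ κ' (m + 1) i := (hc.strip m (by omega)).1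
        have hadd : (κ' m + fun i => κ' (m + 1) i - κ' m i) = κ' (m + 1) := by
          ext i; have := hle i; simp; omega
        refine ⟨⟨fun r => κ' (min r m), fun i => κ' (m + 1) i - κ' m i⟩, ⟨?_, ⟨?_, ?_⟩, ?_⟩, ?_⟩
        · refine ⟨by simp [hc.zero], ?_, ?_, ?_, ?_⟩
          · intro r hr
            have := hc.strip r (by omega)
            dsimp only
            rwa [min_eq_left hr.le, min_eq_left (by omega)]
          · intro r hr
            simp [hr]
          · intro r i hi
            exact hc.supp _ i hi
          · intro r hr
            have := hc.size r (by omega)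
            dsimp only
            rwa [min_eq_left hr.le, min_eq_left (by omega)]
        · have := hc.size m (by omega)
          dsimp only
          rw [Finset.sum_tsub_distrib _ (fun i _ => hle i), this]
          simp
        · intro i hi
          by_contra h
          apply hi
          simp [hc.supp _ i (by omega)]
        · dsimp only
          rw [min_self, hadd]
          exact hc.strip m (by omega)
        · funext r
          by_cases h : r ≤ m
          · simp [φ, h]
          · simp only [φ, h, if_false, min_self]
            rw [hadd, hc.const r (by omega)]
    · rw [Finset.prod_range_succ, ← mul_assoc, hsum, Finset.sum_mul, Finset.sum_image]
      · rw [Finset.sum_sigma]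
        refine Finset.sum_congr rfl fun κ hκ => ?_
        rw [altP_mul_hpoly _ (((hF κ).1 hκ).isPar hα m)]
        refine Finset.sum_congr rfl fun x _ => ?_
        simp [φ]
      · rintro ⟨κ, x⟩ hp ⟨κ₁, x₁⟩ hp₁ heq
        have h1 := ((hF κ).1 (Finset.mem_sigma.1 hp).1)
        have h2 := ((hF κ₁).1 (Finset.mem_sigma.1 hp₁).1)
        have h3 : ∀ r ≤ m, κ r = κ₁ r := by
          intro r hr
          have := congrFun heq r
          simpa [φ, hr] using this
        have h4 : κ = κ₁ := by
          funext r
          by_cases hr : r ≤ m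
          · exact h3 r hr
          · rw [h1.const r (by omega), h2.const r (by omega), h3 m le_rfl]
        subst h4
        have := congrFun heq (m + 1)
        simp only [φ, add_le_iff_nonpos_right, nonpos_iff_eq_zero, one_ne_zero, if_false] at this
        rw [add_left_cancel this]

/-- The number of boxes of the `r`-th strip of a chain. -/
def wt (n : ℕ) (κ : ℕ → ℕ → ℕ) (r : ℕ) : ℕ :=
  ∑ i ∈ Finset.range n, κ (r + 1) i - ∑ i ∈ Finset.range n, κ r i

/-- Chains of `n` horizontal strips from `α` to `μ`. -/
structure IsCh (n : ℕ) (α μ : ℕ → ℕ) (κ : ℕ → ℕ → ℕ) : Prop where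
  zero : κ 0 = α
  last : κ n = μ
  strip : ∀ r < n, Strip (κ r) (κ (r + 1))
  const : ∀ r, n ≤ r → κ r = κ n
  supp : ∀ r i, n ≤ i → κ r i = 0

lemma IsChain.congr {m : ℕ} {α y z : ℕ → ℕ} {κ : ℕ → ℕ → ℕ} (h : IsChain n m α y κ)
    (hyz : ∀ r < m, y r = z r) : IsChain n m α z κ :=
  ⟨h.zero, h.strip, h.const, h.supp, fun r hr => by rw [h.size r hr, hyz r hr]⟩

lemma IsCh.isChain {α μ : ℕ → ℕ} {κ : ℕ → ℕ → ℕ} (h : IsCh n α μ κ) :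
    IsChain n n α (wt n κ) κ :=
  ⟨h.zero, h.strip, h.const, h.supp, fun r hr => by
    have : ∑ i ∈ Finset.range n, κ r i ≤ ∑ i ∈ Finset.range n, κ (r + 1) i :=
      Finset.sum_le_sum fun i _ => (h.strip r hr).1 i
    simp only [wt]; omega⟩

lemma isCh_finite (α μ : ℕ → ℕ) (hα : IsPar n α) : {κ | IsCh n α μ κ}.Finite := by
  classical
  choose F hF _ using fun y => exists_chains (n := n) α y hα n
  have hfin : (⋃ k ∈ Finset.range (∑ i ∈ Finset.range n, μ i + 1),
      ⋃ y ∈ Finset.piAntidiag (Finset.range n) k, (F y : Set (ℕ → ℕ → ℕ))).Finite :=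
    Set.Finite.biUnion (Finset.finite_toSet _) fun k _ =>
      Set.Finite.biUnion (Finset.finite_toSet _) fun y _ => Finset.finite_toSet _
  refine hfin.subset fun κ hκ => ?_
  have hc := IsCh.isChain hκ
  simp only [Set.mem_iUnion]
  have htel : ∀ r ≤ n, ∑ s ∈ Finset.range r, wt n κ s + ∑ i ∈ Finset.range n, κ 0 i
      = ∑ i ∈ Finset.range n, κ r i := by
    intro r hr
    induction r with
    | zero => simp
    | succ r ih =>
      rw [Finset.sum_range_succ, hc.size r (by omega), ← ih (by omega)]; ring
  refine ⟨∑ s ∈ Finset.range n, wt n κ s, ?_, wt n κ, ?_, ?_⟩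
  · have := htel n le_rfl
    rw [hκ.last] at this
    simp; omega
  · rw [Finset.mem_piAntidiag]
    refine ⟨rfl, fun i hi => ?_⟩
    by_contra h
    apply hi
    have h : n ≤ i := by simpa using h
    simp [wt, hκ.const i h, hκ.const (i + 1) (by omega)]
  · simpa [hF] using hc

open Classical in
/-- The finite set of chains from `α` to `μ`. -/
def chs (n : ℕ) (α μ : ℕ → ℕ) : Finset (ℕ → ℕ → ℕ) :=
  if h : IsPar n α then (isCh_finite α μ h).toFinset else ∅

lemma mem_chs {α μ : ℕ → ℕ} (hα : IsPar n α) {κ : ℕ → ℕ → ℕ} :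
    κ ∈ chs n α μ ↔ IsCh n α μ κ := by
  simp [chs, hα]

open Classical in
lemma coeff_altP_mul_prod {α μ : ℕ → ℕ} (hα : IsPar n α) (hμ : IsPar n μ) (y : ℕ → ℕ) :
    (altP n α * ∏ r ∈ Finset.range n, hpoly n (y r)).coeff
        (expo fun i : Fin n => μ i + rho n i)
      = (((chs n α μ).filter fun κ => ∀ i < n, wt n κ i = y i).card : ℤ) := by
  obtain ⟨F, hF, h⟩ := exists_chains (n := n) α y hα n
  rw [h, MvPolynomial.coeff_sum]
  rw [Finset.sum_congr rfl fun κ hκ => altP_coeff (((hF κ).1 hκ).isPar hα n) hμ]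
  rw [← Finset.sum_filter, Finset.sum_const, nsmul_eq_mul, mul_one]
  congr 2
  ext κ
  simp only [Finset.mem_filter, hF, mem_chs hα]
  constructor
  · rintro ⟨hc, hl⟩
    refine ⟨⟨hc.zero, hl, hc.strip, hc.const, hc.supp⟩, fun i hi => ?_⟩
    rw [wt, hc.size i hi]; omega
  · rintro ⟨hc, hl⟩
    exact ⟨hc.isChain.congr hl, hc.last⟩

end Chains

section Stembridge

variable {n : ℕ}

/-- The number of boxes of the `r`-th strip lying in columns at least `j`. -/
def colCount (n : ℕ) (κ : ℕ → ℕ → ℕ) (r j : ℕ) : ℕ :=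
  ∑ i ∈ Finset.range n, ((κ (r + 1) i - j) - (κ r i - j))

/-- The number of boxes of the `r`-th strip lying in column `j`. -/
def colMult (n : ℕ) (κ : ℕ → ℕ → ℕ) (r j : ℕ) : ℕ :=
  ∑ i ∈ Finset.range n, if κ r i ≤ j ∧ j < κ (r + 1) i then 1 else 0

lemma colCount_succ (κ : ℕ → ℕ → ℕ) (r j : ℕ) (h : ∀ i, κ r i ≤ κ (r + 1) i) :
    colCount n κ r j = colCount n κ r (j + 1) + colMult n κ r j := by
  rw [colCount, colCount, colMult, ← Finset.sum_add_distrib]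
  refine Finset.sum_congr rfl fun i _ => ?_
  have := h i
  split_ifs <;> omega

lemma colMult_le_one (κ : ℕ → ℕ → ℕ) (r j : ℕ) (hs : Strip (κ r) (κ (r + 1)))
    (ha : Antitone (κ r)) : colMult n κ r j ≤ 1 := by
  rw [colMult, ← Finset.sum_filter, Finset.sum_const, smul_eq_mul, mul_one, Finset.card_le_one]
  have key : ∀ a b, a < b → κ r a ≤ j → j < κ (r + 1) b → False := by
    intro a b hab h1 h2
    obtain ⟨b, rfl⟩ : ∃ c, b = c + 1 := ⟨b - 1, by omega⟩
    have h3 := hs.2 b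
    have h4 := ha (show a ≤ b by omega)
    omega
  intro a ha b hb
  simp only [Finset.mem_filter] at ha hb
  rcases lt_trichotomy a b with h | h | h
  · exact (key a b h ha.2.1 hb.2.2).elim
  · exact h
  · exact (key b a h hb.2.1 ha.2.2).elim

/-- Bender–Knuth toggle of the `(r+1)`-st member of a chain on the columns `< j`. -/
def toggle (κ : ℕ → ℕ → ℕ) (r j : ℕ) : ℕ → ℕ → ℕ := fun s i =>
  if s = r + 1 ∧ κ s i ≤ j then
    max (κ r i) (κ (r + 2) (i + 1)) +
      min (min (κ (r + 2) i) j) (if i = 0 then j else κ r (i - 1)) - κ (r + 1) i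
  else κ s i

/-- The hypotheses under which the toggle is applied. -/
structure Togglable (n : ℕ) (κ : ℕ → ℕ → ℕ) (r j : ℕ) : Prop where
  strip : Strip (κ r) (κ (r + 1))
  strip' : Strip (κ (r + 1)) (κ (r + 2))
  supp : ∀ s i, n ≤ i → κ s i = 0
  col : ∀ i, j < κ (r + 1) i → j < κ r i

variable {κ : ℕ → ℕ → ℕ} {r j : ℕ}

lemma Togglable.bounds (h : Togglable n κ r j) (i : ℕ) (hi : κ (r + 1) i ≤ j) :
    max (κ r i) (κ (r + 2) (i + 1)) ≤ κ (r + 1) i ∧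
      κ (r + 1) i ≤ min (min (κ (r + 2) i) j) (if i = 0 then j else κ r (i - 1)) := by
  have h1 := h.strip.1 i
  have h2 := h.strip'.1 i
  have h3 := h.strip'.2 i
  refine ⟨max_le h1 h3, le_min (le_min h2 hi) ?_⟩
  split_ifs with h0
  · exact hi
  · have := h.strip.2 (i - 1)
    rwa [Nat.sub_add_cancel (by omega)] at this

lemma toggle_of_ne {s : ℕ} (hs : s ≠ r + 1) : toggle κ r j s = κ s := by
  ext i; simp [toggle, hs]

lemma toggle_of_lt {i : ℕ} (hi : j < κ (r + 1) i) : toggle κ r j (r + 1) i = κ (r + 1) i := by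
  simp [toggle, hi]

lemma toggle_of_le {i : ℕ} (hi : κ (r + 1) i ≤ j) : toggle κ r j (r + 1) i =
    max (κ r i) (κ (r + 2) (i + 1)) +
      min (min (κ (r + 2) i) j) (if i = 0 then j else κ r (i - 1)) - κ (r + 1) i := by
  simp [toggle, hi]

lemma Togglable.toggle_bounds (h : Togglable n κ r j) (i : ℕ) (hi : κ (r + 1) i ≤ j) :
    max (κ r i) (κ (r + 2) (i + 1)) ≤ toggle κ r j (r + 1) i ∧
      toggle κ r j (r + 1) i ≤
        min (min (κ (r + 2) i) j) (if i = 0 then j else κ r (i - 1)) := by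
  have := h.bounds i hi
  rw [toggle_of_le hi]
  omega

lemma Togglable.toggle_lt_iff (h : Togglable n κ r j) (i : ℕ) :
    j < toggle κ r j (r + 1) i ↔ j < κ (r + 1) i := by
  by_cases hi : κ (r + 1) i ≤ j
  · have := (h.toggle_bounds i hi).2
    have h2 : min (min (κ (r + 2) i) j) (if i = 0 then j else κ r (i - 1)) ≤ j :=
      (min_le_left _ _).trans (min_le_right _ _)
    omega
  · rw [toggle_of_lt (by omega)]

lemma Togglable.toggle_sub (h : Togglable n κ r j) (s i j' : ℕ) (hj : j ≤ j') :
    toggle κ r j s i - j' = κ s i - j' := by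
  by_cases hs : s = r + 1
  · subst hs
    by_cases hi : j < κ (r + 1) i
    · rw [toggle_of_lt hi]
    · have := h.toggle_lt_iff i
      omega
  · rw [toggle_of_ne hs]

lemma Togglable.colCount_toggle (h : Togglable n κ r j) (s j' : ℕ) (hj : j ≤ j') :
    colCount n (toggle κ r j) s j' = colCount n κ s j' := by
  simp [colCount, h.toggle_sub _ _ _ hj]

lemma Togglable.toggle (h : Togglable n κ r j) : Togglable n (toggle κ r j) r j := by
  have hr : r ≠ r + 1 := by omega
  have hr2 : r + 2 ≠ r + 1 := by omega
  refine ⟨⟨?_, ?_⟩, ⟨?_, ?_⟩, ?_, ?_⟩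
  · intro i
    rw [toggle_of_ne hr]
    by_cases hi : κ (r + 1) i ≤ j
    · exact (le_max_left _ _).trans (h.toggle_bounds i hi).1
    · rw [toggle_of_lt (by omega)]; exact h.strip.1 i
  · intro i
    rw [toggle_of_ne hr]
    by_cases hi : κ (r + 1) (i + 1) ≤ j
    · have := (h.toggle_bounds _ hi).2.trans (min_le_right _ _)
      simpa using this
    · rw [toggle_of_lt (by omega)]; exact h.strip.2 i
  · intro i
    rw [toggle_of_ne hr2]
    by_cases hi : κ (r + 1) i ≤ j
    · exact (h.toggle_bounds i hi).2.trans ((min_le_left _ _).trans (min_le_left _ _))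
    · rw [toggle_of_lt (by omega)]; exact h.strip'.1 i
  · intro i
    rw [toggle_of_ne hr2]
    by_cases hi : κ (r + 1) i ≤ j
    · exact (le_max_right _ _).trans (h.toggle_bounds i hi).1
    · rw [toggle_of_lt (by omega)]; exact h.strip'.2 i
  · intro s i hi
    by_cases hs : s = r + 1
    · subst hs
      have h1 : κ (r + 1) i ≤ j := by rw [h.supp _ _ hi]; omega
      have := (h.toggle_bounds i h1).2.trans ((min_le_left _ _).trans (min_le_left _ _))
      rw [h.supp _ _ hi] at this
      omega
    · rw [toggle_of_ne hs]; exact h.supp _ _ hi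
  · intro i
    rw [h.toggle_lt_iff, toggle_of_ne hr]
    exact h.col i

lemma Togglable.toggle_toggle (h : Togglable n κ r j) :
    SpTensor.toggle (SpTensor.toggle κ r j) r j = κ := by
  have hr : r ≠ r + 1 := by omega
  have hr2 : r + 2 ≠ r + 1 := by omega
  ext s i
  by_cases hs : s = r + 1
  · subst hs
    by_cases hi : κ (r + 1) i ≤ j
    · have h1 : SpTensor.toggle κ r j (r + 1) i ≤ j := by
        have := h.toggle_lt_iff i; omega
      have h2 := h.bounds i hi
      rw [toggle_of_le h1, toggle_of_ne hr, toggle_of_ne hr2, toggle_of_le hi]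
      omega
    · have h1 : j < SpTensor.toggle κ r j (r + 1) i := by
        have := h.toggle_lt_iff i; omega
      rw [toggle_of_lt h1, toggle_of_lt (by omega)]
  · rw [toggle_of_ne hs, toggle_of_ne hs]

lemma Togglable.sum_min (h : Togglable n κ r j) :
    ∑ i ∈ Finset.range n, (min (κ (r + 1) i) j + min (SpTensor.toggle κ r j (r + 1) i) j)
      = ∑ i ∈ Finset.range n, (min (κ r i) j + min (κ (r + 2) i) j) := by
  let m : ℕ → ℕ := fun i => if i = 0 then min (κ (r + 2) 0) j
    else min (min (κ (r + 2) i) j) (min (κ r (i - 1)) j)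
  have h1 : ∀ i, min (κ (r + 1) i) j + min (SpTensor.toggle κ r j (r + 1) i) j
      = max (min (κ r i) j) (min (κ (r + 2) (i + 1)) j) + m i := by
    intro i
    by_cases hi : κ (r + 1) i ≤ j
    · have h2 := h.bounds i hi
      have h3 := h.toggle_bounds i hi
      rw [toggle_of_le hi] at h3 ⊢
      by_cases h0 : i = 0
      · subst h0; simp only [m, if_true] at *; omega
      · simp only [m, h0, if_false] at *; omega
    · have h2 := h.col i (by omega)
      have h3 := h.strip'.1 i
      rw [toggle_of_lt (by omega)]
      by_cases h0 : i = 0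
      · subst h0; simp only [m, if_true]; omega
      · have h4 := h.strip.2 (i - 1)
        rw [Nat.sub_add_cancel (by omega)] at h4
        simp only [m, h0, if_false]; omega
  rw [Finset.sum_congr rfl fun i _ => h1 i, Finset.sum_add_distrib, Finset.sum_add_distrib]
  have e1 : ∑ i ∈ Finset.range n, m i = ∑ i ∈ Finset.range n, m (i + 1) + m 0 := by
    rw [← Finset.sum_range_succ', Finset.sum_range_succ]
    have : m n = 0 := by
      simp only [m, h.supp (r + 2) n le_rfl]
      split_ifs with h0
      · subst h0; simp [h.supp (r + 2) 0 le_rfl]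
      · simp
    omega
  have e2 : ∑ i ∈ Finset.range n, min (κ (r + 2) i) j
      = ∑ i ∈ Finset.range n, min (κ (r + 2) (i + 1)) j + m 0 := by
    have : m 0 = min (κ (r + 2) 0) j := by simp [m]
    rw [this, ← Finset.sum_range_succ' (fun i => min (κ (r + 2) i) j), Finset.sum_range_succ]
    simp [h.supp (r + 2) n le_rfl]
  rw [e1, e2, ← add_assoc, ← add_assoc, ← Finset.sum_add_distrib, ← Finset.sum_add_distrib]
  congr 1
  refine Finset.sum_congr rfl fun i _ => ?_
  simp only [m, Nat.add_eq_zero_iff, one_ne_zero, and_false, if_false, Nat.add_sub_cancel]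
  omega

lemma Togglable.sum_toggle (h : Togglable n κ r j)
    (hc : colCount n κ (r + 1) j = colCount n κ r j + 1) :
    ∑ i ∈ Finset.range n, κ (r + 1) i + ∑ i ∈ Finset.range n, SpTensor.toggle κ r j (r + 1) i + 1
      = ∑ i ∈ Finset.range n, κ r i + ∑ i ∈ Finset.range n, κ (r + 2) i := by
  have h1 := h.sum_min
  have h2 : ∑ i ∈ Finset.range n, (κ (r + 2) i - j) + ∑ i ∈ Finset.range n, (κ r i - j)
      = ∑ i ∈ Finset.range n, (κ (r + 1) i - j) + ∑ i ∈ Finset.range n, (κ (r + 1) i - j) + 1 := by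
    have e1 : colCount n κ (r + 1) j + ∑ i ∈ Finset.range n, (κ (r + 1) i - j)
        = ∑ i ∈ Finset.range n, (κ (r + 2) i - j) := by
      rw [colCount, ← Finset.sum_add_distrib]
      refine Finset.sum_congr rfl fun i _ => ?_
      have := h.strip'.1 i
      show κ (r + 2) i - j - _ + _ = _
      omega
    have e2 : colCount n κ r j + ∑ i ∈ Finset.range n, (κ r i - j)
        = ∑ i ∈ Finset.range n, (κ (r + 1) i - j) := by
      rw [colCount, ← Finset.sum_add_distrib]
      refine Finset.sum_congr rfl fun i _ => ?_
      have := h.strip.1 i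
      omega
    omega
  have h3 : ∀ f : ℕ → ℕ, ∑ i ∈ Finset.range n, f i
      = ∑ i ∈ Finset.range n, min (f i) j + ∑ i ∈ Finset.range n, (f i - j) := by
    intro f
    rw [← Finset.sum_add_distrib]
    exact Finset.sum_congr rfl fun i _ => by omega
  have h4 : ∑ i ∈ Finset.range n, (SpTensor.toggle κ r j (r + 1) i - j)
      = ∑ i ∈ Finset.range n, (κ (r + 1) i - j) := by
    simp [h.toggle_sub _ _ _ le_rfl]
  rw [Finset.sum_add_distrib, Finset.sum_add_distrib] at h1
  have := h3 (κ (r + 1)); have := h3 (SpTensor.toggle κ r j (r + 1))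
  have := h3 (κ r); have := h3 (κ (r + 2))
  omega

end Stembridge

section Involution

variable {n : ℕ}

/-- The lattice condition fails for the letters `r`, `r + 1` in the columns `≥ j`. -/
def BadAt (n : ℕ) (κ : ℕ → ℕ → ℕ) (j r : ℕ) : Prop :=
  r + 1 < n ∧ colCount n κ r j < colCount n κ (r + 1) j

/-- The (column reading) lattice condition. -/
def Good (n : ℕ) (κ : ℕ → ℕ → ℕ) : Prop := ∀ j r, ¬ BadAt n κ j r

variable {κ : ℕ → ℕ → ℕ} {r j : ℕ} {α μ : ℕ → ℕ}

lemma IsCh.isPar (h : IsCh n α μ κ) (hα : IsPar n α) (r : ℕ) : IsPar n (κ r) :=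
  h.isChain.isPar hα r

lemma IsCh.mono (h : IsCh n α μ κ) (r i : ℕ) : κ r i ≤ κ (r + 1) i := by
  by_cases hr : r < n
  · exact (h.strip r hr).1 i
  · rw [h.const r (by omega), h.const (r + 1) (by omega)]

lemma IsCh.togglable (h : IsCh n α μ κ) (hα : IsPar n α) (hb : BadAt n κ j r)
    (hmax : ∀ j', j < j' → ∀ r', ¬ BadAt n κ j' r') :
    Togglable n κ r j ∧ colCount n κ (r + 1) j = colCount n κ r j + 1 := by
  obtain ⟨hr, hlt⟩ := hb
  have h1 := colCount_succ (n := n) κ r j (h.mono r)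
  have h2 := colCount_succ (n := n) κ (r + 1) j (h.mono (r + 1))
  have h3 := colMult_le_one (n := n) κ (r + 1) j (h.strip (r + 1) hr) (h.isPar hα _).1
  have h4 : ¬ BadAt n κ (j + 1) r := hmax (j + 1) (by omega) r
  simp only [BadAt, hr, true_and, not_lt] at h4
  have h5 : colMult n κ r j = 0 := by omega
  refine ⟨⟨h.strip r (by omega), h.strip (r + 1) hr, h.supp, ?_⟩, by omega⟩
  intro i hi
  by_contra hj
  have hin : i ∈ Finset.range n := by
    rw [Finset.mem_range]
    by_contra hn
    rw [h.supp _ i (by omega)] at hi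
    omega
  rw [colMult, Finset.sum_eq_zero_iff] at h5
  have := h5 i hin
  rw [if_pos ⟨by omega, hi⟩] at this
  omega

lemma IsCh.toggle (h : IsCh n α μ κ) (ht : Togglable n κ r j) (hr : r + 1 < n) :
    IsCh n α μ (toggle κ r j) := by
  refine ⟨?_, ?_, ?_, ?_, ht.toggle.supp⟩
  · rw [toggle_of_ne (by omega), h.zero]
  · rw [toggle_of_ne (by omega), h.last]
  · intro s hs
    by_cases h1 : s = r
    · subst h1; exact ht.toggle.strip
    by_cases h2 : s = r + 1
    · subst h2; exact ht.toggle.strip'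
    rw [toggle_of_ne h2, toggle_of_ne (by omega)]
    exact h.strip s hs
  · intro s hs
    rw [toggle_of_ne (by omega), toggle_of_ne (by omega)]
    exact h.const s hs

lemma IsCh.wt_add (h : IsCh n α μ κ) (r : ℕ) :
    wt n κ r + ∑ i ∈ Finset.range n, κ r i = ∑ i ∈ Finset.range n, κ (r + 1) i := by
  rw [wt, Nat.sub_add_cancel (Finset.sum_le_sum fun i _ => h.mono r i)]

lemma wt_toggle (h : IsCh n α μ κ) (ht : Togglable n κ r j) (hr : r + 1 < n)
    (hc : colCount n κ (r + 1) j = colCount n κ r j + 1) (k : Fin n) :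
    wt n (toggle κ r j) (Equiv.swap (⟨r, by omega⟩ : Fin n) ⟨r + 1, hr⟩ k)
      + rho n (Equiv.swap (⟨r, by omega⟩ : Fin n) ⟨r + 1, hr⟩ k) = wt n κ k + rho n k := by
  have h1 := ht.sum_toggle hc
  have h' := h.toggle ht hr
  have a1 := h.wt_add r
  have a2 : _ = ∑ i ∈ Finset.range n, κ (r + 2) i := h.wt_add (r + 1)
  have a3 := h'.wt_add r
  have a4 : _ = ∑ i ∈ Finset.range n, toggle κ r j (r + 2) i := h'.wt_add (r + 1)
  rw [toggle_of_ne (s := r) (by omega)] at a3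
  rw [toggle_of_ne (s := r + 2) (by omega)] at a4
  by_cases e1 : k = ⟨r, by omega⟩
  · rw [e1, Equiv.swap_apply_left]
    show wt n (toggle κ r j) (r + 1) + (n - 1 - (r + 1)) = wt n κ r + (n - 1 - r)
    omega
  by_cases e2 : k = ⟨r + 1, hr⟩
  · rw [e2, Equiv.swap_apply_right]
    show wt n (toggle κ r j) r + (n - 1 - r) = wt n κ (r + 1) + (n - 1 - (r + 1))
    omega
  rw [Equiv.swap_apply_of_ne_of_ne e1 e2]
  have f1 : (k : ℕ) ≠ r := fun h => e1 (Fin.ext h)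
  have f2 : (k : ℕ) ≠ r + 1 := fun h => e2 (Fin.ext h)
  rw [wt, wt, toggle_of_ne f2, toggle_of_ne (by omega)]

/-- The rightmost column at which the lattice condition fails. -/
def badCol (n : ℕ) (μ : ℕ → ℕ) (κ : ℕ → ℕ → ℕ) : ℕ :=
  open Classical in Nat.findGreatest (fun j => ∃ r, BadAt n κ j r) (μ 0)

/-- The first letter for which the lattice condition fails at the column `badCol`. -/
def badLetter (n : ℕ) (μ : ℕ → ℕ) (κ : ℕ → ℕ → ℕ) : ℕ :=
  sInf {r | BadAt n κ (badCol n μ κ) r}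

lemma IsCh.le_last (h : IsCh n α μ κ) (r i : ℕ) : κ r i ≤ μ i := by
  have hm : Monotone fun r => κ r i := monotone_nat_of_le_succ fun r => h.mono r i
  by_cases hr : r ≤ n
  · have := hm hr; dsimp only at this; rwa [h.last] at this
  · rw [h.const r (by omega), h.last]

lemma BadAt.le (h : IsCh n α μ κ) (hμ : IsPar n μ) (hb : BadAt n κ j r) : j ≤ μ 0 := by
  by_contra hj
  have : colCount n κ (r + 1) j = 0 := by
    rw [colCount, Finset.sum_eq_zero_iff]
    intro i _
    have := h.le_last (r + 1 + 1) i
    have := hμ.1 (Nat.zero_le i)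
    omega
  have := hb.2
  omega

lemma badCol_spec (h : IsCh n α μ κ) (hμ : IsPar n μ) (hg : ¬ Good n κ) :
    (∃ r, BadAt n κ (badCol n μ κ) r) ∧
      ∀ j', badCol n μ κ < j' → ∀ r', ¬ BadAt n κ j' r' := by
  classical
  simp only [Good, not_forall, not_not] at hg
  obtain ⟨j, r, hb⟩ := hg
  refine ⟨?_, ?_⟩
  · rw [badCol]
    convert Nat.findGreatest_spec (P := fun j => ∃ r, BadAt n κ j r) (BadAt.le h hμ hb) ⟨r, hb⟩
  · intro j' hj' r' hb'
    rw [badCol] at hj'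
    have := Nat.le_findGreatest (P := fun j => ∃ r, BadAt n κ j r) (BadAt.le h hμ hb') ⟨r', hb'⟩
    have h2 : Nat.findGreatest (fun j => ∃ r, BadAt n κ j r) (μ 0) < j' := by convert hj'
    omega

lemma badLetter_spec (h : IsCh n α μ κ) (hμ : IsPar n μ) (hg : ¬ Good n κ) :
    BadAt n κ (badCol n μ κ) (badLetter n μ κ) :=
  Nat.sInf_mem (s := {r | BadAt n κ (badCol n μ κ) r}) (badCol_spec h hμ hg).1

lemma bad_toggle (h : IsCh n α μ κ) (hα : IsPar n α) (hμ : IsPar n μ) (hg : ¬ Good n κ) :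
    ¬ Good n (toggle κ (badLetter n μ κ) (badCol n μ κ)) ∧
    badCol n μ (toggle κ (badLetter n μ κ) (badCol n μ κ)) = badCol n μ κ ∧
    badLetter n μ (toggle κ (badLetter n μ κ) (badCol n μ κ)) = badLetter n μ κ := by
  have hb := badLetter_spec h hμ hg
  have hmax := (badCol_spec h hμ hg).2
  obtain ⟨ht, hc⟩ := h.togglable hα hb hmax
  have h' := h.toggle ht hb.1
  set κ' := toggle κ (badLetter n μ κ) (badCol n μ κ) with hκ'
  have hiff : ∀ j', badCol n μ κ ≤ j' → ∀ r', BadAt n κ' j' r' ↔ BadAt n κ j' r' := by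
    intro j' hj' r'
    rw [BadAt, BadAt, hκ', ht.colCount_toggle _ _ hj', ht.colCount_toggle _ _ hj']
  have hg' : ¬ Good n κ' := fun hg' => hg' _ _ ((hiff _ le_rfl _).2 hb)
  have hcol : badCol n μ κ' = badCol n μ κ := by
    have h1 := badCol_spec h' hμ hg'
    apply le_antisymm
    · by_contra hlt
      obtain ⟨r', hr'⟩ := h1.1
      exact hmax _ (by omega) r' ((hiff _ (by omega) _).1 hr')
    · by_contra hlt
      exact h1.2 _ (by omega) _ ((hiff _ le_rfl _).2 hb)
  refine ⟨hg', hcol, ?_⟩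
  rw [badLetter, hcol, badLetter]
  congr 1
  ext r'
  exact hiff _ le_rfl _

lemma colCount_zero (h : IsCh n α μ κ) (r : ℕ) : colCount n κ r 0 = wt n κ r := by
  simp only [colCount, wt, Nat.sub_zero]
  rw [Finset.sum_tsub_distrib _ fun i _ => h.mono r i]

lemma wt_antitone (h : IsCh n α μ κ) (hg : Good n κ) : Antitone (wt n κ) := by
  refine antitone_nat_of_succ_le fun r => ?_
  by_cases hr : r + 1 < n
  · have := hg 0 r
    simp only [BadAt, hr, true_and, not_lt] at this
    rwa [colCount_zero h, colCount_zero h] at this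
  · rw [wt, h.const (r + 1) (by omega), h.const (r + 1 + 1) (by omega)]
    simp

/-- The Jacobi–Trudi polynomial. -/
def schur (n : ℕ) (γ : ℕ → ℕ) : MvPolynomial (Fin n) ℤ :=
  ∑ w : Equiv.Perm (Fin n), (Equiv.Perm.sign w : ℤ) •
    if ∀ i : Fin n, rho n (w i) ≤ γ i + rho n i then
      ∏ i : Fin n, hpoly n (γ i + rho n i - rho n (w i)) else 0

open Classical in
lemma coeff_altP_mul_jt (hα : IsPar n α) (hμ : IsPar n μ) (γ : ℕ → ℕ) (w : Equiv.Perm (Fin n)) :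
    (altP n α * if ∀ i : Fin n, rho n (w i) ≤ γ i + rho n i then
      ∏ i : Fin n, hpoly n (γ i + rho n i - rho n (w i)) else 0).coeff
        (expo fun i : Fin n => μ i + rho n i)
      = (((chs n α μ).filter fun κ => ∀ i : Fin n,
          wt n κ (w i) + rho n (w i) = γ i + rho n i).card : ℤ) := by
  split_ifs with hw
  · let y : ℕ → ℕ := fun k => if h : k < n then
      γ (w.symm ⟨k, h⟩) + rho n (w.symm ⟨k, h⟩) - rho n k else 0
    have e1 : ∏ i : Fin n, hpoly n (γ i + rho n i - rho n (w i))
        = ∏ r ∈ Finset.range n, hpoly n (y r) := by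
      rw [Finset.prod_range, ← Equiv.prod_comp w fun i => hpoly n (y i)]
      refine Finset.prod_congr rfl fun i _ => ?_
      simp [y]
    rw [e1, coeff_altP_mul_prod hα hμ]
    congr 2
    ext κ
    simp only [Finset.mem_filter, and_congr_right_iff]
    intro _
    constructor
    · intro h i
      rw [h _ (w i).2]
      simp only [y, Fin.is_lt, Fin.eta, Equiv.symm_apply_apply, dite_true]
      have := hw i
      omega
    · intro h k hk
      have := h (w.symm ⟨k, hk⟩)
      simp only [Equiv.apply_symm_apply] at this
      simp only [y, hk, dite_true]
      omega
  · rw [mul_zero, MvPolynomial.coeff_zero, eq_comm, Nat.cast_eq_zero, Finset.card_eq_zero,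
      Finset.filter_eq_empty_iff]
    intro κ _ h
    exact hw fun i => by rw [← h i]; omega

open Classical in
/-- Stembridge's form of the Littlewood–Richardson rule. -/
lemma coeff_altP_mul_schur (hα : IsPar n α) (hμ : IsPar n μ) {γ : ℕ → ℕ} (hγ : Antitone γ) :
    (altP n α * schur n γ).coeff (expo fun i : Fin n => μ i + rho n i)
      = (((chs n α μ).filter fun κ => Good n κ ∧ ∀ i < n, wt n κ i = γ i).card : ℤ) := by
  rw [schur, Finset.mul_sum, MvPolynomial.coeff_sum]
  have h1 : ∀ w : Equiv.Perm (Fin n), (altP n α * ((Equiv.Perm.sign w : ℤ) •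
      if ∀ i : Fin n, rho n (w i) ≤ γ i + rho n i then
      ∏ i : Fin n, hpoly n (γ i + rho n i - rho n (w i)) else 0)).coeff
        (expo fun i : Fin n => μ i + rho n i) = ∑ κ ∈ chs n α μ,
        if ∀ i : Fin n, wt n κ (w i) + rho n (w i) = γ i + rho n i
          then (Equiv.Perm.sign w : ℤ) else 0 := by
    intro w
    rw [mul_smul_comm, MvPolynomial.coeff_smul, coeff_altP_mul_jt hα hμ, ← Finset.sum_filter,
      Finset.sum_const, nsmul_eq_mul, smul_eq_mul, mul_comm]
  rw [Finset.sum_congr rfl fun w _ => h1 w, ← Finset.sum_product', ← Finset.sum_filter]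
  rw [← Finset.sum_filter_add_sum_filter_not _ fun p => Good n p.2]
  have hbad : ∑ p ∈ ((Finset.univ ×ˢ chs n α μ).filter fun p : Equiv.Perm (Fin n) × (ℕ → ℕ → ℕ) =>
      ∀ i : Fin n, wt n p.2 (p.1 i) + rho n (p.1 i) = γ i + rho n i).filter
        (fun p => ¬ Good n p.2), ((Equiv.Perm.sign p.1 : ℤ)) = 0 := by
    have hch : ∀ p ∈ (((Finset.univ ×ˢ chs n α μ).filter
        fun p : Equiv.Perm (Fin n) × (ℕ → ℕ → ℕ) =>
        ∀ i : Fin n, wt n p.2 (p.1 i) + rho n (p.1 i) = γ i + rho n i).filter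
        (fun p => ¬ Good n p.2)), IsCh n α μ p.2 ∧ ¬ Good n p.2 ∧
        ∀ i : Fin n, wt n p.2 (p.1 i) + rho n (p.1 i) = γ i + rho n i := by
      intro p hp
      simp only [Finset.mem_filter, Finset.mem_product, mem_chs hα] at hp
      exact ⟨hp.1.1.2, hp.2, hp.1.2⟩
    have hlt : ∀ p ∈ (((Finset.univ ×ˢ chs n α μ).filter
        fun p : Equiv.Perm (Fin n) × (ℕ → ℕ → ℕ) =>
        ∀ i : Fin n, wt n p.2 (p.1 i) + rho n (p.1 i) = γ i + rho n i).filter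
        (fun p => ¬ Good n p.2)), badLetter n μ p.2 + 1 < n := fun p hp =>
      (badLetter_spec (hch p hp).1 hμ (hch p hp).2.1).1
    refine Finset.sum_involution (fun p hp =>
      (Equiv.swap (⟨badLetter n μ p.2, by have := hlt p hp; omega⟩ : Fin n)
        ⟨badLetter n μ p.2 + 1, hlt p hp⟩ * p.1,
        toggle p.2 (badLetter n μ p.2) (badCol n μ p.2))) ?_ ?_ ?_ ?_
    · intro p hp
      dsimp only
      rw [Equiv.Perm.sign_mul, Equiv.Perm.sign_swap]
      · simp
      · intro h; simpa using congrArg Fin.val h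
    · intro p hp _ heq
      have := congrArg (fun q => (Equiv.Perm.sign q.1 : ℤ)) heq
      dsimp only at this
      rw [Equiv.Perm.sign_mul, Equiv.Perm.sign_swap (fun h => by simpa using congrArg Fin.val h)]
        at this
      have h2 : ((Equiv.Perm.sign p.1 : ℤˣ) : ℤ) ≠ 0 := Units.ne_zero _
      simp at this
      omega
    · intro p hp
      obtain ⟨h1, h2, h3⟩ := hch p hp
      have hb := badLetter_spec h1 hμ h2
      obtain ⟨ht, hc⟩ := h1.togglable hα hb (badCol_spec h1 hμ h2).2
      simp only [Finset.mem_filter, Finset.mem_product, Finset.mem_univ, true_and, mem_chs hα]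
      refine ⟨⟨h1.toggle ht hb.1, fun i => ?_⟩, (bad_toggle h1 hα hμ h2).1⟩
      rw [← h3 i]
      exact wt_toggle h1 ht hb.1 hc (p.1 i)
    · intro p hp
      obtain ⟨h1, h2, h3⟩ := hch p hp
      have hb := badLetter_spec h1 hμ h2
      obtain ⟨ht, hc⟩ := h1.togglable hα hb (badCol_spec h1 hμ h2).2
      obtain ⟨-, e1, e2⟩ := bad_toggle h1 hα hμ h2
      refine Prod.ext ?_ ?_
      · dsimp only
        simp only [e2]
        rw [← mul_assoc, Equiv.swap_mul_self, one_mul]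
      · dsimp only
        rw [e1, e2, ht.toggle_toggle]
  rw [hbad, add_zero]
  have hgood : ∀ p : Equiv.Perm (Fin n) × (ℕ → ℕ → ℕ), IsCh n α μ p.2 → Good n p.2 →
      (∀ i : Fin n, wt n p.2 (p.1 i) + rho n (p.1 i) = γ i + rho n i) → p.1 = 1 := by
    intro p h1 h2 h3
    exact perm_eq_one_of_strictAnti (strictAnti_add_rho (wt_antitone h1 h2))
      (strictAnti_add_rho hγ) p.1 fun i => (h3 i).symm
  rw [Finset.card_eq_sum_ones, Nat.cast_sum]
  refine Finset.sum_nbij' (fun p => p.2) (fun κ => (1, κ)) ?_ ?_ ?_ ?_ ?_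
  · intro p hp
    simp only [Finset.mem_filter, Finset.mem_product, mem_chs hα] at hp ⊢
    have h1 := hgood p hp.1.1.2 hp.2 hp.1.2
    refine ⟨hp.1.1.2, hp.2, fun i hi => ?_⟩
    have := hp.1.2 ⟨i, hi⟩
    rw [h1] at this
    simpa using this
  · intro κ hκ
    simp only [Finset.mem_filter, Finset.mem_product, mem_chs hα, Finset.mem_univ, true_and]
      at hκ ⊢
    exact ⟨⟨hκ.1, fun i => by simp [hκ.2.2 i i.2]⟩, hκ.2.1⟩
  · intro p hp
    simp only [Finset.mem_filter, Finset.mem_product, mem_chs hα] at hp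
    exact Prod.ext (hgood p hp.1.1.2 hp.2 hp.1.2).symm rfl
  · intro κ _; rfl
  · intro p hp
    simp only [Finset.mem_filter, Finset.mem_product, mem_chs hα] at hp
    rw [hgood p hp.1.1.2 hp.2 hp.1.2]
    simp

end Involution

section Tableaux

variable {n : ℕ} {α μ γ : ℕ → ℕ} {T : ℕ → ℕ → ℕ} {κ : ℕ → ℕ → ℕ}

lemma lt_add_card_iff {a b : ℕ} {S : Finset ℕ} (hS : S ⊆ Finset.Ico a b)
    (hlow : ∀ i ∈ S, ∀ j, a ≤ j → j ≤ i → j ∈ S) {j : ℕ} (hj : a ≤ j) :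
    j < a + S.card ↔ j ∈ S := by
  constructor
  · intro h
    by_contra hn
    have : S ⊆ Finset.Ico a j := by
      intro i hi
      rw [Finset.mem_Ico]
      refine ⟨(Finset.mem_Ico.1 (hS hi)).1, ?_⟩
      by_contra hij
      exact hn (hlow i hi j hj (by omega))
    have := Finset.card_le_card this
    rw [Nat.card_Ico] at this
    omega
  · intro h
    have : Finset.Ico a (j + 1) ⊆ S := by
      intro i hi
      rw [Finset.mem_Ico] at hi
      exact hlow j h i hi.1 (by omega)
    have := Finset.card_le_card this
    rw [Nat.card_Ico] at this
    omega

/-- The entries of `T` mark the boxes added by the successive strips of `κ`. -/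
def Compat (T κ : ℕ → ℕ → ℕ) : Prop := ∀ i j r, T i j = r + 1 ↔ κ r i ≤ j ∧ j < κ (r + 1) i

lemma Compat.ncard (h : Compat T κ) (s : Finset ℕ) (b : ℕ → ℕ) (r : ℕ) :
    Set.ncard {p : ℕ × ℕ | (p.1 ∈ s ∧ b p.1 ≤ p.2) ∧ T p.1 p.2 = r + 1}
      = ∑ i ∈ s, ((κ (r + 1) i - b i) - (κ r i - b i)) := by
  have : {p : ℕ × ℕ | (p.1 ∈ s ∧ b p.1 ≤ p.2) ∧ T p.1 p.2 = r + 1}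
      = ((s.sigma fun i => Finset.Ico (max (κ r i) (b i)) (κ (r + 1) i)).map
        (Equiv.sigmaEquivProd ℕ ℕ).toEmbedding : Set (ℕ × ℕ)) := by
    ext ⟨i, j⟩
    simp only [Set.mem_ofPred_eq, h i j r, Finset.coe_map, Set.mem_image, Finset.mem_coe,
      Finset.mem_sigma, Finset.mem_Ico]
    constructor
    · rintro ⟨⟨h1, h2⟩, h3, h4⟩
      exact ⟨⟨i, j⟩, ⟨h1, max_le h3 h2, h4⟩, rfl⟩
    · rintro ⟨⟨i', j'⟩, ⟨h1, h2, h3⟩, heq⟩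
      simp only [Equiv.coe_toEmbedding, Equiv.sigmaEquivProd_apply, Prod.mk.injEq] at heq
      obtain ⟨rfl, rfl⟩ := heq
      exact ⟨⟨h1, (le_max_right _ _).trans h2⟩, (le_max_left _ _).trans h2, h3⟩
  rw [this, Set.ncard_coe_finset, Finset.card_map, Finset.card_sigma]
  refine Finset.sum_congr rfl fun i _ => ?_
  rw [Nat.card_Ico]
  omega

/-- The row form of the lattice condition for a chain. -/
def RowGood (κ : ℕ → ℕ → ℕ) : Prop := ∀ i r,
  ∑ k ∈ Finset.range (i + 1), (κ (r + 2) k - κ (r + 1) k)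
    ≤ ∑ k ∈ Finset.range i, (κ (r + 1) k - κ r k)

lemma Compat.rowGood_iff (h : Compat T κ) :
    (∀ i j r, Set.ncard {p : ℕ × ℕ | (p.1 < i ∨ (p.1 = i ∧ j ≤ p.2)) ∧ T p.1 p.2 = r + 2}
          ≤ Set.ncard {p : ℕ × ℕ | (p.1 < i ∨ (p.1 = i ∧ j ≤ p.2)) ∧ T p.1 p.2 = r + 1})
      ↔ RowGood κ := by
  have key : ∀ i j r, Set.ncard {p : ℕ × ℕ | (p.1 < i ∨ (p.1 = i ∧ j ≤ p.2)) ∧ T p.1 p.2 = r + 1}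
      = ∑ k ∈ Finset.range i, (κ (r + 1) k - κ r k) + ((κ (r + 1) i - j) - (κ r i - j)) := by
    intro i j r
    have h1 := h.ncard (Finset.range (i + 1)) (fun k => if k < i then 0 else j) r
    rw [Finset.sum_range_succ] at h1
    simp only [lt_irrefl, if_false] at h1
    rw [Finset.sum_congr rfl (g := fun k => κ (r + 1) k - κ r k)
      fun k hk => by simp [Finset.mem_range.1 hk]] at h1
    rw [← h1]
    congr 1
    ext ⟨a, b⟩
    simp only [Set.mem_ofPred_eq, Finset.mem_range]
    refine and_congr_left fun _ => ?_
    split_ifs with hab <;> omega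
  constructor
  · intro hl i r
    have := hl i (κ (r + 1) i) r
    have e := key i (κ (r + 1) i) (r + 1)
    rw [show r + 1 + 1 = r + 2 from rfl] at e
    rw [e, key] at this
    rw [Finset.sum_range_succ]
    omega
  · intro hR i j r
    have e := key i j (r + 1)
    rw [show r + 1 + 1 = r + 2 from rfl] at e
    rw [e, key]
    have := hR i r
    rw [Finset.sum_range_succ] at this
    omega

lemma sum_range_of_support (f : ℕ → ℕ) (hf : ∀ i, n ≤ i → f i = 0) {N : ℕ} (hN : n ≤ N) :
    ∑ i ∈ Finset.range N, f i = ∑ i ∈ Finset.range n, f i := by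
  symm
  refine Finset.sum_subset (by simpa using hN) fun i _ hi => hf i (by simpa using hi)

lemma rowGood_iff_good (h : IsCh n α μ κ) (hα : IsPar n α) : RowGood κ ↔ Good n κ := by
  have cc : ∀ r j N, n ≤ N → colCount n κ r j
      = ∑ i ∈ Finset.range N, ((κ (r + 1) i - j) - (κ r i - j)) := by
    intro r j N hN
    rw [colCount, sum_range_of_support (n := n) _ (fun i hi => by simp [h.supp _ i hi]) hN]
  have st : ∀ r, Strip (κ r) (κ (r + 1)) := by
    intro r
    by_cases hr : r < n
    · exact h.strip r hr
    · have := (h.isPar hα n).1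
      rw [h.const r (by omega), h.const (r + 1) (by omega)]
      exact ⟨fun _ => le_rfl, fun i => this (Nat.le_succ i)⟩
  constructor
  · rintro hR j r ⟨hr, hlt⟩
    refine absurd hlt (not_lt.2 ?_)
    rw [cc r j (n + 1) (by omega), cc (r + 1) j (n + 1) (by omega)]
    have hex : ∃ m, κ (r + 2) m ≤ j := ⟨n, by rw [h.supp _ _ le_rfl]; omega⟩
    classical
    let m := Nat.find hex
    have hm : κ (r + 2) m ≤ j := Nat.find_spec hex
    have hm' : ∀ i < m, j < κ (r + 2) i := fun i hi => not_le.1 (Nat.find_min hex hi)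
    have hmn : m ≤ n := Nat.find_min' hex (by rw [h.supp _ _ le_rfl]; omega)
    have hz : ∀ i, m ≤ i → κ (r + 2) i ≤ j := fun i hi => ((h.isPar hα _).1 hi).trans hm
    have hL : ∑ i ∈ Finset.range (n + 1), ((κ (r + 1 + 1) i - j) - (κ (r + 1) i - j))
        = ∑ i ∈ Finset.range m, ((κ (r + 2) i - j) - (κ (r + 1) i - j)) := by
      refine sum_range_of_support (n := m) _ (fun i hi => ?_) (by omega)
      have : κ (r + 1 + 1) i ≤ j := hz i hi
      omega
    have hRR : ∑ i ∈ Finset.range m, ((κ (r + 1) i - j) - (κ r i - j))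
        ≤ ∑ i ∈ Finset.range (n + 1), ((κ (r + 1) i - j) - (κ r i - j)) :=
      Finset.sum_le_sum_of_subset (by simp; omega)
    rw [hL]
    refine le_trans ?_ hRR
    have s1 := st r
    have s2 : Strip (κ (r + 1)) (κ (r + 2)) := st (r + 1)
    generalize hmm : m = M at *
    match M with
    | 0 => simp
    | 1 =>
      have := hR 0 r
      simp at this ⊢
      omega
    | q + 2 =>
      have hq := hR (q + 1) r
      simp only [Finset.sum_range_succ] at hq ⊢
      have e1 : ∑ i ∈ Finset.range q, ((κ (r + 2) i - j) - (κ (r + 1) i - j))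
          = ∑ i ∈ Finset.range q, (κ (r + 2) i - κ (r + 1) i) := by
        refine Finset.sum_congr rfl fun i hi => ?_
        rw [Finset.mem_range] at hi
        have := hm' (i + 1) (by omega)
        have := s2.2 i
        omega
      have e2 : ∑ i ∈ Finset.range q, ((κ (r + 1) i - j) - (κ r i - j))
          = ∑ i ∈ Finset.range q, (κ (r + 1) i - κ r i) := by
        refine Finset.sum_congr rfl fun i hi => ?_
        rw [Finset.mem_range] at hi
        have := hm' (i + 2) (by omega)
        have : κ (r + 2) (i + 2) ≤ κ (r + 1) (i + 1) := s2.2 (i + 1)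
        have := s1.2 i
        omega
      rw [e1, e2]
      have a1 := hm' (q + 1) (by omega)
      have a2 := s2.2 q
      have a3 := s1.2 q
      have a4 := s1.1 q
      have a5 := s2.1 (q + 1)
      omega
  · intro hg i r
    by_cases hr : r + 1 < n
    · have hg' := hg (κ (r + 1) i) r
      simp only [BadAt, hr, true_and, not_lt] at hg'
      rw [cc r _ (n + i + 1) (by omega), cc (r + 1) _ (n + i + 1) (by omega)] at hg'
      have e1 : ∑ k ∈ Finset.range (i + 1), (κ (r + 2) k - κ (r + 1) k)
          ≤ ∑ k ∈ Finset.range (n + i + 1),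
            ((κ (r + 1 + 1) k - κ (r + 1) i) - (κ (r + 1) k - κ (r + 1) i)) := by
        refine le_trans (Finset.sum_le_sum fun k hk => ?_)
          (Finset.sum_le_sum_of_subset (s := Finset.range (i + 1)) (by
            intro a ha; simp at ha ⊢; omega))
        have : κ (r + 1) i ≤ κ (r + 1) k :=
          (h.isPar hα _).1 (by have := Finset.mem_range.1 hk; omega)
        show κ (r + 2) k - _ ≤ (κ (r + 2) k - _) - _
        omega
      have e2 : ∑ k ∈ Finset.range (n + i + 1),
            ((κ (r + 1) k - κ (r + 1) i) - (κ r k - κ (r + 1) i))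
          ≤ ∑ k ∈ Finset.range i, (κ (r + 1) k - κ r k) := by
        rw [sum_range_of_support (n := i) _ (fun k hk => ?_) (by omega)]
        · exact Finset.sum_le_sum fun k _ => by omega
        · have : κ (r + 1) k ≤ κ (r + 1) i := (h.isPar hα _).1 hk
          omega
      omega
    · have : ∀ k, κ (r + 2) k - κ (r + 1) k = 0 := by
        intro k
        rw [h.const (r + 1) (by omega), h.const (r + 2) (by omega), Nat.sub_self]
      simp [this]

lemma IsLRTableau.entry_le (h : IsLRTableau μ α γ T) (hfin : ∀ i, n ≤ i → μ i = 0) :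
    ∀ i j, T i j ≤ i + 1 := by
  obtain ⟨h1, h2, h3, h4, h5, h6⟩ := h
  intro i
  induction i using Nat.strong_induction_on with
  | _ i ih =>
    intro j
    by_contra hlt
    obtain ⟨r, hr⟩ : ∃ r, T i j = r + 2 := ⟨T i j - 2, by omega⟩
    have hsk := (h2 i j).1 (by omega)
    have hfinite : ∀ s, {p : ℕ × ℕ | (p.1 < i ∨ (p.1 = i ∧ j ≤ p.2)) ∧ T p.1 p.2 = s + 1}.Finite := by
      intro s
      refine ((Finset.range n ×ˢ Finset.range (∑ k ∈ Finset.range n, μ k)).finite_toSet).subset ?_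
      rintro ⟨a, b⟩ ⟨-, hab⟩
      have hs := (h2 a b).1 (by dsimp only at hab; omega)
      have han : a ∈ Finset.range n := by
        rw [Finset.mem_range]; by_contra hn
        have := hfin a (by omega); have := hs.2; omega
      have := Finset.single_le_sum (f := μ) (fun k _ => Nat.zero_le _) han
      have := hs.2
      simp only [Finset.coe_product, Set.mem_prod, Finset.mem_coe]
      exact ⟨han, by rw [Finset.mem_range]; omega⟩
    have hpos : 0 < Set.ncard {p : ℕ × ℕ | (p.1 < i ∨ (p.1 = i ∧ j ≤ p.2)) ∧ T p.1 p.2 = r + 2} := by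
      rw [Set.ncard_pos (hfinite (r + 1))]
      exact ⟨(i, j), Or.inr ⟨rfl, le_rfl⟩, hr⟩
    have hpos' := lt_of_lt_of_le hpos (h6 i j r)
    rw [Set.ncard_pos (hfinite r)] at hpos'
    obtain ⟨⟨a, b⟩, hab, hT⟩ := hpos'
    dsimp only at hab hT
    rcases hab with hab | ⟨rfl, hb⟩
    · have := ih a hab b
      omega
    · have := h3 a j b hsk ((h2 a b).1 (by omega)) hb
      omega

lemma IsLRTableau.content_eq_zero (h : IsLRTableau μ α γ T) (hμ : IsPar n μ) {r : ℕ}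
    (hr : n ≤ r) : γ r = 0 := by
  rw [← h.2.2.2.2.1 r]
  have : {p : ℕ × ℕ | T p.1 p.2 = r + 1} = ∅ := by
    ext ⟨i, j⟩
    simp only [Set.mem_ofPred_eq, Set.mem_empty_iff_false, iff_false]
    intro hT
    have h1 := IsLRTableau.entry_le h hμ.2 i j
    have h2 := ((h.2.1 i j).1 (by omega)).2
    have h3 := hμ.2 i (by omega)
    omega
  rw [this, Set.ncard_empty]

/-- The chain of shapes of a tableau. -/
def toChain (α μ : ℕ → ℕ) (T : ℕ → ℕ → ℕ) : ℕ → ℕ → ℕ := fun r i =>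
  α i + ((Finset.Ico (α i) (μ i)).filter fun j => T i j ≤ r).card

/-- The tableau of a chain of shapes. -/
def toTab (n : ℕ) (α μ : ℕ → ℕ) (κ : ℕ → ℕ → ℕ) : ℕ → ℕ → ℕ := fun i j =>
  if α i ≤ j ∧ j < μ i then ((Finset.range (n + 1)).filter fun r => κ r i ≤ j).card else 0

lemma IsLRTableau.lt_toChain (h : IsLRTableau μ α γ T) {i j r : ℕ} (h1 : α i ≤ j) (h2 : j < μ i) :
    j < toChain α μ T r i ↔ T i j ≤ r := by
  rw [toChain, lt_add_card_iff (b := μ i) (Finset.filter_subset _ _) _ h1]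
  · simp [h1, h2]
  · intro a ha b hb hba
    simp only [Finset.mem_filter, Finset.mem_Ico] at ha ⊢
    refine ⟨⟨hb, by omega⟩, le_trans (h.2.2.1 i b a ⟨hb, by omega⟩ ⟨ha.1.1, ha.1.2⟩ hba) ha.2⟩

lemma IsCh.toTab_le (h : IsCh n α μ κ) {i j r : ℕ} (hr : r ≤ n) (h1 : α i ≤ j) (h2 : j < μ i) :
    toTab n α μ κ i j ≤ r ↔ j < κ r i := by
  rw [toTab, if_pos ⟨h1, h2⟩, ← not_lt]
  have hm : Monotone fun r => κ r i := monotone_nat_of_le_succ fun r => h.mono r i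
  have := lt_add_card_iff (a := 0) (b := n + 1)
    (S := (Finset.range (n + 1)).filter fun r => κ r i ≤ j) (by
      intro x hx; simp at hx ⊢; omega) (by
      intro x hx y _ hy
      simp only [Finset.mem_filter, Finset.mem_range] at hx ⊢
      exact ⟨by omega, (hm hy).trans hx.2⟩) (j := r) (by omega)
  rw [zero_add] at this
  rw [this, Finset.mem_filter, Finset.mem_range]
  omega

lemma toChain_le (hle : ∀ i, α i ≤ μ i) (r i : ℕ) : toChain α μ T r i ≤ μ i := by
  rw [toChain]
  have := Finset.card_filter_le (Finset.Ico (α i) (μ i)) fun j => T i j ≤ r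
  rw [Nat.card_Ico] at this
  have := hle i
  omega

lemma le_toChain (r i : ℕ) : α i ≤ toChain α μ T r i := Nat.le_add_right _ _

lemma IsLRTableau.compat (h : IsLRTableau μ α γ T) : Compat T (toChain α μ T) := by
  intro i j r
  constructor
  · intro hT
    obtain ⟨h1, h2⟩ := (h.2.1 i j).1 (by omega)
    rw [← not_lt, IsLRTableau.lt_toChain h h1 h2, IsLRTableau.lt_toChain h h1 h2]
    omega
  · rintro ⟨h1, h2⟩
    have h3 : α i ≤ j := (le_toChain r i).trans h1
    have h4 : j < μ i := lt_of_lt_of_le h2 (toChain_le h.1 _ _)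
    rw [← not_lt, IsLRTableau.lt_toChain h h3 h4] at h1
    rw [IsLRTableau.lt_toChain h h3 h4] at h2
    omega

lemma IsLRTableau.isCh (h : IsLRTableau μ α γ T) (hα : IsPar n α) (hμ : IsPar n μ) :
    IsCh n α μ (toChain α μ T) := by
  have hn : ∀ i j, T i j ≤ n := by
    intro i j
    by_contra hlt
    have h1 := IsLRTableau.entry_le h hμ.2 i j
    have h2 := ((h.2.1 i j).1 (by omega)).2
    have h3 := hμ.2 i (by omega)
    omega
  have hmax : ∀ r, n ≤ r → toChain α μ T r = μ := by
    intro r hr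
    ext i
    rw [toChain, Finset.filter_true_of_mem (fun j _ => (hn i j).trans hr), Nat.card_Ico]
    have := h.1 i
    omega
  refine ⟨?_, hmax n le_rfl, ?_, fun r hr => by rw [hmax r hr, hmax n le_rfl], ?_⟩
  · ext i
    rw [toChain, Finset.filter_false_of_mem]
    · simp
    · intro j hj
      rw [Finset.mem_Ico] at hj
      have := (h.2.1 i j).2 hj
      omega
  · intro r _
    refine ⟨fun i => ?_, fun i => ?_⟩
    · rw [toChain, toChain]
      refine Nat.add_le_add_left (Finset.card_le_card fun j hj => ?_) _
      simp only [Finset.mem_filter] at hj ⊢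
      exact ⟨hj.1, by omega⟩
    · by_contra hlt
      rw [not_le] at hlt
      set j := toChain α μ T r i with hj
      have a1 : α i ≤ j := le_toChain r i
      have a2 : j < μ (i + 1) := lt_of_lt_of_le hlt (toChain_le h.1 _ _)
      have a3 : j < μ i := lt_of_lt_of_le a2 (hμ.1 (Nat.le_succ i))
      have a4 : α (i + 1) ≤ j := (hα.1 (Nat.le_succ i)).trans a1
      rw [IsLRTableau.lt_toChain h a4 a2] at hlt
      have a5 : ¬ T i j ≤ r := by rw [← IsLRTableau.lt_toChain h a1 a3]; omega
      have := h.2.2.2.1 i (i + 1) j ⟨a1, a3⟩ ⟨a4, a2⟩ (by omega)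
      omega
  · intro r i hi
    have := toChain_le (T := T) h.1 r i
    rw [hμ.2 i hi] at this
    omega

lemma IsCh.compat (h : IsCh n α μ κ) : Compat (toTab n α μ κ) κ := by
  have hm : ∀ i, Monotone fun r => κ r i := fun i => monotone_nat_of_le_succ fun r => h.mono r i
  intro i j r
  have hlow : α i ≤ κ r i := by rw [← h.zero]; exact hm i (Nat.zero_le r)
  constructor
  · intro hT
    have hsk : α i ≤ j ∧ j < μ i := by
      by_contra hn; rw [show toTab n α μ κ i j = 0 from if_neg hn] at hT; omega
    have hle : toTab n α μ κ i j ≤ n := by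
      rw [h.toTab_le le_rfl hsk.1 hsk.2, h.last]; exact hsk.2
    rw [← not_lt, ← h.toTab_le (by omega) hsk.1 hsk.2, ← h.toTab_le (by omega) hsk.1 hsk.2]
    omega
  · rintro ⟨h1, h2⟩
    have h3 : α i ≤ j := hlow.trans h1
    have h4 : j < μ i := lt_of_lt_of_le h2 (h.le_last _ _)
    have hr : r < n := by
      by_contra hr
      rw [h.const r (by omega), h.last] at h1
      omega
    rw [← not_lt, ← h.toTab_le (by omega) h3 h4] at h1
    rw [← h.toTab_le (by omega) h3 h4] at h2
    omega

lemma Compat.content (hc : Compat T κ) (h : IsCh n α μ κ) (r : ℕ) :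
    Set.ncard {p : ℕ × ℕ | T p.1 p.2 = r + 1} = wt n κ r := by
  have := hc.ncard (Finset.range n) (fun _ => 0) r
  simp only [Nat.sub_zero] at this
  rw [Finset.sum_tsub_distrib _ fun i _ => h.mono r i] at this
  rw [wt, ← this]
  congr 1
  ext ⟨i, j⟩
  simp only [Set.mem_ofPred_eq, Finset.mem_range, zero_le, and_true]
  constructor
  · intro hT
    refine ⟨?_, hT⟩
    by_contra hi
    have := ((hc i j r).1 hT).2
    rw [h.supp _ i (by omega)] at this
    omega
  · exact fun h => h.2

lemma IsCh.isLRTableau (h : IsCh n α μ κ) (hα : IsPar n α) (hg : Good n κ)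
    (hw : ∀ i, wt n κ i = γ i) : IsLRTableau μ α γ (toTab n α μ κ) := by
  have hc := h.compat
  have hm : ∀ i, Monotone fun r => κ r i := fun i => monotone_nat_of_le_succ fun r => h.mono r i
  refine ⟨fun i => ?_, ?_, ?_, ?_, fun r => by rw [hc.content h, hw], ?_⟩
  · rw [← h.zero]; exact h.le_last 0 i
  · intro i j
    constructor
    · intro hT
      by_contra hn; exact hT (if_neg hn)
    · rintro ⟨h1, h2⟩ h0
      have := (h.toTab_le (Nat.zero_le n) h1 h2).1 (by omega)
      rw [h.zero] at this
      omega
  · intro i j k hj hk hjk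
    rw [toTab, toTab, if_pos ⟨hj.1, hj.2⟩, if_pos ⟨hk.1, hk.2⟩]
    refine Finset.card_le_card fun r hr => ?_
    simp only [Finset.mem_filter] at hr ⊢
    exact ⟨hr.1, by omega⟩
  · intro i k j hi hk hik
    obtain ⟨r, hr⟩ : ∃ r, toTab n α μ κ k j = r + 1 := by
      refine ⟨toTab n α μ κ k j - 1, ?_⟩
      have : toTab n α μ κ k j ≠ 0 := by
        intro h0
        have := (h.toTab_le (Nat.zero_le n) hk.1 hk.2).1 (by omega)
        rw [h.zero] at this
        have := hk.1
        omega
      omega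
    have h1 := (hc k j r).1 hr
    have hrn : r < n := by
      by_contra hn
      rw [h.const r (by omega), h.last] at h1
      have := hk.2
      omega
    rw [hr, Nat.lt_succ_iff, h.toTab_le hrn.le hi.1 hi.2]
    have h2 := (h.strip r hrn).2 (k - 1)
    rw [Nat.sub_add_cancel (by omega)] at h2
    have h3 := (h.isPar hα r).1 (show i ≤ k - 1 by omega)
    omega
  · exact hc.rowGood_iff.2 ((rowGood_iff_good h hα).2 hg)

open Classical in
/-- Littlewood–Richardson coefficients count good chains. -/
lemma lrCoeff_eq_card (hα : IsPar n α) (hμ : IsPar n μ) (hγ : IsPar n γ) :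
    lrCoeff μ α γ
      = ((chs n α μ).filter fun κ => Good n κ ∧ ∀ i < n, wt n κ i = γ i).card := by
  rw [lrCoeff, ← Set.ncard_coe_finset]
  have hmem : ∀ κ, κ ∈ (((chs n α μ).filter fun κ => Good n κ ∧ ∀ i < n, wt n κ i = γ i :
      Finset (ℕ → ℕ → ℕ)) : Set (ℕ → ℕ → ℕ)) ↔
      IsCh n α μ κ ∧ Good n κ ∧ ∀ i, wt n κ i = γ i := by
    intro κ
    rw [Finset.mem_coe, Finset.mem_filter, mem_chs hα]
    refine and_congr_right fun h => and_congr_right fun _ => ⟨fun hw i => ?_, fun hw i _ => hw i⟩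
    by_cases hi : i < n
    · exact hw i hi
    · rw [hγ.2 i (by omega), wt, h.const i (by omega), h.const (i + 1) (by omega), Nat.sub_self]
  refine Set.ncard_congr (fun T _ => toChain α μ T) ?_ ?_ ?_
  · intro T hT
    have h := IsLRTableau.isCh hT hα hμ
    rw [hmem]
    refine ⟨h, ?_, ?_⟩
    · rw [← rowGood_iff_good h hα, ← (IsLRTableau.compat hT).rowGood_iff]
      exact hT.2.2.2.2.2
    · intro i
      rw [← (IsLRTableau.compat hT).content h, hT.2.2.2.2.1 i]
  · intro T T' hT hT' heq
    have h1 := IsLRTableau.compat hT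
    have h2 := IsLRTableau.compat hT'
    rw [← heq] at h2
    ext i j
    by_cases h0 : T i j = 0
    · by_cases h0' : T' i j = 0
      · rw [h0, h0']
      · obtain ⟨r, hr⟩ : ∃ r, T' i j = r + 1 := ⟨T' i j - 1, by omega⟩
        have := (h1 i j r).2 ((h2 i j r).1 hr)
        omega
    · obtain ⟨r, hr⟩ : ∃ r, T i j = r + 1 := ⟨T i j - 1, by omega⟩
      rw [hr, (h2 i j r).2 ((h1 i j r).1 hr)]
  · intro κ hκ
    rw [hmem] at hκ
    obtain ⟨h, hg, hw⟩ := hκ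
    refine ⟨toTab n α μ κ, h.isLRTableau hα hg hw, ?_⟩
    have hm : ∀ i, Monotone fun r => κ r i :=
      fun i => monotone_nat_of_le_succ fun r => h.mono r i
    have key : ∀ r ≤ n, toChain α μ (toTab n α μ κ) r = κ r := by
      intro r hr
      ext i
      have h1 : α i ≤ κ r i := by rw [← h.zero]; exact hm i (Nat.zero_le r)
      have h2 := h.le_last r i
      rw [toChain]
      have : (Finset.Ico (α i) (μ i)).filter (fun j => toTab n α μ κ i j ≤ r)
          = Finset.Ico (α i) (κ r i) := by
        ext j
        simp only [Finset.mem_filter, Finset.mem_Ico]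
        constructor
        · rintro ⟨⟨h3, h4⟩, h5⟩
          exact ⟨h3, (h.toTab_le hr h3 h4).1 h5⟩
        · rintro ⟨h3, h4⟩
          exact ⟨⟨h3, by omega⟩, (h.toTab_le hr h3 (by omega)).2 h4⟩
      rw [this, Nat.card_Ico]
      omega
    funext r
    by_cases hr : r ≤ n
    · exact key r hr
    · rw [h.const r (by omega), ← key n le_rfl]
      have hT := h.isLRTableau hα hg hw
      have hμ' := IsLRTableau.isCh hT hα hμ
      exact hμ'.const r (by omega)

open Classical in
lemma lrCoeff_zero_left (hμ : IsPar n μ) :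
    lrCoeff μ 0 γ = if γ = μ then 1 else 0 := by
  have hT : ∀ γ T, IsLRTableau μ 0 γ T → T = fun i j => if j < μ i then i + 1 else 0 := by
    intro γ T h
    have hlow : ∀ i j, j < μ i → i + 1 ≤ T i j := by
      intro i
      induction i with
      | zero =>
        intro j hj
        have := (h.2.1 0 j).2 ⟨by simp, hj⟩
        omega
      | succ i ih =>
        intro j hj
        have h1 : j < μ i := lt_of_lt_of_le hj (hμ.1 (Nat.le_succ i))
        have := ih j h1
        have := h.2.2.2.1 i (i + 1) j ⟨by simp, h1⟩ ⟨by simp, hj⟩ (by omega)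
        omega
    ext i j
    split_ifs with hj
    · exact le_antisymm (IsLRTableau.entry_le h hμ.2 i j) (hlow i j hj)
    · by_contra h0
      exact hj ((h.2.1 i j).1 h0).2
  have hcount : ∀ i, Set.ncard {p : ℕ × ℕ | (if p.2 < μ p.1 then p.1 + 1 else 0) = i + 1} = μ i := by
    intro i
    have : {p : ℕ × ℕ | (if p.2 < μ p.1 then p.1 + 1 else 0) = i + 1}
        = (({i} ×ˢ Finset.range (μ i) : Finset (ℕ × ℕ)) : Set (ℕ × ℕ)) := by
      ext ⟨a, b⟩
      simp only [Set.mem_ofPred_eq, Finset.coe_product, Finset.coe_singleton, Set.mem_prod,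
        Set.mem_singleton_iff, Finset.mem_coe, Finset.mem_range]
      split_ifs with hb
      · constructor
        · intro h
          obtain rfl : a = i := Nat.succ_injective h
          exact ⟨rfl, hb⟩
        · rintro ⟨rfl, _⟩; rfl
      · constructor
        · intro h; exact h.elim
        · rintro ⟨rfl, h⟩; exact absurd h hb
    rw [this, Set.ncard_coe_finset]
    simp
  split_ifs with hγ
  · subst hγ
    rw [lrCoeff, Set.ncard_eq_one]
    refine ⟨fun i j => if j < γ i then i + 1 else 0, ?_⟩
    ext T
    simp only [Set.mem_ofPred_eq, Set.mem_singleton_iff]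
    refine ⟨hT γ T, ?_⟩
    rintro rfl
    have hcompat : Compat (fun i j => if j < γ i then i + 1 else 0)
        (fun r i => if i < r then γ i else 0) := by
      intro i j r
      show (if j < γ i then i + 1 else 0) = r + 1 ↔ (if i < r then γ i else 0) ≤ j ∧ j < (if i < r + 1 then γ i else 0)
      split_ifs <;> simp <;> omega
    refine ⟨by simp, ?_, ?_, ?_, hcount, ?_⟩
    · intro i j; simp [InSkew]
    · intro i j k h1 h2 _; simp [h1.2, h2.2]
    · intro i k j h1 h2 h; simp [h1.2, h2.2, h]
    · refine hcompat.rowGood_iff.2 fun i r => ?_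
      have e : ∀ r k, ((if k < r + 1 then γ k else 0) - if k < r then γ k else 0)
          = if k = r then γ r else 0 := by
        intro r k
        by_cases h : k = r
        · subst h; simp
        · rw [if_neg h]; split_ifs <;> omega
      simp only [e, show ∀ r, r + 2 = r + 1 + 1 from fun _ => rfl]
      simp only [Finset.sum_ite_eq', Finset.mem_range]
      have := hμ.1 (Nat.le_succ r)
      split_ifs <;> simp_all
  · rw [lrCoeff]
    have : {T | IsLRTableau μ 0 γ T} = ∅ := by
      ext T
      simp only [Set.mem_ofPred_eq, Set.mem_empty_iff_false, iff_false]
      intro h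
      apply hγ
      ext i
      rw [← h.2.2.2.2.1 i, hT γ T h]
      exact hcount i
    rw [this, Set.ncard_empty]

end Tableaux

section Expansion

variable {n : ℕ}

/-- The coefficient of the dominant monomial of `altP n μ` in `altP n 0 * p`. -/
def altCoeff (n : ℕ) (μ : ℕ → ℕ) : MvPolynomial (Fin n) ℤ →ₗ[ℤ] ℤ :=
  (MvPolynomial.lcoeff ℤ (expo fun i : Fin n => μ i + rho n i)) ∘ₗ LinearMap.mulLeft ℤ (altP n 0)

lemma altCoeff_apply (μ : ℕ → ℕ) (p : MvPolynomial (Fin n) ℤ) :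
    altCoeff n μ p = (altP n 0 * p).coeff (expo fun i : Fin n => μ i + rho n i) := rfl

/-- The span of the alternants. -/
def altSpan (n : ℕ) : Submodule ℤ (MvPolynomial (Fin n) ℤ) :=
  Submodule.span ℤ (altP n '' {κ | IsPar n κ})

lemma altP_mem_altSpan {κ : ℕ → ℕ} (hκ : IsPar n κ) : altP n κ ∈ altSpan n :=
  Submodule.subset_span ⟨κ, hκ, rfl⟩

lemma isPar_zero : IsPar n 0 := ⟨fun _ _ _ => le_rfl, fun _ _ => rfl⟩

open Classical in
lemma mul_hpoly_mem_altSpan {p : MvPolynomial (Fin n) ℤ} (hp : p ∈ altSpan n) (k : ℕ) :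
    p * hpoly n k ∈ altSpan n := by
  induction hp using Submodule.span_induction with
  | mem x hx =>
    obtain ⟨κ, hκ, rfl⟩ := hx
    rw [altP_mul_hpoly κ hκ]
    refine Submodule.sum_mem _ fun x hx => altP_mem_altSpan ?_
    rw [Finset.mem_filter, Finset.mem_piAntidiag] at hx
    refine IsPar.strip hx.2 fun i hi => ?_
    have : x i = 0 := by
      by_contra h
      have := Finset.mem_range.1 (hx.1.2 i h)
      omega
    simp [this, hκ.2 i hi]
  | zero => simp
  | add x y _ _ hx hy => rw [add_mul]; exact add_mem hx hy
  | smul a x _ hx => rw [smul_mul_assoc]; exact Submodule.smul_mem _ _ hx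

lemma mul_prod_hpoly_mem_altSpan {ι : Type*} {p : MvPolynomial (Fin n) ℤ} (hp : p ∈ altSpan n)
    (s : Finset ι) (y : ι → ℕ) : p * ∏ i ∈ s, hpoly n (y i) ∈ altSpan n := by
  classical
  induction s using Finset.induction_on with
  | empty => simpa
  | insert a s ha ih =>
    rw [Finset.prod_insert ha, mul_comm (hpoly n (y a)), ← mul_assoc]
    exact mul_hpoly_mem_altSpan ih _

lemma mul_schur_mem_altSpan {p : MvPolynomial (Fin n) ℤ} (hp : p ∈ altSpan n) (γ : ℕ → ℕ) :
    p * schur n γ ∈ altSpan n := by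
  rw [schur, Finset.mul_sum]
  refine Submodule.sum_mem _ fun w _ => ?_
  rw [mul_smul_comm]
  refine Submodule.smul_mem _ _ ?_
  split_ifs
  · exact mul_prod_hpoly_mem_altSpan hp _ _
  · simp

lemma eq_zero_of_mem_altSpan {p : MvPolynomial (Fin n) ℤ} (hp : p ∈ altSpan n)
    (h : ∀ μ, IsPar n μ → p.coeff (expo fun i : Fin n => μ i + rho n i) = 0) : p = 0 := by
  classical
  rw [altSpan, Finsupp.mem_span_image_iff_linearCombination] at hp
  obtain ⟨l, hl, rfl⟩ := hp
  rw [Finsupp.mem_supported] at hl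
  have : l = 0 := by
    ext κ
    by_cases hκ : IsPar n κ
    · have := h κ hκ
      rw [Finsupp.linearCombination_apply, Finsupp.sum, MvPolynomial.coeff_sum] at this
      rw [Finset.sum_congr rfl (g := fun x => if x = κ then l x else 0), Finset.sum_ite_eq'] at this
      · simpa using this
      · intro x hx
        rw [MvPolynomial.coeff_smul, altP_coeff (hl hx) hκ]
        simp
    · by_contra hne
      exact hκ (hl (Finsupp.mem_support_iff.2 hne))
  rw [this, map_zero]

lemma eq_sum_of_mem_altSpan {p : MvPolynomial (Fin n) ℤ} (hp : p ∈ altSpan n)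
    (B : Finset (ℕ → ℕ)) (hB : ∀ κ ∈ B, IsPar n κ)
    (h : ∀ μ, IsPar n μ → μ ∉ B → p.coeff (expo fun i : Fin n => μ i + rho n i) = 0) :
    p = ∑ κ ∈ B, p.coeff (expo fun i : Fin n => κ i + rho n i) • altP n κ := by
  classical
  rw [← sub_eq_zero]
  refine eq_zero_of_mem_altSpan (sub_mem hp (Submodule.sum_mem _ fun κ hκ =>
    Submodule.smul_mem _ _ (altP_mem_altSpan (hB κ hκ)))) fun μ hμ => ?_
  rw [MvPolynomial.coeff_sub, MvPolynomial.coeff_sum, sub_eq_zero,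
    Finset.sum_congr rfl (g := fun x => if x = μ then
      p.coeff (expo fun i : Fin n => x i + rho n i) else 0), Finset.sum_ite_eq']
  · split_ifs with hμB
    · rfl
    · exact h μ hμ hμB
  · intro x hx
    rw [MvPolynomial.coeff_smul, altP_coeff (hB x hx) hμ]
    simp

lemma coeff_altP_mul_schur_eq_lrCoeff {α μ γ : ℕ → ℕ} (hα : IsPar n α) (hμ : IsPar n μ)
    (hγ : IsPar n γ) : (altP n α * schur n γ).coeff (expo fun i : Fin n => μ i + rho n i)
      = lrCoeff μ α γ := by
  classical
  rw [coeff_altP_mul_schur hα hμ hγ.1, lrCoeff_eq_card hα hμ hγ]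

lemma altP_zero_mul_schur {γ : ℕ → ℕ} (hγ : IsPar n γ) : altP n 0 * schur n γ = altP n γ := by
  classical
  rw [← sub_eq_zero]
  refine eq_zero_of_mem_altSpan (sub_mem (mul_schur_mem_altSpan (altP_mem_altSpan isPar_zero) _)
    (altP_mem_altSpan hγ)) fun μ hμ => ?_
  rw [MvPolynomial.coeff_sub, coeff_altP_mul_schur_eq_lrCoeff isPar_zero hμ hγ, altP_coeff hγ hμ,
    lrCoeff_zero_left hμ]
  simp

lemma altCoeff_schur_mul_schur {α μ γ : ℕ → ℕ} (hα : IsPar n α) (hμ : IsPar n μ)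
    (hγ : IsPar n γ) : altCoeff n μ (schur n α * schur n γ) = lrCoeff μ α γ := by
  rw [altCoeff_apply, ← mul_assoc, altP_zero_mul_schur hα, coeff_altP_mul_schur_eq_lrCoeff hα hμ hγ]

lemma altP_zero_ne_zero : altP n 0 ≠ 0 := by
  intro h
  have := altP_coeff (n := n) isPar_zero isPar_zero
  rw [h] at this
  simp at this

/-- Natural number matrices with given row and column sums. -/
def natMat (x y : Fin n → ℕ) : Finset (Fin n → Fin n → ℕ) :=
  (Fintype.piFinset fun i => Finset.piAntidiag Finset.univ (x i)).filter
    fun A => ∀ j, ∑ i, A i j = y j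

lemma mem_natMat {x y : Fin n → ℕ} {A : Fin n → Fin n → ℕ} :
    A ∈ natMat x y ↔ (∀ i, ∑ j, A i j = x i) ∧ ∀ j, ∑ i, A i j = y j := by
  simp [natMat]

lemma card_natMat_comm (x y : Fin n → ℕ) : (natMat x y).card = (natMat y x).card := by
  refine Finset.card_nbij' (fun A i j => A j i) (fun A i j => A j i) ?_ ?_ ?_ ?_
  · intro A hA
    have := mem_natMat.1 hA
    exact mem_natMat.2 ⟨this.2, this.1⟩
  · intro A hA
    have := mem_natMat.1 hA
    exact mem_natMat.2 ⟨this.2, this.1⟩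
  · intro A _; rfl
  · intro A _; rfl

lemma coeff_prod_hpoly (x y : Fin n → ℕ) :
    (∏ i, hpoly n (x i)).coeff (expo y) = (natMat x y).card := by
  simp_rw [hpoly]
  rw [Finset.prod_univ_sum, MvPolynomial.coeff_sum, natMat, Finset.card_filter, Nat.cast_sum]
  refine Finset.sum_congr rfl fun A _ => ?_
  have h1 : ∏ i, (MvPolynomial.monomial (expo (A i)) 1 : MvPolynomial (Fin n) ℤ)
      = MvPolynomial.monomial (expo fun j => ∑ i, A i j) 1 := by
    rw [← MvPolynomial.monomial_sum_one]
    have : ∑ i, expo (A i) = expo fun j => ∑ i, A i j := by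
      ext j
      simp
    rw [this]
  rw [h1, MvPolynomial.coeff_monomial]
  push_cast
  refine if_congr ?_ rfl rfl
  rw [Equiv.apply_eq_iff_eq, funext_iff]

lemma coeff_altP_zero_mul (p : MvPolynomial (Fin n) ℤ) (f : Fin n → ℕ) :
    (altP n 0 * p).coeff (expo f) = ∑ w : Equiv.Perm (Fin n), (Equiv.Perm.sign w : ℤ) •
      if ∀ i : Fin n, rho n (w i) ≤ f i then
        p.coeff (expo fun i => f i - rho n (w i)) else 0 := by
  rw [altP, alternant_eq_sum, Finset.sum_mul, MvPolynomial.coeff_sum,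
    ← Equiv.sum_comp (Equiv.inv (Equiv.Perm (Fin n)))]
  refine Finset.sum_congr rfl fun w _ => ?_
  rw [smul_mul_assoc, MvPolynomial.coeff_smul, MvPolynomial.coeff_monomial_mul']
  simp only [Equiv.inv_apply, Equiv.Perm.sign_inv, one_mul, Pi.zero_apply, zero_add]
  congr 1
  refine if_congr ?_ ?_ rfl
  · rw [Finsupp.le_def]; rfl
  · congr 1
    ext i
    rfl

lemma coeff_schur (κ : ℕ → ℕ) (y : Fin n → ℕ) :
    (schur n κ).coeff (expo y) = altCoeff n κ (∏ i, hpoly n (y i)) := by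
  rw [altCoeff_apply, coeff_altP_zero_mul, schur, MvPolynomial.coeff_sum]
  refine Finset.sum_congr rfl fun w _ => ?_
  rw [MvPolynomial.coeff_smul]
  congr 1
  split_ifs
  · rw [coeff_prod_hpoly, coeff_prod_hpoly, card_natMat_comm]
  · simp

open Classical in
/-- Partitions with at most `n` parts, each at most `D`. -/
def parBox (n D : ℕ) : Finset (ℕ → ℕ) :=
  (((Fintype.piFinset fun _ : Fin n => Finset.range (D + 1)).image
    fun f i => if h : i < n then f ⟨i, h⟩ else 0)).filter fun κ => IsPar n κ

lemma mem_parBox {D : ℕ} {κ : ℕ → ℕ} : κ ∈ parBox n D ↔ IsPar n κ ∧ ∀ i, κ i ≤ D := by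
  classical
  rw [parBox, Finset.mem_filter, Finset.mem_image]
  constructor
  · rintro ⟨⟨f, hf, rfl⟩, h⟩
    refine ⟨h, fun i => ?_⟩
    rw [Fintype.mem_piFinset] at hf
    dsimp only
    split_ifs with hi
    · exact Nat.le_of_lt_succ (Finset.mem_range.1 (hf ⟨i, hi⟩))
    · exact Nat.zero_le _
  · rintro ⟨h, hD⟩
    refine ⟨⟨fun i => κ i, ?_, ?_⟩, h⟩
    · simp only [Fintype.mem_piFinset, Finset.mem_range]
      exact fun i => Nat.lt_succ_of_le (hD i)
    · ext i
      split_ifs with hi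
      · rfl
      · exact (h.2 i (by omega)).symm

lemma hpoly_isHomogeneous (k : ℕ) : (hpoly n k).IsHomogeneous k := by
  refine MvPolynomial.IsHomogeneous.sum _ _ _ fun x hx => ?_
  refine MvPolynomial.isHomogeneous_monomial _ ?_
  rw [Finset.mem_piAntidiag] at hx
  rw [← hx.1, Finsupp.degree_eq_sum]
  rfl

lemma altP_isHomogeneous (α : ℕ → ℕ) :
    (altP n α).IsHomogeneous (∑ i : Fin n, (α i + rho n i)) := by
  rw [altP, alternant_eq_sum]
  refine MvPolynomial.IsHomogeneous.sum _ _ _ fun w _ => ?_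
  refine Submodule.smul_mem (MvPolynomial.homogeneousSubmodule (Fin n) ℤ _) _ ?_
  refine MvPolynomial.isHomogeneous_monomial _ ?_
  rw [Finsupp.degree_eq_sum, ← Equiv.sum_comp w.symm fun i : Fin n => α i + rho n i]
  rfl

lemma prod_hpoly_eq_sum (y : Fin n → ℕ) {D : ℕ} (hD : ∑ i, y i ≤ D) :
    ∏ i, hpoly n (y i) = ∑ κ ∈ parBox n D, altCoeff n κ (∏ i, hpoly n (y i)) • schur n κ := by
  have h1 : altP n 0 * ∏ i, hpoly n (y i) = ∑ κ ∈ parBox n D,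
      altCoeff n κ (∏ i, hpoly n (y i)) • altP n κ := by
    refine eq_sum_of_mem_altSpan (mul_prod_hpoly_mem_altSpan (altP_mem_altSpan isPar_zero) _ _) _
      (fun κ hκ => (mem_parBox.1 hκ).1) fun μ hμ hn => ?_
    have hhom := (altP_isHomogeneous (n := n) 0).mul (MvPolynomial.IsHomogeneous.prod Finset.univ
      (fun i => hpoly n (y i)) y fun i _ => hpoly_isHomogeneous _)
    refine hhom.coeff_eq_zero ?_
    intro hdeg
    refine hn (mem_parBox.2 ⟨hμ, fun i => ?_⟩)
    rw [Finsupp.degree_eq_sum] at hdeg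
    simp only [Finsupp.equivFunOnFinite_symm_apply_apply, Finset.sum_add_distrib, Pi.zero_apply,
      Finset.sum_const_zero] at hdeg
    by_cases hi : i < n
    · have := Finset.single_le_sum (f := fun i : Fin n => μ i) (fun _ _ => Nat.zero_le _)
        (Finset.mem_univ ⟨i, hi⟩)
      dsimp only at this
      omega
    · rw [hμ.2 i (by omega)]; exact Nat.zero_le _
  refine mul_left_cancel₀ (altP_zero_ne_zero (n := n)) ?_
  rw [h1, Finset.mul_sum]
  refine Finset.sum_congr rfl fun κ hκ => ?_
  rw [mul_smul_comm, altP_zero_mul_schur (mem_parBox.1 hκ).1]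

/-- The Cauchy identity, coefficientwise. -/
lemma card_natMat_eq_sum (x y : Fin n → ℕ) {D : ℕ} (hD : ∑ i, y i ≤ D) :
    ((natMat x y).card : ℤ) = ∑ κ ∈ parBox n D,
      (schur n κ).coeff (expo x) * (schur n κ).coeff (expo y) := by
  rw [card_natMat_comm, ← coeff_prod_hpoly, prod_hpoly_eq_sum y hD, MvPolynomial.coeff_sum]
  refine Finset.sum_congr rfl fun κ _ => ?_
  rw [MvPolynomial.coeff_smul, ← coeff_schur, smul_eq_mul, mul_comm]

end Expansion

section SymCount

/-- Symmetric matrices of natural numbers with zero diagonal and given row sums. -/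
def IsSymMat {ι : Type*} [Fintype ι] (a : ι → ℕ) (d : ι → ι → ℕ) : Prop :=
  (∀ i j, d i j = d j i) ∧ (∀ i, d i i = 0) ∧ ∀ i, ∑ j, d i j = a i

/-- The number of symmetric matrices of natural numbers with zero diagonal and given row sums. -/
def symCount {ι : Type*} [Fintype ι] (a : ι → ℕ) : ℕ := Nat.card {d : ι → ι → ℕ // IsSymMat a d}

variable {n : ℕ}

/-- Pairs of increasing indices. -/
abbrev Edge (n : ℕ) : Type := {p : Fin n × Fin n // p.1 < p.2}

/-- The symmetric matrix attached to a function on increasing pairs. -/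
def symm (d : Edge n → ℕ) (i j : Fin n) : ℕ :=
  if h : i < j then d ⟨(i, j), h⟩ else if h : j < i then d ⟨(j, i), h⟩ else 0

lemma symm_comm (d : Edge n → ℕ) (i j : Fin n) : symm d i j = symm d j i := by
  rw [symm, symm]
  rcases lt_trichotomy i j with h | h | h
  · simp [h, h.not_gt]
  · simp [h]
  · simp [h, h.not_gt]

lemma symm_self (d : Edge n → ℕ) (i : Fin n) : symm d i i = 0 := by simp [symm]

/-- Row sums of the associated symmetric matrix. -/
def edgeDeg (d : Edge n → ℕ) : Fin n → ℕ := fun i => ∑ j, symm d i j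

/-- The monomial of an edge. -/
def edgeMon (e : Edge n) : MvPolynomial (Fin n) ℤ := MvPolynomial.X e.1.1 * MvPolynomial.X e.1.2

lemma expo_add (x y : Fin n → ℕ) : expo (x + y) = expo x + expo y := by
  ext; rfl

lemma sum_single_edge (d : Edge n → ℕ) :
    ∑ e : Edge n, (Finsupp.single e.1.1 (d e) + Finsupp.single e.1.2 (d e)) = expo (edgeDeg d) := by
  ext i
  rw [Finsupp.finsetSum_apply]
  simp only [Finsupp.add_apply, Finset.sum_add_distrib, Finsupp.single_apply,
    Finsupp.equivFunOnFinite_symm_apply_apply, edgeDeg]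
  let F : Fin n → Fin n → ℕ := fun a b => if h : a < b then d ⟨(a, b), h⟩ else 0
  have hF : ∀ (P : Fin n × Fin n → Prop) [DecidablePred P],
      ∑ e : Edge n, (if P e.1 then d e else 0)
        = ∑ a, ∑ b, if P (a, b) then F a b else 0 := by
    intro P _
    rw [← Fintype.sum_prod_type (f := fun p : Fin n × Fin n => if P p then F p.1 p.2 else 0),
      ← Finset.sum_filter_add_sum_filter_not Finset.univ fun p : Fin n × Fin n => p.1 < p.2,
      Finset.sum_eq_zero (s := Finset.univ.filter fun p : Fin n × Fin n => ¬ p.1 < p.2), add_zero,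
      Finset.sum_subtype (p := fun p : Fin n × Fin n => p.1 < p.2) _ (by simp)]
    · refine Finset.sum_congr rfl fun e _ => ?_
      simp only [F, dif_pos e.2]
    · intro p hp
      simp only [F, dif_neg (Finset.mem_filter.1 hp).2, ite_self]
  rw [hF fun p => p.1 = i, hF fun p => p.2 = i]
  have h2 : ∀ j, symm d i j = F i j + F j i := by
    intro j
    simp only [symm, F]
    rcases lt_trichotomy i j with h | h | h
    · simp [h, h.not_gt]
    · simp [h]
    · simp [h, h.not_gt]
  simp_rw [h2]
  rw [Finset.sum_add_distrib]
  congr 1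
  · rw [Finset.sum_comm]
    simp
  · simp

lemma prod_edgeMon (d : Edge n → ℕ) :
    ∏ e, edgeMon e ^ d e = MvPolynomial.monomial (expo (edgeDeg d)) 1 := by
  have h1 : ∀ e : Edge n, edgeMon e ^ d e = MvPolynomial.monomial
      (Finsupp.single e.1.1 (d e) + Finsupp.single e.1.2 (d e)) 1 := by
    intro e
    rw [edgeMon, mul_pow, MvPolynomial.X_pow_eq_monomial, MvPolynomial.X_pow_eq_monomial,
      MvPolynomial.monomial_mul, one_mul]
  simp_rw [h1]
  rw [← MvPolynomial.monomial_sum_one, sum_single_edge]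

/-- The coefficients expressing symplectic characters through products of complete functions. -/
def coefP (n : ℕ) (μ : ℕ → ℕ) (a : Fin n → ℕ) : ℤ :=
  altCoeff n μ (MvPolynomial.monomial (expo a) 1 * ∏ e : Edge n, (1 - edgeMon e))

/-- Exponent vectors bounded by `D`. -/
def box (n D : ℕ) : Finset (Fin n → ℕ) := Fintype.piFinset fun _ => Finset.range (D + 1)

lemma mem_box {D : ℕ} {a : Fin n → ℕ} : a ∈ box n D ↔ ∀ i, a i ≤ D := by
  simp [box]

lemma altCoeff_monomial_mul_eq_zero {μ : ℕ → ℕ} {a : Fin n → ℕ} {i : Fin n}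
    (h : μ i + rho n i < a i) (p : MvPolynomial (Fin n) ℤ) :
    altCoeff n μ (MvPolynomial.monomial (expo a) 1 * p) = 0 := by
  rw [altCoeff_apply, mul_left_comm, MvPolynomial.coeff_monomial_mul', if_neg]
  intro hle
  have := hle i
  simp at this
  omega

lemma altCoeff_mul_monomial_eq_zero {μ : ℕ → ℕ} {D : ℕ} (hD : ∀ i, μ i + rho n i ≤ D)
    {a : Fin n → ℕ} (ha : a ∉ box n D) (p : MvPolynomial (Fin n) ℤ) :
    altCoeff n μ (p * MvPolynomial.monomial (expo a) 1) = 0 := by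
  rw [mem_box] at ha
  push Not at ha
  obtain ⟨i, hi⟩ := ha
  rw [mul_comm]
  exact altCoeff_monomial_mul_eq_zero (lt_of_le_of_lt (hD _) hi) p

lemma coefP_eq_zero {μ : ℕ → ℕ} {D : ℕ} (hD : ∀ i, μ i + rho n i ≤ D)
    {a : Fin n → ℕ} (ha : a ∉ box n D) : coefP n μ a = 0 := by
  rw [coefP, mul_comm]
  exact altCoeff_mul_monomial_eq_zero hD ha _

lemma altCoeff_mul_prod_one_sub {μ : ℕ → ℕ} {D : ℕ} (hD : ∀ i, μ i + rho n i ≤ D)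
    (p : MvPolynomial (Fin n) ℤ) (s : Finset (Edge n)) :
    altCoeff n μ (p * ∏ e ∈ s, (1 - edgeMon e ^ (D + 1))) = altCoeff n μ p := by
  classical
  induction s using Finset.induction_on with
  | empty => simp
  | insert e s he ih =>
    rw [Finset.prod_insert he, mul_left_comm, sub_mul, one_mul, map_sub, ih, sub_eq_self]
    have : edgeMon e ^ (D + 1) * (p * ∏ e ∈ s, (1 - edgeMon e ^ (D + 1)))
        = MvPolynomial.monomial (expo (Pi.single e.1.1 (D + 1))) 1 *
          (MvPolynomial.X e.1.2 ^ (D + 1) * (p * ∏ e ∈ s, (1 - edgeMon e ^ (D + 1)))) := by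
      rw [edgeMon, mul_pow, mul_assoc, MvPolynomial.X_pow_eq_monomial (n := e.1.1)]
      have : expo (Pi.single e.1.1 (D + 1)) = Finsupp.single e.1.1 (D + 1) :=
        DFunLike.coe_injective (Finsupp.single_eq_pi_single _ _).symm
      rw [this]
    rw [this]
    refine altCoeff_monomial_mul_eq_zero (i := e.1.1) ?_ _
    rw [Pi.single_eq_same]
    exact Nat.lt_succ_of_le (hD _)

/-- Bounded functions on edges. -/
def ebox (n D : ℕ) : Finset (Edge n → ℕ) := Fintype.piFinset fun _ => Finset.range (D + 1)

lemma sum_coefP {μ : ℕ → ℕ} {D : ℕ} (hD : ∀ i, μ i + rho n i ≤ D) (x : Fin n → ℕ) :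
    ∑ d ∈ ebox n D, coefP n μ (x + edgeDeg d) = altCoeff n μ (MvPolynomial.monomial (expo x) 1) := by
  have h1 : ∀ d : Edge n → ℕ, coefP n μ (x + edgeDeg d) = altCoeff n μ
      ((MvPolynomial.monomial (expo x) 1 * ∏ e : Edge n, (1 - edgeMon e)) *
        ∏ e, edgeMon e ^ d e) := by
    intro d
    rw [coefP, prod_edgeMon, mul_right_comm, MvPolynomial.monomial_mul, one_mul, expo_add]
  simp_rw [h1]
  rw [← map_sum, ← Finset.mul_sum, ebox, ← Finset.prod_univ_sum, mul_assoc,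
    ← Finset.prod_mul_distrib]
  simp_rw [mul_neg_geom_sum]
  exact altCoeff_mul_prod_one_sub hD _ _

/-- Bounded matrices. -/
def mbox (n D : ℕ) : Finset (Fin n → Fin n → ℕ) :=
  Fintype.piFinset fun _ => Fintype.piFinset fun _ => Finset.range (D + 1)

lemma sum_mbox (D : ℕ) (F : (Fin n → ℕ) → (Fin n → ℕ) → ℤ)
    (hx : ∀ x y, x ∉ box n D → F x y = 0) (hy : ∀ x y, y ∉ box n D → F x y = 0) :
    ∑ A ∈ mbox n D, F (fun i => ∑ j, A i j) (fun j => ∑ i, A i j)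
      = ∑ κ ∈ parBox n (n * D), ∑ x ∈ box n D, ∑ y ∈ box n D,
        (schur n κ).coeff (expo x) * (schur n κ).coeff (expo y) * F x y := by
  have h1 : ∀ A : Fin n → Fin n → ℕ, F (fun i => ∑ j, A i j) (fun j => ∑ i, A i j)
      = ∑ x ∈ box n D, ∑ y ∈ box n D, if A ∈ natMat x y then F x y else 0 := by
    intro A
    have h2 : ∀ x y, (if A ∈ natMat x y then F x y else 0)
        = if (fun j => ∑ i, A i j) = y then (if (fun i => ∑ j, A i j) = x then F x y else 0)
          else 0 := by
      intro x y
      rw [← ite_and]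
      refine if_congr ?_ rfl rfl
      rw [mem_natMat, funext_iff, funext_iff, and_comm]
    simp_rw [h2]
    simp only [Finset.sum_ite_eq]
    by_cases hyy : (fun j => ∑ i, A i j) ∈ box n D
    · simp only [hyy, if_true, Finset.sum_ite_eq]
      split_ifs with hxx
      · rfl
      · exact hx _ _ hxx
    · simp only [hyy, if_false, Finset.sum_const_zero]
      exact hy _ _ hyy
  simp_rw [h1]
  rw [Finset.sum_comm]
  conv_rhs => rw [Finset.sum_comm]
  refine Finset.sum_congr rfl fun x hx' => ?_
  rw [Finset.sum_comm]
  conv_rhs => rw [Finset.sum_comm]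
  refine Finset.sum_congr rfl fun y hy' => ?_
  rw [← Finset.sum_mul, ← card_natMat_eq_sum x y (D := n * D), ← Finset.sum_filter,
    Finset.sum_const, nsmul_eq_mul]
  · congr 3
    ext A
    rw [Finset.mem_filter, and_iff_right_of_imp]
    intro hA
    simp only [mbox, Fintype.mem_piFinset, Finset.mem_range]
    intro i j
    have h3 := (mem_natMat.1 hA).1 i
    have h4 := Finset.single_le_sum (f := A i) (fun _ _ => Nat.zero_le _) (Finset.mem_univ j)
    have h5 := mem_box.1 hx' i
    omega
  · calc ∑ i, y i ≤ ∑ i : Fin n, D := Finset.sum_le_sum fun i _ => mem_box.1 hy' i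
      _ = n * D := by simp

lemma altCoeff_mul {μ : ℕ → ℕ} {D : ℕ} (hD : ∀ i, μ i + rho n i ≤ D)
    (p q : MvPolynomial (Fin n) ℤ) :
    altCoeff n μ (p * q) = ∑ x ∈ box n D, q.coeff (expo x) *
      altCoeff n μ (p * MvPolynomial.monomial (expo x) 1) := by
  induction q using MvPolynomial.induction_on' with
  | add q1 q2 h1 h2 =>
    rw [mul_add, map_add, h1, h2]
    simp only [MvPolynomial.coeff_add, add_mul, Finset.sum_add_distrib]
  | monomial v b =>
    obtain ⟨v, rfl⟩ := Finsupp.equivFunOnFinite.symm.surjective v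
    have h1 : (MvPolynomial.monomial (expo v) b : MvPolynomial (Fin n) ℤ)
        = b • MvPolynomial.monomial (expo v) 1 := by
      rw [MvPolynomial.smul_monomial]; simp
    rw [h1, mul_smul_comm, map_smul, smul_eq_mul, ← h1]
    simp only [MvPolynomial.coeff_monomial, Equiv.apply_eq_iff_eq, ite_mul, zero_mul,
      Finset.sum_ite_eq]
    split_ifs with hv
    · rfl
    · rw [altCoeff_mul_monomial_eq_zero hD hv, mul_zero]

/-- Summing a pair of functionals over matrices of natural numbers. -/
lemma sum_mbox_altCoeff {μ ν : ℕ → ℕ} {D : ℕ} (hDμ : ∀ i, μ i + rho n i ≤ D)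
    (hDν : ∀ i, ν i + rho n i ≤ D) (p q : MvPolynomial (Fin n) ℤ) :
    ∑ A ∈ mbox n D, altCoeff n μ (p * MvPolynomial.monomial (expo fun i => ∑ j, A i j) 1) *
        altCoeff n ν (q * MvPolynomial.monomial (expo fun j => ∑ i, A i j) 1)
      = ∑ κ ∈ parBox n (n * D),
        altCoeff n μ (p * schur n κ) * altCoeff n ν (q * schur n κ) := by
  rw [sum_mbox D fun x y => altCoeff n μ (p * MvPolynomial.monomial (expo x) 1) *
        altCoeff n ν (q * MvPolynomial.monomial (expo y) 1)]
  · refine Finset.sum_congr rfl fun κ _ => ?_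
    rw [altCoeff_mul hDμ, altCoeff_mul hDν, Finset.sum_mul_sum]
    refine Finset.sum_congr rfl fun x _ => Finset.sum_congr rfl fun y _ => ?_
    ring
  · intro x y hx
    rw [altCoeff_mul_monomial_eq_zero hDμ hx, zero_mul]
  · intro x y hy
    rw [altCoeff_mul_monomial_eq_zero hDν hy, mul_zero]

end SymCount

section Total

variable {n : ℕ}

/-- The symmetric matrix with three blocks. -/
def blockMat (d₁ d₂ d₃ : Edge n → ℕ) (A B C : Fin n → Fin n → ℕ) :
    Fin n ⊕ Fin n ⊕ Fin n → Fin n ⊕ Fin n ⊕ Fin n → ℕ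
  | .inl i, .inl j => symm d₁ i j
  | .inl i, .inr (.inl j) => A i j
  | .inl i, .inr (.inr j) => B i j
  | .inr (.inl i), .inl j => A j i
  | .inr (.inl i), .inr (.inl j) => symm d₂ i j
  | .inr (.inl i), .inr (.inr j) => C i j
  | .inr (.inr i), .inl j => B j i
  | .inr (.inr i), .inr (.inl j) => C j i
  | .inr (.inr i), .inr (.inr j) => symm d₃ i j

lemma isSymMat_blockMat {a b c : Fin n → ℕ} {d₁ d₂ d₃ : Edge n → ℕ} {A B C : Fin n → Fin n → ℕ} :
    IsSymMat (Sum.elim a (Sum.elim b c)) (blockMat d₁ d₂ d₃ A B C) ↔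
      ((fun i => ∑ j, A i j) + fun i => ∑ j, B i j) + edgeDeg d₁ = a ∧
      ((fun j => ∑ i, A i j) + fun i => ∑ j, C i j) + edgeDeg d₂ = b ∧
      ((fun j => ∑ i, B i j) + fun j => ∑ i, C i j) + edgeDeg d₃ = c := by
  have h1 : ∀ i j, blockMat d₁ d₂ d₃ A B C i j = blockMat d₁ d₂ d₃ A B C j i := by
    rintro (i | i | i) (j | j | j) <;> simp [blockMat, symm_comm]
  have h2 : ∀ i, blockMat d₁ d₂ d₃ A B C i i = 0 := by
    rintro (i | i | i) <;> simp [blockMat, symm_self]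
  simp only [IsSymMat, h1, h2, implies_true, true_and]
  rw [Sum.forall, Sum.forall, funext_iff, funext_iff, funext_iff]
  refine and_congr (forall_congr' fun i => ?_) (and_congr (forall_congr' fun i => ?_)
    (forall_congr' fun i => ?_)) <;>
  · simp only [Fintype.sum_sum_type, blockMat, Sum.elim_inl, Sum.elim_inr, Pi.add_apply, edgeDeg]
    constructor <;> intro h <;> omega

lemma exists_blockMat {a : Fin n ⊕ Fin n ⊕ Fin n → ℕ} {d} (h : IsSymMat a d) :
    d = blockMat (fun e => d (.inl e.1.1) (.inl e.1.2)) (fun e => d (.inr (.inl e.1.1)) (.inr (.inl e.1.2)))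
      (fun e => d (.inr (.inr e.1.1)) (.inr (.inr e.1.2)))
      (fun i j => d (.inl i) (.inr (.inl j))) (fun i j => d (.inl i) (.inr (.inr j)))
      (fun i j => d (.inr (.inl i)) (.inr (.inr j))) := by
  have hs : ∀ f : Fin n → Fin n ⊕ Fin n ⊕ Fin n, ∀ i j,
      d (f i) (f j) = symm (fun e => d (f e.1.1) (f e.1.2)) i j := by
    intro f i j
    rw [symm]
    rcases lt_trichotomy i j with hij | hij | hij
    · simp [hij]
    · subst hij; simp [h.2.1]
    · simp [hij, hij.not_gt, h.1 (f i)]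
  ext (i | i | i) (j | j | j)
  · exact hs (fun i => .inl i) i j
  · rfl
  · rfl
  · exact h.1 _ _
  · exact hs (fun i => .inr (.inl i)) i j
  · rfl
  · exact h.1 _ _
  · exact h.1 _ _
  · exact hs (fun i => .inr (.inr i)) i j

lemma IsSymMat.le {ι : Type*} [Fintype ι] {a : ι → ℕ} {d : ι → ι → ℕ} (h : IsSymMat a d)
    (i j : ι) : d i j ≤ a i := by
  rw [← h.2.2 i]
  exact Finset.single_le_sum (f := d i) (fun _ _ => Nat.zero_le _) (Finset.mem_univ j)

/-- The index set of the total count. -/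
abbrev BlockData (n : ℕ) : Type := (Fin n → Fin n → ℕ) × (Fin n → Fin n → ℕ) × (Fin n → Fin n → ℕ) ×
      (Edge n → ℕ) × (Edge n → ℕ) × (Edge n → ℕ)

/-- Bounded block data. -/
def blockBox (n D : ℕ) : Finset (BlockData n) :=
  mbox n D ×ˢ mbox n D ×ˢ mbox n D ×ˢ ebox n D ×ˢ ebox n D ×ˢ ebox n D

open Classical in
lemma symCount_eq_sum {D : ℕ} {a b c : Fin n → ℕ} (ha : a ∈ box n D) (hb : b ∈ box n D)
    (hc : c ∈ box n D) :
    symCount (Sum.elim a (Sum.elim b c)) = ∑ t ∈ blockBox n D,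
      if IsSymMat (Sum.elim a (Sum.elim b c))
        (blockMat t.2.2.2.1 t.2.2.2.2.1 t.2.2.2.2.2 t.1 t.2.1 t.2.2.1) then 1 else 0 := by
  rw [← Finset.card_filter, symCount, ← Finset.card_image_of_injOn (f := fun t : BlockData n =>
    blockMat t.2.2.2.1 t.2.2.2.2.1 t.2.2.2.2.2 t.1 t.2.1 t.2.2.1), ← Set.ncard_coe_finset]
  · rw [← Nat.card_coe_set_eq]
    refine Nat.card_congr (Equiv.setCongr (s := {d | IsSymMat (Sum.elim a (Sum.elim b c)) d}) ?_)
    ext d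
    simp only [Set.mem_ofPred_eq, Finset.coe_image, Set.mem_image, Finset.mem_coe, Finset.mem_filter]
    constructor
    · intro h
      refine ⟨⟨_, _, _, _, _, _⟩, ⟨?_, ?_⟩, (exists_blockMat h).symm⟩
      · have ha' := mem_box.1 ha
        have hb' := mem_box.1 hb
        have hc' := mem_box.1 hc
        simp only [blockBox, Finset.mem_product, mbox, ebox, Fintype.mem_piFinset, Finset.mem_range,
          Nat.lt_succ_iff]
        exact ⟨fun i j => (h.le _ _).trans (ha' i), fun i j => (h.le _ _).trans (ha' i),
          fun i j => (h.le _ _).trans (hb' i), fun e => (h.le _ _).trans (ha' _),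
          fun e => (h.le _ _).trans (hb' _), fun e => (h.le _ _).trans (hc' _)⟩
      · rw [← exists_blockMat h]; exact h
    · rintro ⟨t, ⟨_, h⟩, rfl⟩
      exact h
  · rintro ⟨A, B, C, d₁, d₂, d₃⟩ _ ⟨A', B', C', d₁', d₂', d₃'⟩ _ h
    have hs : ∀ d d' : Edge n → ℕ, (∀ i j, symm d i j = symm d' i j) → d = d' := by
      intro d d' h
      ext e
      have := h e.1.1 e.1.2
      simpa [symm, e.2] using this
    have h' := fun i j => congr_fun (congr_fun h i) j
    have e1 : A = A' := by ext i j; exact h' (.inl i) (.inr (.inl j))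
    have e2 : B = B' := by ext i j; exact h' (.inl i) (.inr (.inr j))
    have e3 : C = C' := by ext i j; exact h' (.inr (.inl i)) (.inr (.inr j))
    have e4 : d₁ = d₁' := hs _ _ fun i j => h' (.inl i) (.inl j)
    have e5 : d₂ = d₂' := hs _ _ fun i j => h' (.inr (.inl i)) (.inr (.inl j))
    have e6 : d₃ = d₃' := hs _ _ fun i j => h' (.inr (.inr i)) (.inr (.inr j))
    subst e1 e2 e3 e4 e5 e6
    rfl

lemma sum_box_delta {D : ℕ} {f g h : (Fin n → ℕ) → ℤ} (hf : ∀ x, x ∉ box n D → f x = 0)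
    (hg : ∀ x, x ∉ box n D → g x = 0) (hh : ∀ x, x ∉ box n D → h x = 0) (p q r : Fin n → ℕ) :
    ∑ u ∈ box n D ×ˢ box n D ×ˢ box n D, f u.1 * g u.2.1 * h u.2.2 *
      (if p = u.1 ∧ q = u.2.1 ∧ r = u.2.2 then 1 else 0) = f p * g q * h r := by
  classical
  rw [Finset.sum_eq_single (p, q, r)]
  · simp
  · rintro ⟨a, b, c⟩ _ hne
    rw [if_neg, mul_zero]
    rintro ⟨rfl, rfl, rfl⟩
    exact hne rfl
  · intro hn
    rw [Finset.mem_product, Finset.mem_product] at hn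
    by_cases h1 : p ∈ box n D
    · by_cases h2 : q ∈ box n D
      · by_cases h3 : r ∈ box n D
        · exact absurd ⟨h1, h2, h3⟩ hn
        · simp [hh r h3]
      · simp [hg q h2]
    · simp [hf p h1]

/-- The total count, in terms of Littlewood–Richardson coefficients. -/
lemma sum_coefP_symCount {l m v : ℕ → ℕ} (hl : IsPar n l) (hm : IsPar n m) (hv : IsPar n v)
    {D : ℕ} (hDl : ∀ i, l i + rho n i ≤ D) (hDm : ∀ i, m i + rho n i ≤ D)
    (hDv : ∀ i, v i + rho n i ≤ D) :
    ∑ u ∈ box n D ×ˢ box n D ×ˢ box n D,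
      coefP n l u.1 * coefP n m u.2.1 * coefP n v u.2.2 *
        symCount (Sum.elim u.1 (Sum.elim u.2.1 u.2.2))
    = ∑ α ∈ parBox n (n * D), ∑ β ∈ parBox n (n * D), ∑ γ ∈ parBox n (n * D),
      (lrCoeff l α β * lrCoeff m α γ * lrCoeff v β γ : ℤ) := by
  classical
  have h1 : ∀ u ∈ box n D ×ˢ box n D ×ˢ box n D,
      coefP n l u.1 * coefP n m u.2.1 * coefP n v u.2.2 *
        symCount (Sum.elim u.1 (Sum.elim u.2.1 u.2.2))
      = ∑ t ∈ blockBox n D, coefP n l u.1 * coefP n m u.2.1 * coefP n v u.2.2 *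
        (if ((fun i => ∑ j, t.1 i j) + fun i => ∑ j, t.2.1 i j) + edgeDeg t.2.2.2.1 = u.1 ∧
      ((fun j => ∑ i, t.1 i j) + fun i => ∑ j, t.2.2.1 i j) + edgeDeg t.2.2.2.2.1 = u.2.1 ∧
      ((fun j => ∑ i, t.2.1 i j) + fun j => ∑ i, t.2.2.1 i j) + edgeDeg t.2.2.2.2.2 = u.2.2
        then 1 else 0) := by
    intro u hu
    rw [Finset.mem_product, Finset.mem_product] at hu
    rw [symCount_eq_sum hu.1 hu.2.1 hu.2.2, ← Finset.mul_sum]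
    simp only [isSymMat_blockMat]
    push_cast
    rfl
  rw [Finset.sum_congr rfl h1, Finset.sum_comm]
  simp_rw [sum_box_delta (fun _ => coefP_eq_zero hDl) (fun _ => coefP_eq_zero hDm)
    (fun _ => coefP_eq_zero hDv)]
  rw [blockBox]
  simp only [Finset.sum_product]
  simp_rw [← Finset.mul_sum, ← Finset.sum_mul, ← Finset.mul_sum, ← Finset.sum_mul,
    sum_coefP hDl, sum_coefP hDm, sum_coefP hDv]
  have hmon : ∀ x y : Fin n → ℕ, (MvPolynomial.monomial (expo (x + y)) 1 : MvPolynomial (Fin n) ℤ)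
      = MvPolynomial.monomial (expo x) 1 * MvPolynomial.monomial (expo y) 1 := by
    intro x y
    rw [MvPolynomial.monomial_mul, one_mul, expo_add]
  simp_rw [hmon, mul_assoc, ← Finset.mul_sum, sum_mbox_altCoeff hDm hDv]
  have hB : ∀ A : Fin n → Fin n → ℕ,
      ∑ B ∈ mbox n D, altCoeff n l (MvPolynomial.monomial (expo fun i => ∑ j, A i j) 1 *
        MvPolynomial.monomial (expo fun i => ∑ j, B i j) 1) *
        ∑ κ ∈ parBox n (n * D), altCoeff n m (MvPolynomial.monomial (expo fun j => ∑ i, A i j) 1 *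
          schur n κ) * altCoeff n v (MvPolynomial.monomial (expo fun j => ∑ i, B i j) 1 * schur n κ)
      = ∑ γ ∈ parBox n (n * D), ∑ β ∈ parBox n (n * D),
        altCoeff n l (schur n β * MvPolynomial.monomial (expo fun i => ∑ j, A i j) 1) *
        altCoeff n m (schur n γ * MvPolynomial.monomial (expo fun j => ∑ i, A i j) 1) *
        altCoeff n v (schur n γ * schur n β) := by
    intro A
    simp_rw [Finset.mul_sum]
    rw [Finset.sum_comm]
    refine Finset.sum_congr rfl fun γ _ => ?_
    have := sum_mbox_altCoeff hDl hDv (MvPolynomial.monomial (expo fun i => ∑ j, A i j) 1)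
      (schur n γ)
    calc _ = altCoeff n m (schur n γ * MvPolynomial.monomial (expo fun j => ∑ i, A i j) 1) *
          ∑ κ ∈ parBox n (n * D), altCoeff n l
            (MvPolynomial.monomial (expo fun i => ∑ j, A i j) 1 * schur n κ) *
            altCoeff n v (schur n γ * schur n κ) := by
            rw [← this, Finset.mul_sum]
            refine Finset.sum_congr rfl fun B _ => ?_
            rw [mul_comm (schur n γ) (MvPolynomial.monomial _ _),
              mul_comm (schur n γ) (MvPolynomial.monomial _ _)]; ring
      _ = _ := by
            rw [Finset.mul_sum]
            refine Finset.sum_congr rfl fun B _ => ?_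
            rw [mul_comm _ (schur n B)]; ring
  simp_rw [hB]
  rw [Finset.sum_comm]
  calc _ = ∑ γ ∈ parBox n (n * D), ∑ β ∈ parBox n (n * D), ∑ α ∈ parBox n (n * D),
        altCoeff n l (schur n β * schur n α) * altCoeff n m (schur n γ * schur n α) *
          altCoeff n v (schur n γ * schur n β) := by
        refine Finset.sum_congr rfl fun γ _ => ?_
        rw [Finset.sum_comm]
        refine Finset.sum_congr rfl fun β _ => ?_
        rw [← Finset.sum_mul, ← Finset.sum_mul, sum_mbox_altCoeff hDl hDm]
    _ = ∑ γ ∈ parBox n (n * D), ∑ β ∈ parBox n (n * D), ∑ α ∈ parBox n (n * D),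
        (lrCoeff l α β * lrCoeff m α γ * lrCoeff v β γ : ℤ) := by
        refine Finset.sum_congr rfl fun γ hγ => Finset.sum_congr rfl fun β hβ =>
          Finset.sum_congr rfl fun α hα => ?_
        have hγ' := (mem_parBox.1 hγ).1
        have hβ' := (mem_parBox.1 hβ).1
        have hα' := (mem_parBox.1 hα).1
        rw [mul_comm (schur n β), mul_comm (schur n γ), mul_comm (schur n γ),
          altCoeff_schur_mul_schur hα' hl hβ', altCoeff_schur_mul_schur hα' hm hγ',
          altCoeff_schur_mul_schur hβ' hv hγ']
    _ = _ := by
        rw [Finset.sum_congr rfl fun γ _ => Finset.sum_comm, Finset.sum_comm]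
        refine Finset.sum_congr rfl fun α _ => ?_
        rw [Finset.sum_comm]
        simp only [Finset.mul_sum, mul_assoc]

end Total

section CoefP

variable {n : ℕ}

lemma altCoeff_monomial (μ : ℕ → ℕ) (x : Fin n → ℕ) :
    altCoeff n μ (MvPolynomial.monomial (expo x) 1) = ∑ w : Equiv.Perm (Fin n),
      if ∀ i : Fin n, x i + rho n (w i) = μ i + rho n i then (Equiv.Perm.sign w : ℤ) else 0 := by
  rw [altCoeff_apply, coeff_altP_zero_mul]
  refine Finset.sum_congr rfl fun w _ => ?_
  simp only [MvPolynomial.coeff_monomial, (Finsupp.equivFunOnFinite.symm).injective.eq_iff,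
    funext_iff, smul_eq_mul]
  by_cases h : ∀ i : Fin n, x i + rho n (w i) = μ i + rho n i
  · rw [if_pos fun i => by have := h i; omega, if_pos fun i => by have := h i; omega, if_pos h,
      mul_one]
  · rw [if_neg h]
    split_ifs with h1 h2
    · exact absurd (fun i => by have := h1 i; have := h2 i; omega) h
    · simp
    · simp

open Classical in
lemma prod_one_sub_edgeMon : ∏ e : Edge n, (1 - edgeMon e) = ∑ t : Finset (Edge n),
    (-1 : ℤ) ^ t.card • MvPolynomial.monomial (expo (edgeDeg fun e => if e ∈ t then 1 else 0)) 1 := by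
  simp_rw [sub_eq_neg_add]
  rw [Finset.prod_add, Finset.powerset_univ]
  refine Finset.sum_congr rfl fun t _ => ?_
  rw [← prod_edgeMon]
  simp only [Finset.prod_const_one, mul_one, pow_ite, pow_one, pow_zero]
  rw [Finset.prod_ite_mem, Finset.univ_inter, Finset.prod_neg, zsmul_eq_mul]
  push_cast
  rfl

open Classical in
lemma coefP_eq_sum (μ : ℕ → ℕ) (a : Fin n → ℕ) :
    coefP n μ a = ∑ t : Finset (Edge n), ∑ w : Equiv.Perm (Fin n),
      if ∀ i : Fin n, a i + edgeDeg (fun e => if e ∈ t then 1 else 0) i + rho n (w i)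
        = μ i + rho n i then (-1 : ℤ) ^ t.card * (Equiv.Perm.sign w : ℤ) else 0 := by
  rw [coefP, prod_one_sub_edgeMon, Finset.mul_sum, map_sum]
  refine Finset.sum_congr rfl fun t _ => ?_
  rw [mul_smul_comm, map_smul, MvPolynomial.monomial_mul, one_mul, ← expo_add, altCoeff_monomial,
    Finset.smul_sum]
  refine Finset.sum_congr rfl fun w _ => ?_
  rw [smul_ite, smul_zero, smul_eq_mul]
  rfl

lemma exists_of_coefP_ne_zero {μ : ℕ → ℕ} {a : Fin n → ℕ} (h : coefP n μ a ≠ 0) :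
    ∃ (d : Edge n → ℕ) (w : Equiv.Perm (Fin n)), ∀ i : Fin n,
      a i + edgeDeg d i + rho n (w i) = μ i + rho n i := by
  classical
  rw [coefP_eq_sum] at h
  obtain ⟨t, -, ht⟩ := Finset.exists_ne_zero_of_sum_ne_zero h
  obtain ⟨w, -, hw⟩ := Finset.exists_ne_zero_of_sum_ne_zero ht
  exact ⟨_, w, by by_contra hc; exact hw (if_neg hc)⟩

lemma perm_eq_self_of_le {w : Equiv.Perm (Fin n)} {k : ℕ}
    (h : ∀ i : Fin n, k ≤ i → i ≤ w i) (i : Fin n) (hi : k ≤ i) : w i = i := by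
  induction hm : n - i.1 using Nat.strong_induction_on generalizing i with
  | _ m ih =>
    subst hm
    by_contra hne
    have hlt : i < w i := lt_of_le_of_ne (h i hi) (Ne.symm hne)
    have := ih (n - (w i).1) (by have := (w i).2; omega) (w i) (hi.trans (h i hi)) rfl
    exact hne (w.injective this)

lemma le_of_rho_le {i j : Fin n} (h : rho n j ≤ rho n i) : i ≤ j := by
  rw [rho, rho] at h
  exact Fin.le_def.2 (by omega)

lemma coefP_support_zero {μ : ℕ → ℕ} {a : Fin n → ℕ} (h : coefP n μ a ≠ 0) {k : ℕ}
    (hk : ∀ i, k ≤ i → μ i = 0) (i : Fin n) (hi : k ≤ i) : a i = 0 := by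
  obtain ⟨d, w, hw⟩ := exists_of_coefP_ne_zero h
  have h1 := perm_eq_self_of_le (w := w) (k := k) (fun j hj => by
    have := hw j
    rw [hk j hj] at this
    exact le_of_rho_le (by omega)) i hi
  have := hw i
  rw [h1, hk i hi] at this
  omega

lemma sum_rho_perm (w : Equiv.Perm (Fin n)) : ∑ i, rho n (w i) = ∑ i : Fin n, rho n i :=
  Equiv.sum_comp w fun i : Fin n => rho n i

lemma sum_le_of_coefP_ne_zero {μ : ℕ → ℕ} {a : Fin n → ℕ} (h : coefP n μ a ≠ 0) :
    ∑ i, a i ≤ ∑ i : Fin n, μ i := by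
  obtain ⟨d, w, hw⟩ := exists_of_coefP_ne_zero h
  have := Finset.sum_congr (rfl : Finset.univ = Finset.univ) fun i _ => hw i
  simp only [Finset.sum_add_distrib, sum_rho_perm] at this
  omega

lemma sum_rho_comp_le (w : Equiv.Perm (Fin n)) (k : ℕ) :
    ∑ i with (i : Fin n).1 < k, rho n (w i) ≤ ∑ i with (i : Fin n).1 < k, rho n i := by
  have h := Monovary.sum_smul_comp_perm_le_sum_smul (σ := w)
    (f := fun i : Fin n => if i.1 < k then 1 else 0) (g := fun i : Fin n => rho n i) ?_
  · simpa [Finset.sum_filter] using h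
  · intro i j hij
    have : j.1 < i.1 := by
      by_contra hc
      push Not at hc
      exact absurd hij (by simp only [rho]; omega)
    simp only
    split_ifs <;> omega

lemma sum_le_sum_of_coefP_ne_zero {μ : ℕ → ℕ} {a : Fin n → ℕ} (h : coefP n μ a ≠ 0)
    (hs : ∑ i, a i = ∑ i : Fin n, μ i) (k : ℕ) :
    ∑ i with (i : Fin n).1 < k, μ i ≤ ∑ i with (i : Fin n).1 < k, a i := by
  obtain ⟨d, w, hw⟩ := exists_of_coefP_ne_zero h
  have h1 := Finset.sum_congr (rfl : Finset.univ = Finset.univ) fun i _ => hw i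
  simp only [Finset.sum_add_distrib, sum_rho_perm] at h1
  have h2 : ∑ i, edgeDeg d i = 0 := by omega
  rw [Finset.sum_eq_zero_iff] at h2
  have h3 := Finset.sum_congr (rfl : Finset.univ.filter (fun i : Fin n => i.1 < k) = _)
    fun i _ => hw i
  simp only [Finset.sum_add_distrib] at h3
  rw [Finset.sum_eq_zero (f := edgeDeg d) fun i _ => h2 i (Finset.mem_univ i)] at h3
  have := sum_rho_comp_le w k
  omega

lemma eq_zero_of_edgeDeg_eq_zero {d : Edge n → ℕ} (h : ∀ i, edgeDeg d i = 0) (e : Edge n) :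
    d e = 0 := by
  have h1 := h e.1.1
  rw [edgeDeg, Finset.sum_eq_zero_iff] at h1
  have := h1 e.1.2 (Finset.mem_univ _)
  simpa [symm, e.2] using this

lemma coefP_self (μ : ℕ → ℕ) : coefP n μ (fun i => μ i) = 1 := by
  classical
  rw [coefP_eq_sum]
  have key : ∀ (t : Finset (Edge n)) (w : Equiv.Perm (Fin n)), (∀ i : Fin n, μ i +
      edgeDeg (fun e => if e ∈ t then 1 else 0) i + rho n (w i) = μ i + rho n i) →
      t = ∅ ∧ w = 1 := by
    intro t w h
    have hw : w = 1 := by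
      ext i
      rw [perm_eq_self_of_le (k := 0) (fun j _ => le_of_rho_le (by have := h j; omega)) i
        (Nat.zero_le _)]
      rfl
    refine ⟨Finset.eq_empty_iff_forall_notMem.2 fun e he => ?_, hw⟩
    have := eq_zero_of_edgeDeg_eq_zero (d := fun e => if e ∈ t then 1 else 0) (fun i => by
      have := h i
      rw [hw] at this
      simp only [Equiv.Perm.coe_one, id] at this
      omega) e
    simp [he] at this
  rw [Finset.sum_eq_single ∅, Finset.sum_eq_single 1]
  · rw [if_pos]
    · simp
    · intro i
      simp [edgeDeg, symm]
  · intro w _ hw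
    rw [if_neg]
    exact fun h => hw (key _ _ h).2
  · simp
  · intro t _ ht
    refine Finset.sum_eq_zero fun w _ => ?_
    rw [if_neg]
    exact fun h => ht (key _ _ h).1
  · simp

lemma coefP_zero (a : Fin n → ℕ) : coefP n 0 a = if a = 0 then 1 else 0 := by
  split_ifs with h
  · subst h
    exact coefP_self 0
  · by_contra hc
    refine h (funext fun i => ?_)
    exact coefP_support_zero hc (k := 0) (fun _ _ => rfl) i (Nat.zero_le _)

end CoefP

section SymCount

lemma IsSymMat.eq_zero {ι : Type*} [Fintype ι] {a : ι → ℕ} {d : ι → ι → ℕ} (h : IsSymMat a d)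
    {i j : ι} (h0 : a i = 0 ∨ a j = 0) : d i j = 0 := by
  rcases h0 with h0 | h0
  · exact Nat.le_zero.1 (h0 ▸ h.le i j)
  · rw [h.1]
    exact Nat.le_zero.1 (h0 ▸ h.le j i)

/-- Indices with zero row sum do not matter. -/
lemma symCount_comp {ι κ : Type*} [Fintype ι] [Fintype κ] (e : κ ↪ ι) (a : ι → ℕ)
    (h : ∀ i, i ∉ Set.range e → a i = 0) : symCount (a ∘ e) = symCount a := by
  classical
  have hsum : ∀ f : ι → ℕ, (∀ i, i ∉ Set.range e → f i = 0) → ∑ i, f i = ∑ k, f (e k) := by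
    intro f hf
    rw [← Finset.sum_map Finset.univ e f]
    refine (Finset.sum_subset (Finset.subset_univ _) fun i _ hi => hf i ?_).symm
    simpa using hi
  symm
  refine Nat.card_eq_of_bijective (fun d => ⟨fun k l => d.1 (e k) (e l), fun _ _ => d.2.1 _ _,
    fun _ => d.2.2.1 _, fun k => ?_⟩) ⟨?_, ?_⟩
  · rw [Function.comp_apply, ← d.2.2.2 (e k), hsum]
    exact fun i hi => d.2.eq_zero (.inr (h i hi))
  · intro d d' hd
    ext i j
    by_cases hi : i ∈ Set.range e
    · by_cases hj : j ∈ Set.range e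
      · obtain ⟨k, rfl⟩ := hi
        obtain ⟨l, rfl⟩ := hj
        exact congr_fun (congr_fun (congr_arg Subtype.val hd) k) l
      · rw [d.2.eq_zero (.inr (h j hj)), d'.2.eq_zero (.inr (h j hj))]
    · rw [d.2.eq_zero (.inl (h i hi)), d'.2.eq_zero (.inl (h i hi))]
  · intro d
    have hinj : Function.Injective (Prod.map e e) := e.injective.prodMap e.injective
    set x : ι → ι → ℕ := fun i j =>
      Function.extend (Prod.map e e) (fun p : κ × κ => d.1 p.1 p.2) 0 (i, j) with hx
    have h1 : ∀ k l, x (e k) (e l) = d.1 k l := fun k l => hinj.extend_apply _ _ (k, l)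
    have h2 : ∀ i j, ¬ (i ∈ Set.range e ∧ j ∈ Set.range e) → x i j = 0 := by
      intro i j hij
      refine Function.extend_apply' _ _ _ fun ⟨p, hp⟩ => hij ⟨⟨p.1, ?_⟩, ⟨p.2, ?_⟩⟩
      · exact congr_arg Prod.fst hp
      · exact congr_arg Prod.snd hp
    refine ⟨⟨x, fun i j => ?_, fun i => ?_, fun i => ?_⟩, ?_⟩
    · by_cases hij : i ∈ Set.range e ∧ j ∈ Set.range e
      · obtain ⟨⟨k, rfl⟩, ⟨l, rfl⟩⟩ := hij
        rw [h1, h1, d.2.1]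
      · rw [h2 i j hij, h2 j i fun hc => hij hc.symm]
    · by_cases hij : i ∈ Set.range e
      · obtain ⟨k, rfl⟩ := hij
        rw [h1, d.2.2.1]
      · exact h2 _ _ fun hc => hij hc.1
    · by_cases hi : i ∈ Set.range e
      · obtain ⟨k, rfl⟩ := hi
        rw [hsum _ fun j hj => h2 _ _ fun hc => hj hc.2, ← Function.comp_apply (f := a),
          ← d.2.2.2 k]
        exact Finset.sum_congr rfl fun l _ => h1 k l
      · rw [h i hi]
        exact Finset.sum_eq_zero fun j _ => h2 _ _ fun hc => hi hc.1
    · ext k l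
      exact h1 k l

end SymCount

section Final

variable {n : ℕ}

lemma IsLRTableau.content_le {α μ γ : ℕ → ℕ} {T : ℕ → ℕ → ℕ} (h : IsLRTableau μ α γ T)
    (hμ : IsPar n μ) {D : ℕ} (hD : ∀ i, μ i ≤ D) (r : ℕ) : γ r ≤ n * D := by
  rw [← h.2.2.2.2.1 r]
  have hsub : {p : ℕ × ℕ | T p.1 p.2 = r + 1} ⊆
      (Finset.range n ×ˢ Finset.range D : Finset (ℕ × ℕ)) := by
    rintro ⟨a, b⟩ hab
    have hs := ((h.2.1 a b).1 (by have : T a b = r + 1 := hab; omega)).2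
    have h1 := hD a
    have h2 := hμ.2 a
    simp only [Finset.coe_product, Set.mem_prod, Finset.mem_coe, Finset.mem_range]
    constructor
    · by_contra hc
      have := h2 (by omega)
      omega
    · omega
  refine (Set.ncard_le_ncard hsub (Finset.finite_toSet _)).trans ?_
  rw [Set.ncard_coe_finset, Finset.card_product, Finset.card_range, Finset.card_range]

lemma mem_parBox_of_lrCoeff_ne_zero {α μ γ : ℕ → ℕ} (hα : IsPartition α) (hγ : IsPartition γ)
    (hμ : IsPar n μ) {D : ℕ} (hD : ∀ i, μ i ≤ D) (h : lrCoeff μ α γ ≠ 0) :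
    α ∈ parBox n (n * D) ∧ γ ∈ parBox n (n * D) := by
  obtain ⟨T, hT⟩ := Set.nonempty_of_ncard_ne_zero h
  have h0 : ∀ i, n ≤ i → α i = 0 := fun i hi =>
    Nat.le_zero.1 ((hT.1 i).trans (hμ.2 i hi).le)
  refine ⟨mem_parBox.2 ⟨⟨fun i j hij => hα.1 hij, h0⟩, fun i => ?_⟩,
    mem_parBox.2 ⟨⟨fun i j hij => hγ.1 hij, fun i hi => IsLRTableau.content_eq_zero hT hμ hi⟩,
      IsLRTableau.content_le hT hμ hD⟩⟩
  rcases lt_or_ge i n with hi | hi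
  · exact ((hT.1 i).trans (hD i)).trans (Nat.le_mul_of_pos_left D (by omega))
  · rw [h0 i hi]
    exact Nat.zero_le _

lemma IsPar.isPartition {f : ℕ → ℕ} (hf : IsPar n f) : IsPartition f :=
  ⟨fun _ _ h => hf.1 h, n, hf.2 n le_rfl⟩

lemma finsum_ptn_eq_sum {B : Finset (ℕ → ℕ)} (hB : ∀ f ∈ B, IsPartition f) (F : (ℕ → ℕ) → ℕ)
    (hF : ∀ a : Ptn, F a.1 ≠ 0 → a.1 ∈ B) : ∑ᶠ a : Ptn, F a.1 = ∑ f ∈ B, F f := by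
  classical
  change ∑ᶠ a : {f : ℕ → ℕ // IsPartition f}, F a.1 = _
  rw [finsum_eq_sum_of_support_subset (s := B.preimage Subtype.val Subtype.val_injective.injOn)]
  · rw [Finset.sum_preimage]
    intro f hf hn
    exact absurd ⟨⟨f, hB f hf⟩, rfl⟩ hn
  · intro a ha
    simpa using hF a ha

lemma finsum_lrCoeff {l m v : ℕ → ℕ} (hl : IsPar n l) (hm : IsPar n m) {D : ℕ}
    (hDl : ∀ i, l i ≤ D) (hDm : ∀ i, m i ≤ D) :
    ∑ᶠ (a : Ptn) (b : Ptn) (c : Ptn), lrCoeff l a.1 b.1 * lrCoeff m a.1 c.1 * lrCoeff v b.1 c.1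
    = ∑ α ∈ parBox n (n * D), ∑ β ∈ parBox n (n * D), ∑ γ ∈ parBox n (n * D),
      lrCoeff l α β * lrCoeff m α γ * lrCoeff v β γ := by
  have hB : ∀ f ∈ parBox n (n * D), IsPartition f := fun f hf => (mem_parBox.1 hf).1.isPartition
  have h3 : ∀ a b : Ptn, ∑ᶠ c : Ptn, lrCoeff l a.1 b.1 * lrCoeff m a.1 c.1 * lrCoeff v b.1 c.1
      = ∑ γ ∈ parBox n (n * D), lrCoeff l a.1 b.1 * lrCoeff m a.1 γ * lrCoeff v b.1 γ := by
    intro a b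
    refine finsum_ptn_eq_sum hB (fun γ => lrCoeff l a.1 b.1 * lrCoeff m a.1 γ * lrCoeff v b.1 γ)
      fun c hc => ?_
    exact (mem_parBox_of_lrCoeff_ne_zero a.2 c.2 hm hDm fun h => hc (by simp [h])).2
  have h2 : ∀ a : Ptn, ∑ᶠ b : Ptn, ∑ γ ∈ parBox n (n * D),
        lrCoeff l a.1 b.1 * lrCoeff m a.1 γ * lrCoeff v b.1 γ
      = ∑ β ∈ parBox n (n * D), ∑ γ ∈ parBox n (n * D),
        lrCoeff l a.1 β * lrCoeff m a.1 γ * lrCoeff v β γ := by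
    intro a
    refine finsum_ptn_eq_sum hB (fun β => ∑ γ ∈ parBox n (n * D),
        lrCoeff l a.1 β * lrCoeff m a.1 γ * lrCoeff v β γ) fun b hb => ?_
    exact (mem_parBox_of_lrCoeff_ne_zero a.2 b.2 hl hDl fun h => hb (by simp [h])).2
  simp_rw [h3, h2]
  refine finsum_ptn_eq_sum hB (fun α => ∑ β ∈ parBox n (n * D), ∑ γ ∈ parBox n (n * D),
        lrCoeff l α β * lrCoeff m α γ * lrCoeff v β γ) fun a ha => ?_
  obtain ⟨β, hβ, hb⟩ := Finset.exists_ne_zero_of_sum_ne_zero ha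
  exact (mem_parBox_of_lrCoeff_ne_zero a.2 (hB β hβ) hl hDl fun h => hb (by simp [h])).1

/-- The total count equals the sum of triple products of Littlewood–Richardson coefficients. -/
theorem finsum_lrCoeff_eq_sum_coefP {l m v : ℕ → ℕ} (hl : IsPar n l) (hm : IsPar n m)
    (hv : IsPar n v) {D : ℕ} (hDl : ∀ i, l i + rho n i ≤ D) (hDm : ∀ i, m i + rho n i ≤ D)
    (hDv : ∀ i, v i + rho n i ≤ D) :
    ((∑ᶠ (a : Ptn) (b : Ptn) (c : Ptn),
      lrCoeff l a.1 b.1 * lrCoeff m a.1 c.1 * lrCoeff v b.1 c.1 : ℕ) : ℤ)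
    = ∑ a ∈ box n D, ∑ b ∈ box n D, ∑ c ∈ box n D,
      coefP n l a * coefP n m b * coefP n v c * symCount (Sum.elim a (Sum.elim b c)) := by
  rw [finsum_lrCoeff hl hm (fun i => le_of_add_le_left (hDl i)) fun i => le_of_add_le_left (hDm i)]
  push_cast
  rw [← sum_coefP_symCount hl hm hv hDl hDm hDv]
  simp only [Finset.sum_product]

lemma lrCoeff_zero_right (hμ : IsPar n μ) (hα : IsPar n α) [Decidable (α = μ)] :
    lrCoeff μ α 0 = if α = μ then 1 else 0 := by
  rw [← Nat.cast_inj (R := ℤ), ← altCoeff_schur_mul_schur hα hμ isPar_zero, mul_comm,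
    altCoeff_schur_mul_schur isPar_zero hμ hα, lrCoeff_zero_left hμ]
  congr

lemma symCount_elim_zero (a b : Fin n → ℕ) :
    symCount (Sum.elim a (Sum.elim b (0 : Fin n → ℕ))) = symCount (Sum.elim a b) := by
  rw [← symCount_comp (⟨Sum.map id Sum.inl, Sum.map_injective.2 ⟨Function.injective_id,
    Sum.inl_injective⟩⟩ : Fin n ⊕ Fin n ↪ Fin n ⊕ Fin n ⊕ Fin n)]
  · congr 1
    ext (i | i) <;> rfl
  · rintro (i | i | i) h
    · exact absurd ⟨.inl i, rfl⟩ h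
    · exact absurd ⟨.inr i, rfl⟩ h
    · rfl

/-- The virtual character given by `coefP` has norm one. -/
theorem sum_coefP_mul_coefP {l : ℕ → ℕ} (hl : IsPar n l) {D : ℕ} (hDl : ∀ i, l i + rho n i ≤ D) :
    ∑ a ∈ box n D, ∑ b ∈ box n D, coefP n l a * coefP n l b * symCount (Sum.elim a b) = 1 := by
  classical
  have hD0 : ∀ i, (0 : ℕ → ℕ) i + rho n i ≤ D := fun i =>
    (Nat.add_le_add_right (Nat.zero_le _) _).trans (hDl i)
  have key := sum_coefP_symCount hl hl isPar_zero hDl hDl hD0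
  have hz : (0 : ℕ → ℕ) ∈ parBox n (n * D) := mem_parBox.2 ⟨isPar_zero, fun _ => Nat.zero_le _⟩
  have hlm : l ∈ parBox n (n * D) := mem_parBox.2 ⟨hl, fun i => by
    rcases lt_or_ge i n with hi | hi
    · exact (le_of_add_le_left (hDl i)).trans (Nat.le_mul_of_pos_left D (by omega))
    · rw [hl.2 i hi]
      exact Nat.zero_le _⟩
  have h0 : ∀ β γ, lrCoeff (0 : ℕ → ℕ) β γ ≠ 0 → β = 0 := by
    intro β γ h
    obtain ⟨T, hT⟩ := Set.nonempty_of_ncard_ne_zero h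
    exact funext fun i => Nat.le_zero.1 (hT.1 i)
  have h0' : ∀ γ, lrCoeff (0 : ℕ → ℕ) 0 γ = if γ = 0 then 1 else 0 := fun γ => by
    rw [lrCoeff_zero_left (n := n) isPar_zero]
  simp only [Finset.sum_product] at key
  calc _ = ∑ a ∈ box n D, ∑ b ∈ box n D, ∑ c ∈ box n D, coefP n l a * coefP n l b * coefP n 0 c *
        symCount (Sum.elim a (Sum.elim b c)) := by
        refine Finset.sum_congr rfl fun a _ => Finset.sum_congr rfl fun b _ => ?_
        rw [Finset.sum_eq_single 0]
        · rw [coefP_zero, if_pos rfl, mul_one, symCount_elim_zero]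
        · intro c _ hc
          rw [coefP_zero, if_neg hc, mul_zero, zero_mul]
        · intro h
          exact absurd (mem_box.2 fun _ => Nat.zero_le _) h
    _ = _ := key
    _ = 1 := by
        rw [Finset.sum_eq_single l]
        · rw [Finset.sum_eq_single 0]
          · rw [Finset.sum_eq_single 0]
            · rw [lrCoeff_zero_right hl hl, if_pos rfl, h0', if_pos rfl]
              rfl
            · intro γ _ hγ
              rw [h0', if_neg hγ]
              simp
            · exact fun h => absurd hz h
          · intro β _ hβ
            refine Finset.sum_eq_zero fun γ _ => ?_
            by_contra hc
            exact hβ (h0 β γ fun h => hc (by simp [h]))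
          · exact fun h => absurd hz h
        · intro α hα hαl
          refine Finset.sum_eq_zero fun β _ => Finset.sum_eq_zero fun γ _ => ?_
          by_contra hc
          have hb := h0 β γ fun h => hc (by simp [h])
          subst hb
          exact hc (by rw [lrCoeff_zero_right hl (mem_parBox.1 hα).1, if_neg hαl]; simp)
        · exact fun h => absurd hlm h

end Final

section Gram

/-- Every alternating matrix of size at most `2 n` is a Gram matrix for the symplectic form. -/
theorem exists_gram {K : Type*} [Field K] (n : ℕ) : ∀ {ι : Type} [Fintype ι],
    Fintype.card ι ≤ 2 * n → ∀ A : ι → ι → K, (∀ i j, A i j = - A j i) → (∀ i, A i i = 0) →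
    ∃ x y : Fin n → ι → K, ∀ i j, A i j = ∑ p, (y p i * x p j - x p i * y p j) := by
  classical
  induction n with
  | zero =>
    intro ι _ hι A _ _
    have : IsEmpty ι := Fintype.card_eq_zero_iff.1 (by omega)
    exact ⟨0, 0, fun i => isEmptyElim i⟩
  | succ n ih =>
    intro ι _ hι A hs hd
    by_cases h0 : ∀ i j, A i j = 0
    · exact ⟨0, 0, fun i j => by simp [h0]⟩
    push Not at h0
    obtain ⟨i₀, j₀, hc⟩ := h0
    have hne : i₀ ≠ j₀ := fun h => hc (h ▸ hd i₀)
    set u : ι → K := fun k => A i₀ k / A i₀ j₀ with hu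
    set v : ι → K := fun k => A j₀ k with hv
    set B : ι → ι → K := fun k l => A k l - (u k * v l - v k * u l) with hB
    have hBs : ∀ i j, B i j = - B j i := fun i j => by simp only [hB]; rw [hs i j]; ring
    have hBd : ∀ i, B i i = 0 := fun i => by simp only [hB]; rw [hd i]; ring
    have hBi : ∀ l, B i₀ l = 0 := fun l => by
      simp only [hB, hu, hv]; rw [hd, hs j₀ i₀]; field_simp; ring
    have hBj : ∀ l, B j₀ l = 0 := fun l => by
      simp only [hB, hu, hv]; rw [hd]; field_simp; ring
    have hcard : Fintype.card {k : ι // k ≠ i₀ ∧ k ≠ j₀} ≤ 2 * n := by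
      rw [Fintype.card_subtype]
      have : (Finset.univ.filter fun k : ι => k ≠ i₀ ∧ k ≠ j₀) = (Finset.univ.erase i₀).erase j₀ := by
        ext k; simp [and_comm]
      rw [this, Finset.card_erase_of_mem (by simp [hne.symm]), Finset.card_erase_of_mem (by simp),
        Finset.card_univ]
      omega
    obtain ⟨x, y, hxy⟩ := ih hcard (fun k l => B k l) (fun _ _ => hBs _ _) (fun _ => hBd _)
    refine ⟨Fin.cons v fun p k => if h : k ≠ i₀ ∧ k ≠ j₀ then x p ⟨k, h⟩ else 0,
      Fin.cons u fun p k => if h : k ≠ i₀ ∧ k ≠ j₀ then y p ⟨k, h⟩ else 0, fun i j => ?_⟩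
    rw [Fin.sum_univ_succ]
    simp only [Fin.cons_zero, Fin.cons_succ]
    have hA : A i j = u i * v j - v i * u j + B i j := by simp only [hB]; ring
    rw [hA]
    congr 1
    by_cases hi : i ≠ i₀ ∧ i ≠ j₀
    · by_cases hj : j ≠ i₀ ∧ j ≠ j₀
      · simp only [dif_pos hi, dif_pos hj]
        exact hxy ⟨i, hi⟩ ⟨j, hj⟩
      · simp only [dif_neg hj, mul_zero, sub_zero, Finset.sum_const_zero]
        rw [hBs]
        have : j = i₀ ∨ j = j₀ := by tauto
        rcases this with rfl | rfl <;> simp [hBi, hBj]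
    · simp only [dif_neg hi, zero_mul, sub_zero, Finset.sum_const_zero]
      have : i = i₀ ∨ i = j₀ := by tauto
      rcases this with rfl | rfl <;> simp [hBi, hBj]

end Gram

section FFT

/-- The index set of the standard representation. -/
abbrev Idx (n : ℕ) : Type := Fin n ⊕ Fin n

/-- Polynomials in the entries of a matrix with columns indexed by `ι`. -/
abbrev Pol (n : ℕ) (ι : Type) : Type := MvPolynomial (Idx n × ι) ℂ

/-- Evaluation at a matrix. -/
abbrev evalMat {n : ℕ} {ι : Type} (X : Matrix (Idx n) ι ℂ) : Pol n ι →+* ℂ :=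
  MvPolynomial.eval fun p => X p.1 p.2

/-- Gram matrices for the symplectic form. -/
def gram {R : Type*} [CommRing R] {n : ℕ} {ι : Type} (X : Matrix (Idx n) ι R) : Matrix ι ι R :=
  Xᵀ * J (Fin n) R * X

variable {n m : ℕ}

lemma gram_apply {R : Type*} [CommRing R] {ι : Type} (X : Matrix (Idx n) ι R) (i j : ι) :
    gram X i j = ∑ p, (X (.inr p) i * X (.inl p) j - X (.inl p) i * X (.inr p) j) := by
  simp only [gram, Matrix.mul_apply, Matrix.transpose_apply, J, Fintype.sum_sum_type,
    Matrix.fromBlocks_apply₁₁, Matrix.fromBlocks_apply₁₂, Matrix.fromBlocks_apply₂₁,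
    Matrix.fromBlocks_apply₂₂, Matrix.zero_apply, mul_zero, Finset.sum_const_zero, zero_add,
    add_zero, Matrix.neg_apply, Matrix.one_apply, mul_ite, mul_one, mul_neg,
    Finset.sum_neg_distrib, Finset.sum_ite_eq', Finset.mem_univ, if_true, Finset.sum_sub_distrib]
  simp only [neg_mul, Finset.sum_neg_distrib]
  ring

/-- The upper triangular entries of the Gram matrix. -/
def gramVec {R : Type*} [CommRing R] (X : Matrix (Idx n) (Fin m) R) (e : Edge m) : R :=
  gram X e.1.1 e.1.2

/-- The alternating matrix with given upper triangular entries. -/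
def altMat {R : Type*} [CommRing R] (z : Edge m → R) : Matrix (Fin m) (Fin m) R :=
  Matrix.of fun i j => if h : i < j then z ⟨(i, j), h⟩ else if h : j < i then - z ⟨(j, i), h⟩ else 0

lemma gram_eq_altMat {R : Type*} [CommRing R] (X : Matrix (Idx n) (Fin m) R) :
    gram X = altMat (gramVec X) := by
  ext i j
  rw [altMat, Matrix.of_apply]
  split_ifs with h1 h2
  · rfl
  · rw [gramVec, gram_apply, gram_apply, ← Finset.sum_neg_distrib]
    exact Finset.sum_congr rfl fun p _ => by ring
  · rw [le_antisymm (not_lt.1 h2) (not_lt.1 h1), gram_apply]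
    exact Finset.sum_eq_zero fun p _ => by ring

lemma exists_gram_eq {K : Type*} [Field K] (hm : m ≤ 2 * n) (z : Edge m → K) :
    ∃ X : Matrix (Idx n) (Fin m) K, gram X = altMat z := by
  obtain ⟨x, y, h⟩ := exists_gram n (ι := Fin m) (by simpa using hm) (altMat z)
    (fun i j => by
      rcases lt_trichotomy i j with hij | rfl | hij
      · simp [altMat, hij, hij.not_gt]
      · simp [altMat]
      · simp [altMat, hij, hij.not_gt]) (fun i => by simp [altMat])
  refine ⟨Matrix.of fun r k => Sum.elim (fun p => x p k) (fun p => y p k) r, ?_⟩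
  ext i j
  rw [h, gram_apply]
  rfl

lemma exists_gramVec_eq (hm : m ≤ 2 * n) (z : Edge m → ℂ) :
    ∃ X : Matrix (Idx n) (Fin m) ℂ, gramVec X = z := by
  obtain ⟨X, hX⟩ := exists_gram_eq hm z
  refine ⟨X, funext fun e => ?_⟩
  rw [gramVec, hX]
  simp [altMat, e.2]

/-- Pullback of polynomials along the Gram map. -/
def gramPull (n m : ℕ) : MvPolynomial (Edge m) ℂ →ₐ[ℂ] Pol n (Fin m) :=
  MvPolynomial.aeval (gramVec (Matrix.of fun r k => MvPolynomial.X (r, k)))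

lemma evalMat_gramPull (X : Matrix (Idx n) (Fin m) ℂ) (p : MvPolynomial (Edge m) ℂ) :
    evalMat X (gramPull n m p) = MvPolynomial.eval (gramVec X) p := by
  rw [gramPull, MvPolynomial.aeval_def, MvPolynomial.algebraMap_eq, MvPolynomial.eval_eval₂]
  have h1 : (evalMat X).comp MvPolynomial.C = RingHom.id ℂ := by ext; simp [evalMat]
  rw [MvPolynomial.eval, MvPolynomial.coe_eval₂Hom]
  change MvPolynomial.eval₂ ((evalMat X).comp MvPolynomial.C) _ p = _
  rw [h1]
  congr 1
  ext e
  simp [gramVec, gram_apply]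

lemma pol_ext {ι : Type} {f g : Pol n ι} (h : ∀ X, evalMat X f = evalMat X g) : f = g :=
  MvPolynomial.funext fun x => h (Matrix.of fun r k => x (r, k))

lemma gramPull_injective (hm : m ≤ 2 * n) : Function.Injective (gramPull n m) := by
  intro p q h
  refine MvPolynomial.funext fun z => ?_
  obtain ⟨X, rfl⟩ := exists_gramVec_eq hm z
  rw [← evalMat_gramPull, ← evalMat_gramPull, h]

/-- Invariance under the symplectic group. -/
def IsInv {ι : Type} (f : Pol n ι) : Prop :=
  ∀ M ∈ symplecticGroup (Fin n) ℂ, ∀ X, evalMat (M * X) f = evalMat X f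

lemma mem_range_of_mul_mem_range (hm : m ≤ 2 * n) {f : Pol n (Fin m)}
    (q : MvPolynomial (Edge m) ℂ) (hq : q ≠ 0) : ∀ p, f * gramPull n m q = gramPull n m p →
      f ∈ (gramPull n m).range := by
  induction q using UniqueFactorizationMonoid.induction_on_prime with
  | h₁ => exact absurd rfl hq
  | h₂ u hu =>
    obtain ⟨v, rfl⟩ := hu
    intro p h
    refine ⟨p * (v⁻¹ : (MvPolynomial (Edge m) ℂ)ˣ), ?_⟩
    change gramPull n m _ = f
    rw [map_mul, ← h, mul_assoc, ← map_mul, Units.mul_inv, map_one, mul_one]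
  | h₃ a π ha hπ ih =>
    intro p h
    have hprime : (Ideal.span {π}).IsPrime := (Ideal.span_singleton_prime hπ.ne_zero).2 hπ
    have hp : p ∈ Ideal.span {π} := by
      rw [← MvPolynomial.IsPrime.vanishingIdeal_zeroLocus (K := ℂ) (Ideal.span {π})]
      rw [MvPolynomial.mem_vanishingIdeal_iff]
      intro z hz
      rw [MvPolynomial.mem_zeroLocus_iff] at hz
      have hz := hz π (Ideal.subset_span rfl)
      obtain ⟨X, rfl⟩ := exists_gramVec_eq hm z
      rw [MvPolynomial.aeval_eq_eval] at hz ⊢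
      have hz' : MvPolynomial.eval (gramVec X) π = 0 := hz
      have := congr_arg (evalMat X) h
      rw [map_mul, evalMat_gramPull, evalMat_gramPull, map_mul, hz', zero_mul, mul_zero] at this
      exact this.symm
    obtain ⟨p', rfl⟩ := Ideal.mem_span_singleton.1 hp
    refine ih ha p' ?_
    have hπ0 : gramPull n m π ≠ 0 := fun h0 =>
      hπ.ne_zero (gramPull_injective hm (h0.trans (map_zero _).symm))
    refine mul_left_cancel₀ hπ0 ?_
    rw [map_mul, map_mul] at h
    rw [← h]; ring

lemma gram_smul {R : Type*} [CommRing R] {ι : Type} (c : R) (X : Matrix (Idx n) ι R) :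
    gram (c • X) = c ^ 2 • gram X := by
  ext i j
  rw [Matrix.smul_apply, gram_apply, gram_apply, smul_eq_mul, Finset.mul_sum]
  exact Finset.sum_congr rfl fun p _ => by simp only [Matrix.smul_apply, smul_eq_mul]; ring

lemma gram_map {R S : Type*} [CommRing R] [CommRing S] {ι : Type} (φ : R →+* S)
    (X : Matrix (Idx n) ι R) : gram (X.map φ) = (gram X).map φ := by
  ext i j
  simp [gram_apply]

lemma altMat_map {R S : Type*} [CommRing R] [CommRing S] (φ : R →+* S) (z : Edge m → R) :
    altMat (fun e => φ (z e)) = (altMat z).map φ := by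
  ext i j
  simp only [altMat, Matrix.of_apply, Matrix.map_apply]
  split_ifs <;> simp

/-- A denominator-free matrix realising the generic alternating matrix up to a square. -/
lemma exists_generic_gram (hm : m ≤ 2 * n) :
    ∃ (q : MvPolynomial (Edge m) ℂ) (Y : Matrix (Idx n) (Fin m) (MvPolynomial (Edge m) ℂ)),
      q ≠ 0 ∧ gram Y = q ^ 2 • altMat MvPolynomial.X := by
  set R := MvPolynomial (Edge m) ℂ
  obtain ⟨X, hX⟩ := exists_gram_eq hm fun e => algebraMap R (FractionRing R) (MvPolynomial.X e)
  obtain ⟨q, hq⟩ := IsLocalization.exist_integer_multiples_of_finite (nonZeroDivisors R)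
    fun p : Idx n × Fin m => X p.1 p.2
  choose Y hY using hq
  refine ⟨q, Matrix.of fun r k => Y (r, k), nonZeroDivisors.ne_zero q.2, ?_⟩
  have h1 : (Matrix.of fun r k => Y (r, k)).map (algebraMap R (FractionRing R))
      = algebraMap R (FractionRing R) q • X := by
    ext r k
    rw [Matrix.map_apply, Matrix.of_apply, hY]
    simp [Algebra.smul_def]
  refine Matrix.map_injective (IsFractionRing.injective R (FractionRing R)) ?_
  change (gram _).map (algebraMap R (FractionRing R)) =
    (q.1 ^ 2 • altMat MvPolynomial.X : Matrix _ _ R).map (algebraMap R (FractionRing R))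
  rw [← gram_map, h1, gram_smul, hX, altMat_map (algebraMap R (FractionRing R)) MvPolynomial.X]
  ext i j
  simp

lemma evalMat_smul {ι : Type} {d : ℕ} {f : Pol n ι} (hf : f.IsHomogeneous d) (c : ℂ)
    (X : Matrix (Idx n) ι ℂ) : evalMat (c • X) f = c ^ d * evalMat X f := by
  rw [evalMat, evalMat, MvPolynomial.eval_eq, MvPolynomial.eval_eq, Finset.mul_sum]
  refine Finset.sum_congr rfl fun s hs => ?_
  have h1 : ∑ i ∈ s.support, s i = d := by
    by_contra h
    exact (MvPolynomial.mem_support_iff.1 hs) (hf.coeff_eq_zero h)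
  simp only [Matrix.smul_apply, smul_eq_mul, mul_pow]
  rw [Finset.prod_mul_distrib, Finset.prod_pow_eq_pow_sum, h1]
  ring

/-- The first fundamental theorem for `2n` vectors. -/
theorem mem_range_gramPull {d : ℕ} {f : Pol n (Fin (n + n))} (hd : f.IsHomogeneous d)
    (hf : IsInv f) : f ∈ (gramPull n (n + n)).range := by
  classical
  obtain ⟨q, Y, hq, hY⟩ := exists_generic_gram (n := n) (m := n + n) (by omega)
  set e : Idx n ≃ Fin (n + n) := finSumFinEquiv
  set p : MvPolynomial (Edge (n + n)) ℂ := MvPolynomial.aeval (fun i => Y i.1 i.2) f with hp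
  set D : Pol n (Fin (n + n)) := Matrix.det (Matrix.of fun r s : Idx n => MvPolynomial.X (r, e s))
  have hD : D ≠ 0 := by
    intro h
    have h1 := congr_arg (evalMat (Matrix.of fun r k => if k = e r then 1 else 0)) h
    rw [RingHom.map_det, map_zero] at h1
    have h2 : (RingHom.mapMatrix (evalMat (Matrix.of fun r k => if k = e r then 1 else 0)))
        (Matrix.of fun r s : Idx n => (MvPolynomial.X (r, e s) : Pol n (Fin (n + n)))) = 1 := by
      ext r s
      simp [evalMat, Matrix.one_apply, eq_comm]
    rw [h2, Matrix.det_one] at h1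
    exact one_ne_zero h1
  have hq' : gramPull n (n + n) q ≠ 0 := fun h0 =>
    hq (gramPull_injective (by omega) (h0.trans (map_zero _).symm))
  refine mem_range_of_mul_mem_range (by omega) (q ^ d) (pow_ne_zero _ hq) p ?_
  refine mul_right_cancel₀ (mul_ne_zero hD hq') (pol_ext fun X => ?_)
  by_cases hDX : evalMat X D = 0
  · rw [map_mul (evalMat X) _ (D * _), map_mul (evalMat X) _ (D * _), map_mul (evalMat X) D, hDX]
    ring
  by_cases hqX : evalMat X (gramPull n (n + n) q) = 0
  · rw [map_mul (evalMat X) _ (D * _), map_mul (evalMat X) _ (D * _), map_mul (evalMat X) D, hqX]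
    ring
  rw [map_mul (evalMat X) _ (D * _), map_mul (evalMat X) _ (D * _)]
  congr 1
  rw [evalMat_gramPull] at hqX
  rw [map_mul, evalMat_gramPull, evalMat_gramPull, map_pow]
  set q₀ := MvPolynomial.eval (gramVec X) q with hq₀
  set X₁ : Matrix (Idx n) (Fin (n + n)) ℂ := Y.map (MvPolynomial.eval (gramVec X)) with hX₁
  have hg₁ : gram X₁ = q₀ ^ 2 • gram X := by
    rw [hX₁, gram_map, hY, gram_eq_altMat X]
    have := altMat_map (MvPolynomial.eval (gramVec X)) (MvPolynomial.X (R := ℂ) (σ := Edge (n + n)))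
    simp only [MvPolynomial.eval_X] at this
    rw [this]
    ext i j
    simp [hq₀]
  have hdet : IsUnit (X.submatrix id e).det := by
    rw [isUnit_iff_ne_zero]
    intro h
    apply hDX
    rw [RingHom.map_det, ← h]
    congr 1
    ext r s
    simp [evalMat]
  set Z : Matrix (Fin (n + n)) (Idx n) ℂ := ((X.submatrix id e)⁻¹).submatrix e.symm id
  have hXZ : X * Z = 1 := by
    have h1 := Matrix.mul_nonsing_inv _ hdet
    have h2 : X * Z = (X.submatrix id e * (X.submatrix id e)⁻¹) := by
      ext r s
      simp only [Matrix.mul_apply, Z, Matrix.submatrix_apply, id]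
      exact (Equiv.sum_comp e _).symm.trans (by simp)
    rw [h2, h1]
  have hZX : Z * X = 1 := by
    have h1 := Matrix.nonsing_inv_mul _ hdet
    have h2 : Z * X = ((X.submatrix id e)⁻¹ * X.submatrix id e).submatrix e.symm e.symm := by
      ext r s
      simp [Matrix.mul_apply, Z]
    rw [h2, h1, Matrix.submatrix_one_equiv]
  set X₀ := q₀⁻¹ • X₁ with hX₀
  have hg₀ : gram X₀ = gram X := by
    rw [hX₀, gram_smul, hg₁, smul_smul, ← mul_pow, inv_mul_cancel₀ hqX, one_pow, one_smul]
  have hM : (X₀ * Z) ∈ symplecticGroup (Fin n) ℂ := by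
    rw [SymplecticGroup.mem_iff']
    have : (X₀ * Z)ᵀ * J (Fin n) ℂ * (X₀ * Z) = Zᵀ * gram X₀ * Z := by
      rw [gram, Matrix.transpose_mul]; simp only [Matrix.mul_assoc]
    rw [this, hg₀, gram]
    have : Zᵀ * (Xᵀ * J (Fin n) ℂ * X) * Z = (X * Z)ᵀ * J (Fin n) ℂ * (X * Z) := by
      rw [Matrix.transpose_mul]; simp only [Matrix.mul_assoc]
    rw [this, hXZ]; simp
  have h1 := hf _ hM X
  rw [Matrix.mul_assoc, hZX, Matrix.mul_one] at h1
  rw [← h1, mul_comm, ← evalMat_smul hd, hX₀, smul_inv_smul₀ hqX, hp, hX₁]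
  rw [MvPolynomial.aeval_def, MvPolynomial.algebraMap_eq, MvPolynomial.eval_eval₂]
  have h2 : (MvPolynomial.eval (gramVec X)).comp MvPolynomial.C = RingHom.id ℂ := by ext; simp
  rw [evalMat, MvPolynomial.eval, MvPolynomial.coe_eval₂Hom]
  change _ = MvPolynomial.eval₂ ((MvPolynomial.eval (gramVec X)).comp MvPolynomial.C) _ f
  rw [h2]
  rfl

end FFT

section Grading

open MvPolynomial

variable {n : ℕ} {ι κ : Type}

/-- Substitution of homogeneous polynomials respects weights. -/
lemma IsWeightedHomogeneous_aeval {σ τ M : Type*} [AddCommMonoid M] {w : σ → M} {w' : τ → M}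
    {φ : σ → MvPolynomial τ ℂ} (hφ : ∀ i, IsWeightedHomogeneous w' (φ i) (w i))
    {f : MvPolynomial σ ℂ} {a : M} (hf : IsWeightedHomogeneous w f a) :
    IsWeightedHomogeneous w' (aeval φ f) a := by
  rw [aeval_def, eval₂_eq]
  refine IsWeightedHomogeneous.sum _ _ _ fun s hs => ?_
  have h1 : Finsupp.weight w s = a := hf (mem_support_iff.1 hs)
  have h2 : IsWeightedHomogeneous w' (∏ i ∈ s.support, φ i ^ s i) (∑ i ∈ s.support, s i • w i) :=
    IsWeightedHomogeneous.prod _ _ _ fun i _ => (hφ i).pow _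
  have h3 : ∑ i ∈ s.support, s i • w i = a := by
    rw [← h1, Finsupp.weight_apply, Finsupp.sum]
  rw [h3] at h2
  exact h2.C_mul _

lemma weightedHomogeneousComponent_aeval {σ τ M : Type*} [AddCommMonoid M] {w : σ → M}
    {w' : τ → M} {φ : σ → MvPolynomial τ ℂ} (hφ : ∀ i, IsWeightedHomogeneous w' (φ i) (w i))
    (f : MvPolynomial σ ℂ) (a : M) :
    weightedHomogeneousComponent w' a (aeval φ f) =
      aeval φ (weightedHomogeneousComponent w a f) := by
  classical
  induction f using MvPolynomial.induction_on' with
  | monomial s c =>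
    have h1 := isWeightedHomogeneous_monomial w s c rfl
    have h2 := IsWeightedHomogeneous_aeval hφ h1
    rw [weightedHomogeneousComponent_of_mem h1, weightedHomogeneousComponent_of_mem h2]
    split_ifs <;> simp
  | add p q hp hq => simp only [map_add, hp, hq]

/-- The weights recording the degree in each column. -/
def colW (p : Idx n × ι) : ι → ℕ := open Classical in fun k => if k = p.2 then 1 else 0

/-- The substitution by left multiplication with the transpose of a matrix. -/
def act (M : Matrix (Idx n) (Idx n) ℂ) : Pol n ι →ₐ[ℂ] Pol n ι :=
  aeval fun p => ∑ s, C (M s p.1) * X (s, p.2)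

lemma evalMat_act (M : Matrix (Idx n) (Idx n) ℂ) (A : Matrix (Idx n) ι ℂ) (f : Pol n ι) :
    evalMat A (act M f) = evalMat (Mᵀ * A) f := by
  rw [act, aeval_def, MvPolynomial.algebraMap_eq, eval_eval₂]
  have h2 : (evalMat A).comp MvPolynomial.C = RingHom.id ℂ := by ext; simp
  rw [evalMat, MvPolynomial.eval, MvPolynomial.coe_eval₂Hom]
  change MvPolynomial.eval₂ ((evalMat A).comp MvPolynomial.C) _ f = _
  rw [h2]
  congr 1
  ext p
  simp [Matrix.mul_apply]

lemma act_one : (act (1 : Matrix (Idx n) (Idx n) ℂ) : Pol n ι →ₐ[ℂ] Pol n ι) = AlgHom.id ℂ _ := by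
  ext1 p
  simp [act, Matrix.one_apply]

lemma act_mul (M N : Matrix (Idx n) (Idx n) ℂ) (f : Pol n ι) :
    act (M * N) f = act M (act N f) := by
  refine pol_ext fun A => ?_
  rw [evalMat_act, evalMat_act, evalMat_act, Matrix.transpose_mul, Matrix.mul_assoc]

/-- The representation of the symplectic group on polynomials. -/
def polRep (n : ℕ) (ι : Type) : Representation ℂ (symplecticGroup (Fin n) ℂ) (Pol n ι) where
  toFun g := (act g.1).toLinearMap
  map_one' := by
    rw [Submonoid.coe_one, act_one]; rfl
  map_mul' g h := LinearMap.ext fun f => act_mul _ _ f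

lemma polRep_apply (g : symplecticGroup (Fin n) ℂ) (f : Pol n ι) : polRep n ι g f = act g.1 f := rfl

lemma isInv_iff {f : Pol n ι} : IsInv f ↔ ∀ g, polRep n ι g f = f := by
  constructor
  · intro h g
    refine pol_ext fun A => ?_
    rw [polRep_apply, evalMat_act, h _ (SymplecticGroup.transpose_mem g.2)]
  · intro h M hM A
    have := h ⟨Mᵀ, SymplecticGroup.transpose_mem hM⟩
    conv_rhs => rw [← this, polRep_apply, evalMat_act, Matrix.transpose_transpose]

/-- The space of polynomials with given degrees in the columns. -/
def gr (n : ℕ) {ι : Type} (a : ι → ℕ) : Submodule ℂ (Pol n ι) :=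
  weightedHomogeneousSubmodule ℂ colW a

lemma mem_gr {a : ι → ℕ} {f : Pol n ι} : f ∈ gr n a ↔ IsWeightedHomogeneous colW f a := Iff.rfl

lemma act_mem_gr {a : ι → ℕ} (M : Matrix (Idx n) (Idx n) ℂ) {f : Pol n ι} (hf : f ∈ gr n a) :
    act M f ∈ gr n a := by
  refine IsWeightedHomogeneous_aeval (fun p => ?_) hf
  refine IsWeightedHomogeneous.sum _ _ _ fun s _ => ?_
  exact (isWeightedHomogeneous_X ℂ (colW (n := n)) (s, p.2)).C_mul _

/-- The space of polynomials with given degrees in the columns, as a representation. -/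
def grRep (n : ℕ) {ι : Type} (a : ι → ℕ) : Subrepresentation (polRep n ι) where
  toSubmodule := gr n a
  apply_mem_toSubmodule g _ hv := act_mem_gr g.1 hv

lemma weight_colW [Fintype ι] (s : Idx n × ι →₀ ℕ) :
    Finsupp.weight colW s = fun k => ∑ r, s (r, k) := by
  classical
  ext k
  rw [Finsupp.weight_apply, Finsupp.sum_fintype _ _ (by simp), Fintype.sum_prod_type,
    Finset.sum_apply]
  refine Finset.sum_congr rfl fun r _ => ?_
  simp [colW]

lemma isHomogeneous_of_mem_gr [Fintype ι] {a : ι → ℕ} {f : Pol n ι} (hf : f ∈ gr n a) :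
    f.IsHomogeneous (∑ k, a k) := by
  intro s hs
  have h1 := hf hs
  rw [weight_colW] at h1
  rw [← h1, Finset.sum_comm, ← Fintype.sum_prod_type', Finsupp.weight_apply,
    Finsupp.sum_fintype _ _ (by simp)]
  simp

instance [Fintype ι] (a : ι → ℕ) : FiniteDimensional ℂ (gr n a) := by
  have h1 : gr n a ≤ homogeneousSubmodule (Idx n × ι) ℂ (∑ k, a k) :=
    fun f hf => isHomogeneous_of_mem_gr hf
  have h2 := homogeneousSubmodule_fg (σ := Idx n × ι) (R := ℂ) (∑ k, a k)
  have : FiniteDimensional ℂ (homogeneousSubmodule (Idx n × ι) ℂ (∑ k, a k)) :=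
    Module.Finite.iff_fg.2 h2
  exact Submodule.finiteDimensional_of_le h1

end Grading

section Counting

open MvPolynomial

variable {n : ℕ} {ι κ : Type}

/-- The invariants with given degrees in the columns. -/
def invGr (n : ℕ) {ι : Type} (a : ι → ℕ) : Submodule ℂ (Pol n ι) where
  carrier := {f | f ∈ gr n a ∧ IsInv f}
  add_mem' := fun hf hg => ⟨add_mem hf.1 hg.1, fun M hM A => by
    rw [map_add, map_add, hf.2 M hM, hg.2 M hM]⟩
  zero_mem' := ⟨zero_mem _, fun M hM A => by rw [map_zero, map_zero]⟩
  smul_mem' := fun c f hf => ⟨Submodule.smul_mem _ c hf.1, fun M hM A => by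
    rw [MvPolynomial.smul_eq_C_mul, map_mul, map_mul, hf.2 M hM, evalMat, evalMat, eval_C, eval_C]⟩

lemma mem_invGr {a : ι → ℕ} {f : Pol n ι} : f ∈ invGr n a ↔ f ∈ gr n a ∧ IsInv f := Iff.rfl

/-- The weight of an edge. -/
def edgeW {m : ℕ} (e : Edge m) : Fin m → ℕ :=
  fun k => (if k = e.1.1 then 1 else 0) + if k = e.1.2 then 1 else 0

lemma weight_edgeW {m : ℕ} (d : Edge m →₀ ℕ) : Finsupp.weight edgeW d = edgeDeg d := by
  ext k
  have h1 := DFunLike.congr_fun (sum_single_edge d) k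
  rw [Finsupp.finsetSum_apply] at h1
  refine Eq.trans ?_ h1
  rw [Finsupp.weight_apply, Finsupp.sum_fintype _ _ (by simp), Finset.sum_apply]
  refine Finset.sum_congr rfl fun e _ => ?_
  simp [edgeW, Finsupp.single_apply, mul_add, eq_comm]

lemma gramVec_mul {m : ℕ} {M : Matrix (Idx n) (Idx n) ℂ} (hM : M ∈ symplecticGroup (Fin n) ℂ)
    (A : Matrix (Idx n) (Fin m) ℂ) : gramVec (M * A) = gramVec A := by
  have h1 : gram (M * A) = gram A := by
    conv_rhs => rw [gram, ← SymplecticGroup.mem_iff'.1 hM]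
    rw [gram, Matrix.transpose_mul]
    simp only [Matrix.mul_assoc]
  ext e
  rw [gramVec, gramVec, h1]

lemma isWeightedHomogeneous_gramPull {m : ℕ} (e : Edge m) :
    IsWeightedHomogeneous (colW (n := n)) (gramPull n m (X e)) (edgeW e) := by
  have hX : ∀ r s : Idx n, IsWeightedHomogeneous (colW (n := n))
      (X (r, e.1.1) * X (s, e.1.2) : Pol n (Fin m)) (edgeW e) := by
    intro r s
    convert (isWeightedHomogeneous_X ℂ (colW (n := n)) (r, e.1.1)).mul
      (isWeightedHomogeneous_X ℂ (colW (n := n)) (s, e.1.2)) using 1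
    ext k
    simp only [edgeW, colW, Pi.add_apply]
    congr
  rw [gramPull, aeval_X, gramVec, gram_apply]
  exact IsWeightedHomogeneous.sum _ _ _ fun p _ => (hX _ _).sub (hX _ _)

lemma invGr_eq_map (a : Fin (n + n) → ℕ) :
    invGr n a = (weightedHomogeneousSubmodule ℂ edgeW a).map (gramPull n (n + n)).toLinearMap := by
  have hw : ∀ e, IsWeightedHomogeneous (colW (n := n)) (gramVec (Matrix.of fun r k => X (r, k)) e)
      (edgeW (m := n + n) e) := fun e => by
    simpa [gramPull] using isWeightedHomogeneous_gramPull (n := n) e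
  ext f
  rw [Submodule.mem_map]
  constructor
  · rintro ⟨h1, h2⟩
    obtain ⟨F, rfl⟩ := mem_range_gramPull (isHomogeneous_of_mem_gr h1) h2
    refine ⟨weightedHomogeneousComponent edgeW a F,
      weightedHomogeneousComponent_mem _ _ _, ?_⟩
    change aeval _ _ = aeval _ _
    erw [← weightedHomogeneousComponent_aeval hw]
    exact weightedHomogeneousComponent_eq_self h1
  · rintro ⟨F, hF, rfl⟩
    refine ⟨IsWeightedHomogeneous_aeval hw hF, fun M hM A => ?_⟩
    change evalMat _ (gramPull _ _ F) = evalMat _ (gramPull _ _ F)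
    rw [evalMat_gramPull, evalMat_gramPull, gramVec_mul hM]

lemma finrank_weightedHomogeneousSubmodule {σ M : Type} [AddCommMonoid M] (w : σ → M) (a : M) :
    Module.finrank ℂ (weightedHomogeneousSubmodule ℂ w a) =
      Nat.card {d : σ →₀ ℕ // Finsupp.weight w d = a} := by
  have h1 : LinearIndependent ℂ
      (fun d : {d : σ →₀ ℕ // Finsupp.weight w d = a} => (monomial d.1 (1 : ℂ))) := by
    have := (basisMonomials σ ℂ).linearIndependent.comp
      (fun d : {d : σ →₀ ℕ // Finsupp.weight w d = a} => d.1) Subtype.val_injective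
    simpa [Function.comp_def] using this
  have h2 : weightedHomogeneousSubmodule ℂ w a = Submodule.span ℂ (Set.range
      (fun d : {d : σ →₀ ℕ // Finsupp.weight w d = a} => (monomial d.1 (1 : ℂ)))) := by
    apply le_antisymm
    · intro f hf
      rw [f.as_sum]
      refine Submodule.sum_mem _ fun s hs => ?_
      have : monomial s (f.coeff s) = f.coeff s • monomial s (1 : ℂ) := by
        rw [smul_monomial, smul_eq_mul, mul_one]
      rw [this]
      exact Submodule.smul_mem _ _ (Submodule.subset_span ⟨⟨s, hf (mem_support_iff.1 hs)⟩, rfl⟩)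
    · rw [Submodule.span_le]
      rintro _ ⟨d, rfl⟩
      exact isWeightedHomogeneous_monomial w d.1 1 d.2
  rw [h2, Module.finrank_eq_nat_card_basis (Module.Basis.span h1)]

lemma finrank_map_of_injective {V W : Type*} [AddCommGroup V] [Module ℂ V] [AddCommGroup W]
    [Module ℂ W] (f : V →ₗ[ℂ] W) (hf : Function.Injective f) (p : Submodule ℂ V) :
    Module.finrank ℂ (p.map f) = Module.finrank ℂ p :=
  (Submodule.equivMapOfInjective f hf p).finrank_eq.symm

lemma finrank_invGr_fin (a : Fin (n + n) → ℕ) : Module.finrank ℂ (invGr n a) = symCount a := by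
  rw [invGr_eq_map, finrank_map_of_injective _ (gramPull_injective (by omega)),
    finrank_weightedHomogeneousSubmodule, symCount]
  refine Nat.card_congr
    { toFun := fun d => ⟨symm d.1, symm_comm _, symm_self _, fun i => ?_⟩
      invFun := fun d => ⟨Finsupp.equivFunOnFinite.symm fun e => d.1 e.1.1 e.1.2, ?_⟩
      left_inv := fun d => ?_
      right_inv := fun d => ?_ }
  · exact (congr_fun (weight_edgeW d.1) i).symm.trans (congr_fun d.2 i)
  · rw [weight_edgeW]
    ext i
    rw [← d.2.2.2 i]
    refine Finset.sum_congr rfl fun j _ => ?_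
    rw [symm]
    split_ifs with h1 h2
    · rfl
    · exact d.2.1 _ _
    · rw [le_antisymm (not_lt.1 h2) (not_lt.1 h1), d.2.2.1]
  · ext e
    simp [symm, e.2]
  · ext i j
    simp only [symm]
    split_ifs with h1 h2
    · rfl
    · exact d.2.1 _ _
    · rw [le_antisymm (not_lt.1 h2) (not_lt.1 h1), d.2.2.1]

lemma finrank_invGr [Fintype ι] (e : Fin (n + n) ↪ ι) (a : ι → ℕ)
    (ha : ∀ k, k ∉ Set.range e → a k = 0) : Module.finrank ℂ (invGr n a) = symCount a := by
  rw [← symCount_comp e a ha, ← finrank_invGr_fin]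
  set E : Idx n × Fin (n + n) → Idx n × ι := Prod.map id e with hE
  have hEi : Function.Injective E := Function.injective_id.prodMap e.injective
  have hev : ∀ (A : Matrix (Idx n) ι ℂ) (f : Pol n (Fin (n + n))),
      evalMat A (rename E f) = evalMat (A.submatrix id e) f := by
    intro A f
    rw [evalMat, eval_rename]; rfl
  have hmap : invGr n a =
      (invGr n (a ∘ e)).map (rename E : Pol n (Fin (n + n)) →ₐ[ℂ] _).toLinearMap := by
    ext f
    rw [Submodule.mem_map]
    constructor
    · rintro ⟨h1, h2⟩
      have h3 : ↑f.vars ⊆ Set.range E := by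
        intro p hp
        obtain ⟨s, hs, hps⟩ := (mem_vars_iff_mem_support p).1 hp
        have h4 := h1 (mem_support_iff.1 hs)
        rw [weight_colW] at h4
        obtain ⟨k, hk⟩ : p.2 ∈ Set.range e := by
          by_contra hk
          have h5 := congr_fun h4 p.2
          rw [ha _ hk, Finset.sum_eq_zero_iff] at h5
          exact (Finsupp.mem_support_iff.1 hps) (h5 p.1 (Finset.mem_univ _))
        exact ⟨(p.1, k), Prod.ext rfl hk⟩
      obtain ⟨F, rfl⟩ := exists_rename_eq_of_vars_subset_range f E hEi h3
      refine ⟨F, ⟨?_, ?_⟩, rfl⟩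
      · intro s hs
        have h4 := h1 (d := s.mapDomain E) (by rwa [coeff_rename_mapDomain _ hEi])
        rw [weight_colW] at h4 ⊢
        ext k
        rw [Function.comp_apply, ← h4]
        refine Finset.sum_congr rfl fun r _ => ?_
        exact (Finsupp.mapDomain_apply hEi s (r, k)).symm
      · intro M hM A
        obtain ⟨B, rfl⟩ : ∃ B : Matrix (Idx n) ι ℂ, A = B.submatrix id e :=
          ⟨Matrix.of fun r => Function.extend e (A r) 0, by
            ext r k
            simp [e.injective.extend_apply]⟩
        have h4 := h2 M hM B
        rw [hev, hev] at h4
        exact h4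
    · rintro ⟨F, ⟨h1, h2⟩, rfl⟩
      refine ⟨?_, fun M hM A => ?_⟩
      · intro s hs
        obtain ⟨t, rfl, ht⟩ := coeff_rename_ne_zero E F s hs
        have h3 := h1 ht
        rw [weight_colW] at h3 ⊢
        ext k
        by_cases hk : k ∈ Set.range e
        · obtain ⟨k, rfl⟩ := hk
          refine Eq.trans (Finset.sum_congr rfl fun r _ => ?_) (congr_fun h3 k)
          exact Finsupp.mapDomain_apply hEi t (r, k)
        · rw [ha k hk]
          refine Finset.sum_eq_zero fun r _ => Finsupp.mapDomain_of_notMem_range _ _ ?_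
          rintro ⟨⟨r', k'⟩, h⟩
          exact hk ⟨k', (Prod.ext_iff.1 h).2⟩
      · have h4 := h2 M hM (A.submatrix id e)
        change evalMat _ (rename E F) = evalMat _ (rename E F)
        rw [hev, hev, ← h4]
        rfl
  rw [hmap, finrank_map_of_injective _ (rename_injective E hEi)]

end Counting

section Fischer

open MvPolynomial

variable {n : ℕ} {ι σ : Type}

variable [Fintype σ] [Fintype ι]

/-- The product of the factorials of the exponents. -/
def expFact (s : σ →₀ ℕ) : ℂ := ∏ p, ((s p).factorial : ℂ)

lemma expFact_add_single (s : σ →₀ ℕ) (p : σ) :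
    expFact (s + Finsupp.single p 1) = expFact s * (s p + 1) := by
  classical
  rw [expFact, expFact, ← Finset.mul_prod_erase _ _ (Finset.mem_univ p),
    ← Finset.mul_prod_erase _ _ (Finset.mem_univ p),
    Finset.prod_congr (g := fun q => ((s q).factorial : ℂ)) rfl fun q hq => by
      simp [(Finset.mem_erase.1 hq).1.symm]]
  simp [Nat.factorial_succ]
  ring

/-- The Fischer form. -/
def fischer (σ : Type) [Fintype σ] : MvPolynomial σ ℂ →ₗ[ℂ] MvPolynomial σ ℂ →ₗ[ℂ] ℂ :=
  (basisMonomials σ ℂ).constr ℂ fun s => expFact s • lcoeff ℂ s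

lemma fischer_monomial (s : σ →₀ ℕ) (h : MvPolynomial σ ℂ) :
    fischer σ (monomial s 1) h = expFact s * coeff s h := by
  have := (basisMonomials σ ℂ).constr_basis ℂ (fun s => expFact s • lcoeff ℂ s) s
  rw [coe_basisMonomials] at this
  rw [fischer, this]; rfl

lemma fischer_apply (f h : MvPolynomial σ ℂ) :
    fischer σ f h = ∑ s ∈ f.support, expFact s * coeff s f * coeff s h := by
  conv_lhs => rw [f.as_sum]
  rw [map_sum, LinearMap.sum_apply]
  refine Finset.sum_congr rfl fun s _ => ?_
  have : monomial s (f.coeff s) = f.coeff s • monomial s (1 : ℂ) := by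
    rw [smul_monomial, smul_eq_mul, mul_one]
  rw [this, map_smul, LinearMap.smul_apply, fischer_monomial, smul_eq_mul]
  ring

lemma fischer_C (c : ℂ) (h : MvPolynomial σ ℂ) : fischer σ (C c) h = c * coeff 0 h := by
  have : (C c : MvPolynomial σ ℂ) = c • monomial 0 (1 : ℂ) := by
    rw [smul_monomial, smul_eq_mul, mul_one]; rfl
  rw [this, map_smul, LinearMap.smul_apply, fischer_monomial]
  simp [expFact]

lemma fischer_symm (f h : MvPolynomial σ ℂ) : fischer σ f h = fischer σ h f := by
  classical
  rw [fischer_apply, fischer_apply,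
    Finset.sum_subset (Finset.subset_union_left (s₂ := h.support)),
    Finset.sum_subset (Finset.subset_union_right (s₁ := f.support) (s₂ := h.support))]
  · exact Finset.sum_congr rfl fun s _ => by ring
  · intro s _ hs
    rw [notMem_support_iff.1 hs]; ring
  · intro s _ hs
    rw [notMem_support_iff.1 hs]; ring

lemma fischer_mul_X (f h : MvPolynomial σ ℂ) (p : σ) :
    fischer σ (f * X p) h = fischer σ f (pderiv p h) := by
  classical
  induction f using MvPolynomial.induction_on' with
  | monomial s c =>
    have h1 : monomial s c * X p = c • monomial (s + Finsupp.single p 1) (1 : ℂ) := by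
      rw [X, monomial_mul, smul_monomial, smul_eq_mul]
    have h2 : monomial s c = c • monomial s (1 : ℂ) := by
      rw [smul_monomial, smul_eq_mul, mul_one]
    rw [h1, h2, map_smul, map_smul, LinearMap.smul_apply, LinearMap.smul_apply, fischer_monomial,
      fischer_monomial, expFact_add_single, coeff_pderiv]
    simp only [smul_eq_mul]
    ring
  | add f g hf hg => rw [add_mul, map_add, map_add, LinearMap.add_apply, LinearMap.add_apply, hf, hg]

omit [Fintype ι] in
lemma pderiv_act (M : Matrix (Idx n) (Idx n) ℂ) (h : Pol n ι) (r : Idx n) (k : ι) :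
    pderiv (r, k) (act M h) = ∑ s, C (M r s) * act M (pderiv (s, k) h) := by
  classical
  induction h using MvPolynomial.induction_on with
  | C c => simp [act]
  | add f g hf hg => simp only [map_add, hf, hg, mul_add, Finset.sum_add_distrib]
  | mul_X f p hf =>
    have h1 : pderiv (r, k) (act M (X p)) = if p.2 = k then C (M r p.1) else 0 := by
      rw [act, aeval_X, map_sum]
      simp only [pderiv_C_mul, pderiv_X, Pi.single_apply, Prod.mk.injEq]
      split_ifs with h
      · simp [h]
      · simp [h]
    rw [map_mul, pderiv_mul, hf, h1]
    simp only [pderiv_mul, map_add, map_mul, mul_add, Finset.sum_add_distrib, pderiv_X]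
    congr 1
    · rw [Finset.sum_mul]
      exact Finset.sum_congr rfl fun s _ => by ring
    · obtain ⟨q, l⟩ := p
      by_cases h : l = k
      · subst h
        rw [Finset.sum_eq_single q]
        · simp; ring
        · intro b _ hb
          simp [hb]
        · simp
      · simp [h]

omit [Fintype ι] in
lemma coeff_zero_act (M : Matrix (Idx n) (Idx n) ℂ) (h : Pol n ι) : coeff 0 (act M h) = coeff 0 h := by
  have h1 : ∀ g : Pol n ι, coeff 0 g = evalMat (0 : Matrix (Idx n) ι ℂ) g := by
    intro g
    have : (fun p : Idx n × ι => (0 : Matrix (Idx n) ι ℂ) p.1 p.2) = 0 := rfl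
    rw [← constantCoeff_eq, evalMat, this, eval_zero]
  rw [h1, h1, evalMat_act, Matrix.mul_zero]

lemma fischer_act (M : Matrix (Idx n) (Idx n) ℂ) (f h : Pol n ι) :
    fischer _ (act M f) h = fischer _ f (act Mᵀ h) := by
  induction f using MvPolynomial.induction_on generalizing h with
  | C c =>
    have : act M (C c : Pol n ι) = C c := by simp [act]
    rw [this, fischer_C, fischer_C, coeff_zero_act]
  | add f g hf hg => simp only [map_add, LinearMap.add_apply, hf, hg]
  | mul_X f p hf =>
    obtain ⟨r, k⟩ := p
    have h1 : ∀ s, act M f * (C (M s r) * X (s, k)) = M s r • (act M f * X (s, k)) := by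
      intro s
      rw [smul_eq_C_mul]; ring
    have h2 : act M (X (r, k) : Pol n ι) = ∑ s, C (M s r) * X (s, k) := by rw [act, aeval_X]
    rw [map_mul, h2, Finset.mul_sum, map_sum, LinearMap.sum_apply, fischer_mul_X, pderiv_act, map_sum]
    refine Finset.sum_congr rfl fun s _ => ?_
    rw [h1, map_smul, LinearMap.smul_apply, fischer_mul_X, hf, ← smul_eq_C_mul, map_smul,
      Matrix.transpose_apply]

/-- Complex conjugation of the coefficients. -/
abbrev cj : MvPolynomial σ ℂ →+* MvPolynomial σ ℂ := MvPolynomial.map (starRingEnd ℂ)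

lemma fischer_cj (f h : MvPolynomial σ ℂ) :
    starRingEnd ℂ (fischer σ f h) = fischer σ (cj f) (cj h) := by
  have h1 : (cj f).support = f.support :=
    MvPolynomial.support_map_of_injective _ (starRingEnd ℂ).injective
  rw [fischer_apply, fischer_apply, map_sum, h1]
  refine Finset.sum_congr rfl fun s _ => ?_
  simp [expFact, coeff_map]

omit [Fintype σ] in
lemma cj_cj (f : MvPolynomial σ ℂ) : cj (cj f) = f := by
  ext s
  simp [coeff_map]

omit [Fintype ι] in
lemma cj_act (M : Matrix (Idx n) (Idx n) ℂ) (f : Pol n ι) :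
    cj (act M f) = act (M.map (starRingEnd ℂ)) (cj f) := by
  induction f using MvPolynomial.induction_on with
  | C c => simp [act]
  | add f g hf hg => simp only [map_add, hf, hg]
  | mul_X f p hf =>
    rw [map_mul, map_mul, hf, map_mul, map_mul, map_X]
    congr 1
    simp [act]

lemma fischer_cj_self (f : MvPolynomial σ ℂ) :
    fischer σ (cj f) f = ((∑ s ∈ f.support, (∏ p, ((s p).factorial : ℝ)) * ‖coeff s f‖ ^ 2 : ℝ) : ℂ) := by
  rw [fischer_symm, fischer_apply, Complex.ofReal_sum]
  refine Finset.sum_congr rfl fun s _ => ?_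
  rw [coeff_map, mul_assoc, Complex.mul_conj, Complex.normSq_eq_norm_sq]
  simp [expFact]

/-- The Hermitian Fischer inner product. -/
@[reducible]
def fischerCore (σ : Type) [Fintype σ] : InnerProductSpace.Core ℂ (MvPolynomial σ ℂ) where
  inner f h := fischer σ (cj f) h
  conj_inner_symm f h := by
    rw [fischer_cj, cj_cj, fischer_symm]
  re_inner_nonneg f := by
    rw [fischer_cj_self]
    simp only [RCLike.re_to_complex, Complex.ofReal_re]
    positivity
  add_left f g h := by rw [map_add, map_add, LinearMap.add_apply]
  smul_left f h c := by
    rw [smul_eq_C_mul, map_mul, map_C, ← smul_eq_C_mul, map_smul, LinearMap.smul_apply, smul_eq_mul]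
  definite f hf := by
    rw [fischer_cj_self] at hf
    have h1 := Complex.ofReal_eq_zero.1 hf
    rw [Finset.sum_eq_zero_iff_of_nonneg fun s _ => by positivity] at h1
    ext s
    by_contra h2
    have h3 := h1 s (mem_support_iff.2 h2)
    have h4 : (∏ p, ((s p).factorial : ℝ)) ≠ 0 :=
      Finset.prod_ne_zero_iff.2 fun p _ => by exact_mod_cast (s p).factorial_ne_zero
    rcases mul_eq_zero.1 h3 with h5 | h5
    · exact h4 h5
    · rw [coeff_zero] at h2
      exact h2 (norm_eq_zero.1 (pow_eq_zero_iff two_ne_zero |>.1 h5))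

lemma conjTranspose_mem {M : Matrix (Idx n) (Idx n) ℂ} (hM : M ∈ symplecticGroup (Fin n) ℂ) :
    Mᵀ.map (starRingEnd ℂ) ∈ symplecticGroup (Fin n) ℂ := by
  have h1 := SymplecticGroup.mem_iff.1 (SymplecticGroup.transpose_mem hM)
  have hJ : (J (Fin n) ℂ).map (starRingEnd ℂ) = J (Fin n) ℂ := by
    ext i j
    rcases i with i | i <;> rcases j with j | j <;> simp [J, Matrix.one_apply, apply_ite]
  rw [SymplecticGroup.mem_iff]
  have h2 := congr_arg (fun N => N.map (starRingEnd ℂ)) h1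
  simp only [Matrix.map_mul, hJ] at h2
  exact h2

/-- Complete reducibility. -/
theorem exists_isCompl (E : Subrepresentation (polRep n ι)) [FiniteDimensional ℂ E.toSubmodule] :
    ∃ Y : Subrepresentation (polRep n ι), IsCompl E.toSubmodule Y.toSubmodule := by
  let core := fischerCore (Idx n × ι)
  let : NormedAddCommGroup (Pol n ι) := core.toNormedAddCommGroup
  let : InnerProductSpace ℂ (Pol n ι) := InnerProductSpace.ofCore core.toCore
  refine ⟨⟨E.toSubmoduleᗮ, fun g h hh => ?_⟩, Submodule.isCompl_orthogonal _⟩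
  rw [Submodule.mem_orthogonal] at hh ⊢
  intro f hf
  have h1 := hh _ (E.apply_mem_toSubmodule ⟨_, conjTranspose_mem g.2⟩ hf)
  change fischer _ (cj (act _ f)) h = 0 at h1
  change fischer _ (cj f) (act g.1 h) = 0
  have h2 : ((g.1ᵀ.map (starRingEnd ℂ)).map (starRingEnd ℂ))ᵀ = g.1 := by
    ext i j
    simp
  rwa [cj_act, fischer_act, h2] at h1

end Fischer

section HomSpaces

variable {G : Type*} [Group G]
variable {U V W T : Type*} [AddCommGroup U] [Module ℂ U] [AddCommGroup V] [Module ℂ V]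
  [AddCommGroup W] [Module ℂ W] [AddCommGroup T] [Module ℂ T]

/-- The dimension of the space of equivariant maps. -/
def homDim (ρ : Representation ℂ G U) (σ : Representation ℂ G V) : ℕ :=
  Module.finrank ℂ (equivariantMaps ρ σ)

lemma mem_equivariantMaps {ρ : Representation ℂ G U} {σ : Representation ℂ G V} {f : U →ₗ[ℂ] V} :
    f ∈ equivariantMaps ρ σ ↔ ∀ g u, f (ρ g u) = σ g (f u) :=
  ⟨fun h g u => LinearMap.congr_fun (h g) u, fun h g => LinearMap.ext (h g)⟩

lemma finrank_eq_of_linearEquiv_iff (e : V ≃ₗ[ℂ] W) (A : Submodule ℂ V) (B : Submodule ℂ W)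
    (h : ∀ v, v ∈ A ↔ e v ∈ B) : Module.finrank ℂ A = Module.finrank ℂ B := by
  have h1 : A.map (e : V →ₗ[ℂ] W) = B := by
    ext w
    rw [Submodule.mem_map]
    constructor
    · rintro ⟨v, hv, rfl⟩
      exact (h v).1 hv
    · intro hw
      exact ⟨e.symm w, (h _).2 (by simpa using hw), by simp⟩
  rw [← h1]
  exact (e.finrank_map_eq A).symm

/-- Maps out of a self-dual representation are invariants of a tensor product. -/
lemma homDim_eq_finrank_invariants [FiniteDimensional ℂ U] {ρ : Representation ℂ G U}
    {σ : Representation ℂ G W} {τ : Representation ℂ G T} (D : U ≃ₗ[ℂ] Module.Dual ℂ U)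
    (hD : ∀ g u v, D (ρ g u) v = D u (ρ g⁻¹ v)) (e : (ρ.tprod σ).Equiv τ) :
    homDim ρ σ = Module.finrank ℂ τ.invariants := by
  let Φ : (U ⊗[ℂ] W) ≃ₗ[ℂ] (U →ₗ[ℂ] W) :=
    (TensorProduct.congr D (LinearEquiv.refl ℂ W)).trans (dualTensorHomEquiv ℂ U W)
  have hΦ : ∀ u w v, Φ (u ⊗ₜ w) v = D u v • w := fun u w v => by
    simp [Φ, dualTensorHomEquiv]
  have hΦ' : ∀ g t v, Φ (ρ.tprod σ g t) v = σ g (Φ t (ρ g⁻¹ v)) := by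
    intro g t v
    induction t using TensorProduct.induction_on with
    | zero => simp
    | add x y hx hy => simp only [map_add, LinearMap.add_apply, hx, hy]
    | tmul u w =>
      rw [Representation.tprod_apply, TensorProduct.map_tmul, hΦ, hΦ, hD, map_smul]
  symm
  rw [homDim]
  refine finrank_eq_of_linearEquiv_iff (e.toLinearEquiv.symm.trans Φ) _ _ fun t => ?_
  rw [mem_equivariantMaps, Representation.mem_invariants]
  obtain ⟨x, rfl⟩ := e.toLinearEquiv.surjective t
  have he0 : ∀ g x, e.toLinearEquiv (ρ.tprod σ g x) = τ g (e.toLinearEquiv x) := e.isIntertwining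
  have he : ∀ g, τ g (e.toLinearEquiv x) = e.toLinearEquiv (ρ.tprod σ g x) := fun g =>
    (he0 g x).symm
  simp only [he, LinearEquiv.trans_apply, LinearEquiv.symm_apply_apply, EmbeddingLike.apply_eq_iff_eq]
  constructor
  · intro h g u
    have := hΦ' g x (ρ g u)
    rwa [h g, ← Module.End.mul_apply, ← map_mul, inv_mul_cancel, map_one, Module.End.one_apply] at this
  · intro h g
    apply Φ.injective
    ext v
    rw [hΦ', ← h, ← Module.End.mul_apply, ← map_mul, mul_inv_cancel, map_one, Module.End.one_apply]

/-- Precomposition and postcomposition with isomorphisms. -/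
lemma homDim_congr {U' V' : Type*} [AddCommGroup U'] [Module ℂ U'] [AddCommGroup V'] [Module ℂ V']
    {ρ : Representation ℂ G U} {ρ' : Representation ℂ G U'} {σ : Representation ℂ G V}
    {σ' : Representation ℂ G V'} (e : ρ.Equiv ρ') (e' : σ.Equiv σ') :
    homDim ρ σ = homDim ρ' σ' := by
  refine finrank_eq_of_linearEquiv_iff (e.toLinearEquiv.arrowCongr e'.toLinearEquiv) _ _ fun f => ?_
  rw [mem_equivariantMaps, mem_equivariantMaps]
  have he : ∀ g u, e.toLinearEquiv (ρ g u) = ρ' g (e.toLinearEquiv u) := e.isIntertwining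
  have he' : ∀ g u, e'.toLinearEquiv (σ g u) = σ' g (e'.toLinearEquiv u) := e'.isIntertwining
  constructor
  · intro h g u
    obtain ⟨u, rfl⟩ := e.toLinearEquiv.surjective u
    simp only [← he, LinearEquiv.arrowCongr_apply, LinearEquiv.symm_apply_apply, h, he']
  · intro h g u
    have := h g (e.toLinearEquiv u)
    simp only [← he, LinearEquiv.arrowCongr_apply, LinearEquiv.symm_apply_apply, ← he'] at this
    exact e'.toLinearEquiv.injective this

/-- The tensor product of isomorphisms. -/
def tprodCongr {U' V' : Type*} [AddCommGroup U'] [Module ℂ U'] [AddCommGroup V'] [Module ℂ V']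
    {ρ : Representation ℂ G U} {ρ' : Representation ℂ G U'} {σ : Representation ℂ G V}
    {σ' : Representation ℂ G V'} (e : ρ.Equiv ρ') (e' : σ.Equiv σ') :
    (ρ.tprod σ).Equiv (ρ'.tprod σ') :=
  .mk (TensorProduct.congr e.toLinearEquiv e'.toLinearEquiv) fun g => by
    have he : ∀ g u, e.toLinearEquiv (ρ g u) = ρ' g (e.toLinearEquiv u) := e.isIntertwining
    have he' : ∀ g u, e'.toLinearEquiv (σ g u) = σ' g (e'.toLinearEquiv u) := e'.isIntertwining
    ext u v
    exact congrArg₂ (· ⊗ₜ[ℂ] ·) (he g u) (he' g v)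

end HomSpaces

section SelfDual

open MvPolynomial

variable {n : ℕ} {ι κ : Type} [Fintype ι] [Fintype κ]

/-- The representation on polynomials with given degrees in the columns. -/
def grR (n : ℕ) {ι : Type} (a : ι → ℕ) : Representation ℂ (symplecticGroup (Fin n) ℂ) (gr n a) :=
  (grRep n a).toRepresentation

omit [Fintype ι] in
lemma grR_apply {a : ι → ℕ} (g : symplecticGroup (Fin n) ℂ) (f : gr n a) :
    (grR n a g f : Pol n ι) = act g.1 f.1 := rfl

omit [Fintype ι] in
lemma cj_mem_gr {a : ι → ℕ} {f : Pol n ι} (hf : f ∈ gr n a) : cj f ∈ gr n a := by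
  intro s hs
  refine hf (d := s) fun h => hs ?_
  rw [coeff_map, h, map_zero]

lemma fischer_cj_ne_zero {σ : Type} [Fintype σ] {f : MvPolynomial σ ℂ} (hf : fischer σ (cj f) f = 0) :
    f = 0 :=
  (fischerCore σ).definite f hf

lemma transpose_mul_J (g : symplecticGroup (Fin n) ℂ) :
    g.1ᵀ * J (Fin n) ℂ = J (Fin n) ℂ * (g⁻¹).1 := by
  have h1 : g.1 * (g⁻¹).1 = 1 := by
    rw [← Submonoid.coe_mul, mul_inv_cancel, Submonoid.coe_one]
  calc g.1ᵀ * J (Fin n) ℂ = g.1ᵀ * J (Fin n) ℂ * (g.1 * (g⁻¹).1) := by rw [h1, Matrix.mul_one]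
    _ = g.1ᵀ * J (Fin n) ℂ * g.1 * (g⁻¹).1 := by rw [Matrix.mul_assoc _ g.1]
    _ = _ := by rw [SymplecticGroup.mem_iff'.1 g.2]

/-- The invariant bilinear form on polynomials. -/
def jForm (n : ℕ) {ι : Type} [Fintype ι] (a : ι → ℕ) : gr n a →ₗ[ℂ] Module.Dual ℂ (gr n a) :=
  ((fischer (Idx n × ι)).compl₂ (act (J (Fin n) ℂ)).toLinearMap).domRestrict₁₂ (gr n a) (gr n a)

lemma jForm_apply {a : ι → ℕ} (f h : gr n a) :
    jForm n a f h = fischer _ f.1 (act (J (Fin n) ℂ) h.1) := rfl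

lemma jForm_injective (a : ι → ℕ) : Function.Injective (jForm n a) := by
  rw [← LinearMap.ker_eq_bot, LinearMap.ker_eq_bot']
  intro f hf
  let h : gr n a := ⟨act (-J (Fin n) ℂ) (cj f.1), act_mem_gr _ (cj_mem_gr f.2)⟩
  have h1 := LinearMap.congr_fun hf h
  rw [jForm_apply, ← act_mul, Matrix.mul_neg, J_squared, neg_neg, act_one, fischer_symm] at h1
  exact Subtype.ext (fischer_cj_ne_zero h1)

/-- The spaces of polynomials with given column degrees are self-dual. -/
def dualEquiv (n : ℕ) {ι : Type} [Fintype ι] (a : ι → ℕ) : gr n a ≃ₗ[ℂ] Module.Dual ℂ (gr n a) :=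
  LinearEquiv.ofInjectiveOfFinrankEq (jForm n a) (jForm_injective a) Subspace.dual_finrank_eq.symm

lemma dualEquiv_equivariant (a : ι → ℕ) (g : symplecticGroup (Fin n) ℂ) (u v : gr n a) :
    dualEquiv n a ((grR n a) g u) v =
      dualEquiv n a u ((grR n a) g⁻¹ v) := by
  change jForm n a _ _ = jForm n a _ _
  rw [jForm_apply, jForm_apply, grR_apply, grR_apply, fischer_act, ← act_mul, ← act_mul,
    transpose_mul_J]

omit [Fintype ι] in
lemma finrank_invariants_grRep (a : ι → ℕ) :
    Module.finrank ℂ (grR n a).invariants = Module.finrank ℂ (invGr n a) := by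
  rw [← finrank_map_of_injective (gr n a).subtype (Submodule.injective_subtype _)]
  have : Submodule.map (gr n a).subtype (grR n a).invariants = invGr n a := by
    ext f
    rw [Submodule.mem_map, mem_invGr, isInv_iff]
    constructor
    · rintro ⟨f, hf, rfl⟩
      exact ⟨f.2, fun g => congrArg Subtype.val (hf g)⟩
    · rintro ⟨hf, h⟩
      exact ⟨⟨f, hf⟩, fun g => Subtype.ext (h g), rfl⟩
  exact congrArg (fun S : Submodule ℂ (Pol n ι) => Module.finrank ℂ S) this

omit [Fintype ι] [Fintype κ] in
lemma evalMat_rename (e : ι → κ) (A : Matrix (Idx n) κ ℂ) (f : Pol n ι) :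
    evalMat A (rename (Prod.map id e) f : Pol n κ) = evalMat (A.submatrix id e) f := by
  rw [evalMat, evalMat, eval_rename]; rfl

omit [Fintype ι] [Fintype κ] in
lemma act_rename (e : ι → κ) (M : Matrix (Idx n) (Idx n) ℂ) (f : Pol n ι) :
    act M (rename (Prod.map id e) f : Pol n κ) = rename (Prod.map id e) (act M f) := by
  refine pol_ext fun A => ?_
  rw [evalMat_act, evalMat_rename, evalMat_rename, evalMat_act]; rfl

lemma weight_colW_mapDomain_inl (s : Idx n × ι →₀ ℕ) (t : Idx n × κ →₀ ℕ) :
    Finsupp.weight colW (s.mapDomain (Prod.map id Sum.inl) + t.mapDomain (Prod.map id Sum.inr)) =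
      Sum.elim (Finsupp.weight colW s) (Finsupp.weight colW t) := by
  have hl : Function.Injective (Prod.map id Sum.inl : Idx n × ι → Idx n × (ι ⊕ κ)) :=
    Function.injective_id.prodMap Sum.inl_injective
  have hr : Function.Injective (Prod.map id Sum.inr : Idx n × κ → Idx n × (ι ⊕ κ)) :=
    Function.injective_id.prodMap Sum.inr_injective
  rw [weight_colW, weight_colW, weight_colW]
  ext (k | k)
  · refine Finset.sum_congr rfl fun r _ => ?_
    rw [Finsupp.add_apply, Finsupp.mapDomain_of_notMem_range t _ (by rintro ⟨⟨r', k'⟩, h⟩; simp at h),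
      add_zero]
    exact Finsupp.mapDomain_apply hl s (r, k)
  · refine Finset.sum_congr rfl fun r _ => ?_
    rw [Finsupp.add_apply, Finsupp.mapDomain_of_notMem_range _ _ (by rintro ⟨⟨r', k'⟩, h⟩; simp at h), zero_add]
    exact Finsupp.mapDomain_apply hr t (r, k)

/-- Splitting exponents according to the columns. -/
def splitExp (n : ℕ) (ι κ : Type) :
    ((Idx n × ι →₀ ℕ) × (Idx n × κ →₀ ℕ)) ≃ (Idx n × (ι ⊕ κ) →₀ ℕ) where
  toFun p := p.1.mapDomain (Prod.map id Sum.inl) + p.2.mapDomain (Prod.map id Sum.inr)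
  invFun s := (s.comapDomain (Prod.map id Sum.inl)
      (Function.injective_id.prodMap Sum.inl_injective).injOn,
    s.comapDomain (Prod.map id Sum.inr) (Function.injective_id.prodMap Sum.inr_injective).injOn)
  left_inv p := by
    ext ⟨r, k⟩
    · simp only [Finsupp.comapDomain_apply, Finsupp.add_apply]
      rw [Finsupp.mapDomain_apply (Function.injective_id.prodMap Sum.inl_injective),
        Finsupp.mapDomain_of_notMem_range _ _ (by rintro ⟨⟨r', k'⟩, h⟩; simp at h), add_zero]
    · simp only [Finsupp.comapDomain_apply, Finsupp.add_apply]
      rw [Finsupp.mapDomain_apply (Function.injective_id.prodMap Sum.inr_injective),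
        Finsupp.mapDomain_of_notMem_range _ _ (by rintro ⟨⟨r', k'⟩, h⟩; simp at h), zero_add]
  right_inv s := by
    ext ⟨r, k | k⟩
    · simp only [Finsupp.add_apply]
      rw [Finsupp.mapDomain_of_notMem_range (f := Prod.map id Sum.inr) _ _ (by rintro ⟨⟨r', k'⟩, h⟩; simp at h), add_zero]
      exact (Finsupp.mapDomain_apply (Function.injective_id.prodMap Sum.inl_injective) _ (r, k)).trans
        (Finsupp.comapDomain_apply _ _ _ _)
    · simp only [Finsupp.add_apply]
      rw [Finsupp.mapDomain_of_notMem_range (f := Prod.map id Sum.inl) _ _ (by rintro ⟨⟨r', k'⟩, h⟩; simp at h), zero_add]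
      exact (Finsupp.mapDomain_apply (Function.injective_id.prodMap Sum.inr_injective) _ (r, k)).trans
        (Finsupp.comapDomain_apply _ _ _ _)

lemma finrank_gr_elim (a : ι → ℕ) (b : κ → ℕ) :
    Module.finrank ℂ (gr n (Sum.elim a b)) = Module.finrank ℂ (gr n a) * Module.finrank ℂ (gr n b) := by
  rw [gr, gr, gr, finrank_weightedHomogeneousSubmodule, finrank_weightedHomogeneousSubmodule,
    finrank_weightedHomogeneousSubmodule, ← Nat.card_prod]
  refine Nat.card_congr (Equiv.trans ?_ (Equiv.subtypeProdEquivProd)).symm.symm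
  refine ((splitExp n ι κ).symm.subtypeEquiv fun s => ?_)
  obtain ⟨p, rfl⟩ := (splitExp n ι κ).surjective s
  rw [Equiv.symm_apply_apply]
  change Finsupp.weight colW (Finsupp.mapDomain _ p.1 + Finsupp.mapDomain _ p.2) = _ ↔ _
  rw [weight_colW_mapDomain_inl]
  constructor
  · intro h
    exact ⟨funext fun k => congrFun h (Sum.inl k), funext fun k => congrFun h (Sum.inr k)⟩
  · rintro ⟨h1, h2⟩
    rw [h1, h2]

lemma rename_mul_rename_mem {a : ι → ℕ} {b : κ → ℕ} {f : Pol n ι} {h : Pol n κ} (hf : f ∈ gr n a)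
    (hh : h ∈ gr n b) :
    rename (Prod.map id Sum.inl) f * rename (Prod.map id Sum.inr) h ∈ gr n (Sum.elim a b) := by
  have hab : Sum.elim a b = Sum.elim a (0 : κ → ℕ) + Sum.elim (0 : ι → ℕ) b := by
    ext (k | k) <;> simp
  rw [hab, mem_gr]
  refine IsWeightedHomogeneous.mul (fun s hs => ?_) fun s hs => ?_
  · obtain ⟨u, rfl, hu⟩ := coeff_rename_ne_zero _ _ _ hs
    have := weight_colW_mapDomain_inl u (0 : Idx n × κ →₀ ℕ)
    rwa [Finsupp.mapDomain_zero, add_zero, hf hu, map_zero] at this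
  · obtain ⟨u, rfl, hu⟩ := coeff_rename_ne_zero _ _ _ hs
    have := weight_colW_mapDomain_inl (0 : Idx n × ι →₀ ℕ) u
    rwa [Finsupp.mapDomain_zero, zero_add, hh hu, map_zero] at this

/-- The multiplication map. -/
def mulMap (n : ℕ) {ι κ : Type} [Fintype ι] [Fintype κ] (a : ι → ℕ) (b : κ → ℕ) :
    gr n a ⊗[ℂ] gr n b →ₗ[ℂ] gr n (Sum.elim a b) :=
  TensorProduct.lift (LinearMap.mk₂ ℂ (fun f h => ⟨_, rename_mul_rename_mem f.2 h.2⟩)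
    (fun f f' h => Subtype.ext (by simp [add_mul]))
    (fun c f h => Subtype.ext (by simp))
    (fun f h h' => Subtype.ext (by simp [mul_add]))
    (fun c f h => Subtype.ext (by simp)))

lemma mulMap_tmul {a : ι → ℕ} {b : κ → ℕ} (f : gr n a) (h : gr n b) :
    (mulMap n a b (f ⊗ₜ h) : Pol n (ι ⊕ κ)) =
      rename (Prod.map id Sum.inl) f.1 * rename (Prod.map id Sum.inr) h.1 := rfl

lemma mulMap_surjective (a : ι → ℕ) (b : κ → ℕ) : Function.Surjective (mulMap n a b) := by
  rintro ⟨f, hf⟩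
  suffices h : f ∈ (LinearMap.range (mulMap n a b)).map (gr n (Sum.elim a b)).subtype by
    obtain ⟨y, ⟨x, hx⟩, hy⟩ := h
    exact ⟨x, hx.trans (Subtype.ext hy)⟩
  rw [f.as_sum]
  refine sum_mem fun s hs => ?_
  have h1 : Finsupp.weight colW s = Sum.elim a b := hf (mem_support_iff.1 hs)
  obtain ⟨p, rfl⟩ := (splitExp n ι κ).surjective s
  change Finsupp.weight colW (Finsupp.mapDomain _ p.1 + Finsupp.mapDomain _ p.2) = _ at h1
  rw [weight_colW_mapDomain_inl] at h1
  have ha : monomial p.1 (1 : ℂ) ∈ gr n a :=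
    isWeightedHomogeneous_monomial _ _ _ (funext fun k => congrFun h1 (Sum.inl k))
  have hb : monomial p.2 (1 : ℂ) ∈ gr n b :=
    isWeightedHomogeneous_monomial _ _ _ (funext fun k => congrFun h1 (Sum.inr k))
  have h2 : ∀ c : ℂ, monomial (splitExp n ι κ p) c = c • (mulMap n a b (⟨_, ha⟩ ⊗ₜ ⟨_, hb⟩)).1 := by
    intro c
    rw [mulMap_tmul, rename_monomial, rename_monomial, monomial_mul, smul_monomial]
    simp [splitExp]
  rw [h2]
  exact Submodule.smul_mem _ _ 
    ⟨mulMap n a b (⟨_, ha⟩ ⊗ₜ ⟨_, hb⟩), LinearMap.mem_range_self (mulMap n a b) _, rfl⟩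

lemma mulMap_injective (a : ι → ℕ) (b : κ → ℕ) : Function.Injective (mulMap n a b) := by
  have h : Module.finrank ℂ (gr n a ⊗[ℂ] gr n b) = Module.finrank ℂ (gr n (Sum.elim a b)) := by
    rw [Module.finrank_tensorProduct, finrank_gr_elim]
  have : Function.Injective (mulMap n a b) ↔ Function.Surjective (mulMap n a b) :=
    @LinearMap.injective_iff_surjective_of_finrank_eq_finrank ℂ (gr n a ⊗[ℂ] gr n b) _ _ _
      (gr n (Sum.elim a b)) _ _ _ _ h (mulMap n a b)
  exact this.2 (mulMap_surjective a b)

/-- Multiplication identifies the tensor product with polynomials in more columns. -/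
def mulEquiv (n : ℕ) {ι κ : Type} [Fintype ι] [Fintype κ] (a : ι → ℕ) (b : κ → ℕ) :
    ((grR n a).tprod (grR n b)).Equiv
      (grR n (Sum.elim a b)) :=
  .mk (LinearEquiv.ofBijective (mulMap n a b)
    ⟨mulMap_injective a b, mulMap_surjective a b⟩) fun g =>
    TensorProduct.ext' fun f h => Subtype.ext <| by
      refine Eq.trans (b := act g.1 (mulMap n a b (f ⊗ₜ h)).1) ?_ rfl
      rw [mulMap_tmul, map_mul, act_rename, act_rename]
      rfl

/-- Homomorphisms between spaces of polynomials are counted by symmetric matrices. -/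
theorem homDim_grR (e : Fin (n + n) ↪ ι ⊕ κ) (a : ι → ℕ) (b : κ → ℕ)
    (h : ∀ k, k ∉ Set.range e → Sum.elim a b k = 0) :
    homDim (grR n a) (grR n b) = symCount (Sum.elim a b) := by
  rw [homDim_eq_finrank_invariants (dualEquiv n a) (dualEquiv_equivariant a) (mulEquiv n a b),
    finrank_invariants_grRep, finrank_invGr e _ h]

/-- Homomorphisms into tensor products of spaces of polynomials are counted by symmetric matrices. -/
theorem homDim_grR_tprod {μ : Type} [Fintype μ] (e : Fin (n + n) ↪ ι ⊕ (κ ⊕ μ)) (c : ι → ℕ)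
    (a : κ → ℕ) (b : μ → ℕ) (h : ∀ k, k ∉ Set.range e → Sum.elim c (Sum.elim a b) k = 0) :
    homDim (V := gr n a ⊗[ℂ] gr n b) (grR n c) ((grR n a).tprod (grR n b)) = symCount (Sum.elim c (Sum.elim a b)) := by
  rw [homDim_congr (.refl _) (mulEquiv n a b), homDim_grR e _ _ h]

end SelfDual

section Biproducts

variable {G : Type*} [Group G]
variable {A B C U : Type*} [AddCommGroup A] [Module ℂ A] [AddCommGroup B] [Module ℂ B]
  [AddCommGroup C] [Module ℂ C] [AddCommGroup U] [Module ℂ U]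

/-- Data exhibiting a representation as a direct sum of two others. -/
structure Biprod (α : Representation ℂ G A) (β : Representation ℂ G B) (γ : Representation ℂ G C) where
  i₁ : B →ₗ[ℂ] A
  i₂ : C →ₗ[ℂ] A
  p₁ : A →ₗ[ℂ] B
  p₂ : A →ₗ[ℂ] C
  hi₁ : ∀ g, i₁ ∘ₗ β g = α g ∘ₗ i₁
  hi₂ : ∀ g, i₂ ∘ₗ γ g = α g ∘ₗ i₂
  hp₁ : ∀ g, p₁ ∘ₗ α g = β g ∘ₗ p₁
  hp₂ : ∀ g, p₂ ∘ₗ α g = γ g ∘ₗ p₂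
  h₁₁ : p₁ ∘ₗ i₁ = LinearMap.id
  h₂₂ : p₂ ∘ₗ i₂ = LinearMap.id
  h₁₂ : p₁ ∘ₗ i₂ = 0
  h₂₁ : p₂ ∘ₗ i₁ = 0
  htot : i₁ ∘ₗ p₁ + i₂ ∘ₗ p₂ = LinearMap.id

variable {α : Representation ℂ G A} {β : Representation ℂ G B} {γ : Representation ℂ G C}

/-- A direct sum decomposition from a bijective map. -/
def Biprod.ofBijective (f : B →ₗ[ℂ] A) (g : C →ₗ[ℂ] A) (hf : ∀ x, f ∘ₗ β x = α x ∘ₗ f)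
    (hg : ∀ x, g ∘ₗ γ x = α x ∘ₗ g) (h : Function.Bijective (f.coprod g)) : Biprod α β γ := by
  let e := LinearEquiv.ofBijective (f.coprod g) h
  have he : ∀ b c, e (b, c) = f b + g c := fun b c => rfl
  have hf' : ∀ x b, f (β x b) = α x (f b) := fun x b => LinearMap.congr_fun (hf x) b
  have hg' : ∀ x b, g (γ x b) = α x (g b) := fun x b => LinearMap.congr_fun (hg x) b
  have hp : ∀ x a, e.symm (α x a) = (β x (e.symm a).1, γ x (e.symm a).2) := by
    intro x a
    rw [LinearEquiv.symm_apply_eq, he, hf', hg', ← map_add, ← he, Prod.mk.eta, e.apply_symm_apply]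
  have h1 : ∀ b, e.symm (f b) = (b, 0) := fun b => by rw [LinearEquiv.symm_apply_eq, he]; simp
  have h2 : ∀ c, e.symm (g c) = (0, c) := fun b => by rw [LinearEquiv.symm_apply_eq, he]; simp
  exact
  { i₁ := f
    i₂ := g
    p₁ := LinearMap.fst ℂ B C ∘ₗ e.symm.toLinearMap
    p₂ := LinearMap.snd ℂ B C ∘ₗ e.symm.toLinearMap
    hi₁ := hf
    hi₂ := hg
    hp₁ := fun x => LinearMap.ext fun a => congrArg Prod.fst (hp x a)
    hp₂ := fun x => LinearMap.ext fun a => congrArg Prod.snd (hp x a)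
    h₁₁ := LinearMap.ext fun b => congrArg Prod.fst (h1 b)
    h₂₂ := LinearMap.ext fun b => congrArg Prod.snd (h2 b)
    h₁₂ := LinearMap.ext fun b => congrArg Prod.fst (h2 b)
    h₂₁ := LinearMap.ext fun b => congrArg Prod.snd (h1 b)
    htot := LinearMap.ext fun a => by
      change f (e.symm a).1 + g (e.symm a).2 = a
      rw [← he, Prod.mk.eta, e.apply_symm_apply] }

/-- Tensoring a direct sum on the right. -/
def Biprod.tprodRight (D : Biprod α β γ) (σ : Representation ℂ G U) :
    Biprod (α.tprod σ) (β.tprod σ) (γ.tprod σ) where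
  i₁ := TensorProduct.map D.i₁ LinearMap.id
  i₂ := TensorProduct.map D.i₂ LinearMap.id
  p₁ := TensorProduct.map D.p₁ LinearMap.id
  p₂ := TensorProduct.map D.p₂ LinearMap.id
  hi₁ g := by
    simp only [Representation.tprod_apply, ← TensorProduct.map_comp, D.hi₁, LinearMap.id_comp,
      LinearMap.comp_id]
  hi₂ g := by
    simp only [Representation.tprod_apply, ← TensorProduct.map_comp, D.hi₂, LinearMap.id_comp,
      LinearMap.comp_id]
  hp₁ g := by
    simp only [Representation.tprod_apply, ← TensorProduct.map_comp, D.hp₁, LinearMap.id_comp,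
      LinearMap.comp_id]
  hp₂ g := by
    simp only [Representation.tprod_apply, ← TensorProduct.map_comp, D.hp₂, LinearMap.id_comp,
      LinearMap.comp_id]
  h₁₁ := by rw [← TensorProduct.map_comp, D.h₁₁, LinearMap.id_comp, TensorProduct.map_id]
  h₂₂ := by rw [← TensorProduct.map_comp, D.h₂₂, LinearMap.id_comp, TensorProduct.map_id]
  h₁₂ := by rw [← TensorProduct.map_comp, D.h₁₂, TensorProduct.map_zero_left]
  h₂₁ := by rw [← TensorProduct.map_comp, D.h₂₁, TensorProduct.map_zero_left]
  htot := by
    rw [← TensorProduct.map_comp, ← TensorProduct.map_comp, LinearMap.id_comp,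
      ← TensorProduct.map_add_left, D.htot, TensorProduct.map_id]

/-- Tensoring a direct sum on the left. -/
def Biprod.tprodLeft (D : Biprod α β γ) (σ : Representation ℂ G U) :
    Biprod (σ.tprod α) (σ.tprod β) (σ.tprod γ) where
  i₁ := TensorProduct.map LinearMap.id D.i₁
  i₂ := TensorProduct.map LinearMap.id D.i₂
  p₁ := TensorProduct.map LinearMap.id D.p₁
  p₂ := TensorProduct.map LinearMap.id D.p₂
  hi₁ g := by
    simp only [Representation.tprod_apply, ← TensorProduct.map_comp, D.hi₁, LinearMap.id_comp,
      LinearMap.comp_id]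
  hi₂ g := by
    simp only [Representation.tprod_apply, ← TensorProduct.map_comp, D.hi₂, LinearMap.id_comp,
      LinearMap.comp_id]
  hp₁ g := by
    simp only [Representation.tprod_apply, ← TensorProduct.map_comp, D.hp₁, LinearMap.id_comp,
      LinearMap.comp_id]
  hp₂ g := by
    simp only [Representation.tprod_apply, ← TensorProduct.map_comp, D.hp₂, LinearMap.id_comp,
      LinearMap.comp_id]
  h₁₁ := by rw [← TensorProduct.map_comp, D.h₁₁, LinearMap.id_comp, TensorProduct.map_id]
  h₂₂ := by rw [← TensorProduct.map_comp, D.h₂₂, LinearMap.id_comp, TensorProduct.map_id]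
  h₁₂ := by rw [← TensorProduct.map_comp, D.h₁₂, TensorProduct.map_zero_right]
  h₂₁ := by rw [← TensorProduct.map_comp, D.h₂₁, TensorProduct.map_zero_right]
  htot := by
    rw [← TensorProduct.map_comp, ← TensorProduct.map_comp, LinearMap.id_comp,
      ← TensorProduct.map_add_right, D.htot, TensorProduct.map_id]

lemma comp_mem_equivariantMaps {f : A →ₗ[ℂ] B} {g : B →ₗ[ℂ] C} (hf : f ∈ equivariantMaps α β)
    (hg : g ∈ equivariantMaps β γ) : g ∘ₗ f ∈ equivariantMaps α γ := by
  intro x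
  rw [LinearMap.comp_assoc, hf x, ← LinearMap.comp_assoc, hg x, LinearMap.comp_assoc]

variable [FiniteDimensional ℂ B] [FiniteDimensional ℂ C] [FiniteDimensional ℂ U]

/-- Additivity of the dimension of the space of equivariant maps in the target. -/
lemma Biprod.homDim_right (D : Biprod α β γ) (σ : Representation ℂ G U) :
    homDim σ α = homDim σ β + homDim σ γ := by
  rw [homDim, homDim, homDim, ← Module.finrank_prod]
  refine LinearEquiv.finrank_eq
    { toFun := fun f => (⟨D.p₁ ∘ₗ f.1, comp_mem_equivariantMaps f.2 D.hp₁⟩,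
        ⟨D.p₂ ∘ₗ f.1, comp_mem_equivariantMaps f.2 D.hp₂⟩)
      map_add' := fun f g => by ext <;> simp
      map_smul' := fun c f => by ext <;> simp
      invFun := fun p => ⟨D.i₁ ∘ₗ p.1.1 + D.i₂ ∘ₗ p.2.1,
        add_mem (comp_mem_equivariantMaps p.1.2 D.hi₁) (comp_mem_equivariantMaps p.2.2 D.hi₂)⟩
      left_inv := fun f => Subtype.ext ?_
      right_inv := fun p => Prod.ext (Subtype.ext ?_) (Subtype.ext ?_) }
  · change D.i₁ ∘ₗ (D.p₁ ∘ₗ f.1) + D.i₂ ∘ₗ (D.p₂ ∘ₗ f.1) = f.1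
    rw [← LinearMap.comp_assoc, ← LinearMap.comp_assoc, ← LinearMap.add_comp, D.htot,
      LinearMap.id_comp]
  · change D.p₁ ∘ₗ (D.i₁ ∘ₗ p.1.1 + D.i₂ ∘ₗ p.2.1) = p.1.1
    rw [LinearMap.comp_add, ← LinearMap.comp_assoc, ← LinearMap.comp_assoc, D.h₁₁, D.h₁₂,
      LinearMap.zero_comp, add_zero, LinearMap.id_comp]
  · change D.p₂ ∘ₗ (D.i₁ ∘ₗ p.1.1 + D.i₂ ∘ₗ p.2.1) = p.2.1
    rw [LinearMap.comp_add, ← LinearMap.comp_assoc, ← LinearMap.comp_assoc, D.h₂₁, D.h₂₂,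
      LinearMap.zero_comp, zero_add, LinearMap.id_comp]

/-- Additivity of the dimension of the space of equivariant maps in the source. -/
lemma Biprod.homDim_left (D : Biprod α β γ) (σ : Representation ℂ G U) :
    homDim α σ = homDim β σ + homDim γ σ := by
  rw [homDim, homDim, homDim, ← Module.finrank_prod]
  refine LinearEquiv.finrank_eq
    { toFun := fun f => (⟨f.1 ∘ₗ D.i₁, comp_mem_equivariantMaps D.hi₁ f.2⟩,
        ⟨f.1 ∘ₗ D.i₂, comp_mem_equivariantMaps D.hi₂ f.2⟩)
      map_add' := fun f g => by ext <;> simp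
      map_smul' := fun c f => by ext <;> simp
      invFun := fun p => ⟨p.1.1 ∘ₗ D.p₁ + p.2.1 ∘ₗ D.p₂,
        add_mem (comp_mem_equivariantMaps D.hp₁ p.1.2) (comp_mem_equivariantMaps D.hp₂ p.2.2)⟩
      left_inv := fun f => Subtype.ext ?_
      right_inv := fun p => Prod.ext (Subtype.ext ?_) (Subtype.ext ?_) }
  · change (f.1 ∘ₗ D.i₁) ∘ₗ D.p₁ + (f.1 ∘ₗ D.i₂) ∘ₗ D.p₂ = f.1
    rw [LinearMap.comp_assoc, LinearMap.comp_assoc, ← LinearMap.comp_add, D.htot,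
      LinearMap.comp_id]
  · change (p.1.1 ∘ₗ D.p₁ + p.2.1 ∘ₗ D.p₂) ∘ₗ D.i₁ = p.1.1
    rw [LinearMap.add_comp, LinearMap.comp_assoc, LinearMap.comp_assoc, D.h₁₁, D.h₂₁,
      LinearMap.comp_zero, add_zero, LinearMap.comp_id]
  · change (p.1.1 ∘ₗ D.p₁ + p.2.1 ∘ₗ D.p₂) ∘ₗ D.i₂ = p.2.1
    rw [LinearMap.add_comp, LinearMap.comp_assoc, LinearMap.comp_assoc, D.h₁₂, D.h₂₂,
      LinearMap.comp_zero, zero_add, LinearMap.comp_id]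

end Biproducts

section Schur

variable {G : Type*} [Group G]
variable {A B : Type*} [AddCommGroup A] [Module ℂ A] [AddCommGroup B] [Module ℂ B]
  {α : Representation ℂ G A} {β : Representation ℂ G B}

/-- A nonzero equivariant map between irreducible representations is an isomorphism. -/
lemma bijective_of_equivariant (hα : IsIrreducibleRep α) (hβ : IsIrreducibleRep β) {f : A →ₗ[ℂ] B}
    (hf : f ∈ equivariantMaps α β) (h0 : f ≠ 0) : Function.Bijective f := by
  rw [mem_equivariantMaps] at hf
  constructor
  · rw [← LinearMap.ker_eq_bot]
    refine (hα.2 (LinearMap.ker f) fun g x hx => ?_).resolve_right fun h => h0 (LinearMap.ker_eq_top.1 h)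
    rw [LinearMap.mem_ker] at hx ⊢
    rw [hf, hx, map_zero]
  · rw [← LinearMap.range_eq_top]
    refine (hβ.2 (LinearMap.range f) fun g x hx => ?_).resolve_left
      fun h => h0 (LinearMap.range_eq_bot.1 h)
    obtain ⟨y, rfl⟩ := hx
    exact ⟨α g y, hf g y⟩

/-- The isomorphism given by a bijective equivariant map. -/
def equivOfBijective {f : A →ₗ[ℂ] B} (hf : f ∈ equivariantMaps α β) (h : Function.Bijective f) :
    α.Equiv β :=
  .mk (LinearEquiv.ofBijective f h) fun g => hf g

/-- Schur's lemma for non-isomorphic representations. -/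
lemma homDim_eq_zero (hα : IsIrreducibleRep α) (hβ : IsIrreducibleRep β)
    (h : IsEmpty (α.Equiv β)) : homDim α β = 0 := by
  have : equivariantMaps α β = ⊥ := by
    rw [Submodule.eq_bot_iff]
    intro f hf
    by_contra h0
    exact h.false (equivOfBijective hf (bijective_of_equivariant hα hβ hf h0))
  rw [homDim, this, finrank_bot]

/-- Schur's lemma. -/
lemma homDim_self [FiniteDimensional ℂ A] (hα : IsIrreducibleRep α) : homDim α α = 1 := by
  have := hα.1
  rw [homDim, finrank_eq_one_iff']
  refine ⟨⟨LinearMap.id, fun g => rfl⟩, fun h => one_ne_zero (α := Module.End ℂ A)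
    (congrArg Subtype.val h), fun f => ?_⟩
  obtain ⟨c, hc⟩ := Module.End.exists_eigenvalue f.1
  refine ⟨c, Subtype.ext ?_⟩
  have h1 : c • LinearMap.id - f.1 ∈ equivariantMaps α α :=
    sub_mem (Submodule.smul_mem _ _ fun g => rfl) f.2
  by_contra h2
  obtain ⟨x, hx, hx0⟩ := hc.exists_hasEigenvector
  have h3 := (bijective_of_equivariant hα hα h1 fun h => h2 (sub_eq_zero.1 h)).1
  refine hx0 (h3 ?_)
  rw [map_zero, LinearMap.sub_apply, Module.End.mem_eigenspace_iff.1 hx]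
  simp

end Schur

section Decomposition

variable {G : Type*} [Group G] {A : Type*} [AddCommGroup A] [Module ℂ A]
variable (π : Representation ℂ G A)

/-- The sum of two disjoint subrepresentations is their direct sum. -/
def biprodSup {π : Representation ℂ G A} (X Y : Subrepresentation π)
    (h : Disjoint X.toSubmodule Y.toSubmodule) :
    Biprod (X ⊔ Y).toRepresentation X.toRepresentation Y.toRepresentation :=
  Biprod.ofBijective
    (Submodule.inclusion (le_sup_left : X.toSubmodule ≤ X.toSubmodule ⊔ Y.toSubmodule))
    (Submodule.inclusion (le_sup_right : Y.toSubmodule ≤ X.toSubmodule ⊔ Y.toSubmodule))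
    (fun _ => rfl) (fun _ => rfl) (by
      constructor
      · rw [← LinearMap.ker_eq_bot, LinearMap.ker_eq_bot']
        rintro ⟨x, y⟩ hxy
        have h1 : (x : A) + y = 0 := congrArg Subtype.val hxy
        have h2 : (x : A) ∈ Y.toSubmodule := by
          rw [eq_neg_of_add_eq_zero_left h1]
          exact neg_mem y.2
        have h3 := Submodule.disjoint_def.1 h x x.2 h2
        rw [h3, zero_add] at h1
        exact Prod.ext (Subtype.ext h3) (Subtype.ext h1)
      · rintro ⟨z, hz⟩
        obtain ⟨x, hx, y, hy, rfl⟩ := Submodule.mem_sup.1 hz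
        exact ⟨(⟨x, hx⟩, ⟨y, hy⟩), rfl⟩)

/-- Additive isomorphism-invariant functions on finite-dimensional subrepresentations. -/
structure IsAdditive {π : Representation ℂ G A} (φ : Subrepresentation π → ℤ) : Prop where
  sup : ∀ X Y : Subrepresentation π, FiniteDimensional ℂ X.toSubmodule →
    FiniteDimensional ℂ Y.toSubmodule → Disjoint X.toSubmodule Y.toSubmodule →
    φ (X ⊔ Y) = φ X + φ Y
  congr : ∀ X Y : Subrepresentation π, X.toRepresentation.Equiv Y.toRepresentation → φ X = φ Y

/-- Finite-dimensional irreducible subrepresentations. -/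
def IrrSub : Type _ :=
  {E : Subrepresentation π // FiniteDimensional ℂ E.toSubmodule ∧ IsIrreducibleRep E.toRepresentation}

instance irrSetoid : Setoid (IrrSub π) where
  r E F := Nonempty (E.1.toRepresentation.Equiv F.1.toRepresentation)
  iseqv := ⟨fun _ => ⟨.refl _⟩, fun ⟨e⟩ => ⟨e.symm⟩, fun ⟨e⟩ ⟨f⟩ => ⟨e.trans f⟩⟩

variable {π}

lemma exists_irreducible_le (X : Subrepresentation π) [FiniteDimensional ℂ X.toSubmodule]
    (hX : X.toSubmodule ≠ ⊥) : ∃ E : Subrepresentation π, E.toSubmodule ≤ X.toSubmodule ∧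
      IsIrreducibleRep E.toRepresentation := by
  classical
  have hex : ∃ d : ℕ, ∃ E : Subrepresentation π, E.toSubmodule ≤ X.toSubmodule ∧
      E.toSubmodule ≠ ⊥ ∧ Module.finrank ℂ E.toSubmodule = d := ⟨_, X, le_rfl, hX, rfl⟩
  obtain ⟨E, hEX, hE0, hE⟩ := Nat.find_spec hex
  have hfin : FiniteDimensional ℂ E.toSubmodule := Submodule.finiteDimensional_of_le hEX
  refine ⟨E, hEX, (Submodule.nontrivial_iff_ne_bot).2 hE0, fun U hU => ?_⟩
  rw [or_iff_not_imp_left]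
  intro hU0
  let F : Subrepresentation π :=
    { toSubmodule := U.map E.toSubmodule.subtype
      apply_mem_toSubmodule := by
        rintro g _ ⟨x, hx, rfl⟩
        exact ⟨_, hU g x hx, rfl⟩ }
  have hFE : F.toSubmodule ≤ E.toSubmodule := Submodule.map_subtype_le _ _
  have hF0 : F.toSubmodule ≠ ⊥ := fun h =>
    hU0 (Submodule.map_injective_of_injective (Submodule.injective_subtype _)
      (h.trans (Submodule.map_bot _).symm))
  have h1 := Nat.find_min' hex ⟨F, hFE.trans hEX, hF0, rfl⟩
  rw [← hE] at h1
  have h2 := Submodule.eq_of_le_of_finrank_le hFE h1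
  rw [eq_top_iff]
  rintro x -
  obtain ⟨y, hy, hyx⟩ := (h2.symm.le x.2 : (x : A) ∈ F.toSubmodule)
  rwa [← Subtype.ext (hyx : (y : A) = x)]

lemma IsAdditive.bot {φ : Subrepresentation π → ℤ} (hφ : IsAdditive φ) (X : Subrepresentation π)
    (hX : X.toSubmodule = ⊥) : φ X = 0 := by
  have h1 : FiniteDimensional ℂ X.toSubmodule := by rw [hX]; infer_instance
  have h2 := hφ.sup X X h1 h1 (by rw [hX]; exact disjoint_bot_left)
  rw [sup_idem] at h2
  linarith

/-- Decomposition into irreducible subrepresentations. -/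
lemma exists_multiplicities
    (hss : ∀ E : Subrepresentation π, FiniteDimensional ℂ E.toSubmodule →
      ∃ Y : Subrepresentation π, IsCompl E.toSubmodule Y.toSubmodule)
    (X : Subrepresentation π) [hX : FiniteDimensional ℂ X.toSubmodule] :
    ∃ m : Quotient (irrSetoid π) →₀ ℕ, ∀ φ : Subrepresentation π → ℤ, IsAdditive φ →
      φ X = m.sum fun q k => k * φ q.out.1 := by
  induction h : Module.finrank ℂ X.toSubmodule using Nat.strong_induction_on generalizing X with
  | _ d ih =>
  by_cases h0 : X.toSubmodule = ⊥
  · exact ⟨0, fun φ hφ => by rw [hφ.bot X h0, Finsupp.sum_zero_index]⟩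
  obtain ⟨E, hEX, hE⟩ := exists_irreducible_le X h0
  have hfin : FiniteDimensional ℂ E.toSubmodule := Submodule.finiteDimensional_of_le hEX
  obtain ⟨Z, hZ⟩ := hss E hfin
  have hYX : (Z ⊓ X).toSubmodule ≤ X.toSubmodule := inf_le_right
  have hYfin : FiniteDimensional ℂ (Z ⊓ X).toSubmodule := Submodule.finiteDimensional_of_le hYX
  have hdis : Disjoint E.toSubmodule (Z ⊓ X).toSubmodule := hZ.disjoint.mono_right inf_le_left
  have hsup : E ⊔ (Z ⊓ X) = X := by
    have h1 : E.toSubmodule ⊔ (Z.toSubmodule ⊓ X.toSubmodule) = X.toSubmodule := by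
      rw [← sup_inf_assoc_of_le _ hEX, hZ.codisjoint.eq_top, top_inf_eq]
    exact Subrepresentation.toSubmodule_injective h1
  have hlt : Module.finrank ℂ (Z ⊓ X).toSubmodule < d := by
    rw [← h]
    refine Submodule.finrank_lt_finrank_of_lt (lt_of_le_of_ne hYX fun h1 => ?_)
    rw [h1] at hdis
    exact (Submodule.nontrivial_iff_ne_bot.1 hE.1) (hdis.eq_bot_of_le hEX)
  obtain ⟨m, hm⟩ := ih _ hlt (Z ⊓ X) rfl
  let e : IrrSub π := ⟨E, hfin, hE⟩
  refine ⟨Finsupp.single ⟦e⟧ 1 + m, fun φ hφ => ?_⟩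
  rw [Finsupp.sum_add_index' (by simp) (by intros; push_cast; ring), ← hm φ hφ,
    Finsupp.sum_single_index (by simp), Nat.cast_one, one_mul]
  conv_lhs => rw [← hsup]
  rw [hφ.sup _ _ hfin hYfin hdis]
  obtain ⟨i⟩ : Nonempty ((Quotient.out (⟦e⟧ : Quotient (irrSetoid π))).1.toRepresentation.Equiv
     e.1.toRepresentation) := Quotient.exact (Quotient.out_eq (⟦e⟧ : Quotient (irrSetoid π)))
  rw [hφ.congr _ _ i]

lemma isAdditive_homDim_left {U : Type*} [AddCommGroup U] [Module ℂ U] [FiniteDimensional ℂ U]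
    (σ : Representation ℂ G U) :
    IsAdditive fun X : Subrepresentation π => (homDim X.toRepresentation σ : ℤ) where
  sup X Y _ _ h := by rw [(biprodSup X Y h).homDim_left, Nat.cast_add]
  congr X Y e := by rw [homDim_congr e (.refl σ)]

lemma isAdditive_homDim_right {U : Type*} [AddCommGroup U] [Module ℂ U] [FiniteDimensional ℂ U]
    (σ : Representation ℂ G U) :
    IsAdditive fun X : Subrepresentation π => (homDim σ X.toRepresentation : ℤ) where
  sup X Y _ _ h := by rw [(biprodSup X Y h).homDim_right, Nat.cast_add]
  congr X Y e := by rw [homDim_congr (.refl σ) e]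

lemma isAdditive_homDim_tprod_left {U W : Type*} [AddCommGroup U] [Module ℂ U]
    [FiniteDimensional ℂ U] [AddCommGroup W] [Module ℂ W] [FiniteDimensional ℂ W]
    (σ : Representation ℂ G U) (τ : Representation ℂ G W) :
    IsAdditive fun X : Subrepresentation π => (homDim σ (X.toRepresentation.tprod τ) : ℤ) where
  sup X Y _ _ h := by rw [((biprodSup X Y h).tprodRight τ).homDim_right, Nat.cast_add]
  congr X Y e := by rw [homDim_congr (.refl σ) (tprodCongr e (.refl τ))]

lemma isAdditive_homDim_tprod_right {U W : Type*} [AddCommGroup U] [Module ℂ U]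
    [FiniteDimensional ℂ U] [AddCommGroup W] [Module ℂ W] [FiniteDimensional ℂ W]
    (σ : Representation ℂ G U) (τ : Representation ℂ G W) :
    IsAdditive fun X : Subrepresentation π => (homDim σ (τ.tprod X.toRepresentation) : ℤ) where
  sup X Y _ _ h := by rw [((biprodSup X Y h).tprodLeft τ).homDim_right, Nat.cast_add]
  congr X Y e := by rw [homDim_congr (.refl σ) (tprodCongr (.refl τ) e)]

/-- A virtual representation of norm one that contains an irreducible representation is equal to
it. -/
theorem sum_eq_of_norm_one
    (hss : ∀ E : Subrepresentation π, FiniteDimensional ℂ E.toSubmodule →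
      ∃ Y : Subrepresentation π, IsCompl E.toSubmodule Y.toSubmodule)
    {κ : Type*} (I : Finset κ) (x : κ → ℤ) (S : κ → Subrepresentation π)
    (hS : ∀ a, FiniteDimensional ℂ (S a).toSubmodule)
    (h1 : ∑ a ∈ I, ∑ b ∈ I, x a * x b * homDim (S a).toRepresentation (S b).toRepresentation = 1)
    (E : Subrepresentation π) [hE : FiniteDimensional ℂ E.toSubmodule]
    (hirr : IsIrreducibleRep E.toRepresentation)
    (h2 : 1 ≤ ∑ a ∈ I, x a * homDim E.toRepresentation (S a).toRepresentation)
    {φ : Subrepresentation π → ℤ} (hφ : IsAdditive φ) :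
    ∑ a ∈ I, x a * φ (S a) = φ E := by
  classical
  choose m hm using fun a => exists_multiplicities hss (S a)
  let e : Quotient (irrSetoid π) := ⟦⟨E, hE, hirr⟩⟧
  obtain ⟨i⟩ : Nonempty (e.out.1.toRepresentation.Equiv E.toRepresentation) :=
    Quotient.exact (Quotient.out_eq e)
  have hfd : ∀ q : Quotient (irrSetoid π), FiniteDimensional ℂ q.out.1.toSubmodule :=
    fun q => q.out.2.1
  let T : Finset (Quotient (irrSetoid π)) := insert e (I.biUnion fun a => (m a).support)
  have hmT : ∀ a ∈ I, ∀ ψ : Subrepresentation π → ℤ, IsAdditive ψ →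
      ψ (S a) = ∑ q ∈ T, (m a q : ℤ) * ψ q.out.1 := by
    intro a ha ψ hψ
    rw [hm a ψ hψ, Finsupp.sum]
    refine Finset.sum_subset (fun q hq => ?_) fun q _ hq => ?_
    · exact Finset.mem_insert_of_mem (Finset.mem_biUnion.2 ⟨a, ha, hq⟩)
    · rw [Finsupp.notMem_support_iff.1 hq, Nat.cast_zero, zero_mul]
  have hδ : ∀ q q' : Quotient (irrSetoid π), homDim q.out.1.toRepresentation
      q'.out.1.toRepresentation = if q = q' then 1 else 0 := by
    intro q q'
    split_ifs with h
    · subst h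
      have := hfd q
      exact homDim_self q.out.2.2
    · refine homDim_eq_zero q.out.2.2 q'.out.2.2 ⟨fun f => h ?_⟩
      rw [← Quotient.out_eq q, ← Quotient.out_eq q']
      exact Quotient.sound ⟨f⟩
  have hmq : ∀ a ∈ I, ∀ q ∈ T, (homDim q.out.1.toRepresentation (S a).toRepresentation : ℤ) =
      m a q := by
    intro a ha q hq
    have := hfd q
    rw [hmT a ha _ (isAdditive_homDim_right q.out.1.toRepresentation)]
    simp only [hδ, Nat.cast_ite, Nat.cast_one, Nat.cast_zero, mul_ite, mul_one, mul_zero]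
    rw [Finset.sum_ite_eq, if_pos hq]
  have hmm : ∀ a ∈ I, ∀ b ∈ I, (homDim (S a).toRepresentation (S b).toRepresentation : ℤ) =
      ∑ q ∈ T, (m a q : ℤ) * m b q := by
    intro a ha b hb
    have := hS b
    rw [hmT a ha _ (isAdditive_homDim_left (S b).toRepresentation)]
    exact Finset.sum_congr rfl fun q hq => by rw [hmq b hb q hq]
  let c : Quotient (irrSetoid π) → ℤ := fun q => ∑ a ∈ I, x a * m a q
  have hc : ∑ q ∈ T, c q ^ 2 = 1 := by
    rw [← h1]
    simp only [c, sq, Finset.sum_mul_sum]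
    rw [Finset.sum_comm]
    refine Finset.sum_congr rfl fun a ha => ?_
    rw [Finset.sum_comm]
    refine Finset.sum_congr rfl fun b hb => ?_
    rw [hmm a ha b hb, Finset.mul_sum]
    exact Finset.sum_congr rfl fun q _ => by ring
  have heT : e ∈ T := Finset.mem_insert_self _ _
  have hce : 1 ≤ c e := by
    refine h2.trans_eq (Finset.sum_congr rfl fun a ha => ?_)
    rw [← hmq a ha e heT, homDim_congr i (.refl _)]
  have hsplit := Finset.add_sum_erase T (fun q => c q ^ 2) heT
  have hnn : ∀ q ∈ T.erase e, 0 ≤ c q ^ 2 := fun q _ => sq_nonneg _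
  have hnn' := Finset.sum_nonneg hnn
  have hce1 : c e = 1 := by nlinarith
  have hrest : ∀ q ∈ T, q ≠ e → c q = 0 := by
    intro q hq hqe
    have h3 : ∑ q ∈ T.erase e, c q ^ 2 = 0 := by
      rw [hc] at hsplit
      simp only [hce1] at hsplit
      linarith
    exact pow_eq_zero_iff two_ne_zero |>.1
      ((Finset.sum_eq_zero_iff_of_nonneg hnn).1 h3 q (Finset.mem_erase.2 ⟨hqe, hq⟩))
  calc ∑ a ∈ I, x a * φ (S a) = ∑ a ∈ I, ∑ q ∈ T, x a * ((m a q : ℤ) * φ q.out.1) :=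
        Finset.sum_congr rfl fun a ha => by rw [hmT a ha φ hφ, Finset.mul_sum]
    _ = ∑ q ∈ T, c q * φ q.out.1 := by
        rw [Finset.sum_comm]
        refine Finset.sum_congr rfl fun q _ => ?_
        rw [Finset.sum_mul]
        exact Finset.sum_congr rfl fun a _ => by ring
    _ = c e * φ e.out.1 := Finset.sum_eq_single e (fun q hq hqe => by rw [hrest q hq hqe, zero_mul])
        fun h => absurd heT h
    _ = φ E := by rw [hce1, one_mul, hφ.congr _ _ i]

end Decomposition

section LeadingMinors

variable {n : ℕ} {R S : Type*} [CommRing R] [CommRing S]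

/-- The leading principal minor of size `k`. -/
def lm (k : ℕ) (A : Matrix (Fin n) (Fin n) R) : R :=
  (A.submatrix (Subtype.val : {j : Fin n // j.1 < k} → Fin n) Subtype.val).det

lemma lm_map (f : R →+* S) (k : ℕ) (A : Matrix (Fin n) (Fin n) R) : lm k (A.map f) = f (lm k A) := by
  rw [lm, lm, RingHom.map_det]; rfl

lemma lm_transpose (k : ℕ) (A : Matrix (Fin n) (Fin n) R) : lm k Aᵀ = lm k A := by
  rw [lm, lm, ← Matrix.transpose_submatrix, Matrix.det_transpose]

lemma prod_lt_eq (k : ℕ) (f : Fin n → R) :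
    ∏ i : {j : Fin n // j.1 < k}, f i = ∏ i with i.1 < k, f i := by
  rw [Finset.prod_subtype (p := fun j : Fin n => j.1 < k)]
  simp

lemma lm_lower {L : Matrix (Fin n) (Fin n) R} (hL : ∀ i j, i < j → L i j = 0) (k : ℕ) :
    lm k L = ∏ i with i.1 < k, L i i := by
  rw [lm, Matrix.det_of_isLowerTriangular, ← prod_lt_eq]
  · rfl
  · intro i j hij
    exact hL _ _ hij

lemma lm_lower_mul {L : Matrix (Fin n) (Fin n) R} (hL : ∀ i j, i < j → L i j = 0) (k : ℕ)
    (A : Matrix (Fin n) (Fin n) R) : lm k (L * A) = lm k L * lm k A := by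
  rw [lm, lm, lm, ← Matrix.det_mul]
  congr 1
  ext i j
  rw [Matrix.submatrix_apply, Matrix.mul_apply, Matrix.mul_apply]
  simp only [Matrix.submatrix_apply]
  symm
  rw [Finset.sum_subtype (p := fun j : Fin n => j.1 < k) (Finset.univ.filter fun j => j.1 < k) (by simp)
    (fun x => L i x * A x j) |>.symm, Finset.sum_filter]
  refine Finset.sum_congr rfl fun x _ => ?_
  split_ifs with h
  · rfl
  · rw [hL _ _ (show i.1 < x from Fin.lt_def.2 (lt_of_lt_of_le i.2 (not_lt.1 h))), zero_mul]

lemma lm_upper {U : Matrix (Fin n) (Fin n) R} (hU : ∀ i j, j < i → U i j = 0) (k : ℕ) :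
    lm k U = ∏ i with i.1 < k, U i i := by
  rw [← lm_transpose, lm_lower (L := Uᵀ) (fun i j h => hU j i h)]; rfl

lemma lm_top (A : Matrix (Fin n) (Fin n) R) : lm n A = A.det := by
  rw [lm, ← Matrix.det_submatrix_equiv_self (Equiv.subtypeUnivEquiv fun j : Fin n => j.2) A]; rfl

/-- Lower unipotent matrices. -/
def IsLowerUni {N : ℕ} (A : Matrix (Fin N) (Fin N) ℂ) : Prop :=
  (∀ i, A i i = 1) ∧ ∀ i j : Fin N, i < j → A i j = 0

lemma IsLowerUni.lm {L : Matrix (Fin n) (Fin n) ℂ} (hL : IsLowerUni L) (k : ℕ) : lm k L = 1 := by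
  rw [lm_lower hL.2]
  exact Finset.prod_eq_one fun i _ => hL.1 i

/-- Gaussian elimination. -/
lemma exists_lower_mul_upper (A : Matrix (Fin n) (Fin n) ℂ) (hA : ∀ k < n, lm k A ≠ 0) :
    ∃ L : Matrix (Fin n) (Fin n) ℂ, IsLowerUni L ∧ ∀ i j, j < i → (L * A) i j = 0 := by
  have key : ∀ i : Fin n, ∃ x : Fin n → ℂ, x i = 1 ∧ (∀ j, i < j → x j = 0) ∧
      ∀ j, j < i → (x ᵥ* A) j = 0 := by
    intro i
    set B := A.submatrix (Subtype.val : {j : Fin n // j.1 < i.1} → Fin n) Subtype.val with hB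
    have hdet : IsUnit B.det := isUnit_iff_ne_zero.2 (hA i i.2)
    let y : {j : Fin n // j.1 < i.1} → ℂ := -((fun j => A i j.1) ᵥ* B⁻¹)
    have hy : y ᵥ* B = -(fun j => A i j.1) := by
      rw [Matrix.neg_vecMul, Matrix.vecMul_vecMul, Matrix.nonsing_inv_mul _ hdet, Matrix.vecMul_one]
    let x : Fin n → ℂ := fun j => if h : j.1 < i.1 then y ⟨j, h⟩ else if j = i then 1 else 0
    have hx1 : ∀ j : {j : Fin n // j.1 < i.1}, x j = y j := fun j => dif_pos j.2
    refine ⟨x, by simp [x], fun j hj => ?_, fun j hj => ?_⟩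
    · simp [x, not_lt.2 (le_of_lt hj), (ne_of_lt hj).symm]
    · have h1 := congrFun hy ⟨j, hj⟩
      simp only [Matrix.vecMul, dotProduct, Pi.neg_apply] at h1 ⊢
      rw [← Finset.sum_filter_add_sum_filter_not _ fun l : Fin n => l.1 < i.1,
        Finset.sum_subtype (p := fun l : Fin n => l.1 < i.1) _ (by simp) (fun l => x l * A l j)]
      simp only [hx1]
      have h2 : ∑ l : Fin n with ¬ l.1 < i.1, x l * A l j = A i j := by
        rw [Finset.sum_eq_single i]
        · simp [x]
        · intro l hl hli
          have : ¬ l.1 < i.1 := (Finset.mem_filter.1 hl).2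
          have hx0 : x l = 0 := by
            simp only [x]
            rw [dif_neg this, if_neg hli]
          rw [hx0, zero_mul]
        · simp
      rw [h2]
      have h3 : ∑ l : {l : Fin n // l.1 < i.1}, y l * A l j = -A i j := h1
      rw [h3, neg_add_cancel]
  choose x hx1 hx2 hx3 using key
  exact ⟨Matrix.of x, ⟨hx1, hx2⟩, fun i j hij => hx3 i j hij⟩

end LeadingMinors

section SpElements

variable {n : ℕ}

abbrev Sp (n : ℕ) := symplecticGroup (Fin n) ℂ
abbrev Mat (n : ℕ) := Matrix (Fin n) (Fin n) ℂ

lemma fromBlocks_mem_symplectic_iff {A B C D : Mat n} :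
    fromBlocks A B C D ∈ symplecticGroup (Fin n) ℂ ↔
      Cᵀ * A = Aᵀ * C ∧ Aᵀ * D - Cᵀ * B = 1 ∧ Dᵀ * B = Bᵀ * D := by
  rw [SymplecticGroup.mem_iff', J, fromBlocks_transpose, fromBlocks_multiply, fromBlocks_multiply,
    fromBlocks_inj]
  simp only [mul_zero, mul_one, zero_add, mul_neg, add_zero, neg_mul]
  constructor
  · rintro ⟨h1, h2, h3, h4⟩
    refine ⟨by rwa [← sub_eq_add_neg, sub_eq_zero] at h1, ?_, by rwa [← sub_eq_add_neg, sub_eq_zero] at h4⟩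
    rw [← neg_inj, ← h2]; abel
  · rintro ⟨h1, h2, h3⟩
    refine ⟨by rw [h1]; abel, by rw [← h2]; abel, ?_, by rw [h3]; abel⟩
    have := congrArg transpose h2
    simp only [transpose_sub, transpose_mul, transpose_transpose, transpose_one] at this
    rw [← this]; abel

/-- The blocks of a symplectic matrix. -/
abbrev topLeft (g : Sp n) : Mat n := g.1.toBlocks₁₁
abbrev botLeft (g : Sp n) : Mat n := g.1.toBlocks₂₁

lemma symm_of_symplectic (g : Sp n) : (botLeft g)ᵀ * topLeft g = (topLeft g)ᵀ * botLeft g := by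
  have h := g.2
  rw [← fromBlocks_toBlocks g.1] at h
  exact (fromBlocks_mem_symplectic_iff.1 h).1

/-- The lower Siegel radical. -/
def siegelLow (Y : Mat n) : Sp n :=
  ⟨fromBlocks 1 0 (Y + Yᵀ) 1, fromBlocks_mem_symplectic_iff.2 (by simp [add_comm])⟩

/-- The upper Siegel radical. -/
def siegelUp (Y : Mat n) : Sp n :=
  ⟨fromBlocks 1 (Y + Yᵀ) 0 1, fromBlocks_mem_symplectic_iff.2 (by simp [add_comm])⟩

/-- The Siegel Levi subgroup. -/
def levi : GL (Fin n) ℂ →* Sp n where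
  toFun a := ⟨fromBlocks (a : Mat n) 0 0 ((a⁻¹ : GL (Fin n) ℂ) : Mat n)ᵀ,
    fromBlocks_mem_symplectic_iff.2 ⟨by simp, by
      rw [← transpose_mul, ← Units.val_mul, inv_mul_cancel]; simp, by simp⟩⟩
  map_one' := by ext1; simp
  map_mul' a b := by
    ext1
    simp [fromBlocks_multiply, ← transpose_mul]

lemma coe_levi (a : GL (Fin n) ℂ) :
    (levi a).1 = fromBlocks (a : Mat n) 0 0 ((a⁻¹ : GL (Fin n) ℂ) : Mat n)ᵀ := rfl

lemma coe_siegelLow (Y : Mat n) : (siegelLow Y).1 = fromBlocks 1 0 (Y + Yᵀ) 1 := rfl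

lemma siegelLow_add (X Y : Mat n) : siegelLow (X + Y) = siegelLow X * siegelLow Y := by
  ext1
  simp only [Submonoid.coe_mul, coe_siegelLow, fromBlocks_multiply, transpose_add]
  simp
  abel

lemma levi_mul_siegelLow (a : GL (Fin n) ℂ) (Y : Mat n) :
    levi a * siegelLow Y = siegelLow (((a⁻¹ : GL (Fin n) ℂ) : Mat n)ᵀ * Y * ((a⁻¹ : GL (Fin n) ℂ) : Mat n)) * levi a := by
  ext1
  simp only [Submonoid.coe_mul, coe_siegelLow, coe_levi, fromBlocks_multiply]
  have h : ((a⁻¹ : GL (Fin n) ℂ) : Mat n) * (a : Mat n) = 1 := by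
    rw [← Units.val_mul, inv_mul_cancel, Units.val_one]
  simp [mul_add, add_mul, mul_assoc, h, -coe_units_inv]

/-- Diagonal elements of the general linear group. -/
def diagGL (t : Fin n → ℂˣ) : GL (Fin n) ℂ where
  val := diagonal fun i => (t i : ℂ)
  inv := diagonal fun i => ((t i)⁻¹ : ℂˣ)
  val_inv := by simp
  inv_val := by simp

lemma coe_diagGL (t : Fin n → ℂˣ) : (diagGL t : Mat n) = diagonal fun i => (t i : ℂ) := rfl
lemma coe_diagGL_inv (t : Fin n → ℂˣ) :
    ((diagGL t)⁻¹ : GL (Fin n) ℂ).1 = diagonal fun i => ((t i)⁻¹ : ℂˣ).1 := rfl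

/-- The big cell. -/
lemma exists_bigCell (g : Sp n) (h : ∀ k ≤ n, lm k (topLeft g) ≠ 0) :
    ∃ (Y : Mat n) (L : GL (Fin n) ℂ) (t : Fin n → ℂˣ) (N : Sp n), IsLowerUni (L : Mat n) ∧
      botLeft N = 0 ∧ IsUpperUni (topLeft N) ∧
      levi L * siegelLow Y * g = levi (diagGL t) * N ∧
      ∀ k, ∏ i with i.1 < k, (t i : ℂ) = lm k (topLeft g) := by
  obtain ⟨L, hL, hLA⟩ := exists_lower_mul_upper (topLeft g) fun k hk => h k hk.le
  have hdetL : IsUnit L.det := by rw [← lm_top, hL.lm]; exact isUnit_one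
  have hdetA : IsUnit (topLeft g).det := by
    rw [← lm_top]; exact isUnit_iff_ne_zero.2 (h n le_rfl)
  set U := L * topLeft g with hU
  have hlm : ∀ k, ∏ i with i.1 < k, U i i = lm k (topLeft g) := fun k => by
    rw [← lm_upper hLA, hU, lm_lower_mul hL.2, hL.lm, one_mul]
  have hne : ∀ i, U i i ≠ 0 := fun i => by
    have := hlm n
    rw [lm_top] at this
    have h0 : ∏ i with i.1 < n, U i i ≠ 0 := this ▸ hdetA.ne_zero
    exact Finset.prod_ne_zero_iff.1 h0 i (by simp)
  let t : Fin n → ℂˣ := fun i => Units.mk0 (U i i) (hne i)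
  let L' : GL (Fin n) ℂ := Matrix.GeneralLinearGroup.mk'' L hdetL
  set X := botLeft g * (topLeft g)⁻¹ with hX
  have hXs : Xᵀ = X := by
    have h1 := symm_of_symplectic g
    have h2 : IsUnit (topLeft g)ᵀ.det := by rwa [det_transpose]
    rw [hX, transpose_mul, transpose_nonsing_inv]
    calc (topLeft g)ᵀ⁻¹ * (botLeft g)ᵀ
        = (topLeft g)ᵀ⁻¹ * ((botLeft g)ᵀ * topLeft g) * (topLeft g)⁻¹ := by
          rw [mul_assoc, mul_assoc, mul_nonsing_inv _ hdetA, mul_one]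
      _ = botLeft g * (topLeft g)⁻¹ := by
          rw [h1, ← mul_assoc, nonsing_inv_mul _ h2, one_mul]
  let Y : Mat n := -((1 / 2 : ℂ) • X)
  have hY : Y + Yᵀ = -X := by
    simp only [Y, transpose_neg, transpose_smul, hXs, ← neg_add, ← add_smul]
    norm_num
  have hXA : X * topLeft g = botLeft g := by rw [hX, mul_assoc, nonsing_inv_mul _ hdetA, mul_one]
  have hN : ((levi (diagGL t))⁻¹ * (levi L' * siegelLow Y * g)).1 =
      fromBlocks (diagonal (fun i => (t i : ℂ)⁻¹) * U) ((levi (diagGL t))⁻¹ * (levi L' * siegelLow Y * g)).1.toBlocks₁₂ 0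
      ((levi (diagGL t))⁻¹ * (levi L' * siegelLow Y * g)).1.toBlocks₂₂ := by
    conv_lhs => rw [← fromBlocks_toBlocks ((levi (diagGL t))⁻¹ * (levi L' * siegelLow Y * g)).1]
    have hg := (fromBlocks_toBlocks g.1).symm
    rw [← map_inv, fromBlocks_inj]
    refine ⟨?_, rfl, ?_, rfl⟩
    all_goals
      simp only [Submonoid.coe_mul, coe_levi, coe_siegelLow, hY]
      rw [hg]
      simp only [fromBlocks_multiply, toBlocks_fromBlocks₁₁, toBlocks_fromBlocks₂₁, mul_zero,
        zero_mul, add_zero, zero_add, mul_one]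
    · rw [coe_diagGL_inv, hU]
      simp [L', t]
    · have hXA' : X * g.1.toBlocks₁₁ = g.1.toBlocks₂₁ := hXA
      rw [← hXA', mul_assoc _ (-X), ← mul_add, neg_mul, neg_add_cancel, mul_zero, mul_zero]
  refine ⟨Y, L', t, (levi (diagGL t))⁻¹ * (levi L' * siegelLow Y * g), hL, ?_, ?_, ?_, hlm⟩
  · rw [botLeft, hN, toBlocks_fromBlocks₂₁]
  · rw [topLeft, hN, toBlocks_fromBlocks₁₁]
    refine ⟨fun i => ?_, fun i j hij => ?_⟩
    · rw [diagonal_mul]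
      exact inv_mul_cancel₀ (hne i)
    · rw [diagonal_mul, hLA i j hij, mul_zero]
  · rw [mul_inv_cancel_left]

end SpElements

section GenericPoints

variable {n : ℕ}

lemma exists_eval_ne_zero {κ σ : Type*} (s : Finset κ) (p : κ → MvPolynomial σ ℂ)
    (hp : ∀ i ∈ s, p i ≠ 0) : ∃ x : σ → ℂ, ∀ i ∈ s, MvPolynomial.eval x (p i) ≠ 0 := by
  by_contra! hcon
  have h0 : ∏ i ∈ s, p i = 0 := by
    refine MvPolynomial.funext fun x => ?_
    obtain ⟨i, hi, hx⟩ := hcon x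
    rw [map_prod, map_zero]
    exact Finset.prod_eq_zero hi hx
  obtain ⟨i, hi, h⟩ := Finset.prod_eq_zero_iff.1 h0
  exact hp i hi h

/-- A Lagrangian can be moved off a given one by the upper Siegel radical. -/
lemma exists_det_add_ne_zero (A C : Mat n) (hs : Cᵀ * A = Aᵀ * C)
    (hk : ∀ x, A *ᵥ x = 0 → C *ᵥ x = 0 → x = 0) :
    ∃ Y : Mat n, (A + (Y + Yᵀ) * C).det ≠ 0 := by
  suffices h : ∀ (d : ℕ) (Y : Mat n),
      Module.finrank ℂ (LinearMap.ker (A + (Y + Yᵀ) * C).mulVecLin) ≤ d →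
      ∃ Y : Mat n, (A + (Y + Yᵀ) * C).det ≠ 0 from h _ 0 le_rfl
  intro d
  induction d with
  | zero =>
    intro Y hY
    refine ⟨Y, fun h0 => ?_⟩
    obtain ⟨x, hx, hx0⟩ := Matrix.exists_mulVec_eq_zero_iff.2 h0
    have := Submodule.finrank_eq_zero.1 (Nat.le_zero.1 hY)
    exact hx ((Submodule.eq_bot_iff _).1 this x hx0)
  | succ d ih =>
    intro Y hY
    by_cases h0 : (A + (Y + Yᵀ) * C).det = 0
    swap
    · exact ⟨Y, h0⟩
    set M := A + (Y + Yᵀ) * C with hM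
    obtain ⟨x, hx, hx0⟩ := Matrix.exists_mulVec_eq_zero_iff.2 h0
    have hCx : C *ᵥ x ≠ 0 := by
      intro hC
      refine hx (hk x ?_ hC)
      rwa [hM, add_mulVec, ← mulVec_mulVec, hC, mulVec_zero, add_zero] at hx0
    obtain ⟨i, hi⟩ := Function.ne_iff.1 hCx
    let y : Fin n → ℂ := Pi.single i 1
    have hy : y ⬝ᵥ (C *ᵥ x) ≠ 0 := by simpa [y] using hi
    have hMC : Cᵀ * M = Mᵀ * C := by
      simp only [hM, mul_add, add_mul, transpose_add, transpose_mul, transpose_transpose, hs,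
        mul_assoc]
      abel
    have hM' : A + ((Y + (1 / 2 : ℂ) • vecMulVec y y) + (Y + (1 / 2 : ℂ) • vecMulVec y y)ᵀ) * C =
        M + vecMulVec y y * C := by
      have : (vecMulVec y y)ᵀ = vecMulVec y y := transpose_vecMulVec y y
      rw [hM, transpose_add, transpose_smul, this]
      have h2 : (Y + (1 / 2 : ℂ) • vecMulVec y y) + (Yᵀ + (1 / 2 : ℂ) • vecMulVec y y) =
          (Y + Yᵀ) + vecMulVec y y := by
        rw [add_add_add_comm, ← add_smul]; norm_num
      rw [h2, add_mul, add_assoc]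
    have hact : ∀ z, (M + vecMulVec y y * C) *ᵥ z = M *ᵥ z + (y ⬝ᵥ (C *ᵥ z)) • y := by
      intro z
      rw [add_mulVec, ← mulVec_mulVec]
      congr 1
      ext j
      simp [vecMulVec, mulVec, dotProduct, mul_assoc, Finset.mul_sum, mul_comm, mul_left_comm]
    refine ih (Y + (1 / 2 : ℂ) • vecMulVec y y) (Nat.le_of_lt_succ (lt_of_lt_of_le ?_ hY))
    refine Submodule.finrank_lt_finrank_of_lt (lt_of_le_of_ne ?_ ?_)
    · intro z hz
      rw [LinearMap.mem_ker, mulVecLin_apply, hM', hact] at hz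
      have h1 : (C *ᵥ x) ⬝ᵥ (M *ᵥ z) = 0 := by
        rw [dotProduct_mulVec, ← mulVec_transpose, mulVec_mulVec, ← hMC, ← mulVec_mulVec, hx0,
          mulVec_zero, zero_dotProduct]
      have h2 : y ⬝ᵥ (C *ᵥ z) = 0 := by
        have := congrArg (fun w => (C *ᵥ x) ⬝ᵥ w) hz
        simp only [dotProduct_add, h1, zero_add, dotProduct_smul, dotProduct_zero, smul_eq_mul,
          mul_eq_zero] at this
        exact this.resolve_right (by rwa [dotProduct_comm])
      rwa [h2, zero_smul, add_zero] at hz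
    · intro heq
      have hx' : x ∈ LinearMap.ker (A + ((Y + (1 / 2 : ℂ) • vecMulVec y y) +
          (Y + (1 / 2 : ℂ) • vecMulVec y y)ᵀ) * C).mulVecLin := by
        rw [heq]; exact hx0
      rw [LinearMap.mem_ker, mulVecLin_apply, hM', hact, hx0, zero_add] at hx'
      have := congrFun hx' i
      simp [y] at this hy
      exact hy this

lemma eq_zero_of_mulVec_eq_zero (g : Sp n) (x : Fin n → ℂ) (hA : topLeft g *ᵥ x = 0)
    (hC : botLeft g *ᵥ x = 0) : x = 0 := by
  have h1 : g.1 *ᵥ (Sum.elim x 0) = 0 := by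
    rw [← fromBlocks_toBlocks g.1, fromBlocks_mulVec]
    have hA' : g.1.toBlocks₁₁ *ᵥ x = 0 := hA
    have hC' : g.1.toBlocks₂₁ *ᵥ x = 0 := hC
    ext (i | i) <;> simp [hA', hC']
  have h2 : Sum.elim x (0 : Fin n → ℂ) = 0 := by
    have := congrArg (fun w => (g⁻¹).1 *ᵥ w) h1
    simp only [mulVec_mulVec, mulVec_zero] at this
    rwa [← Submonoid.coe_mul, inv_mul_cancel, Submonoid.coe_one, one_mulVec] at this
  exact funext fun i => congrFun h2 (Sum.inl i)

/-- Finitely many group elements can be moved simultaneously into the big cell. -/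
lemma exists_forall_mul_mem_bigCell (s : Finset (Sp n)) :
    ∃ h : Sp n, ∀ g ∈ s, ∀ k ≤ n, lm k (topLeft (h * g)) ≠ 0 := by
  classical
  let X : Matrix (Fin n) (Fin n) (MvPolynomial (Fin n × Fin n) ℂ) := mvPolynomialX _ _ _
  have hX : ∀ x : Fin n × Fin n → ℂ, X.map (MvPolynomial.eval x) = Matrix.of fun i j => x (i, j) := by
    intro x; ext i j; simp [X]
  have hC : ∀ (x : Fin n × Fin n → ℂ) (M : Mat n), (M.map MvPolynomial.C).map (MvPolynomial.eval x) = M := by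
    intro x M; ext i j; simp
  have hev : ∀ (x : Fin n × Fin n → ℂ) (A C : Mat n), MvPolynomial.eval x
      (A.map MvPolynomial.C + (X + Xᵀ) * C.map MvPolynomial.C).det =
      (A + ((Matrix.of fun i j => x (i, j)) + (Matrix.of fun i j => x (i, j))ᵀ) * C).det := by
    intro x A C
    rw [RingHom.map_det, RingHom.mapMatrix_apply, Matrix.map_add _ (map_add _), Matrix.map_mul,
      Matrix.map_add _ (map_add _), hC, hC, ← hX, transpose_map]
  have hev2 : ∀ (x : Fin n × Fin n → ℂ) (M : Mat n) (k : ℕ), MvPolynomial.eval x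
      (lm k (X * M.map MvPolynomial.C)) = lm k ((Matrix.of fun i j => x (i, j)) * M) := by
    intro x M k
    rw [← lm_map, Matrix.map_mul, hX, hC]
  obtain ⟨x, hx⟩ := exists_eval_ne_zero (insert 1 s)
    (fun g : Sp n => ((topLeft g).map MvPolynomial.C + (X + Xᵀ) * (botLeft g).map MvPolynomial.C).det) (by
      intro g _ h0
      obtain ⟨Y, hY⟩ := exists_det_add_ne_zero (topLeft g) (botLeft g) (symm_of_symplectic g)
        (eq_zero_of_mulVec_eq_zero g)
      have := hev (fun p => Y p.1 p.2) (topLeft g) (botLeft g)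
      rw [h0, map_zero] at this
      exact hY this.symm)
  set Y : Mat n := Matrix.of fun i j => x (i, j)
  simp only [hev] at hx
  let M : Sp n → Mat n := fun g => topLeft g + (Y + Yᵀ) * botLeft g
  obtain ⟨y, hy⟩ := exists_eval_ne_zero (insert 1 s ×ˢ Finset.range (n + 1))
    (fun p : Sp n × ℕ => lm p.2 (X * (M p.1).map MvPolynomial.C)) (by
      intro p hp h0
      have hdet := hx p.1 (Finset.mem_product.1 hp).1
      have h1 := hev2 (fun q => (M p.1)⁻¹ q.1 q.2) (M p.1) p.2
      rw [h0, map_zero] at h1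
      have h2 : ((Matrix.of fun i j => (M p.1)⁻¹ i j) * M p.1) = 1 :=
        nonsing_inv_mul _ (isUnit_iff_ne_zero.2 hdet)
      rw [h2, lm_lower (fun i j hij => Matrix.one_apply_ne hij.ne)] at h1
      simp at h1)
  set a : Mat n := Matrix.of fun i j => y (i, j)
  simp only [hev2] at hy
  have hya : ∀ g ∈ insert 1 s, ∀ k ≤ n, lm k (a * M g) ≠ 0 := fun g hg k hk =>
    hy (g, k) (Finset.mem_product.2 ⟨hg, Finset.mem_range.2 (Nat.lt_succ_of_le hk)⟩)
  have hdet : IsUnit a.det := by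
    have := hya 1 (Finset.mem_insert_self _ _) n le_rfl
    rw [lm_top, det_mul] at this
    exact isUnit_iff_ne_zero.2 (left_ne_zero_of_mul this)
  let a' : GL (Fin n) ℂ := Matrix.GeneralLinearGroup.mk'' a hdet
  refine ⟨levi a' * siegelUp Y, fun g hg k hk => ?_⟩
  have : topLeft (levi a' * siegelUp Y * g) = a * M g := by
    have hg := (fromBlocks_toBlocks g.1).symm
    simp only [topLeft, Submonoid.coe_mul, coe_levi]
    rw [hg, siegelUp]
    simp only [fromBlocks_multiply, toBlocks_fromBlocks₁₁]
    simp [M, a', mul_add, add_mul, mul_assoc]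
  rw [this]
  exact hya g (Finset.mem_insert_of_mem hg) k hk

end GenericPoints

section LieKolchin

variable {W : Type*} [AddCommGroup W] [Module ℂ W] [FiniteDimensional ℂ W]

lemma exists_common_eigenvector (S : Set (Module.End ℂ W))
    (hcomm : ∀ a ∈ S, ∀ b ∈ S, ∀ w, a (b w) = b (a w)) (F : Submodule ℂ W) (hF : F ≠ ⊥)
    (hS : ∀ a ∈ S, ∀ w ∈ F, a w ∈ F) :
    ∃ w ∈ F, w ≠ 0 ∧ ∀ a ∈ S, ∃ c : ℂ, a w = c • w := by
  induction hd : Module.finrank ℂ F using Nat.strong_induction_on generalizing F with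
  | _ d ih =>
  by_cases hall : ∀ a ∈ S, ∃ c : ℂ, ∀ w ∈ F, a w = c • w
  · obtain ⟨w, hw, hw0⟩ := (Submodule.ne_bot_iff F).1 hF
    exact ⟨w, hw, hw0, fun a ha => (hall a ha).imp fun c hc => hc w hw⟩
  · push Not at hall
    obtain ⟨a, ha, hna⟩ := hall
    have : Nontrivial F := Submodule.nontrivial_iff_ne_bot.2 hF
    obtain ⟨c, hc⟩ := Module.End.exists_eigenvalue (a.restrict (hS a ha))
    obtain ⟨v, hv⟩ := hc.exists_hasEigenvector
    let F' : Submodule ℂ W := F ⊓ Module.End.eigenspace a c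
    have hmem : ∀ w, w ∈ F' ↔ w ∈ F ∧ a w = c • w := fun w => by
      rw [Submodule.mem_inf, Module.End.mem_eigenspace_iff]
    have hlt : F' < F := by
      refine lt_of_le_of_ne inf_le_left fun h => ?_
      obtain ⟨w, hw, hne⟩ := hna c
      rw [← h] at hw
      exact hne ((hmem w).1 hw).2
    have hne : F' ≠ ⊥ := by
      refine (Submodule.ne_bot_iff F').2 ⟨v, (hmem _).2 ⟨v.2, ?_⟩, fun h => hv.2 (Subtype.ext h)⟩
      exact congrArg Subtype.val hv.apply_eq_smul
    obtain ⟨w, hw, h⟩ := ih _ (hd ▸ Submodule.finrank_lt_finrank_of_lt hlt) F' hne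
      (fun b hb w hw => (hmem _).2 ⟨hS b hb w ((hmem _).1 hw).1, by
        rw [hcomm a ha b hb, ((hmem _).1 hw).2, map_smul]⟩) rfl
    exact ⟨w, ((hmem _).1 hw).1, h⟩

/-- A vector group contracted by a group element fixes a nonzero vector. -/
lemma exists_fixed_vector {G : Type*} [Group G] (σ : Representation ℂ G W) {M : Type*}
    [AddCommGroup M] [Module ℂ M] (e : M → G) (he : ∀ x y, e (x + y) = e x * e y) (τ : G) (c : ℕ)
    (hc : 2 ≤ c) (hτ : ∀ m, τ * e m = e ((c : ℂ) • m) * τ) (F : Submodule ℂ W) (hF : F ≠ ⊥)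
    (hFe : ∀ m, ∀ w ∈ F, σ (e m) w ∈ F) :
    ∃ w ∈ F, w ≠ 0 ∧ ∀ m, σ (e m) w = w := by
  obtain ⟨w, hwF, hw0, hw⟩ := exists_common_eigenvector (Set.range fun m => σ (e m)) (by
    rintro _ ⟨x, rfl⟩ _ ⟨y, rfl⟩ w
    simp only [← Module.End.mul_apply, ← map_mul, ← he, add_comm x y]) F hF (by
    rintro _ ⟨x, rfl⟩; exact hFe x)
  choose χ hχ using fun m => hw _ ⟨m, rfl⟩
  have hadd : ∀ x y, χ (x + y) = χ x * χ y := fun x y => by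
    have h1 : σ (e (x + y)) w = _ := hχ _
    have hx : σ (e x) w = _ := hχ _
    have hy : σ (e y) w = _ := hχ _
    rw [he, map_mul, Module.End.mul_apply, hy, map_smul, hx, smul_smul] at h1
    rw [smul_left_injective ℂ hw0 h1.symm, mul_comm]
  have he0 : e 0 = 1 := by simpa using he 0 0
  have h0 : χ 0 = 1 := by
    have h1 : σ (e 0) w = _ := hχ _
    rw [he0, map_one] at h1
    exact smul_left_injective ℂ hw0 (by simpa using h1.symm)
  have hpow : ∀ (k : ℕ) x, χ (k • x) = χ x ^ k := fun k x => by
    induction k with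
    | zero => simp [h0]
    | succ k ih => rw [succ_nsmul, hadd, ih, pow_succ]
  have hunit : ∀ x, χ x ≠ 0 := fun x h => by
    have := hadd x (-x)
    rw [add_neg_cancel, h0, h, zero_mul] at this
    exact one_ne_zero this
  have hconj : ∀ (j : ℕ) m, τ ^ j * e m = e (((c : ℂ) ^ j) • m) * τ ^ j := fun j => by
    induction j with
    | zero => intro m; simp
    | succ j ih =>
      intro m
      rw [pow_succ, mul_assoc, hτ, ← mul_assoc, ih, mul_assoc, smul_smul, pow_succ]
  have hc0 : (c : ℂ) ≠ 0 := by exact_mod_cast (by omega : c ≠ 0)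
  set d := Module.finrank ℂ W with hd
  have hroot : ∀ m, ∃ r ∈ Finset.Icc 1 d, χ m ^ (c ^ r - 1) = 1 := fun m => by
    obtain ⟨j, hj, l, hl, hjl, heq⟩ := Finset.exists_ne_map_eq_of_card_lt_of_maps_to
      (s := Finset.range (d + 1)) (t := (σ (e m)).charpoly.roots.toFinset)
      (f := fun j => χ (((c : ℂ) ^ j)⁻¹ • m)) (by
        rw [Finset.card_range, Nat.lt_succ_iff, hd, ← LinearMap.charpoly_natDegree (σ (e m))]
        exact (Multiset.toFinset_card_le _).trans (Polynomial.card_roots' _)) (by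
        intro j _
        have hev : Module.End.HasEigenvalue (σ (e m)) (χ (((c : ℂ) ^ j)⁻¹ • m)) := by
          refine Module.End.hasEigenvalue_of_hasEigenvector (x := σ (τ ^ j) w)
            ⟨Module.End.mem_eigenspace_iff.2 ?_, fun h => hw0 ?_⟩
          · have h1 := hconj j (((c : ℂ) ^ j)⁻¹ • m)
            rw [smul_smul, mul_inv_cancel₀ (pow_ne_zero _ hc0), one_smul] at h1
            rw [← Module.End.mul_apply, ← map_mul, ← h1, map_mul, Module.End.mul_apply]
            have h2 : σ (e (((c : ℂ) ^ j)⁻¹ • m)) w = _ := hχ _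
            rw [h2, map_smul]
          · have := congrArg (σ (τ ^ j)⁻¹) h
            rwa [map_zero, ← Module.End.mul_apply, ← map_mul, inv_mul_cancel, map_one] at this
        simp only [Finset.mem_coe, Multiset.mem_toFinset]
        exact (Polynomial.mem_roots (LinearMap.charpoly_monic _).ne_zero).2
          ((Module.End.hasEigenvalue_iff_isRoot_charpoly _ _).1 hev))
    wlog hlt : j < l generalizing j l
    · exact this l hl j hj hjl.symm heq.symm (lt_of_le_of_ne (not_lt.1 hlt) hjl.symm)
    rw [Finset.mem_range] at hl
    refine ⟨l - j, Finset.mem_Icc.2 (by omega), ?_⟩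
    set m0 := ((c : ℂ) ^ l)⁻¹ • m with hm0
    have hm : m = (c ^ l) • m0 := by
      rw [hm0, ← Nat.cast_smul_eq_nsmul ℂ, smul_smul, Nat.cast_pow, mul_inv_cancel₀ (pow_ne_zero _ hc0),
        one_smul]
    have hj' : ((c : ℂ) ^ j)⁻¹ • m = (c ^ (l - j)) • m0 := by
      rw [hm0, ← Nat.cast_smul_eq_nsmul ℂ, smul_smul, Nat.cast_pow]
      congr 1
      rw [eq_mul_inv_iff_mul_eq₀ (pow_ne_zero _ hc0), inv_mul_eq_iff_eq_mul₀ (pow_ne_zero _ hc0),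
        ← pow_add]
      congr 1; omega
    have h1 : χ m0 ^ (c ^ (l - j)) = χ m0 := by
      rw [← hpow, ← hj']; exact heq
    have h2 : χ m0 ^ (c ^ (l - j) - 1) = 1 := by
      refine mul_right_cancel₀ (hunit m0) ?_
      rw [one_mul, ← pow_succ, Nat.sub_add_cancel (Nat.one_le_pow _ _ (by omega)), h1]
    rw [hm, hpow, ← pow_mul, mul_comm, pow_mul, h2, one_pow]
  set Q := ∏ r ∈ Finset.Icc 1 d, (c ^ r - 1) with hQ
  have hQ0 : Q ≠ 0 := Finset.prod_ne_zero_iff.2 fun r hr => by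
    have := Nat.pow_le_pow_right (by omega : 0 < c) (Finset.mem_Icc.1 hr).1
    rw [pow_one] at this
    omega
  refine ⟨w, hwF, hw0, fun m => ?_⟩
  have h1 : σ (e m) w = _ := hχ _
  have h2 : m = Q • ((Q : ℂ)⁻¹ • m) := by
    rw [← Nat.cast_smul_eq_nsmul ℂ, smul_smul, mul_inv_cancel₀ (Nat.cast_ne_zero.2 hQ0), one_smul]
  obtain ⟨r, hr, hr1⟩ := hroot ((Q : ℂ)⁻¹ • m)
  obtain ⟨q, hq⟩ := Finset.dvd_prod_of_mem (fun r => c ^ r - 1) hr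
  have h3 : χ m = 1 := by
    rw [h2, hpow]
    generalize χ ((Q : ℂ)⁻¹ • m) = z at hr1
    rw [hQ, hq, pow_mul, hr1, one_pow]
  rw [h1, h3, one_smul]

end LieKolchin

section LowestFunctional

variable {n : ℕ}

/-- The part of a vector strictly below position `i`. -/
def cut (i : Fin n) (x : Fin n → ℂ) : Fin n → ℂ := fun a => if i < a then x a else 0

lemma cut_add (i : Fin n) (x y : Fin n → ℂ) : cut i (x + y) = cut i x + cut i y := by
  ext a; simp only [cut, Pi.add_apply]; split_ifs <;> simp

lemma cut_neg (i : Fin n) (x : Fin n → ℂ) : cut i (-x) = -cut i x := by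
  ext a; simp only [cut, Pi.neg_apply]; split_ifs <;> simp

/-- The elementary matrix with column `i` below the diagonal given by `x`. -/
def colMat (i : Fin n) (x : Fin n → ℂ) : Mat n := 1 + vecMulVec (cut i x) (Pi.single i 1)

lemma colMat_apply (i : Fin n) (x : Fin n → ℂ) (a b : Fin n) :
    colMat i x a b = (if a = b then 1 else 0) + if i < a ∧ b = i then x a else 0 := by
  simp only [colMat, Matrix.add_apply, vecMulVec_apply, cut, Matrix.one_apply, Pi.single_apply]
  congr 1
  split_ifs <;> simp_all

lemma mul_colMat (L : Mat n) (i : Fin n) (x : Fin n → ℂ) :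
    L * colMat i x = L + vecMulVec (L *ᵥ cut i x) (Pi.single i 1) := by
  rw [colMat, mul_add, mul_one, mul_vecMulVec]

lemma colMat_mulVec (i : Fin n) (x y : Fin n → ℂ) : colMat i x *ᵥ y = y + y i • cut i x := by
  rw [colMat, add_mulVec, one_mulVec]
  congr 1
  ext a
  simp [mulVec, dotProduct, vecMulVec_apply, Pi.single_apply, mul_comm]

lemma colMat_mul_colMat {i j : Fin n} (h : i ≤ j) (x w : Fin n → ℂ) :
    colMat i w * colMat j x = 1 + vecMulVec (cut i w) (Pi.single i 1) + vecMulVec (cut j x) (Pi.single j 1) := by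
  rw [mul_colMat, colMat_mulVec, cut, if_neg (not_lt.2 h), zero_smul, add_zero, colMat]

lemma colMat_zero (i : Fin n) : colMat i 0 = 1 := by
  ext a b; simp [colMat_apply, Matrix.one_apply]

lemma colMat_add (i : Fin n) (x y : Fin n → ℂ) : colMat i (x + y) = colMat i x * colMat i y := by
  rw [colMat_mul_colMat le_rfl, colMat, cut_add, add_vecMulVec, add_assoc]

def colGL (i : Fin n) (x : Fin n → ℂ) : GL (Fin n) ℂ where
  val := colMat i x
  inv := colMat i (-x)
  val_inv := by rw [← colMat_add, add_neg_cancel, colMat_zero]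
  inv_val := by rw [← colMat_add, neg_add_cancel, colMat_zero]

lemma coe_colGL (i : Fin n) (x : Fin n → ℂ) : (colGL i x : Mat n) = colMat i x := rfl

lemma colGL_add (i : Fin n) (x y : Fin n → ℂ) : colGL i (x + y) = colGL i x * colGL i y :=
  Units.ext (colMat_add i x y)

lemma colGL_comm {i j : Fin n} (h : i < j) (x w : Fin n → ℂ) :
    colGL j x * colGL i w = colGL i (w + w j • cut j x) * colGL j x := by
  refine Units.ext ?_
  rw [Units.val_mul, Units.val_mul, coe_colGL, coe_colGL, coe_colGL, colMat_mul_colMat h.le, mul_colMat,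
    colMat_mulVec, cut_add]
  have h1 : cut i (w j • cut j x) = (cut i w) j • cut j x := by
    rw [show cut i w j = w j from if_pos h]
    ext a
    simp only [cut, Pi.smul_apply, smul_eq_mul]
    split_ifs with h1 h2 h2
    · rfl
    · rfl
    · exact absurd (h.trans h2) h1
    · rw [mul_zero]
  rw [h1, colMat]
  abel

lemma diagGL_mul_colGL (t : Fin n → ℂˣ) (i : Fin n) (x : Fin n → ℂ) :
    diagGL t * colGL i x = colGL i (fun a => t a * x a * ((t i)⁻¹ : ℂˣ)) * diagGL t := by
  refine Units.ext ?_
  ext a b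
  rw [Units.val_mul, Units.val_mul, coe_colGL, coe_colGL, coe_diagGL, diagonal_mul, mul_diagonal,
    colMat_apply, colMat_apply]
  by_cases hab : a = b
  · subst hab
    by_cases h : i < a ∧ a = i
    · exact absurd h.2 h.1.ne'
    · simp [h]
  · by_cases h : i < a ∧ b = i
    · obtain ⟨h1, rfl⟩ := h
      simp [hab, h1]
    · simp [hab, h]

variable {V : Type*} [AddCommGroup V] [Module ℂ V] [FiniteDimensional ℂ V] [Nontrivial V]

/-- A functional fixed by the opposite unipotent subgroup. -/
lemma exists_lowest_functional (ρ : Representation ℂ (Sp n) V) :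
    ∃ ξ : Module.Dual ℂ V, ξ ≠ 0 ∧ (∀ Y v, ξ (ρ (siegelLow Y) v) = ξ v) ∧
      ∀ L : GL (Fin n) ℂ, IsLowerUni (L : Mat n) → ∀ v, ξ (ρ (levi L) v) = ξ v := by
  let σ := ρ.dual
  let F : ℕ → Submodule ℂ (Module.Dual ℂ V) := fun j =>
    { carrier := {ξ | (∀ Y, σ (siegelLow Y) ξ = ξ) ∧
        ∀ i : Fin n, i.1 < j → ∀ x, σ (levi (colGL i x)) ξ = ξ}
      zero_mem' := ⟨fun _ => map_zero _, fun _ _ _ => map_zero _⟩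
      add_mem' := fun ha hb => ⟨fun Y => by rw [map_add, ha.1, hb.1],
        fun i hi x => by rw [map_add, ha.2 i hi, hb.2 i hi]⟩
      smul_mem' := fun c a ha => ⟨fun Y => by rw [map_smul, ha.1],
        fun i hi x => by rw [map_smul, ha.2 i hi]⟩ }
  have hF : ∀ j, j ≤ n → F j ≠ ⊥ := by
    intro j
    induction j with
    | zero =>
      intro _
      obtain ⟨ξ, -, h0, h⟩ := exists_fixed_vector σ (siegelLow (n := n)) siegelLow_add
        (levi (diagGL fun _ => Units.mk0 (1 / 2 : ℂ) (by norm_num))) 4 (by norm_num) (by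
          intro Y
          rw [levi_mul_siegelLow, coe_diagGL_inv]
          congr 2
          ext a b
          simp only [diagonal_transpose, diagonal_mul, mul_diagonal, Matrix.smul_apply]
          simp
          ring) ⊤ top_ne_bot (fun _ _ _ => Submodule.mem_top)
      exact (Submodule.ne_bot_iff _).2 ⟨ξ, ⟨h, fun i hi => absurd hi (Nat.not_lt_zero _)⟩, h0⟩
    | succ j ih =>
      intro hj
      let jj : Fin n := ⟨j, hj⟩
      obtain ⟨ξ, hξ, h0, h⟩ := exists_fixed_vector σ (fun x => levi (colGL jj x))
        (fun x y => by rw [colGL_add, map_mul])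
        (levi (diagGL fun a => if a = jj then Units.mk0 (1 / 2 : ℂ) (by norm_num) else 1)) 2 le_rfl (by
          intro x
          rw [← map_mul, ← map_mul, diagGL_mul_colGL]
          congr 2
          refine Units.ext ?_
          ext a b
          rw [coe_colGL, coe_colGL, colMat_apply, colMat_apply]
          congr 1
          by_cases h1 : jj < a ∧ b = jj
          · rw [if_pos h1, if_pos h1, if_neg h1.1.ne', if_pos rfl]
            simp [mul_comm]
          · rw [if_neg h1, if_neg h1]) (F j) (ih (by omega)) (by
          rintro x ξ ⟨h1, h2⟩
          refine ⟨fun Y => ?_, fun i hi w => ?_⟩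
          · obtain ⟨Y', hY'⟩ : ∃ Y', siegelLow Y * levi (colGL jj x) = levi (colGL jj x) * siegelLow Y' := by
              refine ⟨(colMat jj x)ᵀ * Y * colMat jj x, ?_⟩
              have hu : ((colGL jj x : GL (Fin n) ℂ) : Mat n) * ((colGL jj x)⁻¹ : GL (Fin n) ℂ).1 = 1 := by
                rw [← Units.val_mul, mul_inv_cancel, Units.val_one]
              have hu' := congrArg transpose hu
              rw [transpose_mul, transpose_one] at hu'
              rw [levi_mul_siegelLow, ← coe_colGL]
              congr 2
              rw [mul_assoc, mul_assoc, hu, mul_one, ← mul_assoc, hu', one_mul]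
            rw [← Module.End.mul_apply, ← map_mul, hY', map_mul, Module.End.mul_apply, h1]
          · obtain ⟨w', hw'⟩ : ∃ w', colGL i w * colGL jj x = colGL jj x * colGL i w' := by
              refine ⟨w - w jj • cut jj x, ?_⟩
              rw [colGL_comm (show i < jj from Fin.lt_def.2 hi)]
              congr 2
              simp [cut]
            rw [← Module.End.mul_apply, ← map_mul, ← map_mul, hw', map_mul, map_mul, Module.End.mul_apply,
              h2 i hi])
      refine (Submodule.ne_bot_iff _).2 ⟨ξ, ⟨hξ.1, fun i hi x => ?_⟩, h0⟩
      rcases Nat.lt_succ_iff_lt_or_eq.1 hi with hi | hi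
      · exact hξ.2 i hi x
      · obtain rfl : i = jj := Fin.ext hi
        exact h x
  obtain ⟨ξ, ⟨h1, h2⟩, h0⟩ := (Submodule.ne_bot_iff _).1 (hF n le_rfl)
  have h3 : ∀ k, ∀ L : GL (Fin n) ℂ, IsLowerUni (L : Mat n) →
      (∀ a b : Fin n, k ≤ b.1 → a ≠ b → (L : Mat n) a b = 0) → σ (levi L) ξ = ξ := by
    intro k
    induction k with
    | zero =>
      intro L hL h
      have : L = 1 := by
        refine Units.ext ?_
        ext a b
        rw [Units.val_one, Matrix.one_apply]
        split_ifs with hab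
        · rw [hab, hL.1]
        · exact h a b (Nat.zero_le _) hab
      rw [this, map_one, map_one, Module.End.one_apply]
    | succ k ih =>
      intro L hL h
      by_cases hk : k < n
      swap
      · exact ih L hL fun a b hb => absurd (b.2.trans_le ((not_lt.1 hk).trans hb)) (lt_irrefl _)
      let i : Fin n := ⟨k, hk⟩
      let x : Fin n → ℂ := fun a => (L : Mat n) a i
      have hLx : (L : Mat n) *ᵥ cut i x = cut i x := by
        ext a
        rw [mulVec, dotProduct, Finset.sum_eq_single a]
        · rw [hL.1, one_mul]
        · intro b _ hba
          by_cases hib : i < b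
          · rw [h a b hib (Ne.symm hba), zero_mul]
          · rw [cut, if_neg hib, mul_zero]
        · simp
      have hL' : ((L * colGL i (-x) : GL (Fin n) ℂ) : Mat n) =
          (L : Mat n) - vecMulVec (cut i x) (Pi.single i 1) := by
        rw [Units.val_mul, coe_colGL, mul_colMat, cut_neg, mulVec_neg, hLx, neg_vecMulVec, sub_eq_add_neg]
      have hent : ∀ a b, ((L * colGL i (-x) : GL (Fin n) ℂ) : Mat n) a b =
          if b = i ∧ i < a then 0 else (L : Mat n) a b := by
        intro a b
        rw [hL', Matrix.sub_apply, vecMulVec_apply, Pi.single_apply, cut]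
        by_cases hb : b = i
        · rw [hb]
          by_cases ha : i < a
          · simp [ha, x]
          · simp [ha]
        · simp [hb]
      have h4 : σ (levi (L * colGL i (-x))) ξ = ξ := by
        refine ih _ ⟨fun a => ?_, fun a b hab => ?_⟩ fun a b hb hab => ?_
        · rw [hent, if_neg (fun h => h.2.ne h.1.symm), hL.1]
        · rw [hent, hL.2 a b hab, ite_self]
        · rw [hent]
          split_ifs with hc
          · rfl
          · rcases eq_or_lt_of_le hb with hb | hb
            · have hbi : b = i := Fin.ext hb.symm
              have : ¬ i < a := fun h => hc ⟨hbi, h⟩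
              exact hL.2 a b (hbi ▸ lt_of_le_of_ne (not_lt.1 this) (hbi ▸ hab))
            · exact h a b hb hab
      rwa [map_mul, map_mul, Module.End.mul_apply, h2 i i.2] at h4
  have hdual : ∀ (g : Sp n), σ g ξ = ξ → ∀ v, ξ (ρ g v) = ξ v := by
    intro g hg v
    have := LinearMap.congr_fun hg (ρ g v)
    rw [Representation.dual_apply] at this
    rw [← this]
    rw [Module.Dual.transpose_apply, LinearMap.comp_apply, ← Module.End.mul_apply, ← map_mul,
      inv_mul_cancel, map_one, Module.End.one_apply]
  exact ⟨ξ, h0, fun Y => hdual _ (h1 Y), fun L hL => hdual _ (h3 n L hL fun a b hb =>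
    absurd (b.2.trans_le hb) (lt_irrefl _))⟩

end LowestFunctional

section HighestWeight

open MvPolynomial (IsWeightedHomogeneous)

variable {n : ℕ}

/-- A highest weight vector of weight `μ`. -/
def IsHW {V : Type*} [AddCommGroup V] [Module ℂ V] (μ : ℕ → ℕ) (ρ : Representation ℂ (Sp n) V)
    (v : V) : Prop :=
  (∀ g, botLeft g = 0 → IsUpperUni (topLeft g) → ρ g v = v) ∧
    ∀ t : Fin n → ℂˣ, ρ (levi (diagGL t)) v = (∏ i, (t i : ℂ) ^ μ i) • v

lemma sum_sub_succ {μ : ℕ → ℕ} (hμ : IsPar n μ) (i : Fin n) :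
    ∑ k : Fin n, (if i.1 < k.1 + 1 then μ k - μ (k + 1) else 0) = μ i := by
  rw [Fin.sum_univ_eq_sum_range (fun k => if i.1 < k + 1 then μ k - μ (k + 1) else 0)]
  have h : ∀ m, (∑ k ∈ Finset.range m, (if i.1 < k + 1 then μ k - μ (k + 1) else 0)) +
      μ (max i m) = μ i := by
    intro m
    induction m with
    | zero => simp
    | succ m ih =>
      rw [Finset.sum_range_succ]
      split_ifs with h
      · rw [max_eq_right (by omega)] at ih ⊢
        have := hμ.1 (Nat.le_succ m)
        simp only [Nat.succ_eq_add_one] at this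
        omega
      · rw [max_eq_left (by omega)] at ih ⊢
        exact ih
  simpa [max_eq_right i.2.le, hμ.2 n le_rfl] using h n

/-- The highest weight vector in the polynomial model. -/
def hwPol (n : ℕ) (μ : ℕ → ℕ) : Pol n (Fin n) :=
  ∏ k : Fin n, lm (k + 1) (Matrix.of fun i j : Fin n => (MvPolynomial.X (Sum.inl i, j) : Pol n (Fin n))) ^
    (μ k - μ (k + 1))

lemma evalMat_hwPol (μ : ℕ → ℕ) (M : Matrix (Idx n) (Fin n) ℂ) :
    evalMat M (hwPol n μ) =
      ∏ k : Fin n, lm (k + 1) (Matrix.of fun i j : Fin n => M (Sum.inl i) j) ^ (μ k - μ (k + 1)) := by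
  rw [hwPol, map_prod]
  refine Finset.prod_congr rfl fun k _ => ?_
  rw [map_pow, ← lm_map]
  congr 2
  ext i j
  simp [evalMat]

lemma hwPol_mem {μ : ℕ → ℕ} (hμ : IsPar n μ) : hwPol n μ ∈ gr n (fun j : Fin n => μ j) := by
  have h1 : ∀ k : Fin n, lm (k + 1) (Matrix.of fun i j : Fin n =>
      (MvPolynomial.X (Sum.inl i, j) : Pol n (Fin n))) ∈ gr n (fun j : Fin n => if j.1 < k.1 + 1 then 1 else 0) := by
    intro k
    rw [lm, Matrix.det_apply]
    refine Submodule.sum_mem _ fun σ _ => ?_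
    rw [Units.smul_def]
    refine zsmul_mem ?_ _
    have h := IsWeightedHomogeneous.prod (R := ℂ) (w := colW (n := n) (ι := Fin n)) Finset.univ
      (fun i : {j : Fin n // j.1 < k.1 + 1} => (MvPolynomial.X (Sum.inl (σ i).1, i.1) : Pol n (Fin n)))
      (fun i => colW (n := n) (Sum.inl (σ i).1, i.1)) (fun i _ => MvPolynomial.isWeightedHomogeneous_X _ _ _)
    have hd : ∑ i : {j : Fin n // j.1 < k.1 + 1}, colW (n := n) (Sum.inl (σ i).1, i.1) =
        fun j : Fin n => if j.1 < k.1 + 1 then 1 else 0 := by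
      ext j
      simp only [Finset.sum_apply, colW]
      by_cases hj : j.1 < k.1 + 1
      · rw [if_pos hj, Finset.sum_eq_single ⟨j, hj⟩]
        · simp
        · intro b _ hb
          rw [if_neg fun h => hb (Subtype.ext h.symm)]
        · simp
      · rw [if_neg hj]
        refine Finset.sum_eq_zero fun b _ => if_neg fun h => hj ?_
        rw [show j = b.1 from h]
        exact b.2
    rw [hd] at h
    exact h
  have h2 := IsWeightedHomogeneous.prod (R := ℂ) (w := colW (n := n) (ι := Fin n)) Finset.univ
    (fun k : Fin n => lm (k + 1) (Matrix.of fun i j : Fin n =>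
      (MvPolynomial.X (Sum.inl i, j) : Pol n (Fin n))) ^ (μ k - μ (k + 1)))
    _ (fun k _ => (h1 k).pow _)
  have hd : ∑ k : Fin n, (μ k - μ (k + 1)) • (fun j : Fin n => if j.1 < k.1 + 1 then 1 else 0) =
      fun j : Fin n => μ j := by
    ext j
    rw [← sum_sub_succ hμ j]
    simp [Finset.sum_apply]
  rw [hd] at h2
  exact h2

lemma prod_pow_eq {μ : ℕ → ℕ} (hμ : IsPar n μ) (t : Fin n → ℂ) :
    ∏ i, t i ^ μ i = ∏ k : Fin n, (∏ i with i.1 < k.1 + 1, t i) ^ (μ k - μ (k + 1)) := by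
  calc ∏ i, t i ^ μ i
      = ∏ i : Fin n, ∏ k : Fin n, t i ^ (if i.1 < k.1 + 1 then μ k - μ (k + 1) else 0) := by
        refine Finset.prod_congr rfl fun i _ => ?_
        rw [Finset.prod_pow_eq_pow_sum, sum_sub_succ hμ]
    _ = _ := by
        rw [Finset.prod_comm]
        refine Finset.prod_congr rfl fun k _ => ?_
        rw [← Finset.prod_pow, Finset.prod_filter]
        refine Finset.prod_congr rfl fun i _ => ?_
        split_ifs <;> simp

/-- Evaluation of a polynomial along the orbit of the base point. -/
def orbitEval (g : Sp n) : Pol n (Fin n) →ₗ[ℂ] ℂ :=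
  (MvPolynomial.aeval fun p : Idx n × Fin n => g.1 (Sum.inl p.2) p.1).toLinearMap

lemma orbitEval_apply (g : Sp n) (f : Pol n (Fin n)) :
    orbitEval g f = evalMat (Matrix.of fun p j => g.1 (Sum.inl j) p) f := rfl

lemma orbitEval_polRep (h g : Sp n) (f : Pol n (Fin n)) :
    orbitEval h (polRep n (Fin n) g f) = orbitEval (h * g) f := by
  rw [orbitEval_apply, orbitEval_apply, polRep_apply, evalMat_act]
  congr 2
  ext p j
  simp [Matrix.mul_apply, mul_comm]

lemma orbitEval_hwPol (μ : ℕ → ℕ) (g : Sp n) :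
    orbitEval g (hwPol n μ) = ∏ k : Fin n, lm (k + 1) (topLeft g) ^ (μ k - μ (k + 1)) := by
  rw [orbitEval_apply, evalMat_hwPol]
  refine Finset.prod_congr rfl fun k _ => ?_
  rw [← lm_transpose]
  rfl

variable {V : Type*} [AddCommGroup V] [Module ℂ V] [FiniteDimensional ℂ V]

lemma functional_eq_orbitEval {μ : ℕ → ℕ} (hμ : IsPar n μ) {ρ : Representation ℂ (Sp n) V} {v : V}
    (hv : IsHW μ ρ v) {ξ : Module.Dual ℂ V} (h1 : ∀ Y v, ξ (ρ (siegelLow Y) v) = ξ v)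
    (h2 : ∀ L : GL (Fin n) ℂ, IsLowerUni (L : Mat n) → ∀ v, ξ (ρ (levi L) v) = ξ v) (g : Sp n) :
    ξ (ρ g v) = ξ v * orbitEval g (hwPol n μ) := by
  have hcell : ∀ g : Sp n, (∀ k ≤ n, lm k (topLeft g) ≠ 0) →
      ξ (ρ g v) = ξ v * orbitEval g (hwPol n μ) := by
    intro g hg
    obtain ⟨Y, L, t, N, hL, hN1, hN2, heq, ht⟩ := exists_bigCell g hg
    calc ξ (ρ g v) = ξ (ρ (levi L * siegelLow Y * g) v) := by
          rw [map_mul, map_mul, Module.End.mul_apply, Module.End.mul_apply, h2 L hL, h1]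
      _ = (∏ i, (t i : ℂ) ^ μ i) * ξ v := by
          rw [heq, map_mul, Module.End.mul_apply, hv.1 N hN1 hN2, hv.2, map_smul, smul_eq_mul]
      _ = _ := by
          rw [orbitEval_hwPol, prod_pow_eq hμ, mul_comm]
          simp only [ht]
  let P : gr n (fun j : Fin n => μ j) := ⟨hwPol n μ, hwPol_mem hμ⟩
  let T : Sp n → (V × gr n (fun j : Fin n => μ j)) →ₗ[ℂ] ℂ := fun h =>
    (ξ ∘ₗ ρ h) ∘ₗ LinearMap.fst ℂ _ _ - ξ v • ((orbitEval h ∘ₗ (gr n _).subtype) ∘ₗ LinearMap.snd ℂ _ _)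
  let o : Sp n → V × gr n (fun j : Fin n => μ j) := fun g => (ρ g v, grR n _ g P)
  have hT : ∀ h g, T h (o g) = ξ (ρ (h * g) v) - ξ v * orbitEval (h * g) (hwPol n μ) := by
    intro h g
    rw [← orbitEval_polRep, map_mul]
    rfl
  obtain ⟨s, hs, hspan⟩ := (Submodule.fg_span_iff_fg_span_finset_subset (R := ℂ) (Set.range o)).1
    (IsNoetherian.noetherian _)
  choose! γ hγ using fun w (hw : w ∈ s) => hs hw
  classical
  obtain ⟨h, hh⟩ := exists_forall_mul_mem_bigCell (s.image γ)
  have hzero : ∀ w ∈ Submodule.span ℂ (Set.range o), T h w = 0 := by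
    intro w hw
    rw [hspan] at hw
    refine (Submodule.span_le (p := LinearMap.ker (T h))).2 (fun w hw => ?_) hw
    rw [SetLike.mem_coe, LinearMap.mem_ker, ← hγ w hw, hT,
      hcell _ (hh _ (Finset.mem_image_of_mem γ hw)), sub_self]
  have := hzero (o (h⁻¹ * g)) (Submodule.subset_span ⟨_, rfl⟩)
  rwa [hT, mul_inv_cancel_left, sub_eq_zero] at this

end HighestWeight

section Embedding

variable {G V W : Type*} [Group G] [AddCommGroup V] [Module ℂ V] [AddCommGroup W] [Module ℂ W]

lemma span_orbit_invariant (ρ : Representation ℂ G V) (v : V) (g : G) {x : V}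
    (hx : x ∈ Submodule.span ℂ (Set.range fun g => ρ g v)) :
    ρ g x ∈ Submodule.span ℂ (Set.range fun g => ρ g v) := by
  refine (Submodule.span_le (p := (Submodule.span ℂ (Set.range fun g => ρ g v)).comap (ρ g))).2 ?_ hx
  rintro _ ⟨h, rfl⟩
  refine Submodule.subset_span ⟨g * h, ?_⟩
  simp [map_mul]

lemma span_orbit_eq_top {ρ : Representation ℂ G V} (hirr : IsIrreducibleRep ρ) {v : V}
    (hv : v ≠ 0) : Submodule.span ℂ (Set.range fun g => ρ g v) = ⊤ := by
  refine (hirr.2 _ fun g x hx => span_orbit_invariant ρ v g hx).resolve_left fun h => hv ?_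
  have : ρ 1 v ∈ Submodule.span ℂ (Set.range fun g => ρ g v) := Submodule.subset_span ⟨1, rfl⟩
  rw [h, map_one] at this
  exact this

/-- An equivariant linear relation between an irreducible representation and a semisimple one
which is injective on one side yields an embedding. -/
theorem exists_equiv_of_relation {ρ : Representation ℂ G V} {π : Representation ℂ G W}
    (hirr : IsIrreducibleRep ρ)
    (hcompl : ∀ E : Subrepresentation π, FiniteDimensional ℂ E.toSubmodule →
      ∃ E' : Subrepresentation π, IsCompl E.toSubmodule E'.toSubmodule)
    (M : Subrepresentation π) [FiniteDimensional ℂ M.toSubmodule] (R : Submodule ℂ (V × W))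
    (hRg : ∀ g u p, (u, p) ∈ R → (ρ g u, π g p) ∈ R) (hR0 : ∀ u, (u, 0) ∈ R → u = 0)
    {v : V} {w : W} (hv0 : v ≠ 0) (hw : w ∈ M.toSubmodule) (hvw : (v, w) ∈ R) :
    ∃ E : Subrepresentation π, E.toSubmodule ≤ M.toSubmodule ∧
      Nonempty (ρ.Equiv E.toRepresentation) := by
  have hRv : ∀ g, (ρ g v, π g (w)) ∈ R := fun g => hRg g _ _ (hvw)
  let Y : Subrepresentation π :=
    { toSubmodule := Submodule.span ℂ (Set.range fun g => π g w)
      apply_mem_toSubmodule := fun g x hx => span_orbit_invariant π w g hx }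
  have hYM : Y.toSubmodule ≤ M.toSubmodule := by
    refine Submodule.span_le.2 ?_
    rintro _ ⟨g, rfl⟩
    exact M.apply_mem_toSubmodule g hw
  have hex1 : ∀ p ∈ Y.toSubmodule, ∃ u, (u, p) ∈ R := by
    intro p hp
    have : Y.toSubmodule ≤ R.map (LinearMap.snd ℂ _ _) := by
      refine Submodule.span_le.2 ?_
      rintro _ ⟨g, rfl⟩
      exact ⟨_, hRv g, rfl⟩
    obtain ⟨⟨u, q⟩, h, rfl⟩ := this hp
    exact ⟨u, h⟩
  have hex2 : ∀ u, ∃ p ∈ Y.toSubmodule, (u, p) ∈ R := by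
    intro u
    have : ⊤ ≤ (R ⊓ Y.toSubmodule.comap (LinearMap.snd ℂ _ _)).map (LinearMap.fst ℂ _ _) := by
      rw [← span_orbit_eq_top hirr hv0]
      refine Submodule.span_le.2 ?_
      rintro _ ⟨g, rfl⟩
      exact ⟨_, ⟨hRv g, Submodule.subset_span ⟨g, rfl⟩⟩, rfl⟩
    obtain ⟨⟨u, q⟩, ⟨h1, h2⟩, rfl⟩ := this (Submodule.mem_top (x := u))
    exact ⟨q, h2, h1⟩
  let K : Subrepresentation (π) :=
    { toSubmodule := Y.toSubmodule ⊓ R.comap (LinearMap.inr ℂ _ _)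
      apply_mem_toSubmodule := fun g x hx => ⟨Y.apply_mem_toSubmodule g hx.1, by
        have := hRg g 0 x hx.2
        rw [map_zero] at this
        exact this⟩ }
  have hK : ∀ p, p ∈ K.toSubmodule ↔ p ∈ Y.toSubmodule ∧ (0, p) ∈ R := fun p => Iff.rfl
  have : FiniteDimensional ℂ K.toSubmodule :=
    Submodule.finiteDimensional_of_le (inf_le_left.trans hYM)
  obtain ⟨K', hKK'⟩ := hcompl K this
  let E := Y ⊓ K'
  have hE : ∀ p, p ∈ E.toSubmodule ↔ p ∈ Y.toSubmodule ∧ p ∈ K'.toSubmodule := fun p => Iff.rfl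
  have hexE : ∀ u, ∃ p ∈ E.toSubmodule, (u, p) ∈ R := by
    intro u
    obtain ⟨p, hpY, hp⟩ := hex2 u
    obtain ⟨k, hk, k', hk', rfl⟩ := Submodule.mem_sup.1
      (hKK'.sup_eq_top ▸ Submodule.mem_top : p ∈ K.toSubmodule ⊔ K'.toSubmodule)
    refine ⟨k', (hE _).2 ⟨?_, hk'⟩, ?_⟩
    · have := sub_mem hpY ((hK k).1 hk).1
      rwa [add_sub_cancel_left] at this
    · have := sub_mem hp ((hK k).1 hk).2
      rwa [Prod.mk_sub_mk, sub_zero, add_sub_cancel_left] at this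
  have huniq : ∀ u p q, p ∈ E.toSubmodule → q ∈ E.toSubmodule → (u, p) ∈ R → (u, q) ∈ R → p = q := by
    intro u p q hp hq h1 h2
    have h3 := sub_mem h1 h2
    rw [Prod.mk_sub_mk, sub_self] at h3
    have h4 := sub_mem hp hq
    exact sub_eq_zero.1 (Submodule.disjoint_def.1 hKK'.disjoint _ ((hK _).2 ⟨((hE _).1 h4).1, h3⟩)
      ((hE _).1 h4).2)
  choose f hfE hfR using hexE
  let φ : V →ₗ[ℂ] E.toSubmodule :=
    { toFun := fun u => ⟨f u, hfE u⟩
      map_add' := fun x y => Subtype.ext (huniq (x + y) _ _ (hfE _) (add_mem (hfE x) (hfE y)) (hfR _)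
        (add_mem (hfR x) (hfR y)))
      map_smul' := fun c x => Subtype.ext (huniq (c • x) _ _ (hfE _)
        (E.toSubmodule.smul_mem c (hfE x)) (hfR _) (R.smul_mem c (hfR x))) }
  have hφ : Function.Bijective φ := by
    refine ⟨(injective_iff_map_eq_zero φ).2 fun u hu => hR0 u ?_, fun p => ?_⟩
    · have h1 : f u = 0 := congrArg Subtype.val hu
      have := hfR u
      rwa [h1] at this
    · obtain ⟨u, hu⟩ := hex1 p.1 ((hE _).1 p.2).1
      exact ⟨u, Subtype.ext (huniq u _ _ (hfE u) p.2 (hfR u) hu)⟩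
  refine ⟨E, fun p hp => hYM ((hE p).1 hp).1, ⟨.mk (LinearEquiv.ofBijective φ hφ) fun g => ?_⟩⟩
  refine LinearMap.ext fun u => Subtype.ext ?_
  exact huniq (ρ g u) _ _ (hfE _) (E.apply_mem_toSubmodule g (hfE u)) (hfR _) (hRg g _ _ (hfR u))

theorem exists_subrepresentation_equiv {n : ℕ} {V : Type*} [AddCommGroup V] [Module ℂ V]
    [FiniteDimensional ℂ V] {μ : ℕ → ℕ} (hμ : IsPar n μ) {ρ : Representation ℂ (Sp n) V}
    (hirr : IsIrreducibleRep ρ) {v : V} (hv0 : v ≠ 0) (hv : IsHW μ ρ v) :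
    ∃ E : Subrepresentation (polRep n (Fin n)), E.toSubmodule ≤ gr n (fun j : Fin n => μ j) ∧
      Nonempty (ρ.Equiv E.toRepresentation) := by
  have := hirr.1
  obtain ⟨ξ, hξ0, hξ1, hξ2⟩ := exists_lowest_functional ρ
  have hfun := functional_eq_orbitEval hμ hv hξ1 hξ2
  let R : Submodule ℂ (V × Pol n (Fin n)) := ⨅ h : Sp n,
    LinearMap.ker ((ξ ∘ₗ ρ h) ∘ₗ LinearMap.fst ℂ _ _ - ξ v • (orbitEval h ∘ₗ LinearMap.snd ℂ _ _))
  have hR : ∀ u p, (u, p) ∈ R ↔ ∀ h, ξ (ρ h u) = ξ v * orbitEval h p := by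
    intro u p
    simp only [R, Submodule.mem_iInf, LinearMap.mem_ker]
    refine forall_congr' fun h => ?_
    exact sub_eq_zero
  have hRg : ∀ g u p, (u, p) ∈ R → (ρ g u, polRep n (Fin n) g p) ∈ R := by
    intro g u p h
    rw [hR] at h ⊢
    intro h'
    rw [orbitEval_polRep, ← Module.End.mul_apply, ← map_mul, h]
  have hR0 : ∀ u, (u, 0) ∈ R → u = 0 := by
    let U : Submodule ℂ V := R.comap (LinearMap.inl ℂ _ _)
    have hU : ∀ u, u ∈ U ↔ (u, 0) ∈ R := fun u => Iff.rfl
    intro u hu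
    rcases hirr.2 U (fun g x hx => by
      have := hRg g x 0 hx
      rw [map_zero] at this
      exact this) with h | h
    · exact (Submodule.eq_bot_iff U).1 h u hu
    · refine absurd (LinearMap.ext fun x => ?_) hξ0
      have := (hR x 0).1 ((hU x).1 (h ▸ Submodule.mem_top)) 1
      simpa using this
  have : FiniteDimensional ℂ (grRep n (fun j : Fin n => μ j)).toSubmodule :=
    inferInstanceAs (FiniteDimensional ℂ (gr n (fun j : Fin n => μ j)))
  exact exists_equiv_of_relation hirr (fun E _ => exists_isCompl E) (grRep n fun j : Fin n => μ j)
    R hRg hR0 hv0 (hwPol_mem hμ) ((hR _ _).2 hfun)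

end Embedding

section LeadingWeight

variable {n : ℕ}

lemma coeff_aeval_scale {σ : Type*} (d : σ → ℂ) (f : MvPolynomial σ ℂ) (s : σ →₀ ℕ) :
    MvPolynomial.coeff s (MvPolynomial.aeval
      (fun p => (MvPolynomial.C (d p) * MvPolynomial.X p : MvPolynomial σ ℂ)) f) =
      (s.prod fun p k => d p ^ k) * MvPolynomial.coeff s f := by
  classical
  induction f using MvPolynomial.induction_on' with
  | monomial u a =>
    have h : MvPolynomial.aeval (fun p => (MvPolynomial.C (d p) * MvPolynomial.X p : MvPolynomial σ ℂ))
        (MvPolynomial.monomial u a) = MvPolynomial.monomial u ((u.prod fun p k => d p ^ k) * a) := by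
      rw [MvPolynomial.aeval_monomial, MvPolynomial.algebraMap_eq, mul_comm _ a,
        MvPolynomial.monomial_eq, map_mul, mul_assoc]
      simp only [mul_pow, Finsupp.prod, Finset.prod_mul_distrib, map_prod, map_pow]
    rw [h, MvPolynomial.coeff_monomial, MvPolynomial.coeff_monomial]
    split_ifs with hu
    · rw [hu]
    · rw [mul_zero]
  | add p q hp hq => rw [map_add, MvPolynomial.coeff_add, MvPolynomial.coeff_add, hp, hq, mul_add]

lemma coeff_act_diagonal {ι : Type} [Fintype ι] (d : Idx n → ℂ) (f : Pol n ι)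
    (s : Idx n × ι →₀ ℕ) :
    MvPolynomial.coeff s (act (diagonal d) f) =
      (∏ p, d p ^ ∑ j, s (p, j)) * MvPolynomial.coeff s f := by
  have h : (fun p : Idx n × ι => ∑ r, MvPolynomial.C (diagonal d r p.1) * MvPolynomial.X (r, p.2)) =
      fun p => (MvPolynomial.C (d p.1) * MvPolynomial.X p : Pol n ι) := by
    funext p
    rw [Finset.sum_eq_single p.1]
    · rw [diagonal_apply_eq]
    · intro r _ hr
      rw [diagonal_apply_ne _ hr, map_zero, zero_mul]
    · simp
  rw [act, h]
  refine (coeff_aeval_scale (fun p : Idx n × ι => d p.1) f s).trans ?_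
  rw [Finsupp.prod_fintype _ _ (fun _ => pow_zero _),
    Fintype.prod_prod_type]
  simp only [Finset.prod_pow_eq_pow_sum]

variable {μ : ℕ → ℕ} {a : Fin n → ℕ} {f : Pol n (Fin n)}

lemma topWeight_of_isHW (hf : IsHW μ (polRep n (Fin n)) f) {s : Idx n × Fin n →₀ ℕ}
    (hs : MvPolynomial.coeff s f ≠ 0) (i : Fin n) :
    ∑ j, s (Sum.inl i, j) = μ i + ∑ j, s (Sum.inr i, j) := by
  let t : Fin n → ℂˣ := fun k => if k = i then Units.mk0 2 two_ne_zero else 1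
  have h1 := congrArg (MvPolynomial.coeff s) (hf.2 t)
  have h2 : (levi (diagGL t)).1 = diagonal (Sum.elim (fun k => (t k : ℂ)) fun k => (t k : ℂ)⁻¹) := by
    rw [coe_levi, coe_diagGL, coe_diagGL_inv, diagonal_transpose, fromBlocks_diagonal]
    simp only [Units.val_inv_eq_inv_val]
  rw [polRep_apply, h2, coeff_act_diagonal, MvPolynomial.coeff_smul, smul_eq_mul] at h1
  have h3 := mul_right_cancel₀ hs h1
  rw [Fintype.prod_sum_type, Finset.prod_eq_single i, Finset.prod_eq_single i,
    Finset.prod_eq_single i] at h3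
  · have h4 : t i = Units.mk0 2 two_ne_zero := if_pos rfl
    simp only [Sum.elim_inl, Sum.elim_inr, h4, Units.val_mk0] at h3
    rw [inv_pow, ← div_eq_mul_inv, div_eq_iff (pow_ne_zero _ two_ne_zero), ← pow_add] at h3
    exact_mod_cast Nat.pow_right_injective le_rfl (by exact_mod_cast h3)
  all_goals first
    | (intro k _ hk; simp [t, hk])
    | simp

lemma sum_eq_of_coeff_ne_zero (hfa : f ∈ gr n a) {s : Idx n × Fin n →₀ ℕ}
    (hs : MvPolynomial.coeff s f ≠ 0) (j : Fin n) :
    a j = ∑ i, s (Sum.inl i, j) + ∑ i, s (Sum.inr i, j) := by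
  have := hfa hs
  rw [weight_colW] at this
  rw [← this]
  exact Fintype.sum_sum_type _

lemma bot_eq_zero_of_isHW (hf : IsHW μ (polRep n (Fin n)) f) (hfa : f ∈ gr n a)
    (hle : ∑ j, a j ≤ ∑ i : Fin n, μ i) {s : Idx n × Fin n →₀ ℕ}
    (hs : MvPolynomial.coeff s f ≠ 0) : (∑ j, a j = ∑ i : Fin n, μ i) ∧ ∀ i j, s (Sum.inr i, j) = 0 := by
  have h1 : ∑ j, a j = ∑ i : Fin n, μ i + 2 * ∑ i, ∑ j, s (Sum.inr i, j) := by
    simp only [sum_eq_of_coeff_ne_zero hfa hs, Finset.sum_add_distrib]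
    rw [Finset.sum_comm, Finset.sum_comm (f := fun j i => s (Sum.inr i, j))]
    simp only [topWeight_of_isHW hf hs, Finset.sum_add_distrib]
    ring
  have h2 : ∑ i, ∑ j, s (Sum.inr i, j) = 0 := by omega
  refine ⟨by omega, fun i j => ?_⟩
  have h3 := (Finset.sum_eq_zero_iff.1 h2) i (Finset.mem_univ _)
  exact (Finset.sum_eq_zero_iff.1 h3) j (Finset.mem_univ _)

lemma eval_lower_mul (hf : IsHW μ (polRep n (Fin n)) f)
    (hbot : ∀ s, MvPolynomial.coeff s f ≠ 0 → ∀ i j, s (Sum.inr i, j) = 0)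
    {L : Mat n} (hL : IsLowerUni L) (A B : Matrix (Idx n) (Fin n) ℂ)
    (hB : ∀ i j, B (Sum.inl i) j = (L * Matrix.of fun i j => A (Sum.inl i) j) i j) :
    evalMat B f = evalMat A f := by
  have hdet : IsUnit Lᵀ.det := by
    rw [det_transpose, ← lm_top, hL.lm]
    exact isUnit_one
  have hfix := hf.1 (levi (Lᵀ.nonsingInvUnit hdet)) (by rw [botLeft, coe_levi, toBlocks_fromBlocks₂₁])
    (by
      rw [topLeft, coe_levi, toBlocks_fromBlocks₁₁]
      exact ⟨fun i => hL.1 i, fun i j hij => hL.2 j i hij⟩)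
  conv_rhs => rw [← hfix, polRep_apply, evalMat_act]
  rw [evalMat, evalMat, MvPolynomial.eval_eq, MvPolynomial.eval_eq]
  refine Finset.sum_congr rfl fun s hs => ?_
  congr 1
  refine Finset.prod_congr rfl fun p hp => ?_
  obtain ⟨i | i, j⟩ := p
  · congr 1
    rw [hB, coe_levi, fromBlocks_transpose, Matrix.mul_apply, Matrix.mul_apply, Fintype.sum_sum_type]
    have h : ((Lᵀ.nonsingInvUnit hdet : GL (Fin n) ℂ) : Mat n) = Lᵀ := rfl
    simp [h]
  · exact absurd (hbot s (MvPolynomial.mem_support_iff.1 hs) i j) (Finsupp.mem_support_iff.1 hp)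

theorem eq_of_isHW (hf0 : f ≠ 0) (hf : IsHW μ (polRep n (Fin n)) f) (hfa : f ∈ gr n a)
    (hle : ∑ j, a j ≤ ∑ i : Fin n, μ i) :
    ∑ j, a j = ∑ i : Fin n, μ i ∧
      ∀ k, ∑ j with j.1 < k, a j ≤ ∑ i : Fin n with i.1 < k, μ i := by
  have hbot := fun s hs => bot_eq_zero_of_isHW hf hfa hle (s := s) hs
  obtain ⟨s₀, hs₀⟩ := MvPolynomial.ne_zero_iff.1 hf0
  refine ⟨(hbot s₀ hs₀).1, fun k => ?_⟩
  let P : Option ℕ → Pol n (Fin n) := fun o => o.elim f fun k =>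
    lm k (Matrix.of fun i j => (MvPolynomial.X (Sum.inl i, j) : Pol n (Fin n)))
  have hP : ∀ (A : Matrix (Idx n) (Fin n) ℂ) k,
      evalMat A (P (some k)) = lm k (Matrix.of fun i j : Fin n => A (Sum.inl i) j) := by
    intro A k
    change evalMat A (lm k _) = _
    rw [← lm_map]
    congr 1
    ext i j
    simp [evalMat]
  obtain ⟨x, hx⟩ := exists_eval_ne_zero (Finset.insertNone (Finset.range n)) P (by
    rintro (_ | k) _
    · exact hf0
    · intro h0
      have := hP (Matrix.of fun p j => Sum.elim (fun i => (1 : Mat n) i j) (fun _ => 0) p) k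
      rw [h0, map_zero] at this
      refine zero_ne_one (α := ℂ) (this.trans ?_)
      have h1 : IsLowerUni (1 : Mat n) := ⟨fun i => one_apply_eq i, fun i j h => one_apply_ne h.ne⟩
      exact h1.lm k)
  let A : Matrix (Idx n) (Fin n) ℂ := Matrix.of fun p j => x (p, j)
  have hA0 : evalMat A f ≠ 0 := hx none (by simp)
  obtain ⟨L, hL, hLA⟩ := exists_lower_mul_upper (Matrix.of fun i j => A (Sum.inl i) j) fun k hk => by
    rw [← hP]
    exact hx (some k) (by simpa using hk)
  let B : Matrix (Idx n) (Fin n) ℂ := Matrix.of fun p j =>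
    Sum.elim (fun i => (L * Matrix.of fun i j => A (Sum.inl i) j) i j) (fun _ => 0) p
  have hB := eval_lower_mul hf (fun s hs => (hbot s hs).2) hL A B fun i j => rfl
  rw [← hB, evalMat, MvPolynomial.eval_eq] at hA0
  obtain ⟨s, hs, hne⟩ := Finset.exists_ne_zero_of_sum_ne_zero hA0
  have hs' := MvPolynomial.mem_support_iff.1 hs
  have hupper : ∀ i j, j < i → s (Sum.inl i, j) = 0 := by
    intro i j hij
    by_contra h
    refine hne ?_
    rw [Finset.prod_eq_zero (Finsupp.mem_support_iff.2 h), mul_zero]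
    rw [show B (Sum.inl i) j = 0 from hLA i j hij, zero_pow h]
  calc ∑ j with j.1 < k, a j = ∑ j : Fin n with j.1 < k, ∑ i : Fin n with i.1 < k, s (Sum.inl i, j) := by
        refine Finset.sum_congr rfl fun j hj => ?_
        rw [sum_eq_of_coeff_ne_zero hfa hs', Finset.sum_eq_zero (fun i _ => (hbot s hs').2 i j), add_zero,
          Finset.sum_filter]
        refine Finset.sum_congr rfl fun i _ => ?_
        split_ifs with h
        · rfl
        · have := (Finset.mem_filter.1 hj).2
          exact hupper i j (Fin.lt_def.2 (by omega))
    _ = ∑ i : Fin n with i.1 < k, ∑ j : Fin n with j.1 < k, s (Sum.inl i, j) := Finset.sum_comm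
    _ ≤ ∑ i : Fin n with i.1 < k, ∑ j : Fin n, s (Sum.inl i, j) :=
        Finset.sum_le_sum fun i _ => Finset.sum_le_univ_sum_of_nonneg fun _ => Nat.zero_le _
    _ = ∑ i : Fin n with i.1 < k, μ i := by
        refine Finset.sum_congr rfl fun i _ => ?_
        rw [topWeight_of_isHW hf hs', Finset.sum_eq_zero (fun j _ => (hbot s hs').2 i j), add_zero]

end LeadingWeight

section Combination

variable {n : ℕ}

lemma isIrreducibleRep_congr {G V W : Type*} [Group G] [AddCommGroup V] [Module ℂ V]
    [AddCommGroup W] [Module ℂ W] {ρ : Representation ℂ G V} {σ : Representation ℂ G W}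
    (hρ : IsIrreducibleRep ρ) (e : ρ.Equiv σ) : IsIrreducibleRep σ := by
  have he : ∀ g u, e.toLinearEquiv (ρ g u) = σ g (e.toLinearEquiv u) := e.isIntertwining
  have := hρ.1
  refine ⟨e.toLinearEquiv.symm.surjective.nontrivial, fun U hU => ?_⟩
  have hU' : ∀ x, x ∈ U.comap (e.toLinearEquiv : V →ₗ[ℂ] W) ↔ e.toLinearEquiv x ∈ U := fun _ => Iff.rfl
  rcases hρ.2 (U.comap (e.toLinearEquiv : V →ₗ[ℂ] W)) (fun g x hx => by
    rw [hU'] at hx ⊢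
    rw [he]
    exact hU g _ hx) with h | h
  · refine Or.inl ((Submodule.eq_bot_iff _).2 fun w hw => ?_)
    have h1 := (Submodule.eq_bot_iff _).1 h (e.toLinearEquiv.symm w)
      ((hU' _).2 (by rwa [LinearEquiv.apply_symm_apply]))
    rwa [LinearEquiv.map_eq_zero_iff] at h1
  · refine Or.inr (Submodule.eq_top_iff'.2 fun w => ?_)
    have h1 := (hU' (e.toLinearEquiv.symm w)).1 (h ▸ Submodule.mem_top)
    rwa [LinearEquiv.apply_symm_apply] at h1

lemma homDim_pos {G V W : Type*} [Group G] [AddCommGroup V] [Module ℂ V]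
    [AddCommGroup W] [Module ℂ W] [FiniteDimensional ℂ V] [FiniteDimensional ℂ W]
    {ρ : Representation ℂ G V} {σ : Representation ℂ G W} {T : V →ₗ[ℂ] W}
    (hT : T ∈ equivariantMaps ρ σ) (h0 : T ≠ 0) : 0 < homDim ρ σ :=
  Module.finrank_pos_iff_exists_ne_zero.2 ⟨⟨T, hT⟩, fun h => h0 (congrArg Subtype.val h)⟩

lemma eq_of_partial_sums {a b : Fin n → ℕ}
    (h : ∀ k, ∑ j with j.1 < k, a j = ∑ j with j.1 < k, b j) : a = b := by
  funext i
  have h1 : ∀ c : Fin n → ℕ, ∑ j with j.1 < i.1 + 1, c j = c i + ∑ j with j.1 < i.1, c j := by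
    intro c
    rw [← Finset.sum_insert (by simp)]
    congr 1
    ext j
    simp only [Finset.mem_filter, Finset.mem_univ, true_and, Finset.mem_insert, Fin.ext_iff]
    omega
  have h2 := h (i.1 + 1)
  rw [h1, h1, h i.1] at h2
  exact Nat.add_right_cancel h2

variable {V : Type*} [AddCommGroup V] [Module ℂ V] {ρ : Representation ℂ (Sp n) V} {μ : ℕ → ℕ}

lemma homDim_eq_zero_of_coefP (hirr : IsIrreducibleRep ρ) {v : V} (hv0 : v ≠ 0) (hv : IsHW μ ρ v)
    {a : Fin n → ℕ} (ha : coefP n μ a ≠ 0) (hne : a ≠ fun i : Fin n => μ i) : homDim ρ (grR n a) = 0 := by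
  have hbot : equivariantMaps ρ (grR n a) = ⊥ := by
    refine (Submodule.eq_bot_iff _).2 fun T hT => ?_
    by_contra hT0
    rw [mem_equivariantMaps] at hT
    have hTv : T v ≠ 0 := by
      intro h
      rcases hirr.2 (LinearMap.ker T) (fun g x hx => by
        rw [LinearMap.mem_ker] at hx ⊢
        rw [hT, hx, map_zero]) with h1 | h1
      · exact hv0 ((Submodule.eq_bot_iff _).1 h1 v h)
      · exact hT0 (LinearMap.ker_eq_top.1 h1)
    have hT' : ∀ g u, (T (ρ g u) : Pol n (Fin n)) = polRep n (Fin n) g (T u) := fun g u =>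
      congrArg Subtype.val (hT g u)
    have hf : IsHW μ (polRep n (Fin n)) (T v : Pol n (Fin n)) := by
      refine ⟨fun g h1 h2 => ?_, fun t => ?_⟩
      · rw [← hT', hv.1 g h1 h2]
      · rw [← hT', hv.2, map_smul]
        rfl
    have key := eq_of_isHW (fun h => hTv (Subtype.ext h)) hf (T v).2 (sum_le_of_coefP_ne_zero ha)
    exact hne (eq_of_partial_sums fun k => (key.2 k).antisymm
      (sum_le_sum_of_coefP_ne_zero ha key.1 k))
  rw [homDim, hbot, finrank_bot]

/-- An irreducible representation with a highest weight vector is a virtual combination of the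
multihomogeneous components. -/
theorem exists_combination [FiniteDimensional ℂ V] (hμ : IsPar n μ) {D : ℕ}
    (hD : ∀ i, μ i + rho n i ≤ D) (hirr : IsIrreducibleRep ρ) {v : V} (hv0 : v ≠ 0)
    (hv : IsHW μ ρ v) :
    ∃ E : Subrepresentation (polRep n (Fin n)), FiniteDimensional ℂ E.toSubmodule ∧
      Nonempty (ρ.Equiv E.toRepresentation) ∧ ∀ φ, IsAdditive φ →
        ∑ a ∈ box n D, coefP n μ a * φ (grRep n a) = φ E := by
  obtain ⟨E, hE, ⟨e⟩⟩ := exists_subrepresentation_equiv hμ hirr hv0 hv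
  have hEfin : FiniteDimensional ℂ E.toSubmodule := Submodule.finiteDimensional_of_le hE
  have hgr : ∀ a : Fin n → ℕ, FiniteDimensional ℂ (grRep n a).toSubmodule := fun a =>
    inferInstanceAs (FiniteDimensional ℂ (gr n a))
  refine ⟨E, hEfin, ⟨e⟩, fun φ hφ => ?_⟩
  have hEirr := isIrreducibleRep_congr hirr e
  refine sum_eq_of_norm_one (fun E _ => exists_isCompl E) (box n D) (coefP n μ) (fun a => grRep n a)
    hgr ?_ E hEirr ?_ hφ
  · rw [← sum_coefP_mul_coefP hμ hD]
    refine Finset.sum_congr rfl fun a _ => Finset.sum_congr rfl fun b _ => ?_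
    congr 2
    exact homDim_grR finSumFinEquiv.symm.toEmbedding a b fun k hk =>
      absurd (finSumFinEquiv.symm.surjective k) hk
  · have hmem : (fun i : Fin n => μ i) ∈ box n D := mem_box.2 fun i => le_of_add_le_left (hD i)
    have h1 : ∀ a : Fin n → ℕ, homDim E.toRepresentation (grRep n a).toRepresentation = homDim ρ (grR n a) :=
      fun a => homDim_congr e.symm (.refl _)
    rw [Finset.sum_eq_single_of_mem _ hmem, coefP_self, one_mul]
    · have hE' : E.toSubmodule ≤ (grRep n fun i : Fin n => μ i).toSubmodule := hE
      have := hEirr.1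
      have := hgr fun i => μ i
      obtain ⟨x, hx⟩ := exists_ne (0 : E.toSubmodule)
      exact_mod_cast homDim_pos (mem_equivariantMaps.2 fun g u => rfl : Submodule.inclusion hE' ∈ _)
        fun h => hx (Submodule.inclusion_injective hE' (by rw [h, LinearMap.zero_apply, LinearMap.zero_apply]))
    · intro a _ ha
      by_cases h0 : coefP n μ a = 0
      · rw [h0, zero_mul]
      · rw [h1, homDim_eq_zero_of_coefP hirr hv0 hv h0 ha, Nat.cast_zero, mul_zero]

end Combination

section StableRule

variable {n : ℕ}

lemma exists_embedding {p q : ℕ} (h : p + q ≤ n) :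
    ∃ e : Fin (n + n) ↪ Fin n ⊕ (Fin n ⊕ Fin n), (∀ i, Sum.inl i ∈ Set.range e) ∧
      (∀ i : Fin n, i.1 < p → Sum.inr (Sum.inl i) ∈ Set.range e) ∧
      ∀ i : Fin n, i.1 < q → Sum.inr (Sum.inr i) ∈ Set.range e := by
  let f : Fin n → Fin n ⊕ Fin n := fun i => if i.1 < p then Sum.inl i else
    Sum.inr ⟨i.1 - p, (Nat.sub_le _ _).trans_lt i.2⟩
  have hf : Function.Injective f := by
    intro i j hij
    simp only [f] at hij
    split_ifs at hij
    · exact Sum.inl_injective hij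
    · have := congrArg Fin.val (Sum.inr_injective hij)
      simp only at this
      exact Fin.ext (by omega)
  let e : Fin (n + n) ↪ Fin n ⊕ (Fin n ⊕ Fin n) := finSumFinEquiv.symm.toEmbedding.trans
    ⟨Sum.map id f, Sum.map_injective.2 ⟨Function.injective_id, hf⟩⟩
  have he : ∀ x, e (finSumFinEquiv x) = Sum.map id f x := fun x =>
    congrArg (Sum.map id f) (finSumFinEquiv.symm_apply_apply x)
  refine ⟨e, fun i => ⟨_, he (Sum.inl i)⟩, fun i hi => ⟨_, (he (Sum.inr i)).trans ?_⟩,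
    fun i hi => ⟨_, (he (Sum.inr ⟨i.1 + p, by omega⟩)).trans ?_⟩⟩
  · rw [Sum.map_inr, show f i = Sum.inl i from if_pos hi]
  · simp [f]

lemma homDim_tprod_expand {G A κ : Type*} [Group G] [AddCommGroup A] [Module ℂ A]
    {π : Representation ℂ G A} (I : Finset κ) (S : κ → Subrepresentation π)
    (hS : ∀ a, FiniteDimensional ℂ (S a).toSubmodule) {El Em Ev : Subrepresentation π}
    [FiniteDimensional ℂ El.toSubmodule] [FiniteDimensional ℂ Em.toSubmodule]
    [FiniteDimensional ℂ Ev.toSubmodule] {xl xm xv : κ → ℤ}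
    (hl : ∀ φ, IsAdditive φ → ∑ a ∈ I, xl a * φ (S a) = φ El)
    (hm : ∀ φ, IsAdditive φ → ∑ a ∈ I, xm a * φ (S a) = φ Em)
    (hv : ∀ φ, IsAdditive φ → ∑ a ∈ I, xv a * φ (S a) = φ Ev) :
    (homDim (V := Em.toSubmodule ⊗[ℂ] Ev.toSubmodule) El.toRepresentation
      (Em.toRepresentation.tprod Ev.toRepresentation) : ℤ) =
      ∑ c ∈ I, xl c * ∑ a ∈ I, xm a * ∑ b ∈ I, xv b *
        (homDim (V := (S a).toSubmodule ⊗[ℂ] (S b).toSubmodule) (S c).toRepresentation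
          ((S a).toRepresentation.tprod (S b).toRepresentation) : ℤ) := by
  rw [← hl _ (isAdditive_homDim_left (U := Em.toSubmodule ⊗[ℂ] Ev.toSubmodule)
    (Em.toRepresentation.tprod Ev.toRepresentation))]
  refine Finset.sum_congr rfl fun c _ => congrArg _ ?_
  rw [← hm _ (isAdditive_homDim_tprod_left (S c).toRepresentation Ev.toRepresentation)]
  refine Finset.sum_congr rfl fun a _ => congrArg _ ?_
  rw [← hv _ (isAdditive_homDim_tprod_right (S c).toRepresentation (S a).toRepresentation)]

/-- The stable tensor product rule for the standard symplectic group. -/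
theorem homDim_tprod_eq {Vl Vm Vv : Type*} [AddCommGroup Vl] [Module ℂ Vl] [FiniteDimensional ℂ Vl]
    [AddCommGroup Vm] [Module ℂ Vm] [FiniteDimensional ℂ Vm]
    [AddCommGroup Vv] [Module ℂ Vv] [FiniteDimensional ℂ Vv] {l m v : ℕ → ℕ} (hl : IsPar n l)
    (hm : IsPar n m) (hv : IsPar n v) {p q : ℕ} (hmp : ∀ i, p ≤ i → m i = 0)
    (hvq : ∀ i, q ≤ i → v i = 0) (hpq : p + q ≤ n) {ρl : Representation ℂ (Sp n) Vl}
    {ρm : Representation ℂ (Sp n) Vm} {ρv : Representation ℂ (Sp n) Vv}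
    (hρl : IsIrreducibleRep ρl) (hρm : IsIrreducibleRep ρm) (hρv : IsIrreducibleRep ρv)
    {xl : Vl} {xm : Vm} {xv : Vv} (hl0 : xl ≠ 0) (hm0 : xm ≠ 0) (hv0 : xv ≠ 0)
    (hxl : IsHW l ρl xl) (hxm : IsHW m ρm xm) (hxv : IsHW v ρv xv) :
    homDim ρl (ρm.tprod ρv) = ∑ᶠ (a : Ptn) (b : Ptn) (c : Ptn),
      lrCoeff l a.1 b.1 * lrCoeff m a.1 c.1 * lrCoeff v b.1 c.1 := by
  let D := l 0 + m 0 + v 0 + n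
  have hD : ∀ {w : ℕ → ℕ}, IsPar n w → w 0 ≤ l 0 + m 0 + v 0 → ∀ i, w i + rho n i ≤ D := by
    intro w hw h0 i
    have h1 := hw.1 (Nat.zero_le i)
    simp only [rho, D]
    omega
  have hDl := hD hl (by omega)
  have hDm := hD hm (by omega)
  have hDv := hD hv (by omega)
  obtain ⟨El, hEl, ⟨el⟩, hφl⟩ := exists_combination hl hDl hρl hl0 hxl
  obtain ⟨Em, hEm, ⟨em⟩, hφm⟩ := exists_combination hm hDm hρm hm0 hxm
  obtain ⟨Ev, hEv, ⟨ev⟩, hφv⟩ := exists_combination hv hDv hρv hv0 hxv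
  have hgr : ∀ a : Fin n → ℕ, FiniteDimensional ℂ (grRep n a).toSubmodule := fun a =>
    inferInstanceAs (FiniteDimensional ℂ (gr n a))
  have h1 : (homDim ρl (ρm.tprod ρv) : ℤ) =
      ∑ c ∈ box n D, coefP n l c * ∑ a ∈ box n D, coefP n m a * ∑ b ∈ box n D, coefP n v b *
        (homDim (V := (grRep n a).toSubmodule ⊗[ℂ] (grRep n b).toSubmodule) (grRep n c).toRepresentation
          ((grRep n a).toRepresentation.tprod (grRep n b).toRepresentation) : ℤ) := by
    rw [homDim_congr el (tprodCongr em ev)]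
    exact homDim_tprod_expand (box n D) (fun a => grRep n a) hgr hφl hφm hφv
  have h2 : ∀ c a b : Fin n → ℕ, coefP n m a ≠ 0 → coefP n v b ≠ 0 →
      homDim (V := gr n a ⊗[ℂ] gr n b) (grR n c) ((grR n a).tprod (grR n b)) =
        symCount (Sum.elim c (Sum.elim a b)) := by
    intro c a b ha hb
    obtain ⟨e, he1, he2, he3⟩ := exists_embedding hpq
    refine homDim_grR_tprod e c a b ?_
    rintro (i | i | i) hi
    · exact absurd (he1 i) hi
    · exact coefP_support_zero ha hmp i (not_lt.1 fun h => hi (he2 i h))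
    · exact coefP_support_zero hb hvq i (not_lt.1 fun h => hi (he3 i h))
  rw [← Nat.cast_inj (R := ℤ), finsum_lrCoeff_eq_sum_coefP hl hm hv hDl hDm hDv, h1]
  refine Finset.sum_congr rfl fun c _ => ?_
  rw [Finset.mul_sum]
  refine Finset.sum_congr rfl fun a _ => ?_
  rw [Finset.mul_sum, Finset.mul_sum]
  refine Finset.sum_congr rfl fun b _ => ?_
  by_cases ha : coefP n m a = 0
  · simp [ha]
  by_cases hb : coefP n v b = 0
  · simp [hb]
  rw [← h2 c a b ha hb, ← mul_assoc, ← mul_assoc]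
  rfl

end StableRule

section Transport

variable {n : ℕ}

lemma eq_zero_of_plen_le {f : ℕ → ℕ} (hf : IsPartition f) (i : ℕ) (hi : plen f ≤ i) : f i = 0 :=
  Nat.eq_zero_of_le_zero ((hf.1 hi).trans_eq (Nat.sInf_mem (s := {k | f k = 0}) hf.2))

lemma isPar_of_isPartition {f : ℕ → ℕ} (hf : IsPartition f) (h : plen f ≤ n) : IsPar n f :=
  ⟨fun _ _ hij => hf.1 hij, fun i hi => eq_zero_of_plen_le hf i (h.trans hi)⟩

/-- The order of the standard symplectic basis making the Borel subgroup upper triangular. -/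
def idxEquiv (n : ℕ) : Idx n ≃ Fin (2 * n) where
  toFun p := Sum.elim (fun i => ⟨i.1, by omega⟩) (fun i => ⟨2 * n - 1 - i.1, by omega⟩) p
  invFun k := if h : k.1 < n then Sum.inl ⟨k.1, h⟩ else Sum.inr ⟨2 * n - 1 - k.1, by omega⟩
  left_inv p := by
    rcases p with i | i
    · simp
    · have h : ¬ 2 * n - 1 - i.1 < n := by omega
      refine (dif_neg h).trans (congrArg Sum.inr (Fin.ext ?_))
      change 2 * n - 1 - (2 * n - 1 - i.1) = i.1
      omega
  right_inv k := by
    by_cases h : k.1 < n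
    · simp [h]
    · simp only [h, dite_false, Sum.elim_inr]
      exact Fin.ext (by simp only; omega)

lemma idxEquiv_inl (i : Fin n) : (idxEquiv n (Sum.inl i)).1 = i := rfl

lemma idxEquiv_inr (i : Fin n) : (idxEquiv n (Sum.inr i)).1 = 2 * n - 1 - i := rfl

lemma sympForm_eq : sympForm n = Matrix.reindexAlgEquiv ℂ ℂ (idxEquiv n) (-J (Fin n) ℂ) := by
  suffices h : ∀ p q, sympForm n (idxEquiv n p) (idxEquiv n q) = (-J (Fin n) ℂ) p q by
    ext i j
    obtain ⟨p, rfl⟩ := (idxEquiv n).surjective i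
    obtain ⟨q, rfl⟩ := (idxEquiv n).surjective j
    simp [h]
  rintro (i | i) (j | j)
  · have : ¬ i.1 + j.1 = 2 * n - 1 := by omega
    simp [sympForm, J, idxEquiv_inl, this]
  · have : i.1 + (2 * n - 1 - j.1) = 2 * n - 1 ↔ i = j := by rw [Fin.ext_iff]; omega
    simp [sympForm, J, idxEquiv_inl, idxEquiv_inr, this, Matrix.one_apply]
  · have : (2 * n - 1 - i.1) + j.1 = 2 * n - 1 ↔ i = j := by rw [Fin.ext_iff]; omega
    have h2 : ¬ 2 * n - 1 - i.1 < n := by omega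
    simp [sympForm, J, idxEquiv_inl, idxEquiv_inr, this, Matrix.one_apply, h2, apply_ite]
  · have : ¬ (2 * n - 1 - i.1) + (2 * n - 1 - j.1) = 2 * n - 1 := by omega
    simp [sympForm, J, idxEquiv_inr, this]

lemma mem_spGL_iff {g : GL (Fin (2 * n)) ℂ} {A : Matrix (Idx n) (Idx n) ℂ}
    (h : (g : Matrix (Fin (2 * n)) (Fin (2 * n)) ℂ) = Matrix.reindexAlgEquiv ℂ ℂ (idxEquiv n) A) :
    g ∈ SpGL n ↔ A ∈ symplecticGroup (Fin n) ℂ := by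
  have ht : (Matrix.reindexAlgEquiv ℂ ℂ (idxEquiv n) A)ᵀ = Matrix.reindexAlgEquiv ℂ ℂ (idxEquiv n) Aᵀ := rfl
  rw [SymplecticGroup.mem_iff']
  change (g : Matrix (Fin (2 * n)) (Fin (2 * n)) ℂ)ᵀ * sympForm n * g = sympForm n ↔ _
  rw [h, sympForm_eq, ht, ← map_mul, ← map_mul, (Matrix.reindexAlgEquiv ℂ ℂ (idxEquiv n)).injective.eq_iff,
    mul_neg, neg_mul, neg_inj]

/-- The identification of the two models of the symplectic group. -/
def spHom (n : ℕ) : Sp n →* SpGL n :=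
  ((Units.map (Matrix.reindexAlgEquiv ℂ ℂ (idxEquiv n) :
    Matrix (Idx n) (Idx n) ℂ →* Matrix (Fin (2 * n)) (Fin (2 * n)) ℂ)).comp
    ((Units.map (Submonoid.subtype _)).comp toUnits.toMonoidHom)).codRestrict (SpGL n) fun A =>
      (mem_spGL_iff rfl).2 A.2

lemma coe_spHom (A : Sp n) : ((spHom n A : GL (Fin (2 * n)) ℂ) : Matrix (Fin (2 * n)) (Fin (2 * n)) ℂ) =
    Matrix.reindexAlgEquiv ℂ ℂ (idxEquiv n) A.1 := rfl

lemma coe_spHom_apply (A : Sp n) (p q : Idx n) :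
    ((spHom n A : GL (Fin (2 * n)) ℂ) : Matrix (Fin (2 * n)) (Fin (2 * n)) ℂ)
      (idxEquiv n p) (idxEquiv n q) = A.1 p q := by
  rw [coe_spHom]
  simp

lemma spHom_surjective : Function.Surjective (spHom n) := by
  intro g
  have h : ((g : GL (Fin (2 * n)) ℂ) : Matrix (Fin (2 * n)) (Fin (2 * n)) ℂ) =
      Matrix.reindexAlgEquiv ℂ ℂ (idxEquiv n) ((Matrix.reindexAlgEquiv ℂ ℂ (idxEquiv n)).symm
        ((g : GL (Fin (2 * n)) ℂ) : Matrix (Fin (2 * n)) (Fin (2 * n)) ℂ)) :=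
    ((Matrix.reindexAlgEquiv ℂ ℂ (idxEquiv n)).apply_symm_apply _).symm
  exact ⟨⟨_, (mem_spGL_iff h).1 g.2⟩, Subtype.ext (Units.ext h.symm)⟩

lemma lowerUni_of_transpose_mul {A D : Mat n} (hA : IsUpperUni A) (h : Aᵀ * D = 1) : IsLowerUni D := by
  have key : ∀ j i : Fin n, i ≤ j → D i j = (1 : Mat n) i j := by
    intro j i
    induction i using WellFoundedLT.induction with
    | ind i ih =>
      intro hij
      have h1 := congrFun (congrFun h i) j
      rw [Matrix.mul_apply, Finset.sum_eq_single i] at h1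
      · rw [← h1, transpose_apply, hA.1, one_mul]
      · intro k _ hk
        rcases lt_or_gt_of_ne hk with hk | hk
        · rw [ih k hk (hk.le.trans hij), one_apply_ne (hk.trans_le hij).ne, mul_zero]
        · rw [transpose_apply, hA.2 k i hk, zero_mul]
      · simp
  exact ⟨fun i => (key i i le_rfl).trans (one_apply_eq i),
    fun i j hij => (key j i hij.le).trans (one_apply_ne hij.ne)⟩

lemma isUpperUni_spHom {g : Sp n} (h1 : botLeft g = 0) (h2 : IsUpperUni (topLeft g)) :
    IsUpperUni ((spHom n g : GL (Fin (2 * n)) ℂ) : Matrix (Fin (2 * n)) (Fin (2 * n)) ℂ) := by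
  have h3 : IsLowerUni g.1.toBlocks₂₂ := by
    refine lowerUni_of_transpose_mul h2 ?_
    have hg := g.2
    rw [← fromBlocks_toBlocks g.1, fromBlocks_mem_symplectic_iff] at hg
    have h3 := hg.2.1
    rw [show g.1.toBlocks₂₁ = 0 from h1] at h3
    simpa using h3
  constructor
  · intro i
    obtain ⟨p, rfl⟩ := (idxEquiv n).surjective i
    rw [coe_spHom_apply]
    rcases p with i | i
    · exact h2.1 i
    · exact h3.1 i
  · intro i j hij
    obtain ⟨p, rfl⟩ := (idxEquiv n).surjective i
    obtain ⟨q, rfl⟩ := (idxEquiv n).surjective j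
    rw [coe_spHom_apply]
    rcases p with i | i <;> rcases q with j | j
    · exact h2.2 i j hij
    · rw [idxEquiv_inl, idxEquiv_inr] at hij
      omega
    · exact congrFun (congrFun h1 i) j
    · rw [idxEquiv_inr, idxEquiv_inr] at hij
      exact h3.2 i j (Fin.lt_def.2 (by omega))

variable {V : Type*} [AddCommGroup V] [Module ℂ V]

lemma isHW_comp_spHom {μ : ℕ → ℕ} (hμ : IsPar n μ) {ρ : Representation ℂ (SpGL n) V} {v : V}
    (h1 : ∀ g : SpGL n,
      IsUpperUni ((g : GL (Fin (2 * n)) ℂ) : Matrix (Fin (2 * n)) (Fin (2 * n)) ℂ) → ρ g v = v)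
    (h2 : ∀ (g : SpGL n) (d : Fin (2 * n) → ℂ),
      ((g : GL (Fin (2 * n)) ℂ) : Matrix (Fin (2 * n)) (Fin (2 * n)) ℂ) = Matrix.diagonal d →
      ρ g v = (∏ i, d i ^ (μ (i : ℕ))) • v) :
    IsHW μ (ρ.comp (spHom n)) v := by
  refine ⟨fun g hg1 hg2 => h1 _ (isUpperUni_spHom hg1 hg2), fun t => ?_⟩
  let d : Idx n → ℂ := Sum.elim (fun i => (t i : ℂ)) fun i => (t i : ℂ)⁻¹
  have hd : ((spHom n (levi (diagGL t)) : GL (Fin (2 * n)) ℂ) : Matrix (Fin (2 * n)) (Fin (2 * n)) ℂ) =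
      diagonal (d ∘ (idxEquiv n).symm) := by
    rw [coe_spHom, coe_levi, coe_diagGL, coe_diagGL_inv, diagonal_transpose, fromBlocks_diagonal]
    simp [d]
  refine (h2 _ _ hd).trans ?_
  congr 1
  rw [← (idxEquiv n).prod_comp, Fintype.prod_sum_type]
  have h3 : ∀ i : Fin n, μ (idxEquiv n (Sum.inr i)) = 0 := fun i =>
    hμ.2 _ (by rw [idxEquiv_inr]; omega)
  simp [h3, idxEquiv_inl, d]

lemma isIrreducibleRep_comp {G H : Type*} [Group G] [Group H] {ρ : Representation ℂ G V}
    (hρ : IsIrreducibleRep ρ) {φ : H →* G} (hφ : Function.Surjective φ) :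
    IsIrreducibleRep (ρ.comp φ : Representation ℂ H V) := by
  refine ⟨hρ.1, fun U hU => hρ.2 U fun g x hx => ?_⟩
  obtain ⟨h, rfl⟩ := hφ g
  exact hU h x hx

lemma homDim_comp {G H W : Type*} [Group G] [Group H] [AddCommGroup W] [Module ℂ W]
    {ρ : Representation ℂ G V} {σ : Representation ℂ G W} {φ : H →* G}
    (hφ : Function.Surjective φ) :
    homDim (ρ.comp φ : Representation ℂ H V) (σ.comp φ : Representation ℂ H W) = homDim ρ σ := by
  have h : equivariantMaps (ρ.comp φ : Representation ℂ H V) (σ.comp φ : Representation ℂ H W) =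
      equivariantMaps ρ σ := by
    ext f
    rw [mem_equivariantMaps, mem_equivariantMaps]
    exact hφ.forall (p := fun g => ∀ u, f (ρ g u) = σ g (f u)) |>.symm
  rw [homDim, homDim, h]

end Transport

end SpTensor

/-- Stable tensor product rule for `Sp_{2n}`, i.e. the diagonal
`Sp_{2n} ⊂ Sp_{2n} × Sp_{2n}`.  For partitions `lam, mu, nu` with `ℓ(lam) ≤ n` and
`ℓ(mu) + ℓ(nu) ≤ n`, the multiplicity of `V^lam_(2n)` in `V^mu_(2n) ⊗ V^nu_(2n)` is
`∑ c^lam_{α β} c^mu_{α γ} c^nu_{β γ}`, the sum over all triples of partitions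
`(α, β, γ)`. -/
theorem stable_tensor_product_rule_Sp
    (n : ℕ) (lam mu nu : ℕ → ℕ)
    (hlam : IsPartition lam) (hmu : IsPartition mu) (hnu : IsPartition nu)
    (hlamlen : plen lam ≤ n) (hmunulen : plen mu + plen nu ≤ n)
    {Vl Vm Vn : Type*} [AddCommGroup Vl] [Module ℂ Vl]
    [AddCommGroup Vm] [Module ℂ Vm] [AddCommGroup Vn] [Module ℂ Vn]
    (ρl : Representation ℂ (SpGL n) Vl)
    (ρm : Representation ℂ (SpGL n) Vm)
    (ρn : Representation ℂ (SpGL n) Vn)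
    (hρl : IsSpHW n lam ρl) (hρm : IsSpHW n mu ρm) (hρn : IsSpHW n nu ρn) :
    repMult (ρm.tprod ρn) ρl
      = ∑ᶠ (a : Ptn) (b : Ptn) (c : Ptn),
          lrCoeff lam a.1 b.1 * lrCoeff mu a.1 c.1 * lrCoeff nu b.1 c.1 := by
  obtain ⟨hirl, _, xl, hl0, hl1, hl2⟩ := hρl
  obtain ⟨hirm, _, xm, hm0, hm1, hm2⟩ := hρm
  obtain ⟨hirn, _, xn, hn0, hn1, hn2⟩ := hρn
  have hl := SpTensor.isPar_of_isPartition hlam hlamlen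
  have hm := SpTensor.isPar_of_isPartition hmu ((Nat.le_add_right _ _).trans hmunulen)
  have hn := SpTensor.isPar_of_isPartition hnu ((Nat.le_add_left _ _).trans hmunulen)
  have hs := SpTensor.spHom_surjective (n := n)
  rw [← SpTensor.homDim_tprod_eq hl hm hn (SpTensor.eq_zero_of_plen_le hmu)
    (SpTensor.eq_zero_of_plen_le hnu) hmunulen (SpTensor.isIrreducibleRep_comp hirl hs)
    (SpTensor.isIrreducibleRep_comp hirm hs) (SpTensor.isIrreducibleRep_comp hirn hs) hl0 hm0 hn0
    (SpTensor.isHW_comp_spHom hl hl1 hl2) (SpTensor.isHW_comp_spHom hm hm1 hm2)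
    (SpTensor.isHW_comp_spHom hn hn1 hn2)]
  exact (SpTensor.homDim_comp (ρ := ρl) (σ := ρm.tprod ρn) hs).symm

end
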